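/- Let r(n) = #{(u,v) ∈ ℤ² : u² + v² = n} be the number of representations of n as a sum of two squares, and let χ₋₄ be the nontrivial Dirichlet character modulo 4 with L-function L(s) = ∑_{j≥0} (−1)^j (2j+1)^{-s}. Then, as x → ∞, ∑_{n ≤ x} (r(n))² = 4 x log x + C x + O( x^{1/2} (log x)^3 log log x ), where C = −4 + 8γ + (4/3) log 2 + (32/π) L′(1) − (48/π²) ζ′(2) and γ is the Euler–Mascheroni constant. -/

import Mathlib

open Complex Filter Asymptotics

/-- `r n` is the number of representations of `n` as a sum of two squares of integers. -/
noncomputable def rTwoSquares (n : ℕ) : ℕ :=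
  Nat.card {p : ℤ × ℤ // p.1 ^ 2 + p.2 ^ 2 = (n : ℤ)}

section Arithmetic

open scoped ArithmeticFunction.zeta ArithmeticFunction.Moebius

/-- The nontrivial character modulo `4` as an arithmetic function. -/
def chiFour : ArithmeticFunction ℤ := ⟨fun n => ZMod.χ₄ n, by simp⟩

/-- The divisor sum `∑_{d ∣ n} χ₋₄(d)`, a quarter of the number of representations of `n`. -/
def rho : ArithmeticFunction ℤ := (ζ : ArithmeticFunction ℤ) * chiFour

lemma rho_apply (n : ℕ) : rho n = ∑ d ∈ n.divisors, ZMod.χ₄ d :=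
  ArithmeticFunction.coe_zeta_mul_apply

/-- Hecke relation for `rho` at a prime. -/
lemma rho_prime_mul {p n : ℕ} (hp : p.Prime) (hn : n ≠ 0) :
    rho (p * n) = (1 + ZMod.χ₄ p) * rho n - if p ∣ n then ZMod.χ₄ p * rho (n / p) else 0 := by
  have key : (p * n).divisors = n.divisors ∪ n.divisors.image (p * ·) := by
    ext d
    simp only [Nat.mem_divisors, Finset.mem_union, Finset.mem_image]
    constructor
    · rintro ⟨h, -⟩
      rw [Nat.dvd_mul] at h
      obtain ⟨a, b, ha, hb, rfl⟩ := h
      rcases (Nat.dvd_prime hp).1 ha with rfl | rfl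
      · left; simpa using ⟨hb, hn⟩
      · right; exact ⟨b, ⟨hb, hn⟩, rfl⟩
    · rintro (⟨h, -⟩ | ⟨b, ⟨hb, -⟩, rfl⟩)
      · exact ⟨h.mul_left p, mul_ne_zero hp.ne_zero hn⟩
      · exact ⟨mul_dvd_mul_left p hb, mul_ne_zero hp.ne_zero hn⟩
  have hinter : ∑ d ∈ n.divisors ∩ n.divisors.image (p * ·), ZMod.χ₄ d =
      if p ∣ n then ZMod.χ₄ p * rho (n / p) else 0 := by
    split_ifs with h
    · obtain ⟨m, rfl⟩ := h
      have hm : m ≠ 0 := by rintro rfl; simp at hn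
      have : (p * m).divisors ∩ (p * m).divisors.image (p * ·) = m.divisors.image (p * ·) := by
        ext d
        simp only [Nat.mem_divisors, Finset.mem_inter, Finset.mem_image]
        constructor
        · rintro ⟨⟨h, -⟩, b, -, rfl⟩
          exact ⟨b, ⟨Nat.dvd_of_mul_dvd_mul_left hp.pos h, hm⟩, rfl⟩
        · rintro ⟨b, ⟨hb, -⟩, rfl⟩
          exact ⟨⟨mul_dvd_mul_left p hb, hn⟩, b, ⟨hb.mul_left p, hn⟩, rfl⟩
      rw [this, Finset.sum_image (fun a _ b _ h => Nat.eq_of_mul_eq_mul_left hp.pos h),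
        Nat.mul_div_cancel_left _ hp.pos, rho_apply, Finset.mul_sum]
      exact Finset.sum_congr rfl fun x _ => by rw [Nat.cast_mul, map_mul]
    · apply Finset.sum_eq_zero
      intro d hd
      simp only [Nat.mem_divisors, Finset.mem_inter, Finset.mem_image] at hd
      obtain ⟨⟨h1, -⟩, b, -, rfl⟩ := hd
      exact absurd (dvd_of_mul_right_dvd h1) h
  have hu := Finset.sum_union_inter (s₁ := n.divisors) (s₂ := n.divisors.image (p * ·))
    (f := fun d : ℕ => ZMod.χ₄ d)
  rw [hinter, ← key, ← rho_apply, ← rho_apply,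
    Finset.sum_image (fun a _ b _ h => Nat.eq_of_mul_eq_mul_left hp.pos h)] at hu
  have : ∑ x ∈ n.divisors, ZMod.χ₄ ((p * x : ℕ) : ZMod 4) = ZMod.χ₄ p * rho n := by
    rw [rho_apply, Finset.mul_sum]
    exact Finset.sum_congr rfl fun x _ => by rw [Nat.cast_mul, map_mul]
  rw [this] at hu
  linarith

/-- The Gaussian integers of norm `n`. -/
def gaussSphere (n : ℕ) : Set GaussianInt := {z | z.norm = n}

lemma norm_gaussian (z : GaussianInt) : z.norm = z.re ^ 2 + z.im ^ 2 := by
  rw [Zsqrtd.norm_def]; ring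

lemma finite_gaussSphere (n : ℕ) : (gaussSphere n).Finite := by
  have : (gaussSphere n) ⊆ (fun p : ℤ × ℤ => (⟨p.1, p.2⟩ : GaussianInt)) ''
      (Set.Icc (-(n : ℤ)) n ×ˢ Set.Icc (-(n : ℤ)) n) := by
    intro z hz
    have hz' : z.re ^ 2 + z.im ^ 2 = n := by rw [← norm_gaussian]; exact hz
    refine ⟨(z.re, z.im), ⟨⟨?_, ?_⟩, ?_, ?_⟩, rfl⟩ <;> simp only <;>
      nlinarith [sq_nonneg z.re, sq_nonneg z.im, sq_nonneg (z.re - 1), sq_nonneg (z.im - 1),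
        sq_nonneg (z.re + 1), sq_nonneg (z.im + 1), Int.le_self_sq z.re, Int.le_self_sq z.im,
        Int.le_self_sq (-z.re), Int.le_self_sq (-z.im)]
  exact Set.Finite.subset (((Set.finite_Icc _ _).prod (Set.finite_Icc _ _)).image _) this

lemma rTwoSquares_eq_ncard (n : ℕ) : rTwoSquares n = (gaussSphere n).ncard := by
  rw [rTwoSquares, ← Nat.card_coe_set_eq]
  refine Nat.card_congr ⟨fun p => ⟨⟨p.1.1, p.1.2⟩, ?_⟩, fun z => ⟨(z.1.re, z.1.im), ?_⟩, ?_, ?_⟩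
  · simpa [gaussSphere, norm_gaussian] using p.2
  · have := z.2; simpa [gaussSphere, norm_gaussian] using this
  · intro p; rfl
  · intro z; rfl

lemma rTwoSquares_one : rTwoSquares 1 = 4 := by
  rw [rTwoSquares_eq_ncard]
  have : gaussSphere 1 = (({⟨1, 0⟩, ⟨-1, 0⟩, ⟨0, 1⟩, ⟨0, -1⟩} : Finset GaussianInt) :
      Set GaussianInt) := by
    ext ⟨a, b⟩
    simp only [gaussSphere, norm_gaussian, Set.mem_ofPred_eq, Finset.coe_insert,
      Finset.coe_singleton, Set.mem_insert_iff, Set.mem_singleton_iff, Zsqrtd.ext_iff]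
    constructor
    · intro h
      have ha : a ≤ 1 := by push_cast at h; nlinarith
      have ha' : -1 ≤ a := by push_cast at h; nlinarith
      have hb : b ≤ 1 := by push_cast at h; nlinarith
      have hb' : -1 ≤ b := by push_cast at h; nlinarith
      interval_cases a <;> interval_cases b <;> simp_all
    · rintro (⟨rfl, rfl⟩ | ⟨rfl, rfl⟩ | ⟨rfl, rfl⟩ | ⟨rfl, rfl⟩) <;> norm_num
  rw [this, Set.ncard_coe_finset]
  rfl

lemma ncard_gaussSphere_dvd {w : GaussianInt} {q : ℕ} (hw : w.norm = q) (hq : q ≠ 0) (n : ℕ) :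
    {z ∈ gaussSphere (q * n) | w ∣ z}.ncard = (gaussSphere n).ncard := by
  have hw0 : w ≠ 0 := by
    rintro rfl; simp at hw; exact hq (by exact_mod_cast hw.symm)
  have : {z ∈ gaussSphere (q * n) | w ∣ z} = (w * ·) '' gaussSphere n := by
    ext z
    simp only [gaussSphere, Set.mem_ofPred_eq, Set.mem_image]
    constructor
    · rintro ⟨h, v, rfl⟩
      refine ⟨v, ?_, rfl⟩
      rw [Zsqrtd.norm_mul, hw] at h
      push_cast at h
      exact mul_left_cancel₀ (by exact_mod_cast hq) h
    · rintro ⟨v, hv, rfl⟩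
      refine ⟨?_, dvd_mul_right _ _⟩
      rw [Zsqrtd.norm_mul, hw, hv]; push_cast; ring
  rw [this, Set.ncard_image_of_injective _ (mul_right_injective₀ hw0)]

lemma rTwoSquares_two_mul (n : ℕ) : rTwoSquares (2 * n) = rTwoSquares n := by
  have hw : (⟨1, 1⟩ : GaussianInt).norm = (2 : ℕ) := by rw [norm_gaussian]; norm_num
  rw [rTwoSquares_eq_ncard, rTwoSquares_eq_ncard, ← ncard_gaussSphere_dvd hw two_ne_zero n]
  congr 1
  ext z
  simp only [gaussSphere, norm_gaussian, Set.mem_ofPred_eq, iff_self_and]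
  intro h
  have h2 : Even (z.re + z.im) := by
    have h3 : Even (z.re ^ 2 + z.im ^ 2) := by rw [h]; simp
    simpa [Int.even_add, Int.even_pow] using h3
  obtain ⟨c, hc⟩ := h2
  refine ⟨⟨c, c - z.re⟩, ?_⟩
  ext <;> simp <;> linarith

lemma rTwoSquares_mul_of_mod_four_eq_three {p n : ℕ} (hp : p.Prime) (hp3 : p % 4 = 3) :
    rTwoSquares (p * n) = if p ∣ n then rTwoSquares (n / p) else 0 := by
  have := Fact.mk hp
  have hpp := GaussianInt.prime_of_nat_prime_of_mod_four_eq_three p hp3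
  have hdvd : ∀ z ∈ gaussSphere (p * n), (p : GaussianInt) ∣ z := by
    intro z hz
    have h1 : (p : GaussianInt) ∣ z * star z := by
      rw [← Zsqrtd.norm_eq_mul_conj, show z.norm = _ from hz]
      exact ⟨n, by push_cast; ring⟩
    rcases hpp.dvd_or_dvd h1 with h | ⟨v, hv⟩
    · exact h
    · refine ⟨star v, ?_⟩
      rw [← star_star z, hv, star_mul, mul_comm]; congr 1
  have hw : (p : GaussianInt).norm = (p * p : ℕ) := by rw [norm_gaussian]; simp [sq]
  split_ifs with h
  · obtain ⟨m, rfl⟩ := h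
    rw [Nat.mul_div_cancel_left _ hp.pos, rTwoSquares_eq_ncard, rTwoSquares_eq_ncard,
      ← ncard_gaussSphere_dvd hw (mul_ne_zero hp.ne_zero hp.ne_zero) m, mul_assoc]
    congr 1
    ext z
    simpa using hdvd z
  · rw [rTwoSquares_eq_ncard, Set.ncard_eq_zero (finite_gaussSphere _),
      Set.eq_empty_iff_forall_notMem]
    intro z hz
    obtain ⟨v, rfl⟩ := hdvd z hz
    have h1 : ((p : GaussianInt) * v).norm = (p * n : ℕ) := hz
    rw [Zsqrtd.norm_mul, hw] at h1
    push_cast at h1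
    rw [mul_assoc] at h1
    have h2 := mul_left_cancel₀ (by exact_mod_cast hp.ne_zero) h1
    exact h (Int.natCast_dvd_natCast.1 ⟨_, h2.symm⟩)

lemma prime_of_norm_eq_prime {w : GaussianInt} {p : ℕ} (hp : p.Prime) (hw : w.norm = p) :
    Prime w := by
  rw [← irreducible_iff_prime]
  have hn1 : ∀ z : GaussianInt, IsUnit z ↔ z.norm = 1 := fun z => by
    rw [Zsqrtd.isUnit_iff_norm_isUnit, Int.isUnit_iff]
    have := GaussianInt.norm_nonneg z
    constructor
    · rintro (h | h) <;> omega
    · exact Or.inl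
  constructor
  · rw [hn1, hw]; exact_mod_cast hp.one_lt.ne'
  · rintro a b rfl
    rw [Zsqrtd.norm_mul] at hw
    have ha := GaussianInt.norm_nonneg a
    have hb := GaussianInt.norm_nonneg b
    rw [hn1, hn1]
    obtain ⟨x, hx⟩ := Int.eq_ofNat_of_zero_le ha
    obtain ⟨y, hy⟩ := Int.eq_ofNat_of_zero_le hb
    rw [hx, hy] at hw ⊢
    have h : x * y = p := by exact_mod_cast hw
    rcases (Nat.dvd_prime hp).1 ⟨y, h.symm⟩ with rfl | rfl
    · left; rfl
    · right
      have := Nat.eq_of_mul_eq_mul_left hp.pos (h.trans (mul_one _).symm)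
      rw [this]; rfl

lemma rTwoSquares_mul_of_mod_four_eq_one {p n : ℕ} (hp : p.Prime) (hp1 : p % 4 = 1) :
    rTwoSquares (p * n) + (if p ∣ n then rTwoSquares (n / p) else 0) = 2 * rTwoSquares n := by
  have := Fact.mk hp
  obtain ⟨a, b, hab⟩ := Nat.Prime.sq_add_sq (p := p) (by omega)
  set w : GaussianInt := ⟨a, b⟩ with hwdef
  have hw : w.norm = p := by rw [norm_gaussian, ← hab]; push_cast; rfl
  have hw' : (star w).norm = p := by rw [Zsqrtd.norm_conj, hw]
  have hwp := prime_of_norm_eq_prime hp hw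
  have hwp' := prime_of_norm_eq_prime hp hw'
  have hww : w * star w = p := by rw [← Zsqrtd.norm_eq_mul_conj, hw]; simp
  have hnd : ¬ star w ∣ w := by
    intro h
    have h2 : star w ∣ ((2 * a : ℤ) : GaussianInt) := by
      have : ((2 * a : ℤ) : GaussianInt) = w + star w := by ext <;> simp [hwdef]; ring
      rw [this]
      exact dvd_add h dvd_rfl
    obtain ⟨v, hv⟩ := h2
    have h3 := congrArg Zsqrtd.norm hv
    rw [Zsqrtd.norm_mul, hw', norm_gaussian] at h3
    simp only [Zsqrtd.re_intCast, Zsqrtd.im_intCast] at h3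
    have h4 : (p : ℤ) ∣ ((2 * a : ℕ) : ℤ) ^ 2 := ⟨v.norm, by push_cast; linarith⟩
    have h5 : p ∣ 2 * a := hp.dvd_of_dvd_pow (by exact_mod_cast h4)
    rcases hp.dvd_mul.1 h5 with h | h
    · have := Nat.le_of_dvd two_pos h
      have := hp.two_le
      omega
    · rcases Nat.eq_zero_or_pos a with h0 | h0
      · subst h0
        have : b ∣ p := ⟨b, by rw [← hab]; ring⟩
        rcases (Nat.dvd_prime hp).1 this with rfl | rfl
        · have := hp.one_lt; omega
        · have := hp.one_lt; nlinarith
      · have := Nat.le_of_dvd h0 h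
        have := hp.one_lt
        nlinarith
  have hunion : gaussSphere (p * n) = {z ∈ gaussSphere (p * n) | w ∣ z} ∪
      {z ∈ gaussSphere (p * n) | star w ∣ z} := by
    ext z
    simp only [Set.mem_union, Set.mem_ofPred_eq, ← and_or_left, iff_self_and]
    intro hz
    have h1 : w ∣ z * star z := by
      rw [← Zsqrtd.norm_eq_mul_conj, show z.norm = _ from hz]
      exact ⟨star w * n, by rw [← mul_assoc, hww]; push_cast; ring⟩
    rcases hwp.dvd_or_dvd h1 with h | ⟨v, hv⟩
    · exact Or.inl h
    · refine Or.inr ⟨star v, ?_⟩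
      rw [← star_star z, hv, star_mul, mul_comm]
  have hinter : ({z ∈ gaussSphere (p * n) | w ∣ z} ∩ {z ∈ gaussSphere (p * n) | star w ∣ z}).ncard
      = if p ∣ n then rTwoSquares (n / p) else 0 := by
    have hset : {z ∈ gaussSphere (p * n) | w ∣ z} ∩ {z ∈ gaussSphere (p * n) | star w ∣ z} =
        {z ∈ gaussSphere (p * n) | (p : GaussianInt) ∣ z} := by
      ext z
      simp only [Set.mem_inter_iff, Set.mem_ofPred_eq]
      constructor
      · rintro ⟨⟨h, v, rfl⟩, -, h2⟩
        refine ⟨h, ?_⟩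
        obtain ⟨u, rfl⟩ := (hwp'.dvd_or_dvd h2).resolve_left hnd
        exact ⟨u, by rw [← hww]; ring⟩
      · rintro ⟨h, h2⟩
        rw [← hww] at h2
        exact ⟨⟨h, dvd_of_mul_right_dvd h2⟩, h, dvd_of_mul_left_dvd h2⟩
    have hpn : (p : GaussianInt).norm = (p * p : ℕ) := by rw [norm_gaussian]; simp [sq]
    rw [hset]
    split_ifs with h
    · obtain ⟨m, rfl⟩ := h
      rw [Nat.mul_div_cancel_left _ hp.pos, rTwoSquares_eq_ncard,
        ← ncard_gaussSphere_dvd hpn (mul_ne_zero hp.ne_zero hp.ne_zero) m, mul_assoc]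
    · rw [Set.ncard_eq_zero ((finite_gaussSphere _).subset (Set.sep_subset _ _)),
        Set.eq_empty_iff_forall_notMem]
      rintro z ⟨hz, v, rfl⟩
      have h1 : ((p : GaussianInt) * v).norm = (p * n : ℕ) := hz
      rw [Zsqrtd.norm_mul, hpn] at h1
      push_cast at h1
      rw [mul_assoc] at h1
      have h2 := mul_left_cancel₀ (by exact_mod_cast hp.ne_zero) h1
      exact h (Int.natCast_dvd_natCast.1 ⟨_, h2.symm⟩)
  have hcard := Set.ncard_union_add_ncard_inter {z ∈ gaussSphere (p * n) | w ∣ z}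
    {z ∈ gaussSphere (p * n) | star w ∣ z} ((finite_gaussSphere _).subset (Set.sep_subset _ _))
    ((finite_gaussSphere _).subset (Set.sep_subset _ _))
  rw [← hunion, hinter, ncard_gaussSphere_dvd hw hp.ne_zero,
    ncard_gaussSphere_dvd hw' hp.ne_zero] at hcard
  rw [rTwoSquares_eq_ncard, hcard, rTwoSquares_eq_ncard, two_mul]

/-- Jacobi's two-square theorem. -/
theorem rTwoSquares_eq_four_mul_rho {n : ℕ} (hn : n ≠ 0) : (rTwoSquares n : ℤ) = 4 * rho n := by
  induction n using Nat.strong_induction_on with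
  | _ n ih =>
    rcases eq_or_ne n 1 with rfl | h1
    · rw [rTwoSquares_one, rho_apply]; simp
    obtain ⟨p, hp, m, rfl⟩ := Nat.exists_prime_and_dvd h1
    have hm : m ≠ 0 := by rintro rfl; simp at hn
    have hlt : m < p * m := by
      have := hp.one_lt
      have := Nat.pos_of_ne_zero hm
      nlinarith
    have ih1 := ih m hlt hm
    have ih2 : p ∣ m → (rTwoSquares (m / p) : ℤ) = 4 * rho (m / p) := fun h =>
      ih _ ((Nat.div_le_self m p).trans_lt hlt) (Nat.div_ne_zero_iff_of_dvd h |>.2 ⟨hm, hp.ne_zero⟩)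
    rw [rho_prime_mul hp hm]
    rcases hp.eq_two_or_odd with rfl | hodd
    · rw [rTwoSquares_two_mul, ih1]
      simp
    · have h4 : p % 4 = 1 ∨ p % 4 = 3 := by omega
      rcases h4 with h | h
      · rw [ZMod.χ₄_nat_one_mod_four h]
        have := rTwoSquares_mul_of_mod_four_eq_one (n := m) hp h
        split_ifs at this ⊢ with hd
        · have := ih2 hd; zify at *; linarith
        · zify at *; linarith
      · rw [ZMod.χ₄_nat_three_mod_four h, rTwoSquares_mul_of_mod_four_eq_three hp h]
        split_ifs with hd
        · rw [ih2 hd]; ring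
        · simp

lemma mul_apply_prime_pow' (F G : ArithmeticFunction ℤ) {p : ℕ} (hp : p.Prime) (k : ℕ) :
    (F * G) (p ^ k) = ∑ i ∈ Finset.range (k + 1), F (p ^ i) * G (p ^ (k - i)) := by
  rw [ArithmeticFunction.mul_apply,
    Nat.sum_divisorsAntidiagonal (fun a b => F a * G b), Nat.sum_divisors_prime_pow hp]
  refine Finset.sum_congr rfl fun i hi => ?_
  rw [Nat.pow_div (by simpa [Nat.lt_succ_iff] using hi) hp.pos]

/-- The Möbius function restricted to odd integers. -/
def oddMoebius (d : ℕ) : ℤ := if Odd d then μ d else 0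

/-- The coefficients of `1 / (ζ(2 * s)(1 - 4^{-s}))`: the odd Möbius function placed on squares. -/
def squareOddMoebius : ArithmeticFunction ℤ :=
  ⟨fun n => if IsSquare n then oddMoebius n.sqrt else 0, by simp [oddMoebius]⟩

/-- The coefficients of `1 - 2^{-s}`. -/
def oneSubTwo : ArithmeticFunction ℤ :=
  ⟨fun n => if n = 1 then 1 else if n = 2 then -1 else 0, by simp⟩

lemma oddMoebius_mul {a b : ℕ} (h : a.Coprime b) :
    oddMoebius (a * b) = oddMoebius a * oddMoebius b := by
  simp only [oddMoebius, Nat.odd_mul,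
    ArithmeticFunction.isMultiplicative_moebius.map_mul_of_coprime h]
  by_cases ha : Odd a <;> by_cases hb : Odd b <;> simp [ha, hb]

lemma abs_oddMoebius_le (d : ℕ) : |oddMoebius d| ≤ 1 := by
  unfold oddMoebius
  split_ifs
  · exact ArithmeticFunction.abs_moebius_le_one
  · simp

lemma squareOddMoebius_sq (d : ℕ) : squareOddMoebius (d ^ 2) = oddMoebius d := by
  simp [squareOddMoebius, Nat.sqrt_eq', IsSquare.sq d]

lemma squareOddMoebius_eq_zero {n : ℕ} (h : ¬ IsSquare n) : squareOddMoebius n = 0 := by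
  simp [squareOddMoebius, h]

lemma isMultiplicative_squareOddMoebius : squareOddMoebius.IsMultiplicative := by
  refine ⟨by rw [← one_pow 2, squareOddMoebius_sq]; simp [oddMoebius], fun {m n} h => ?_⟩
  by_cases hmn : IsSquare (m * n)
  · obtain ⟨c, hc⟩ := hmn
    rw [← sq] at hc
    obtain ⟨a, ha⟩ := exists_eq_pow_of_mul_eq_pow (Nat.isUnit_iff.2 h) hc
    obtain ⟨b, hb⟩ := exists_eq_pow_of_mul_eq_pow (Nat.isUnit_iff.2 h.symm)
      ((mul_comm n m).trans hc)
    subst ha; subst hb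
    rw [← mul_pow, squareOddMoebius_sq, squareOddMoebius_sq, squareOddMoebius_sq]
    exact oddMoebius_mul (Nat.Coprime.coprime_dvd_left (dvd_pow_self a two_ne_zero)
      (Nat.Coprime.coprime_dvd_right (dvd_pow_self b two_ne_zero) h))
  · rw [squareOddMoebius_eq_zero hmn]
    by_cases hm : IsSquare m
    · rw [squareOddMoebius_eq_zero (n := n) (fun hn => hmn (hm.mul hn)), mul_zero]
    · rw [squareOddMoebius_eq_zero hm, zero_mul]

lemma isMultiplicative_oneSubTwo : oneSubTwo.IsMultiplicative := by
  refine ⟨by simp [oneSubTwo], fun {m n} h => ?_⟩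
  simp only [oneSubTwo, ArithmeticFunction.coe_mk, mul_eq_one]
  by_cases hm : m = 1
  · simp [hm]
  by_cases hn : n = 1
  · simp [hn]
  have h2 : m * n ≠ 2 := by
    intro h2
    rcases (Nat.dvd_prime Nat.prime_two).1 (Dvd.intro _ h2) with h | h
    · exact hm h
    · subst h; omega
  by_cases hm2 : m = 2
  · subst hm2
    have : n ≠ 2 := by rintro rfl; simp at h
    simp [h2, this, hn]
  · simp [h2, hm, hm2]

lemma isMultiplicative_chiFour : chiFour.IsMultiplicative :=
  ⟨by simp [chiFour], fun {m n} _ => by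
    simp only [chiFour, ArithmeticFunction.coe_mk]
    rw [Nat.cast_mul, map_mul]⟩

lemma isMultiplicative_rho : rho.IsMultiplicative :=
  ArithmeticFunction.isMultiplicative_zeta.natCast.mul isMultiplicative_chiFour

lemma rho_prime_pow_succ_succ {p : ℕ} (hp : p.Prime) (k : ℕ) :
    rho (p ^ (k + 2)) = (1 + ZMod.χ₄ p) * rho (p ^ (k + 1)) - ZMod.χ₄ p * rho (p ^ k) := by
  rw [pow_succ' p (k + 1), rho_prime_mul hp (pow_ne_zero _ hp.ne_zero),
    if_pos (dvd_pow_self p (Nat.succ_ne_zero k)), pow_succ' p k, Nat.mul_div_cancel_left _ hp.pos]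

lemma rho_one : rho 1 = 1 := isMultiplicative_rho.map_one

lemma rho_prime {p : ℕ} (hp : p.Prime) : rho p = 1 + ZMod.χ₄ p := by
  have := rho_prime_mul hp one_ne_zero
  rw [if_neg (by simpa using hp.ne_one), rho_one] at this
  simpa using this

lemma rho_two_pow (k : ℕ) : rho (2 ^ k) = 1 := by
  have h2 : ZMod.χ₄ ((2 : ℕ) : ZMod 4) = 0 := by decide
  induction k using Nat.twoStepInduction with
  | zero => simp [rho_one]
  | one => rw [pow_one, rho_prime Nat.prime_two, h2]; rfl
  | more k ih1 ih2 => rw [rho_prime_pow_succ_succ Nat.prime_two, h2, ih2]; ring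

lemma rho_pow_of_mod_four_eq_one {p : ℕ} (hp : p.Prime) (h : p % 4 = 1) (k : ℕ) :
    rho (p ^ k) = k + 1 := by
  have h2 := ZMod.χ₄_nat_one_mod_four h
  induction k using Nat.twoStepInduction with
  | zero => simp [rho_one]
  | one => rw [pow_one, rho_prime hp, h2]; rfl
  | more k ih1 ih2 => rw [rho_prime_pow_succ_succ hp, h2, ih2, ih1]; push_cast; ring

lemma rho_pow_add_two_of_mod_four_eq_three {p : ℕ} (hp : p.Prime) (h : p % 4 = 3) (k : ℕ) :
    rho (p ^ (k + 2)) = rho (p ^ k) := by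
  rw [rho_prime_pow_succ_succ hp, ZMod.χ₄_nat_three_mod_four h]; ring

lemma rho_pow_sq_of_mod_four_eq_three {p : ℕ} (hp : p.Prime) (h : p % 4 = 3) (k : ℕ) :
    rho (p ^ k) ^ 2 = rho (p ^ k) := by
  induction k using Nat.twoStepInduction with
  | zero => simp [rho_one]
  | one => rw [pow_one, rho_prime hp, ZMod.χ₄_nat_three_mod_four h]; rfl
  | more k ih1 ih2 => rw [rho_pow_add_two_of_mod_four_eq_three hp h, ih1]

lemma rho_mul_rho_pow_add_two {p : ℕ} (hp : p.Prime) (hp2 : p % 2 = 1) (k : ℕ) :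
    (rho * rho) (p ^ (k + 2)) = (rho * rho) (p ^ k) + rho (p ^ (k + 2)) ^ 2 := by
  rw [mul_apply_prime_pow' _ _ hp, mul_apply_prime_pow' _ _ hp]
  have h4 : p % 4 = 1 ∨ p % 4 = 3 := by omega
  rcases h4 with h | h
  · have key : ∀ (m : ℕ) (c : ℤ), 6 * ∑ i ∈ Finset.range m, ((i : ℤ) + 1) * (c - i) =
        m * (m + 1) * (3 * c - 2 * m + 2) := by
      intro m c
      induction m with
      | zero => simp
      | succ m ih => rw [Finset.sum_range_succ, mul_add, ih]; push_cast; ring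
    have hs : ∀ k : ℕ, ∑ i ∈ Finset.range (k + 1), rho (p ^ i) * rho (p ^ (k - i)) =
        ∑ i ∈ Finset.range (k + 1), ((i : ℤ) + 1) * (((k : ℤ) + 1) - i) := by
      intro k
      refine Finset.sum_congr rfl fun i hi => ?_
      rw [rho_pow_of_mod_four_eq_one hp h, rho_pow_of_mod_four_eq_one hp h,
        Nat.cast_sub (by simpa [Nat.lt_succ_iff] using hi)]
      ring
    rw [hs, hs, rho_pow_of_mod_four_eq_one hp h]
    have h1 := key (k + 2 + 1) (((k + 2 : ℕ) : ℤ) + 1)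
    have h2 := key (k + 1) ((k : ℤ) + 1)
    push_cast at *
    linarith
  · rw [Finset.sum_range_succ, Finset.sum_range_succ, rho_pow_sq_of_mod_four_eq_three hp h]
    have h1 : rho (p ^ 1) = 0 := by
      rw [pow_one, rho_prime hp, ZMod.χ₄_nat_three_mod_four h]; rfl
    rw [show k + 2 - (k + 1) = 1 by omega, h1, Nat.sub_self, pow_zero, rho_one, mul_zero, add_zero,
      mul_one]
    congr 1
    refine Finset.sum_congr rfl fun i hi => ?_
    rw [show k + 2 - i = (k - i) + 2 by simp at hi; omega,
      rho_pow_add_two_of_mod_four_eq_three hp h]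

lemma oneSubTwo_mul_apply_pow_of_odd (G : ArithmeticFunction ℤ) {p : ℕ} (hp : p.Prime)
    (hp2 : p % 2 = 1) (k : ℕ) : (oneSubTwo * G) (p ^ k) = G (p ^ k) := by
  rw [mul_apply_prime_pow' _ _ hp, Finset.sum_eq_single 0]
  · simp [oneSubTwo]
  · intro i _ hi
    have h2 : p ^ i ≠ 2 := by
      intro h
      have : Odd (p ^ i) := (Nat.odd_iff.2 hp2).pow
      rw [h] at this
      exact absurd this (by decide)
    simp [oneSubTwo, h2, hp.ne_one, hi]
  · simp

lemma not_isSquare_prime_pow {p k : ℕ} (hp : p.Prime) (hk : Odd k) : ¬ IsSquare (p ^ k) := by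
  rintro ⟨c, hc⟩
  have h := congrArg (fun n => n.factorization p) hc
  have hc0 : c ≠ 0 := by rintro rfl; simp [hp.ne_zero] at hc
  simp only [hp.factorization_pow, Finsupp.single_eq_same, Nat.factorization_mul hc0 hc0,
    Finsupp.add_apply] at h
  rw [Nat.odd_iff] at hk
  omega

/-- `∑ ρ(n)² n^{-s} = ζ(s)² L(s)² / (ζ(2 * s) (1 + 2^{-s}))` in terms of coefficients. -/
lemma pmul_rho_rho :
    rho.pmul rho = squareOddMoebius * (oneSubTwo * (rho * rho)) := by
  rw [ArithmeticFunction.IsMultiplicative.eq_iff_eq_on_prime_powers _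
    (isMultiplicative_rho.pmul isMultiplicative_rho) _
    (isMultiplicative_squareOddMoebius.mul (isMultiplicative_oneSubTwo.mul
      (isMultiplicative_rho.mul isMultiplicative_rho)))]
  intro p k hp
  rw [ArithmeticFunction.pmul_apply, ← sq, mul_apply_prime_pow' _ _ hp]
  have hq1 : squareOddMoebius 1 = 1 := isMultiplicative_squareOddMoebius.map_one
  have hqodd : ∀ i, Odd i → squareOddMoebius (p ^ i) = 0 := fun i hi =>
    squareOddMoebius_eq_zero (not_isSquare_prime_pow hp hi)
  rcases hp.eq_two_or_odd with rfl | hodd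
  · rw [Finset.sum_eq_single 0]
    · rw [pow_zero, hq1, one_mul, Nat.sub_zero, rho_two_pow, mul_apply_prime_pow' _ _ hp]
      have hS : ∀ k : ℕ, (rho * rho) (2 ^ k) = (k : ℤ) + 1 := fun k => by
        rw [mul_apply_prime_pow' _ _ hp]; simp [rho_two_pow]
      simp only [hS]
      rcases k with _ | k
      · simp [oneSubTwo]
      · rw [Finset.sum_eq_add_of_mem 0 1 (by simp) (by simp) (by simp)]
        · simp [oneSubTwo]
        · rintro i - ⟨h0, h1⟩
          have h3 : 2 ^ i ≠ 2 := by
            intro h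
            exact h1 (Nat.pow_right_injective le_rfl (by simpa using h))
          simp [oneSubTwo, h0, h3]
    · intro i _ hi
      rcases Nat.even_or_odd i with he | ho
      · obtain ⟨j, rfl⟩ := he
        have hj : j ≠ 0 := by omega
        rw [← two_mul, mul_comm 2 j, pow_mul, squareOddMoebius_sq, oddMoebius, if_neg, zero_mul]
        exact Nat.not_odd_iff_even.2 (even_two.pow_of_ne_zero hj)
      · rw [hqodd i ho, zero_mul]
    · simp
  · simp only [oneSubTwo_mul_apply_pow_of_odd _ hp hodd]
    have hq2 : squareOddMoebius (p ^ 2) = -1 := by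
      rw [squareOddMoebius_sq, oddMoebius, if_pos (Nat.odd_iff.2 hodd),
        ArithmeticFunction.moebius_apply_prime hp]
    have hq : ∀ i, i ≠ 0 → i ≠ 2 → squareOddMoebius (p ^ i) = 0 := by
      intro i h0 h2
      rcases Nat.even_or_odd i with he | ho
      · obtain ⟨j, rfl⟩ := he
        rw [← two_mul, mul_comm 2 j, pow_mul, squareOddMoebius_sq, oddMoebius,
          if_pos (Nat.odd_iff.2 hodd).pow, ArithmeticFunction.moebius_apply_prime_pow hp (by omega),
          if_neg (by omega)]
      · exact hqodd i ho
    rcases k with _ | _ | k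
    · simp [hq1, rho_one, ArithmeticFunction.mul_apply]
    · rw [Finset.sum_eq_single 0]
      · rw [pow_zero, hq1, one_mul, Nat.sub_zero, mul_apply_prime_pow' _ _ hp]
        simp only [zero_add, Finset.sum_range_succ, Finset.sum_range_zero, pow_zero, pow_one,
          Nat.sub_zero, Nat.sub_self, rho_one]
        have hchi : ZMod.χ₄ (p : ZMod 4) = 1 ∨ ZMod.χ₄ (p : ZMod 4) = -1 := by
          have h4 : p % 4 = 1 ∨ p % 4 = 3 := by omega
          exact h4.imp ZMod.χ₄_nat_one_mod_four ZMod.χ₄_nat_three_mod_four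
        rw [rho_prime hp]
        rcases hchi with h | h <;> rw [h] <;> norm_num
      · intro i hi h0
        rw [hq i h0 (by simp at hi; omega), zero_mul]
      · simp
    · rw [Finset.sum_eq_add_of_mem 0 2 (by simp) (by simp) (by simp)]
      · rw [pow_zero, hq1, one_mul, Nat.sub_zero, hq2, rho_mul_rho_pow_add_two hp hodd]
        simp
      · rintro i - ⟨h0, h2⟩
        rw [hq i h0 h2, zero_mul]

/-- Partial sums of the coefficients of `ζ(s)² L(s)²`. -/
def rhoConvSum (N : ℕ) : ℤ := ∑ n ∈ Finset.Ioc 0 N, (rho * rho) n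

lemma sum_oneSubTwo_mul (N : ℕ) :
    ∑ n ∈ Finset.Ioc 0 N, (oneSubTwo * (rho * rho)) n = rhoConvSum N - rhoConvSum (N / 2) := by
  rw [ArithmeticFunction.sum_Ioc_mul_eq_sum_sum]
  rcases Nat.lt_or_ge N 2 with h | h
  · interval_cases N <;> simp [rhoConvSum, oneSubTwo]
  · rw [Finset.sum_eq_add_of_mem 1 2 (by simp; omega) (by simp; omega) (by simp)]
    · simp [oneSubTwo, rhoConvSum, sub_eq_add_neg]
    · rintro i - ⟨h1, h2⟩
      simp [oneSubTwo, h1, h2]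

/-- The sum of `ρ(n)²` in terms of partial sums of the coefficients of `ζ(s)² L(s)²`. -/
theorem sum_rho_sq (N : ℕ) :
    ∑ n ∈ Finset.Ioc 0 N, rho n ^ 2 = ∑ d ∈ Finset.Ioc 0 N,
      oddMoebius d * (rhoConvSum (N / d ^ 2) - rhoConvSum (N / d ^ 2 / 2)) := by
  have h1 : ∑ n ∈ Finset.Ioc 0 N, rho n ^ 2 = ∑ n ∈ Finset.Ioc 0 N,
      squareOddMoebius n * (rhoConvSum (N / n) - rhoConvSum (N / n / 2)) := by
    simp_rw [sq, ← ArithmeticFunction.pmul_apply, pmul_rho_rho]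
    rw [ArithmeticFunction.sum_Ioc_mul_eq_sum_sum]
    simp_rw [sum_oneSubTwo_mul]
  have hinj : Set.InjOn (fun d : ℕ => d ^ 2) (Finset.Ioc 0 N : Finset ℕ) :=
    fun a _ b _ h => Nat.pow_left_injective two_ne_zero h
  have h2 := Finset.sum_image (s := Finset.Ioc 0 N) (g := fun d : ℕ => d ^ 2)
    (f := fun n => squareOddMoebius n * (rhoConvSum (N / n) - rhoConvSum (N / n / 2))) hinj
  simp_rw [squareOddMoebius_sq] at h2
  rw [h1, ← h2]
  have hsub : Finset.Ioc 0 N ⊆ Finset.Ioc 0 (N ^ 2) := Finset.Ioc_subset_Ioc_right (by nlinarith)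
  have hsub' : (Finset.Ioc 0 N).image (fun d : ℕ => d ^ 2) ⊆ Finset.Ioc 0 (N ^ 2) := by
    intro n hn
    obtain ⟨d, hd, rfl⟩ := Finset.mem_image.1 hn
    simp only [Finset.mem_Ioc] at hd ⊢
    exact ⟨by have := hd.1; positivity, Nat.pow_le_pow_left hd.2 2⟩
  rw [Finset.sum_subset hsub, Finset.sum_subset hsub']
  · intro n hn hn'
    by_cases hs : IsSquare n
    · obtain ⟨d, rfl⟩ := hs
      exfalso
      apply hn'
      rw [← sq] at hn ⊢
      refine Finset.mem_image_of_mem _ ?_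
      simp only [Finset.mem_Ioc] at hn ⊢
      exact ⟨Nat.pos_of_ne_zero (by rintro rfl; simp at hn),
        (Nat.pow_le_pow_iff_left two_ne_zero).1 hn.2⟩
    · rw [squareOddMoebius_eq_zero hs, zero_mul]
  · intro n hn hn'
    have : N / n = 0 := Nat.div_eq_of_lt (by simp at hn hn'; omega)
    simp [this]

lemma sum_mul_le_sum_mul_of_antitone {a b φ : ℕ → ℝ}
    (hab : ∀ N, ∑ n ∈ Finset.Ioc 0 N, a n ≤ ∑ n ∈ Finset.Ioc 0 N, b n)
    (hφ : ∀ n, 1 ≤ n → φ (n + 1) ≤ φ n) (hφ0 : ∀ n, 1 ≤ n → 0 ≤ φ n) (N : ℕ) :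
    ∑ n ∈ Finset.Ioc 0 N, a n * φ n ≤ ∑ n ∈ Finset.Ioc 0 N, b n * φ n := by
  rcases Nat.eq_zero_or_pos N with rfl | hN
  · simp
  have key : ∀ N, 1 ≤ N → φ N * (∑ n ∈ Finset.Ioc 0 N, b n - ∑ n ∈ Finset.Ioc 0 N, a n) ≤
      ∑ n ∈ Finset.Ioc 0 N, b n * φ n - ∑ n ∈ Finset.Ioc 0 N, a n * φ n := by
    intro N hN
    induction N, hN using Nat.le_induction with
    | base => simp; linarith
    | succ N hN ih =>
      simp only [Finset.sum_Ioc_succ_top (Nat.zero_le N)]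
      nlinarith [mul_le_mul_of_nonneg_right (hφ N hN) (sub_nonneg.2 (hab N))]
  have := mul_nonneg (hφ0 N hN) (sub_nonneg.2 (hab N))
  linarith [key N hN]

lemma rho_nonneg (n : ℕ) : 0 ≤ rho n := by
  rcases eq_or_ne n 0 with rfl | hn
  · simp
  · have := rTwoSquares_eq_four_mul_rho hn
    have h : (0 : ℤ) ≤ rTwoSquares n := by positivity
    omega

lemma rhoConv_nonneg (n : ℕ) : 0 ≤ (rho * rho) n := by
  rw [ArithmeticFunction.mul_apply]
  exact Finset.sum_nonneg fun i _ => mul_nonneg (rho_nonneg _) (rho_nonneg _)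

lemma sum_chiFour (N : ℕ) : ∑ n ∈ Finset.Ioc 0 N, chiFour n =
    if N % 4 = 1 ∨ N % 4 = 2 then 1 else 0 := by
  induction N with
  | zero => simp
  | succ N ih =>
    rw [Finset.sum_Ioc_succ_top (Nat.zero_le N), ih]
    have h : chiFour (N + 1) = if (N + 1) % 2 = 0 then 0 else if (N + 1) % 4 = 1 then 1 else -1 := by
      simp only [chiFour, ArithmeticFunction.coe_mk]
      exact ZMod.χ₄_nat_eq_if_mod_four _
    rw [h]
    split_ifs <;> omega

lemma sum_rho_le (N : ℕ) : ∑ n ∈ Finset.Ioc 0 N, rho n ≤ N := by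
  rw [rho, ArithmeticFunction.sum_Ioc_mul_eq_sum_sum]
  calc _ ≤ ∑ n ∈ Finset.Ioc 0 N, (1 : ℤ) := by
        refine Finset.sum_le_sum fun n hn => ?_
        rw [sum_chiFour]
        have : n ≠ 0 := by simp at hn; omega
        simp only [ArithmeticFunction.natCoe_apply, ArithmeticFunction.zeta_apply, this, if_false]
        split_ifs <;> simp
    _ = N := by simp

lemma sum_rho_le_real (N : ℕ) : ∑ n ∈ Finset.Ioc 0 N, (rho n : ℝ) ≤ N := by
  exact_mod_cast sum_rho_le N

lemma sum_inv_le_one_add_log (N : ℕ) : ∑ n ∈ Finset.Ioc 0 N, ((n : ℝ))⁻¹ ≤ 1 + Real.log N := by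
  have := harmonic_le_one_add_log N
  rw [harmonic_eq_sum_Icc] at this
  push_cast at this
  exact this

lemma sum_rho_div_le (N : ℕ) : ∑ n ∈ Finset.Ioc 0 N, (rho n : ℝ) * (n : ℝ)⁻¹ ≤ 1 + Real.log N := by
  refine (sum_mul_le_sum_mul_of_antitone (b := fun _ => 1) ?_ ?_ ?_ N).trans ?_
  · intro N; simpa using sum_rho_le_real N
  · intro n hn; push_cast; gcongr; linarith
  · intro n hn; positivity
  · simpa using sum_inv_le_one_add_log N

lemma rhoConvSum_nonneg (N : ℕ) : 0 ≤ rhoConvSum N :=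
  Finset.sum_nonneg fun i _ => rhoConv_nonneg i

lemma rhoConvSum_mono : Monotone rhoConvSum := fun _ _ h =>
  Finset.sum_le_sum_of_subset_of_nonneg (Finset.Ioc_subset_Ioc_right h) fun i _ _ => rhoConv_nonneg i

lemma rhoConvSum_le (N : ℕ) : (rhoConvSum N : ℝ) ≤ N * (1 + Real.log N) := by
  rw [rhoConvSum, ArithmeticFunction.sum_Ioc_mul_eq_sum_sum]
  push_cast
  calc _ ≤ ∑ n ∈ Finset.Ioc 0 N, (rho n : ℝ) * (N * (n : ℝ)⁻¹) := by
        refine Finset.sum_le_sum fun n hn => ?_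
        have : (0 : ℝ) ≤ rho n := by exact_mod_cast rho_nonneg n
        gcongr
        exact (sum_rho_le_real _).trans (by rw [← div_eq_mul_inv]; exact Nat.cast_div_le)
    _ = N * ∑ n ∈ Finset.Ioc 0 N, (rho n : ℝ) * (n : ℝ)⁻¹ := by
        rw [Finset.mul_sum]; exact Finset.sum_congr rfl fun n _ => by ring
    _ ≤ _ := by gcongr; exact sum_rho_div_le N

lemma sum_inv_sq_le (N : ℕ) : ∑ n ∈ Finset.Ioc 0 N, ((n : ℝ) ^ 2)⁻¹ ≤ 2 := by
  have key : ∀ N : ℕ, ∑ n ∈ Finset.Ioc 0 (N + 1), ((n : ℝ) ^ 2)⁻¹ ≤ 2 - ((N : ℝ) + 1)⁻¹ := by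
    intro N
    induction N with
    | zero => norm_num
    | succ N ih =>
      rw [Finset.sum_Ioc_succ_top (Nat.zero_le _)]
      have : (((N + 1 + 1 : ℕ) : ℝ) ^ 2)⁻¹ ≤ ((N : ℝ) + 1)⁻¹ - ((N : ℝ) + 1 + 1)⁻¹ := by
        push_cast
        rw [inv_sub_inv (by positivity) (by positivity), ← one_div, div_le_div_iff₀ (by positivity)
          (by positivity)]
        nlinarith
      push_cast at *
      linarith
  rcases N with _ | N
  · simp
  · exact (key N).trans (by have : (0 : ℝ) ≤ ((N : ℝ) + 1)⁻¹ := by positivity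
                            linarith)

lemma sum_rho_sq_le (N : ℕ) :
    ∑ n ∈ Finset.Ioc 0 N, (rho n : ℝ) ^ 2 ≤ 2 * N * (1 + Real.log N) := by
  have h := congrArg (Int.cast : ℤ → ℝ) (sum_rho_sq N)
  push_cast at h
  rw [h]
  have hlog : 0 ≤ Real.log N := Real.log_natCast_nonneg N
  calc _ ≤ ∑ d ∈ Finset.Ioc 0 N, (N * (1 + Real.log N)) * ((d : ℝ) ^ 2)⁻¹ := by
        refine Finset.sum_le_sum fun d hd => ?_
        have h1 : |(oddMoebius d : ℝ)| ≤ 1 := by exact_mod_cast abs_oddMoebius_le d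
        have h2 : (0 : ℝ) ≤ rhoConvSum (N / d ^ 2) - rhoConvSum (N / d ^ 2 / 2) :=
          sub_nonneg.2 (by exact_mod_cast rhoConvSum_mono (Nat.div_le_self _ _))
        have h3 : (0 : ℝ) ≤ rhoConvSum (N / d ^ 2 / 2) := by exact_mod_cast rhoConvSum_nonneg _
        have hd1 : 1 ≤ d ^ 2 := Nat.one_le_pow _ _ (by simp at hd; omega)
        have h4 : ((N / d ^ 2 : ℕ) : ℝ) ≤ N * ((d : ℝ) ^ 2)⁻¹ := by
          rw [← div_eq_mul_inv]; exact_mod_cast Nat.cast_div_le (m := N) (n := d ^ 2) (α := ℝ)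
        have h5 : Real.log ((N / d ^ 2 : ℕ) : ℝ) ≤ Real.log N := by
          rcases Nat.eq_zero_or_pos (N / d ^ 2) with h0 | h0
          · simp [h0, hlog]
          · exact Real.log_le_log (by exact_mod_cast h0) (by exact_mod_cast Nat.div_le_self _ _)
        calc _ ≤ 1 * ((rhoConvSum (N / d ^ 2) : ℝ) - rhoConvSum (N / d ^ 2 / 2)) := by
              gcongr; exact (le_abs_self _).trans h1
          _ ≤ rhoConvSum (N / d ^ 2) := by linarith
          _ ≤ _ := rhoConvSum_le _
          _ ≤ (N * ((d : ℝ) ^ 2)⁻¹) * (1 + Real.log N) := by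
              gcongr
          _ = _ := by ring
    _ = (N * (1 + Real.log N)) * ∑ d ∈ Finset.Ioc 0 N, ((d : ℝ) ^ 2)⁻¹ := by rw [Finset.mul_sum]
    _ ≤ (N * (1 + Real.log N)) * 2 := by gcongr; exact sum_inv_sq_le N
    _ = _ := by ring

lemma mul_one_add_log_le (N : ℕ) :
    N * (1 + Real.log N) ≤ 2 * ∑ n ∈ Finset.Ioc 0 N, (1 + Real.log n) := by
  induction N with
  | zero => simp
  | succ N ih =>
    rw [Finset.sum_Ioc_succ_top (Nat.zero_le N), mul_add]
    rcases Nat.eq_zero_or_pos N with rfl | hN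
    · simp
    have h1 : Real.log ((N + 1 : ℕ) : ℝ) - Real.log N ≤ (N : ℝ)⁻¹ := by
      have hN' : (0 : ℝ) < N := by exact_mod_cast hN
      rw [← Real.log_div (by positivity) (by positivity)]
      refine (Real.log_le_sub_one_of_pos (by positivity)).trans (le_of_eq ?_)
      push_cast; field_simp; simp
    have h2 : (N : ℝ) * (Real.log ((N + 1 : ℕ) : ℝ) - Real.log N) ≤ 1 := by
      have hN' : (0 : ℝ) < N := by exact_mod_cast hN
      calc _ ≤ (N : ℝ) * (N : ℝ)⁻¹ := by gcongr
        _ = 1 := mul_inv_cancel₀ hN'.ne'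
    have h3 : 0 ≤ Real.log ((N + 1 : ℕ) : ℝ) := Real.log_natCast_nonneg _
    push_cast at *
    nlinarith

/-- Sums of `ρ(n)²` against nonincreasing weights. -/
lemma sum_rho_sq_mul_le {φ : ℕ → ℝ} (hφ : ∀ n, 1 ≤ n → φ (n + 1) ≤ φ n)
    (hφ0 : ∀ n, 1 ≤ n → 0 ≤ φ n) (N : ℕ) :
    ∑ n ∈ Finset.Ioc 0 N, (rho n : ℝ) ^ 2 * φ n ≤
      ∑ n ∈ Finset.Ioc 0 N, 4 * (1 + Real.log n) * φ n := by
  refine sum_mul_le_sum_mul_of_antitone (fun N => ?_) hφ hφ0 N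
  rw [← Finset.mul_sum]
  linarith [sum_rho_sq_le N, mul_one_add_log_le N]

/-- The square of Jacobi's theta function, as a function on the right half plane. -/
noncomputable def sqTheta (z : ℂ) : ℂ := jacobiTheta₂ 0 (I * z) ^ 2

lemma sqTheta_one_div {z : ℂ} (hz : 0 < z.re) : sqTheta (1 / z) = z * sqTheta z := by
  have hz0 : z ≠ 0 := by rintro rfl; simp at hz
  have h := jacobiTheta₂_functional_equation 0 (I * z)
  have e1 : -1 / (I * z) = I * (1 / z) := by
    field_simp; simp
  have e2 : -I * (I * z) = z := by rw [← mul_assoc]; simp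
  rw [e1, e2] at h
  have h2 : ((z ^ (1 / 2 : ℂ)) ^ 2 : ℂ) = z := by
    rw [← cpow_nat_mul]; norm_num
  have h3 : (z ^ (1 / 2 : ℂ) : ℂ) ≠ 0 := by
    intro h0; rw [h0] at h2; exact hz0 (by rw [← h2]; simp)
  simp only [zero_div, ne_eq, OfNat.ofNat_ne_zero, not_false_eq_true, zero_pow, mul_zero,
    Complex.exp_zero, mul_one] at h
  unfold sqTheta
  rw [h, mul_pow, div_pow, one_pow, h2]
  field_simp

lemma hasSum_theta {z : ℂ} (hz : 0 < z.re) :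
    HasSum (fun n : ℤ => cexp (-(Real.pi * (n : ℂ) ^ 2 * z))) (jacobiTheta₂ 0 (I * z)) := by
  have h := hasSum_jacobiTheta₂_term 0 (τ := I * z) (by simpa using hz)
  convert h using 2 with n
  rw [jacobiTheta₂_term]
  congr 1
  linear_combination (-(Real.pi : ℂ) * n ^ 2 * z) * I_sq

lemma HasSum.mul_self {ι : Type*} {f : ι → ℂ} {S : ℂ} (h : HasSum f S) :
    HasSum (fun p : ι × ι => f p.1 * f p.2) (S * S) :=
  HasSum.mul h h (summable_mul_of_summable_norm h.summable.norm h.summable.norm)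

lemma HasSum.card_fiber_mul {α : Type*} {g : α → ℕ} {c : ℕ → ℂ} {S : ℂ}
    (h : HasSum (fun p => c (g p)) S) :
    HasSum (fun n => (Nat.card {p // g p = n} : ℂ) * c n) S := by
  have h3 := (Equiv.sigmaFiberEquiv g).hasSum_iff.2 h
  refine HasSum.sigma h3 fun n => ?_
  have h5 := (h3.summable.sigma_factor n).hasSum
  have h6 : ∀ p : {p // g p = n}, ((fun p => c (g p)) ∘ (Equiv.sigmaFiberEquiv g)) ⟨n, p⟩ =
      c n := by
    rintro ⟨p, rfl⟩; rfl
  rw [tsum_congr h6, tsum_const, nsmul_eq_mul] at h5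
  exact h5

lemma hasSum_sqTheta_prod {z : ℂ} (hz : 0 < z.re) :
    HasSum (fun p : ℤ × ℤ => cexp (-(Real.pi * (p.1 : ℂ) ^ 2 * z)) *
      cexp (-(Real.pi * (p.2 : ℂ) ^ 2 * z))) (sqTheta z) := by
  have key : ∀ {S : ℂ}, HasSum (fun n : ℤ => cexp (-(Real.pi * (n : ℂ) ^ 2 * z))) S →
      HasSum (fun p : ℤ × ℤ => cexp (-(Real.pi * (p.1 : ℂ) ^ 2 * z)) *
        cexp (-(Real.pi * (p.2 : ℂ) ^ 2 * z))) (S * S) := fun h =>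
    HasSum.mul_self (f := fun n : ℤ => cexp (-(Real.pi * (n : ℂ) ^ 2 * z))) h
  rw [sqTheta, pow_two]
  exact key (hasSum_theta hz)

lemma hasSum_sqTheta {z : ℂ} (hz : 0 < z.re) :
    HasSum (fun n : ℕ => (rTwoSquares n : ℂ) * cexp (-(Real.pi * n * z))) (sqTheta z) := by
  have h2 := hasSum_sqTheta_prod hz
  have hg : ∀ (p : ℤ × ℤ) (n : ℕ), (p.1 ^ 2 + p.2 ^ 2).toNat = n ↔ p.1 ^ 2 + p.2 ^ 2 = (n : ℤ) := by
    intro p n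
    have : (0 : ℤ) ≤ p.1 ^ 2 + p.2 ^ 2 := by positivity
    omega
  have h3 : HasSum (fun p : ℤ × ℤ => (fun n : ℕ => cexp (-(Real.pi * n * z)))
      ((p.1 ^ 2 + p.2 ^ 2).toNat)) (sqTheta z) := by
    have he : ∀ p : ℤ × ℤ, cexp (-(Real.pi * (p.1 : ℂ) ^ 2 * z)) *
        cexp (-(Real.pi * (p.2 : ℂ) ^ 2 * z)) =
          cexp (-(Real.pi * ((p.1 ^ 2 + p.2 ^ 2).toNat : ℂ) * z)) := fun p => ?_
    · simp only [he] at h2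
      exact h2
    have hc : (p.1 : ℂ) ^ 2 + (p.2 : ℂ) ^ 2 = ((p.1 ^ 2 + p.2 ^ 2).toNat : ℂ) := by
      have := congrArg (Int.cast : ℤ → ℂ) ((hg p _).1 rfl)
      push_cast at this
      exact this
    rw [← Complex.exp_add, ← hc]
    congr 1
    ring
  have h4 := HasSum.card_fiber_mul (g := fun p : ℤ × ℤ => (p.1 ^ 2 + p.2 ^ 2).toNat)
    (c := fun n : ℕ => cexp (-(Real.pi * n * z))) h3
  have hr : ∀ n, rTwoSquares n = Nat.card {p : ℤ × ℤ // (p.1 ^ 2 + p.2 ^ 2).toNat = n} := fun n =>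
    Nat.card_congr (Equiv.subtypeEquivRight fun p => (hg p n).symm)
  simp only [hr]
  exact h4

lemma rTwoSquares_zero : rTwoSquares 0 = 1 := by
  rw [rTwoSquares, Nat.card_eq_one_iff_unique]
  refine ⟨⟨fun ⟨p, hp⟩ ⟨q, hq⟩ => ?_⟩, ⟨⟨(0, 0), by simp⟩⟩⟩
  have key : ∀ p : ℤ × ℤ, p.1 ^ 2 + p.2 ^ 2 = ((0 : ℕ) : ℤ) → p = (0, 0) := by
    rintro ⟨a, b⟩ h
    have ha : a = 0 := by
      push_cast at h; nlinarith [sq_nonneg a, sq_nonneg b, pow_eq_zero_iff (two_ne_zero) (a := a)]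
    have hb : b = 0 := by
      push_cast at h; nlinarith [sq_nonneg a, sq_nonneg b]
    rw [ha, hb]
  simp [key p hp, key q hq]

lemma hasSum_sqTheta_sub_one {z : ℂ} (hz : 0 < z.re) :
    HasSum (fun n : ℕ => 4 * (rho (n + 1) : ℂ) * cexp (-(Real.pi * (n + 1 : ℕ) * z)))
      (sqTheta z - 1) := by
  have h := (hasSum_nat_add_iff' 1).2 (hasSum_sqTheta hz)
  simp only [Finset.sum_range_one, rTwoSquares_zero, Nat.cast_one, Nat.cast_zero, mul_zero,
    zero_mul, neg_zero, Complex.exp_zero, mul_one] at h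
  have hr : ∀ n : ℕ, 4 * (rho (n + 1) : ℂ) = rTwoSquares (n + 1) := fun n => by
    exact_mod_cast congrArg (Int.cast : ℤ → ℂ) (rTwoSquares_eq_four_mul_rho n.succ_ne_zero).symm
  simp only [hr]
  exact h

lemma rho_le (n : ℕ) : rho n ≤ n := by
  rcases Nat.eq_zero_or_pos n with rfl | hn
  · simp
  · exact (Finset.single_le_sum (f := fun m => rho m) (fun i _ => rho_nonneg i)
      (Finset.mem_Ioc.2 ⟨hn, le_rfl⟩)).trans (sum_rho_le n)

end Arithmetic

open scoped ArithmeticFunction.zeta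

/-- The nontrivial character modulo `4` with complex values. -/
noncomputable def chiC : DirichletCharacter ℂ 4 := ZMod.χ₄.ringHomComp (Int.castRingHom ℂ)

lemma chiC_apply (a : ZMod 4) : chiC a = (ZMod.χ₄ a : ℂ) := rfl

lemma chiC_ne_one : chiC ≠ 1 := by
  intro h
  have h3 : IsUnit (3 : ZMod 4) := by decide
  have h1 := congrArg (fun χ : DirichletCharacter ℂ 4 => χ 3) h
  simp only [chiC_apply, MulChar.one_apply h3] at h1
  rw [show ZMod.χ₄ 3 = -1 by decide] at h1
  norm_num at h1

/-- The Dedekind zeta function of the Gaussian field, as `ζ(s) L(s, χ₋₄)`. -/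
noncomputable def zetaK (s : ℂ) : ℂ := riemannZeta s * chiC.LFunction s

lemma LSeriesHasSum_rho {s : ℂ} (hs : 1 < s.re) :
    LSeriesHasSum (fun n => (rho n : ℂ)) s (zetaK s) := by
  have h1 := ArithmeticFunction.LSeriesSummable_zeta_iff.2 hs
  have h2 := DirichletCharacter.LSeriesSummable_of_one_lt_re chiC hs
  have h3 : (fun n => (rho n : ℂ)) =
      LSeries.convolution (fun n => ((ζ n : ℕ) : ℂ)) (fun n => chiC n) := by
    funext n
    rw [LSeries.convolution_def, rho, ArithmeticFunction.mul_apply]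
    push_cast
    rfl
  rw [h3, zetaK, DirichletCharacter.LFunction_eq_LSeries _ hs,
    ← ArithmeticFunction.LSeries_zeta_eq_riemannZeta hs]
  exact LSeriesHasSum.convolution h1.LSeriesHasSum h2.LSeriesHasSum

lemma hasSum_rho {s : ℂ} (hs : 1 < s.re) :
    HasSum (fun n : ℕ => (rho (n + 1) : ℂ) / ((n + 1 : ℕ) : ℂ) ^ s) (zetaK s) := by
  have h := (hasSum_nat_add_iff' 1).2 (LSeriesHasSum_rho hs)
  simpa [LSeries.term] using h

lemma norm_sqTheta_sub_one_le {z : ℂ} (hz : 0 < z.re) :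
    ‖sqTheta z - 1‖ ≤ 4 * (Real.exp (-(Real.pi * z.re)) / (1 - Real.exp (-(Real.pi * z.re))) ^ 2) := by
  set q := Real.exp (-(Real.pi * z.re)) with hq
  have hq1 : q < 1 := Real.exp_lt_one_iff.2 (by nlinarith [mul_pos Real.pi_pos hz])
  have hq0 : 0 < q := Real.exp_pos _
  have hg := (hasSum_coe_mul_geometric_of_norm_lt_one (r := q)
    (by rwa [Real.norm_of_nonneg hq0.le]))
  have hg' := ((hasSum_nat_add_iff' 1).2 hg).mul_left 4
  simp only [Finset.sum_range_one, Nat.cast_zero, zero_mul, sub_zero] at hg'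
  refine (hasSum_sqTheta_sub_one hz).norm_le_of_bounded hg' fun n => ?_
  have hr0 : (0 : ℝ) ≤ rho (n + 1) := by exact_mod_cast rho_nonneg _
  have hr : (rho (n + 1) : ℝ) ≤ (n + 1 : ℕ) := by exact_mod_cast rho_le (n + 1)
  have hre : (-(Real.pi * (n + 1 : ℕ) * z) : ℂ).re = (n + 1 : ℕ) * (-(Real.pi * z.re)) := by
    rw [← ofReal_natCast, ← ofReal_mul, neg_re, re_ofReal_mul]; ring
  rw [norm_mul, norm_mul, norm_intCast, Complex.norm_exp, hre, Real.exp_nat_mul, ← hq,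
    abs_of_nonneg hr0, mul_assoc]
  norm_num
  push_cast at hr
  gcongr

lemma continuousAt_sqTheta {z : ℂ} (hz : 0 < z.re) : ContinuousAt sqTheta z := by
  have h1 : ContinuousAt (fun τ => jacobiTheta₂ 0 τ) (I * z) :=
    (differentiableAt_jacobiTheta₂_snd 0 (τ := I * z) (by simpa using hz)).continuousAt
  have h2 : ContinuousAt (fun z => jacobiTheta₂ 0 (I * z)) z :=
    ContinuousAt.comp (f := fun z => I * z) (g := fun τ => jacobiTheta₂ 0 τ) h1 (by fun_prop)
  exact h2.pow 2

lemma continuousOn_sqTheta_ray {w : ℂ} (hw : 0 < w.re) :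
    ContinuousOn (fun x : ℝ => sqTheta (x * w)) (Set.Ioi 0) := by
  intro x hx
  refine ContinuousAt.continuousWithinAt (ContinuousAt.comp (f := fun x : ℝ => (x : ℂ) * w)
    (g := sqTheta) (continuousAt_sqTheta ?_) (by fun_prop))
  rw [re_ofReal_mul]; exact mul_pos hx hw

lemma isBigO_sqTheta_ray {w : ℂ} (hw : 0 < w.re) (r : ℝ) :
    (fun x : ℝ => sqTheta (x * w) - 1) =O[atTop] (fun x : ℝ => x ^ r) := by
  have hc : 0 < Real.pi * w.re := mul_pos Real.pi_pos hw
  refine IsBigO.trans ?_ (isLittleO_exp_neg_mul_rpow_atTop hc r).isBigO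
  refine IsBigO.of_bound (4 / (1 - Real.exp (-(Real.pi * w.re))) ^ 2) ?_
  filter_upwards [eventually_ge_atTop 1] with x hx
  have hz : 0 < ((x : ℂ) * w).re := by rw [re_ofReal_mul]; exact mul_pos (by linarith) hw
  refine (norm_sqTheta_sub_one_le hz).trans ?_
  have h1 : Real.exp (-(Real.pi * w.re)) < 1 := Real.exp_lt_one_iff.2 (by linarith)
  rw [re_ofReal_mul, Real.norm_of_nonneg (Real.exp_pos _).le,
    show -(Real.pi * (x * w.re)) = -(Real.pi * w.re) * x by ring, div_mul_eq_mul_div, mul_div_assoc]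
  have h2 : Real.exp (-(Real.pi * w.re) * x) ≤ Real.exp (-(Real.pi * w.re)) :=
    Real.exp_le_exp.2 (by nlinarith)
  have h3 : 0 < 1 - Real.exp (-(Real.pi * w.re)) := by linarith
  gcongr

/-- The functional equation of `θ²` along a rotated ray. -/
noncomputable def thetaPair (w : ℂ) (hw : 0 < w.re) (hn : ‖w‖ = 1) : WeakFEPair ℂ where
  f x := sqTheta (x * w)
  g x := sqTheta (x * (starRingEnd ℂ) w)
  k := 1
  ε := (starRingEnd ℂ) w
  f₀ := 1
  g₀ := 1
  hf_int := (continuousOn_sqTheta_ray hw).locallyIntegrableOn measurableSet_Ioi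
  hg_int := (continuousOn_sqTheta_ray (w := (starRingEnd ℂ) w) (by simpa)).locallyIntegrableOn
    measurableSet_Ioi
  hk := one_pos
  hε := by
    intro h
    have : w = 0 := by simpa using h
    simp [this] at hw
  h_feq x hx := by
    have hx : 0 < x := hx
    have hx' : (x : ℂ) ≠ 0 := by exact_mod_cast hx.ne'
    have hw' : w * (starRingEnd ℂ) w = 1 := by rw [mul_conj, normSq_eq_norm_sq, hn]; simp
    have hw0 : (starRingEnd ℂ) w ≠ 0 := right_ne_zero_of_mul (hw'.trans_ne one_ne_zero)
    have h := sqTheta_one_div (z := x * (starRingEnd ℂ) w) (by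
      rw [re_ofReal_mul, conj_re]; exact mul_pos hx hw)
    rw [Real.rpow_one, smul_eq_mul, mul_comm ((starRingEnd ℂ) w), ← h]
    congr 1
    push_cast
    field_simp
    linear_combination hw'
  hf_top := isBigO_sqTheta_ray hw
  hg_top := isBigO_sqTheta_ray (w := (starRingEnd ℂ) w) (by simpa)

lemma integrableOn_rpow_mul_exp_neg_mul {p b : ℝ} (hp : -1 < p) (hb : 0 < b) :
    MeasureTheory.IntegrableOn (fun t : ℝ => t ^ p * Real.exp (-(b * t))) (Set.Ioi 0) := by
  have h := integrableOn_rpow_mul_exp_neg_mul_rpow hp one_pos hb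
  simpa [Real.rpow_one] using h

lemma norm_cpow_mul_cexp {a r : ℂ} {t : ℝ} (ht : 0 < t) :
    ‖(t : ℂ) ^ a * cexp (-(r * t))‖ = t ^ a.re * Real.exp (-(r.re * t)) := by
  rw [norm_mul, norm_cpow_eq_rpow_re_of_pos ht, Complex.norm_exp, neg_re, re_mul_ofReal]

lemma continuousOn_cpow_mul_cexp (a r : ℂ) :
    ContinuousOn (fun t : ℝ => (t : ℂ) ^ a * cexp (-(r * t))) (Set.Ioi 0) := by
  refine ContinuousOn.mul (fun t ht => ?_) (by fun_prop)
  exact (continuousAt_ofReal_cpow_const _ _ (Or.inr <| ne_of_gt ht)).continuousWithinAt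

lemma integrableOn_cpow_mul_cexp {a r : ℂ} (ha : -1 < a.re) (hr : 0 < r.re) :
    MeasureTheory.IntegrableOn (fun t : ℝ => (t : ℂ) ^ a * cexp (-(r * t))) (Set.Ioi 0) := by
  refine MeasureTheory.Integrable.mono' (integrableOn_rpow_mul_exp_neg_mul ha hr)
    ((continuousOn_cpow_mul_cexp a r).aestronglyMeasurable measurableSet_Ioi) ?_
  refine (MeasureTheory.ae_restrict_iff' measurableSet_Ioi).2 (Eventually.of_forall fun t ht => ?_)
  exact (norm_cpow_mul_cexp ht).le

/-- The Gamma integral along a rotated ray. -/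
lemma integral_cpow_mul_cexp_neg_mul {a r : ℂ} (ha : 0 < a.re) (hr : 0 < r.re) :
    ∫ t : ℝ in Set.Ioi 0, (t : ℂ) ^ (a - 1) * cexp (-(r * t)) = r ^ (-a) * Complex.Gamma a := by
  have hopen : IsOpen {z : ℂ | 0 < z.re} := isOpen_lt continuous_const continuous_re
  have hd1 : DifferentiableOn ℂ
      (fun r : ℂ => ∫ t : ℝ in Set.Ioi 0, (t : ℂ) ^ (a - 1) * cexp (-(r * t))) {z | 0 < z.re} := by
    intro z hz
    have hz : 0 < z.re := hz
    have hs : {x : ℂ | z.re / 2 < x.re} ∈ nhds z :=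
      (isOpen_lt continuous_const continuous_re).mem_nhds (show z.re / 2 < z.re by linarith)
    refine (hasDerivAt_integral_of_dominated_loc_of_deriv_le (μ := MeasureTheory.volume.restrict
      (Set.Ioi 0)) (F := fun r t => ((t : ℝ) : ℂ) ^ (a - 1) * cexp (-(r * t)))
      (F' := fun r t => -(((t : ℝ) : ℂ) ^ a * cexp (-(r * t))))
      (bound := fun t => t ^ a.re * Real.exp (-(z.re / 2 * t))) hs ?_ ?_ ?_ ?_ ?_
      ?_).2.differentiableAt.differentiableWithinAt
    · exact Eventually.of_forall fun x =>
        (continuousOn_cpow_mul_cexp _ _).aestronglyMeasurable measurableSet_Ioi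
    · exact integrableOn_cpow_mul_cexp (by simpa using ha) hz
    · exact ((continuousOn_cpow_mul_cexp _ _).aestronglyMeasurable measurableSet_Ioi).neg
    · refine (MeasureTheory.ae_restrict_iff' measurableSet_Ioi).2 (Eventually.of_forall ?_)
      intro t ht x hx
      have ht : 0 < t := ht
      have hx : z.re / 2 < x.re := hx
      rw [norm_neg, norm_cpow_mul_cexp ht]
      gcongr
    · exact integrableOn_rpow_mul_exp_neg_mul (by linarith) (by linarith)
    · refine (MeasureTheory.ae_restrict_iff' measurableSet_Ioi).2 (Eventually.of_forall ?_)
      intro t ht x _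
      have ht' : (t : ℂ) ≠ 0 := by exact_mod_cast (ne_of_gt ht)
      have h1 : HasDerivAt (fun x : ℂ => cexp (-(x * t))) (cexp (-(x * t)) * (-(1 * t))) x :=
        (((hasDerivAt_id x).mul_const (t : ℂ)).neg).cexp
      have h2 := h1.const_mul ((t : ℂ) ^ (a - 1))
      rwa [show (t : ℂ) ^ (a - 1) * (cexp (-(x * t)) * (-(1 * t))) =
        -((t : ℂ) ^ a * cexp (-(x * t))) by
          rw [cpow_sub _ _ ht', cpow_one]; field_simp] at h2
  have hd2 : DifferentiableOn ℂ (fun r : ℂ => r ^ (-a) * Complex.Gamma a) {z | 0 < z.re} := by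
    intro z hz
    exact ((differentiableAt_id.cpow_const (Or.inl hz)).mul_const _).differentiableWithinAt
  refine (hd1.analyticOnNhd hopen).eqOn_of_preconnected_of_frequently_eq
    (hd2.analyticOnNhd hopen) (convex_halfSpace_re_gt 0).isPreconnected
    (show (1 : ℂ) ∈ {z : ℂ | 0 < z.re} by simp) ?_ hr
  have htend : Tendsto (fun n : ℕ => ((1 + 1 / ((n : ℝ) + 1) : ℝ) : ℂ)) atTop
      (nhdsWithin 1 {1}ᶜ) := by
    refine tendsto_nhdsWithin_iff.2 ⟨?_, Eventually.of_forall fun n => ?_⟩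
    · have h := (tendsto_one_div_add_atTop_nhds_zero_nat (𝕜 := ℝ)).const_add 1
      rw [add_zero] at h
      have h2 := (continuous_ofReal.tendsto (1 : ℝ)).comp h
      rw [ofReal_one] at h2
      exact h2
    · have : (0 : ℝ) < 1 / ((n : ℝ) + 1) := by positivity
      rw [Set.mem_compl_singleton_iff, ← ofReal_one, Ne, ofReal_inj]
      linarith
  refine htend.frequently (Frequently.of_forall fun n => ?_)
  have hpos : (0 : ℝ) < 1 + 1 / ((n : ℝ) + 1) := by positivity
  rw [integral_cpow_mul_exp_neg_mul_Ioi ha hpos, one_div, inv_cpow _ _ ?_, cpow_neg]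
  rw [arg_ofReal_of_nonneg hpos.le]
  exact Real.pi_pos.ne

lemma natCast_mul_cpow {n : ℕ} (hn : 0 < n) {z : ℂ} (hz : z ≠ 0) (s : ℂ) :
    ((n : ℂ) * z) ^ s = (n : ℂ) ^ s * z ^ s := by
  have hn0 : (n : ℂ) ≠ 0 := by exact_mod_cast hn.ne'
  have h := log_ofReal_mul (r := n) (by exact_mod_cast hn) hz
  rw [ofReal_natCast] at h
  rw [cpow_def_of_ne_zero (mul_ne_zero hn0 hz), cpow_def_of_ne_zero hn0, cpow_def_of_ne_zero hz, h,
    ← natCast_log, ← Complex.exp_add, add_mul]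

lemma summable_rho_div_rpow {σ : ℝ} (hσ : 1 < σ) :
    Summable fun n : ℕ => (rho (n + 1) : ℝ) / ((n + 1 : ℕ) : ℝ) ^ σ := by
  refine (hasSum_rho (s := σ) (by simpa using hσ)).summable.norm.congr fun n => ?_
  have hr0 : (0 : ℝ) ≤ rho (n + 1) := by exact_mod_cast rho_nonneg _
  rw [norm_div, norm_natCast_cpow_of_pos n.succ_pos, ofReal_re, norm_intCast, abs_of_nonneg hr0]

lemma mellin_sqTheta_sub_one {w s : ℂ} (hw : 0 < w.re) (hs : 1 < s.re) :
    mellin (fun x : ℝ => sqTheta (x * w) - 1) s =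
      4 * (w * Real.pi) ^ (-s) * Complex.Gamma s * zetaK s := by
  have hpw : 0 < (w * Real.pi).re := by
    rw [re_mul_ofReal]; exact mul_pos hw Real.pi_pos
  have hpn : ∀ n : ℕ, 0 < (((n + 1 : ℕ) : ℂ) * (w * Real.pi)).re := fun n => by
    rw [← ofReal_natCast, re_ofReal_mul]
    positivity
  have e : ∀ (n : ℕ) (x : ℝ), (x : ℂ) ^ (s - 1) *
      (4 * (rho (n + 1) : ℂ) * cexp (-(Real.pi * (n + 1 : ℕ) * (x * w)))) =
        4 * (rho (n + 1) : ℂ) * ((x : ℂ) ^ (s - 1) *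
          cexp (-(((n + 1 : ℕ) : ℂ) * (w * Real.pi) * x))) := by
    intro n x
    rw [show -(((n + 1 : ℕ) : ℂ) * (w * Real.pi) * x) = -(Real.pi * (n + 1 : ℕ) * (x * w)) by ring]
    ring
  have hint : ∀ n : ℕ, ∫ x : ℝ in Set.Ioi 0, (x : ℂ) ^ (s - 1) *
      (4 * (rho (n + 1) : ℂ) * cexp (-(Real.pi * (n + 1 : ℕ) * (x * w)))) =
        4 * (w * Real.pi) ^ (-s) * Complex.Gamma s * ((rho (n + 1) : ℂ) / ((n + 1 : ℕ) : ℂ) ^ s) := by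
    intro n
    simp_rw [e]
    rw [MeasureTheory.integral_const_mul, integral_cpow_mul_cexp_neg_mul (by linarith) (hpn n),
      natCast_mul_cpow n.succ_pos (fun h0 => by simp [h0] at hpw),
      cpow_neg ((n + 1 : ℕ) : ℂ)]
    ring
  have hsum : Summable fun n : ℕ => ∫ x : ℝ in Set.Ioi 0, ‖(x : ℂ) ^ (s - 1) *
      (4 * (rho (n + 1) : ℂ) * cexp (-(Real.pi * (n + 1 : ℕ) * (x * w))))‖ := by
    refine ((summable_rho_div_rpow hs).mul_left
      (4 * (w * Real.pi).re ^ (-s.re) * Real.Gamma s.re)).congr fun n => ?_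
    have hr0 : (0 : ℝ) ≤ rho (n + 1) := by exact_mod_cast rho_nonneg _
    have hn : (0 : ℝ) < (n + 1 : ℕ) := by positivity
    have hcongr : Set.EqOn (fun x : ℝ => ‖(x : ℂ) ^ (s - 1) *
        (4 * (rho (n + 1) : ℂ) * cexp (-(Real.pi * (n + 1 : ℕ) * (x * w))))‖)
        (fun x => 4 * (rho (n + 1) : ℝ) * (x ^ (s.re - 1) *
          Real.exp (-((n + 1 : ℕ) * (w * Real.pi).re * x)))) (Set.Ioi 0) := by
      intro x hx
      simp only [e]
      rw [norm_mul, norm_cpow_mul_cexp hx, norm_mul, norm_intCast, abs_of_nonneg hr0,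
        ← ofReal_natCast, re_ofReal_mul]
      simp
    rw [MeasureTheory.setIntegral_congr_fun measurableSet_Ioi hcongr,
      MeasureTheory.integral_const_mul,
      Real.integral_rpow_mul_exp_neg_mul_Ioi (by linarith) (mul_pos hn hpw), one_div,
      Real.inv_rpow (mul_pos hn hpw).le, Real.mul_rpow hn.le hpw.le, Real.rpow_neg hpw.le]
    field_simp
  have h := MeasureTheory.hasSum_integral_of_summable_integral_norm (fun n => by
    simp_rw [e]
    exact (integrableOn_cpow_mul_cexp (by simpa using by linarith) (hpn n)).const_mul _) hsum
  simp_rw [hint] at h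
  rw [mellin, ((hasSum_rho hs).mul_left _).unique h]
  refine MeasureTheory.setIntegral_congr_fun measurableSet_Ioi fun x hx => ?_
  have hxw : 0 < ((x : ℂ) * w).re := by rw [re_ofReal_mul]; exact mul_pos hx hw
  exact (((hasSum_sqTheta_sub_one hxw).mul_left _).tsum_eq).symm

lemma differentiableAt_zetaK {s : ℂ} (hs : s ≠ 1) : DifferentiableAt ℂ zetaK s :=
  (differentiableAt_riemannZeta hs).mul
    (DirichletCharacter.differentiable_LFunction chiC_ne_one s)

lemma eqOn_of_eqOn_re_gt {f g : ℂ → ℂ} {U : Set ℂ} (hU : IsOpen U) (hc : IsPreconnected U)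
    (hf : DifferentiableOn ℂ f U) (hg : DifferentiableOn ℂ g U) {b : ℝ} {z : ℂ} (hz : z ∈ U)
    (hzb : b < z.re) (h : ∀ s ∈ U, b < s.re → f s = g s) : Set.EqOn f g U := by
  refine (hf.analyticOnNhd hU).eqOn_of_preconnected_of_eventuallyEq (hg.analyticOnNhd hU) hc hz ?_
  filter_upwards [hU.mem_nhds hz, (isOpen_lt continuous_const continuous_re).mem_nhds hzb]
    with s h1 h2 using h s h1 h2

lemma zetaK_conj {s : ℂ} (hs : s ≠ 1) :
    zetaK ((starRingEnd ℂ) s) = (starRingEnd ℂ) (zetaK s) := by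
  have hc : IsPreconnected ({1}ᶜ : Set ℂ) :=
    (isConnected_compl_singleton_of_one_lt_rank (by simp) 1).isPreconnected
  have h : Set.EqOn (fun s => (starRingEnd ℂ) (zetaK ((starRingEnd ℂ) s))) zetaK {1}ᶜ := by
    refine eqOn_of_eqOn_re_gt (b := 1) (z := 2) isOpen_compl_singleton hc (fun z hz => ?_)
      (fun z hz => (differentiableAt_zetaK hz).differentiableWithinAt) (by simp) (by simp)
      fun z hz hz1 => ?_
    · have hz' : (starRingEnd ℂ) z ≠ 1 := fun h => hz (by
        rw [Set.mem_singleton_iff, ← conj_conj z, h, map_one])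
      exact (differentiableAt_conj_conj_iff.2
        (by simpa using differentiableAt_zetaK hz')).differentiableWithinAt
    · have h1 := (hasSum_rho (s := (starRingEnd ℂ) z) (by simpa using hz1)).map
        (starRingEnd ℂ) continuous_conj
      refine HasSum.unique ?_ (hasSum_rho hz1)
      convert h1 using 2 with n
      simp only [Function.comp, map_div₀, map_intCast]
      rw [← conj_cpow _ _ (by rw [natCast_arg]; exact Real.pi_pos.ne), map_natCast]
  have := congrArg (starRingEnd ℂ) (h hs)
  simpa using this

lemma norm_zetaK_conj (s : ℂ) : ‖zetaK ((starRingEnd ℂ) s)‖ = ‖zetaK s‖ := by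
  rcases eq_or_ne s 1 with rfl | hs
  · simp
  · rw [zetaK_conj hs, RCLike.norm_conj]

lemma thetaPair_Λ_eq {w : ℂ} (hw : 0 < w.re) (hn : ‖w‖ = 1) {s : ℂ} (hs : 0 < s.im) :
    (thetaPair w hw hn).Λ s = 4 * (w * Real.pi) ^ (-s) * Complex.Gamma s * zetaK s := by
  have hw0 : w * Real.pi ≠ 0 := by
    refine mul_ne_zero (fun h => by simp [h] at hw) (by exact_mod_cast Real.pi_ne_zero)
  refine eqOn_of_eqOn_re_gt (b := 1) (z := 2 + I) (U := {s | 0 < s.im}) (f := (thetaPair w hw hn).Λ)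
    (g := fun s => 4 * (w * Real.pi) ^ (-s) * Complex.Gamma s * zetaK s)
    (isOpen_lt continuous_const continuous_im) (convex_halfSpace_im_gt 0).isPreconnected
    (fun z hz => ?_) (fun z hz => ?_) (by simp) (by simp) (fun z hz hz1 => ?_) hs
  · have hz : 0 < z.im := hz
    refine ((thetaPair w hw hn).differentiableAt_Λ (Or.inl ?_)
      (Or.inl ?_)).differentiableWithinAt
    · rintro rfl; simp at hz
    · rintro rfl; simp at hz
  · have hz : 0 < z.im := hz
    refine DifferentiableAt.differentiableWithinAt ?_
    refine DifferentiableAt.mul (DifferentiableAt.mul (DifferentiableAt.const_mul ?_ _) ?_) ?_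
    · exact differentiableAt_id.neg.const_cpow (Or.inl hw0)
    · refine Complex.differentiableAt_Gamma _ fun m h => ?_
      rw [h] at hz; simp at hz
    · exact differentiableAt_zetaK (fun h => by rw [h] at hz; simp at hz)
  · rw [← ((thetaPair w hw hn).hasMellin (by simpa [thetaPair] using hz1)).2,
      ← mellin_sqTheta_sub_one hw hz1]
    rfl

lemma norm_sq_Gamma_half (t : ℝ) :
    ‖Complex.Gamma (1 / 2 + t * I)‖ ^ 2 = Real.pi / Real.cosh (Real.pi * t) := by
  have h := Complex.Gamma_mul_Gamma_one_sub (1 / 2 + t * I)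
  have h2 : (1 : ℂ) - (1 / 2 + t * I) = (starRingEnd ℂ) (1 / 2 + t * I) := by
    apply Complex.ext
    · simp; norm_num
    · simp
  rw [h2, Gamma_conj, mul_conj, normSq_eq_norm_sq] at h
  have h3 : Complex.sin (Real.pi * (1 / 2 + t * I)) = Complex.cosh (Real.pi * t) := by
    rw [show (Real.pi : ℂ) * (1 / 2 + t * I) = (Real.pi * t) * I + Real.pi / 2 by ring,
      Complex.sin_add_pi_div_two, Complex.cos_mul_I]
  rw [h3] at h
  exact_mod_cast h

lemma norm_sq_zetaK_le {φ t : ℝ} (hφ : |φ| < Real.pi / 2) (ht : 0 < t)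
    (hw : 0 < (cexp (φ * I)).re) (hn : ‖cexp (φ * I)‖ = 1) :
    16 * Real.exp (2 * φ * t - Real.pi * t) * ‖zetaK (1 / 2 + t * I)‖ ^ 2 ≤
      ‖(thetaPair (cexp (φ * I)) hw hn).Λ (1 / 2 + t * I)‖ ^ 2 := by
  have hpi := Real.pi_pos
  rw [thetaPair_Λ_eq hw hn (by simpa using ht), norm_mul, norm_mul, norm_mul]
  have h1 : ‖(cexp (φ * I) * Real.pi) ^ (-(1 / 2 + t * I))‖ ^ 2 = Real.pi⁻¹ * Real.exp (2 * φ * t) := by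
    have h0 : cexp (φ * I) * Real.pi ≠ 0 :=
      mul_ne_zero (Complex.exp_ne_zero _) (by exact_mod_cast hpi.ne')
    have hl : Complex.log (cexp (φ * I) * Real.pi) = Real.log Real.pi + φ * I := by
      have := abs_lt.1 hφ
      rw [mul_comm, log_ofReal_mul hpi (Complex.exp_ne_zero _), Complex.log_exp] <;> simp <;> linarith
    rw [cpow_def_of_ne_zero h0, hl, Complex.norm_exp, ← Real.exp_nat_mul]
    have : ((Real.log Real.pi + φ * I) * -(1 / 2 + t * I)).re = -(Real.log Real.pi) / 2 + φ * t := by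
      simp; ring
    rw [this, show ((2 : ℕ) : ℝ) * (-(Real.log Real.pi) / 2 + φ * t) =
      -Real.log Real.pi + 2 * φ * t by push_cast; ring, Real.exp_add, Real.exp_neg, Real.exp_log hpi]
  rw [mul_pow, mul_pow, mul_pow, h1, norm_sq_Gamma_half]
  have h2 : Real.cosh (Real.pi * t) ≤ Real.exp (Real.pi * t) := by
    rw [Real.cosh_eq]
    have : Real.exp (-(Real.pi * t)) ≤ Real.exp (Real.pi * t) :=
      Real.exp_le_exp.2 (by nlinarith [mul_pos hpi ht])
    linarith
  have h3 : Real.exp (-(Real.pi * t)) ≤ 1 / Real.cosh (Real.pi * t) := by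
    rw [Real.exp_neg, ← one_div]
    exact one_div_le_one_div_of_le (Real.cosh_pos _) h2
  rw [sub_eq_add_neg, Real.exp_add]
  have h4 : ‖(4 : ℂ)‖ ^ 2 * (Real.pi⁻¹ * Real.exp (2 * φ * t)) * (Real.pi / Real.cosh (Real.pi * t)) =
      16 * (Real.exp (2 * φ * t) * (1 / Real.cosh (Real.pi * t))) := by
    norm_num; field_simp
  rw [h4]
  gcongr

section Fourier

open scoped FourierTransform SchwartzMap

open MeasureTheory in
lemma fourier_toLp_ae_eq {F : ℝ → ℂ} (h1 : Integrable F) (h2 : MemLp F 2) :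
    (𝓕 (h2.toLp F) : Lp ℂ 2 (volume : Measure ℝ)) =ᵐ[volume] 𝓕 F := by
  have hFF : MemLp (𝓕 (h2.toLp F) : Lp ℂ 2 (volume : Measure ℝ)) 2 volume := Lp.memLp _
  have hcont : Continuous (𝓕 F) := by
    exact VectorFourier.fourierIntegral_continuous Real.continuous_fourierChar
      (by exact continuous_inner) h1
  refine ae_eq_of_integral_contDiff_smul_eq (hFF.locallyIntegrable (by norm_num))
    hcont.locallyIntegrable fun g g_smooth g_cpt => ?_
  have hg₁ : HasCompactSupport (Complex.ofRealCLM ∘ g) := g_cpt.comp_left rfl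
  have hg₂ : ContDiff ℝ (⊤ : ℕ∞) (Complex.ofRealCLM ∘ g) := by fun_prop
  set φ : 𝓢(ℝ, ℂ) := hg₁.toSchwartzMap hg₂ with hφ
  have e1 : ∫ x, g x • (𝓕 (h2.toLp F) : Lp ℂ 2 (volume : Measure ℝ)) x =
      Lp.toTemperedDistribution (𝓕 (h2.toLp F) : Lp ℂ 2 (volume : Measure ℝ)) φ := by
    rw [Lp.toTemperedDistribution_apply]
    simp [hφ]
  rw [e1, ← Lp.fourier_toTemperedDistribution_eq, TemperedDistribution.fourier_apply,
    Lp.toTemperedDistribution_apply]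
  have e2 : ∫ x, (𝓕 φ) x • (h2.toLp F) x = ∫ x, 𝓕 (φ : ℝ → ℂ) x • F x := by
    refine integral_congr_ae ?_
    filter_upwards [h2.coeFn_toLp] with x hx
    rw [hx]; rfl
  rw [e2]
  have e3 : ∫ x, 𝓕 (φ : ℝ → ℂ) x • F x = ∫ x, φ x • 𝓕 F x := by
    simpa using! (VectorFourier.integral_fourierIntegral_smul_eq_flip (L := innerₗ ℝ)
      Real.continuous_fourierChar continuous_inner φ.integrable h1)
  rw [e3]
  simp [hφ]

open MeasureTheory in
/-- Plancherel's theorem for integrable square-integrable functions. -/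
lemma eLpNorm_fourier {F : ℝ → ℂ} (h1 : Integrable F) (h2 : MemLp F 2) :
    eLpNorm (𝓕 F) 2 volume = eLpNorm F 2 volume := by
  rw [← eLpNorm_congr_ae (fourier_toLp_ae_eq h1 h2), ← Lp.enorm_def, ← ofReal_norm, Lp.norm_fourier_eq,
    ofReal_norm, Lp.enorm_def, eLpNorm_congr_ae h2.coeFn_toLp]

lemma hasDerivWithinAt_exp_comp_neg : ∀ x ∈ Set.univ,
    HasDerivWithinAt (fun u : ℝ => Real.exp (-u)) (-Real.exp (-x)) Set.univ x := fun x _ => by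
  simpa using ((hasDerivAt_neg x).exp).hasDerivWithinAt (s := Set.univ)

lemma exp_comp_neg_image : (fun u : ℝ => Real.exp (-u)) '' Set.univ = Set.Ioi 0 := by
  rw [Set.image_univ]
  ext y
  refine ⟨fun ⟨u, hu⟩ => hu ▸ Real.exp_pos _, fun hy => ⟨-Real.log y, ?_⟩⟩
  simp only [neg_neg]
  exact Real.exp_log hy

lemma exp_comp_neg_injOn : Set.univ.InjOn (fun u : ℝ => Real.exp (-u)) := fun x _ y _ h => by
  simpa using h

open MeasureTheory in
/-- The Mellin–Plancherel inequality on the line `Re s = 1/2`. -/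
lemma lintegral_mellin_sq_le {f : ℝ → ℂ} (hf : MellinConvergent f ((1 / 2 : ℝ) : ℂ)) :
    ∫⁻ t : ℝ, ‖mellin f (1 / 2 + t * I)‖ₑ ^ 2 ≤
      ENNReal.ofReal (2 * Real.pi) * ∫⁻ x in Set.Ioi 0, ‖f x‖ₑ ^ 2 := by
  have h2π : 0 < 2 * Real.pi := by positivity
  set g : ℝ → ℂ := fun u => Real.exp (-(1 / 2 : ℝ) * u) • f (Real.exp (-u)) with hg
  have hgint : Integrable g := by
    rw [MellinConvergent, ← exp_comp_neg_image, integrableOn_image_iff_integrableOn_abs_deriv_smul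
      MeasurableSet.univ hasDerivWithinAt_exp_comp_neg exp_comp_neg_injOn,
      integrableOn_univ] at hf
    refine hf.congr (Eventually.of_forall fun u => ?_)
    simp only [hg, abs_neg, Real.abs_exp]
    rw [← ofReal_one, ← ofReal_sub, ← ofReal_cpow (Real.exp_pos _).le, ← Real.exp_mul, smul_eq_mul,
      real_smul, real_smul, ← mul_assoc, ← ofReal_mul, ← Real.exp_add]
    congr 3
    ring
  have hgsq : ∫⁻ u, ‖g u‖ₑ ^ 2 = ∫⁻ x in Set.Ioi 0, ‖f x‖ₑ ^ 2 := by
    rw [← exp_comp_neg_image, lintegral_image_eq_lintegral_abs_deriv_mul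
      MeasurableSet.univ hasDerivWithinAt_exp_comp_neg exp_comp_neg_injOn, setLIntegral_univ]
    refine lintegral_congr fun u => ?_
    rw [hg, enorm_smul, mul_pow, abs_neg, Real.abs_exp, Real.enorm_of_nonneg (Real.exp_pos _).le,
      ← ENNReal.ofReal_pow (Real.exp_pos _).le, ← Real.exp_nat_mul]
    congr 3
    push_cast
    ring
  rw [← hgsq]
  by_cases hfin : ∫⁻ u, ‖g u‖ₑ ^ 2 = ⊤
  · rw [hfin, ENNReal.mul_top (by simpa using Real.pi_pos)]
    exact le_top
  have hsq : ∀ F : ℝ → ℂ, eLpNorm F 2 volume ^ (2 : ℝ) = ∫⁻ u, ‖F u‖ₑ ^ 2 := fun F => by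
    have := eLpNorm_nnreal_pow_eq_lintegral (f := F) (μ := volume) (p := 2) (by norm_num)
    simpa using this
  have hmem : MemLp g 2 := by
    refine ⟨hgint.aestronglyMeasurable, ?_⟩
    rw [← hsq] at hfin
    rw [lt_top_iff_ne_top]
    rintro h
    rw [h] at hfin
    simp at hfin
  rw [← hsq g, ← eLpNorm_fourier hgint hmem, hsq]
  have e : ∀ t : ℝ, mellin f (1 / 2 + t * I) = 𝓕 g (t / (2 * Real.pi)) := fun t => by
    rw [mellin_eq_fourier, hg]
    simp
  have himg : (fun ξ : ℝ => ξ * (2 * Real.pi)) '' Set.univ = Set.univ := by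
    rw [Set.image_univ]
    exact (mul_right_surjective₀ h2π.ne').range_eq
  have hder : ∀ x ∈ Set.univ, HasDerivWithinAt (fun ξ : ℝ => ξ * (2 * Real.pi)) (2 * Real.pi)
      Set.univ x := fun x _ => by
    simpa using ((hasDerivAt_id x).mul_const (2 * Real.pi)).hasDerivWithinAt (s := Set.univ)
  rw [← setLIntegral_univ (fun t : ℝ => ‖mellin f (1 / 2 + t * I)‖ₑ ^ 2)]
  nth_rw 1 [← himg]
  rw [lintegral_image_eq_lintegral_abs_deriv_mul MeasurableSet.univ hder
    (mul_left_injective₀ h2π.ne').injOn, setLIntegral_univ, abs_of_pos h2π,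
    lintegral_const_mul' _ _ ENNReal.ofReal_ne_top]
  simp_rw [e, mul_div_cancel_right₀ _ h2π.ne']
  exact le_rfl

end Fourier

open MeasureTheory in
lemma integral_norm_sq_expSum_le (S : Finset ℕ) (b : ℕ → ℝ) (hb : ∀ n, 0 ≤ b n) {w : ℂ}
    (hw : 0 < w.re) (hS : ∀ n ∈ S, 1 ≤ n) :
    IntegrableOn (fun x : ℝ => ‖∑ n ∈ S, (b n : ℂ) * cexp (-(Real.pi * n * (x * w)))‖ ^ 2) (Set.Ioi 1) ∧
    ∫ x in Set.Ioi (1 : ℝ), ‖∑ n ∈ S, (b n : ℂ) * cexp (-(Real.pi * n * (x * w)))‖ ^ 2 ≤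
      ∑ n ∈ S, ∑ m ∈ S, b n * b m * (Real.exp (-(Real.pi * (n + m) * w.re)) /
        ‖Real.pi * (n * w + m * (starRingEnd ℂ) w)‖) := by
  set z : ℕ → ℕ → ℂ := fun n m => Real.pi * (n * w + m * (starRingEnd ℂ) w) with hz
  have hzre : ∀ n m, (z n m).re = Real.pi * (n + m) * w.re := fun n m => by
    simp only [hz, re_ofReal_mul, add_re, ← ofReal_natCast, conj_re]; ring
  have hzpos : ∀ n ∈ S, ∀ m ∈ S, (-z n m).re < 0 := fun n hn m hm => by
    have h1 : (1 : ℝ) ≤ n := by exact_mod_cast hS n hn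
    rw [neg_re, hzre]
    have := Real.pi_pos
    have : 0 < Real.pi * (n + m) * w.re := by positivity
    linarith
  have e : ∀ x : ℝ, ((‖∑ n ∈ S, (b n : ℂ) * cexp (-(Real.pi * n * (x * w)))‖ ^ 2 : ℝ) : ℂ) =
      ∑ n ∈ S, ∑ m ∈ S, ((b n * b m : ℝ) : ℂ) * cexp (-z n m * x) := fun x => by
    rw [← normSq_eq_norm_sq, ← mul_conj, map_sum, Finset.sum_mul_sum]
    refine Finset.sum_congr rfl fun n _ => Finset.sum_congr rfl fun m _ => ?_
    rw [map_mul, ← exp_conj, conj_ofReal, ofReal_mul, mul_mul_mul_comm, ← Complex.exp_add]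
    congr 2
    simp only [map_neg, map_mul, conj_ofReal, map_natCast, hz]
    ring
  have hI : ∀ n ∈ S, ∀ m ∈ S, IntegrableOn
      (fun x : ℝ => ((b n * b m : ℝ) : ℂ) * cexp (-z n m * x)) (Set.Ioi 1) := fun n hn m hm =>
    (integrableOn_exp_mul_complex_Ioi (hzpos n hn m hm) 1).const_mul _
  have hI1 : IntegrableOn (fun x : ℝ => ∑ n ∈ S, ∑ m ∈ S,
      ((b n * b m : ℝ) : ℂ) * cexp (-z n m * x)) (Set.Ioi 1) :=
    integrable_finsetSum _ fun n hn => integrable_finsetSum _ fun m hm => hI n hn m hm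
  have hI2 : IntegrableOn (fun x : ℝ =>
      ‖∑ n ∈ S, (b n : ℂ) * cexp (-(Real.pi * n * (x * w)))‖ ^ 2) (Set.Ioi 1) := by
    refine hI1.re.congr (Eventually.of_forall fun x => ?_)
    simp only [← e]
    exact ofReal_re _
  refine ⟨hI2, ?_⟩
  have h1 : ((∫ x in Set.Ioi (1 : ℝ), ‖∑ n ∈ S, (b n : ℂ) * cexp (-(Real.pi * n * (x * w)))‖ ^ 2 : ℝ) : ℂ) =
      ∑ n ∈ S, ∑ m ∈ S, ((b n * b m : ℝ) : ℂ) * (-cexp (-z n m * (1 : ℝ)) / (-z n m)) := by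
    rw [← integral_complex_ofReal]
    simp_rw [e]
    rw [integral_finsetSum _ fun n hn => integrable_finsetSum _ fun m hm => hI n hn m hm]
    refine Finset.sum_congr rfl fun n hn => ?_
    rw [integral_finsetSum _ fun m hm => hI n hn m hm]
    refine Finset.sum_congr rfl fun m hm => ?_
    rw [integral_const_mul, integral_exp_mul_complex_Ioi (hzpos n hn m hm)]
  refine (le_abs_self _).trans ?_
  rw [← Real.norm_eq_abs, ← Complex.norm_real, h1]
  refine (norm_sum_le _ _).trans (Finset.sum_le_sum fun n _ => (norm_sum_le _ _).trans
    (Finset.sum_le_sum fun m _ => ?_))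
  rw [norm_mul, norm_div, norm_neg, norm_neg, Complex.norm_exp, norm_real,
    Real.norm_of_nonneg (mul_nonneg (hb n) (hb m)), ofReal_one, mul_one, neg_re, hzre]

/-- Schur's test for symmetric kernels. -/
lemma sum_sum_mul_le_of_symm (S : Finset ℕ) (a : ℕ → ℝ) (K : ℕ → ℕ → ℝ)
    (hK : ∀ n m, 0 ≤ K n m) (hsymm : ∀ n m, K n m = K m n) :
    ∑ n ∈ S, ∑ m ∈ S, a n * a m * K n m ≤ ∑ n ∈ S, a n ^ 2 * ∑ m ∈ S, K n m := by
  have h1 : ∀ n m, a n * a m * K n m ≤ 2⁻¹ * (a n ^ 2 * K n m) + 2⁻¹ * (a m ^ 2 * K m n) := by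
    intro n m
    rw [hsymm m n]
    nlinarith [mul_nonneg (hK n m) (sq_nonneg (a n - a m))]
  calc ∑ n ∈ S, ∑ m ∈ S, a n * a m * K n m
      ≤ ∑ n ∈ S, ∑ m ∈ S, (2⁻¹ * (a n ^ 2 * K n m) + 2⁻¹ * (a m ^ 2 * K m n)) :=
        Finset.sum_le_sum fun n _ => Finset.sum_le_sum fun m _ => h1 n m
    _ = 2⁻¹ * ∑ n ∈ S, ∑ m ∈ S, a n ^ 2 * K n m + 2⁻¹ * ∑ n ∈ S, ∑ m ∈ S, a m ^ 2 * K m n := by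
        simp_rw [Finset.sum_add_distrib, ← Finset.mul_sum]
    _ = ∑ n ∈ S, ∑ m ∈ S, a n ^ 2 * K n m := by
        rw [Finset.sum_comm (f := fun n m => a m ^ 2 * K m n)]; ring
    _ = _ := by simp_rw [Finset.mul_sum]

lemma sum_pow_div_le_neg_log {q : ℝ} (hq0 : 0 ≤ q) (hq1 : q < 1) (N : ℕ) :
    ∑ k ∈ Finset.Ioc 0 N, q ^ k / k ≤ -Real.log (1 - q) := by
  have h := Real.hasSum_pow_div_log_of_abs_lt_one (x := q) (by rwa [abs_of_nonneg hq0])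
  refine le_trans (le_of_eq ?_) (sum_le_hasSum (Finset.range N) (fun n _ => by positivity) h)
  induction N with
  | zero => simp
  | succ N ih => rw [Finset.sum_Ioc_succ_top (by omega), Finset.sum_range_succ, ih]; push_cast; rfl

lemma neg_log_one_sub_exp_le {c : ℝ} (hc : 0 < c) (hc1 : c ≤ 1) :
    -Real.log (1 - Real.exp (-c)) ≤ 1 + Real.log (1 / c) := by
  have h1 : c / (1 + c) ≤ 1 - Real.exp (-c) := by
    have : Real.exp (-c) ≤ 1 / (1 + c) := by
      rw [Real.exp_neg, ← one_div]
      exact one_div_le_one_div_of_le (by linarith) (by linarith [Real.add_one_le_exp c])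
    have h2 : c / (1 + c) = 1 - 1 / (1 + c) := by field_simp; ring
    linarith
  have h3 : c / 2 ≤ 1 - Real.exp (-c) := le_trans (by gcongr; linarith) h1
  have h4 := Real.log_le_log (by positivity) h3
  rw [Real.log_div hc.ne' (by norm_num)] at h4
  rw [one_div, Real.log_inv]
  linarith [Real.log_two_lt_d9]

lemma sum_exp_neg_mul_le {c : ℝ} (hc : 0 < c) (N : ℕ) :
    ∑ n ∈ Finset.Ioc 0 N, Real.exp (-(n * c)) ≤ 1 / c := by
  have hq : Real.exp (-c) < 1 := Real.exp_lt_one_iff.2 (by linarith)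
  have h1 : ∑ n ∈ Finset.Ioc 0 N, Real.exp (-(n * c)) =
      Real.exp (-c) * ∑ n ∈ Finset.range N, Real.exp (-c) ^ n := by
    induction N with
    | zero => simp
    | succ N ih =>
      rw [Finset.sum_Ioc_succ_top (by omega), Finset.sum_range_succ, ih, mul_add, ← pow_succ',
        ← Real.exp_nat_mul]
      congr 2; push_cast; ring
  have h2 := (summable_geometric_of_lt_one (Real.exp_pos (-c)).le hq).sum_le_tsum
    (Finset.range N) (fun n _ => by positivity)
  rw [tsum_geometric_of_lt_one (Real.exp_pos (-c)).le hq] at h2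
  rw [h1]
  refine (mul_le_mul_of_nonneg_left h2 (Real.exp_pos _).le).trans ?_
  have h3 : Real.exp (-c) * (1 + c) ≤ 1 := by
    rw [Real.exp_neg, ← div_eq_inv_mul, div_le_one (Real.exp_pos c)]
    linarith [Real.add_one_le_exp c]
  rw [← div_eq_mul_inv, div_le_div_iff₀ (by linarith) hc]
  linarith

lemma sum_exp_neg_mul_div_le {c : ℝ} (hc : 0 < c) (hc1 : c ≤ 1) (N : ℕ) :
    ∑ n ∈ Finset.Ioc 0 N, Real.exp (-(n * c)) / (n * c) ≤ (1 + Real.log (1 / c)) / c := by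
  have h := (sum_pow_div_le_neg_log (Real.exp_pos (-c)).le (Real.exp_lt_one_iff.2 (by linarith)) N).trans
    (neg_log_one_sub_exp_le hc hc1)
  rw [le_div_iff₀ hc, Finset.sum_mul]
  refine le_trans (le_of_eq (Finset.sum_congr rfl fun n _ => ?_)) h
  rw [← Real.exp_nat_mul]
  field_simp

/-- The kernel appearing in the mean square of the rotated theta series. -/
noncomputable def thetaKernel (w : ℂ) (n m : ℕ) : ℝ :=
  Real.exp (-(Real.pi * (n + m) * w.re / 2)) / ‖Real.pi * (n * w + m * (starRingEnd ℂ) w)‖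

lemma thetaKernel_nonneg (w : ℂ) (n m : ℕ) : 0 ≤ thetaKernel w n m := by
  unfold thetaKernel; positivity

lemma thetaKernel_symm (w : ℂ) (n m : ℕ) : thetaKernel w n m = thetaKernel w m n := by
  unfold thetaKernel
  rw [← Complex.norm_conj (Real.pi * (n * w + m * (starRingEnd ℂ) w)), add_comm (n : ℝ)]
  simp only [map_mul, map_add, conj_ofReal, map_natCast, Complex.conj_conj]
  rw [add_comm ((n : ℂ) * _)]

lemma thetaKernel_self_le {w : ℂ} (hw : 0 < w.re) {n : ℕ} (hn : 1 ≤ n) :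
    thetaKernel w n n ≤ Real.exp (-(Real.pi * n * w.re / 2)) * (1 / (n * w.re)) := by
  have hn' : (1 : ℝ) ≤ n := by exact_mod_cast hn
  have hp := Real.pi_gt_three
  have h1 : n * w.re ≤ ‖(Real.pi : ℂ) * (n * w + n * (starRingEnd ℂ) w)‖ := by
    refine le_trans ?_ (Complex.re_le_norm _)
    simp only [re_ofReal_mul, add_re, ← ofReal_natCast, conj_re]
    have : 0 < n * w.re := by positivity
    nlinarith
  rw [thetaKernel, ← div_eq_mul_one_div]
  have h0 : 0 < n * w.re := by positivity
  gcongr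
  nlinarith [mul_pos (mul_pos Real.pi_pos (by linarith : (0:ℝ) < n)) hw]

lemma thetaKernel_le {w : ℂ} (hw : 0 < w.re) (hi : 1 / 2 ≤ |w.im|) {n m : ℕ} (hnm : n < m) :
    thetaKernel w n m ≤ Real.exp (-(Real.pi * m * w.re / 2)) * (1 / ((m - n : ℕ) : ℝ)) := by
  have hp := Real.pi_gt_three
  have hpos : (0 : ℝ) < (m - n : ℕ) := by exact_mod_cast Nat.sub_pos_of_lt hnm
  have h1 : ((m - n : ℕ) : ℝ) ≤ ‖(Real.pi : ℂ) * (n * w + m * (starRingEnd ℂ) w)‖ := by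
    refine le_trans ?_ (Complex.abs_im_le_norm _)
    simp only [im_ofReal_mul, add_im, ← ofReal_natCast, conj_im]
    rw [show Real.pi * (n * w.im + m * -w.im) = -(Real.pi * ((m - n : ℕ) : ℝ) * w.im) by
      rw [Nat.cast_sub hnm.le]; ring, abs_neg, abs_mul, abs_of_pos (by positivity)]
    nlinarith [mul_le_mul_of_nonneg_left hi (by positivity : 0 ≤ Real.pi * ((m - n : ℕ) : ℝ))]
  rw [thetaKernel, ← div_eq_mul_one_div]
  gcongr
  have : 0 ≤ n * w.re := by positivity
  nlinarith [mul_nonneg Real.pi_pos.le this]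

lemma sum_thetaKernel_le {w : ℂ} (hw : 0 < w.re) (hw1 : w.re ≤ 1) (hi : 1 / 2 ≤ |w.im|) (N : ℕ)
    {n : ℕ} (hn : 1 ≤ n) (hnN : n ≤ N) :
    ∑ m ∈ Finset.Ioc 0 N, thetaKernel w n m ≤ Real.exp (-(Real.pi * n * w.re / 2)) *
      (1 / (n * w.re) + (1 + Real.log n) + (1 + Real.log (1 / w.re))) := by
  have hsplit : Finset.Ioc 0 N = Finset.Ioo 0 n ∪ ({n} ∪ Finset.Ioc n N) := by
    ext m; simp only [Finset.mem_Ioc, Finset.mem_union, Finset.mem_Ioo, Finset.mem_singleton]; omega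
  have hA : ∑ m ∈ Finset.Ioo 0 n, thetaKernel w n m ≤
      Real.exp (-(Real.pi * n * w.re / 2)) * (1 + Real.log n) := by
    calc _ ≤ ∑ m ∈ Finset.Ioo 0 n, Real.exp (-(Real.pi * n * w.re / 2)) * (1 / ((n - m : ℕ) : ℝ)) :=
          Finset.sum_le_sum fun m hm => by
            rw [thetaKernel_symm]; exact thetaKernel_le hw hi (Finset.mem_Ioo.1 hm).2
      _ = Real.exp (-(Real.pi * n * w.re / 2)) * ∑ k ∈ Finset.Ioo 0 n, (k : ℝ)⁻¹ := by
          rw [← Finset.mul_sum]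
          congr 1
          refine Finset.sum_nbij' (fun m => n - m) (fun m => n - m) ?_ ?_ ?_ ?_ ?_ <;>
            intro a ha <;> simp only [Finset.mem_Ioo, one_div] at ha ⊢ <;> omega
      _ ≤ _ := by
          gcongr
          exact (Finset.sum_le_sum_of_subset_of_nonneg Finset.Ioo_subset_Ioc_self
            fun k _ _ => by positivity).trans (sum_inv_le_one_add_log n)
  have hB : ∑ m ∈ Finset.Ioc n N, thetaKernel w n m ≤
      Real.exp (-(Real.pi * n * w.re / 2)) * (1 + Real.log (1 / w.re)) := by
    have hp := Real.pi_gt_three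
    calc _ ≤ ∑ m ∈ Finset.Ioc n N, Real.exp (-(Real.pi * n * w.re / 2)) *
            (Real.exp (-w.re) ^ (m - n) / ((m - n : ℕ) : ℝ)) :=
          Finset.sum_le_sum fun m hm => by
            have hnm := (Finset.mem_Ioc.1 hm).1
            refine (thetaKernel_le hw hi hnm).trans ?_
            rw [mul_one_div, mul_div_assoc', ← Real.exp_nat_mul, ← Real.exp_add]
            gcongr
            rw [Nat.cast_sub hnm.le]
            have : (0 : ℝ) < (m - n) * w.re :=
              mul_pos (sub_pos.2 (by exact_mod_cast hnm)) hw
            nlinarith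
      _ = Real.exp (-(Real.pi * n * w.re / 2)) *
            ∑ k ∈ Finset.Ioc 0 (N - n), Real.exp (-w.re) ^ k / k := by
          rw [← Finset.mul_sum]
          congr 1
          refine Finset.sum_nbij' (fun m => m - n) (fun m => m + n) ?_ ?_ ?_ ?_ ?_ <;>
            intro a ha <;> simp only [Finset.mem_Ioc] at ha ⊢ <;> omega
      _ ≤ _ := by
          gcongr
          exact (sum_pow_div_le_neg_log (Real.exp_pos _).le
            (Real.exp_lt_one_iff.2 (by linarith)) _).trans (neg_log_one_sub_exp_le hw hw1)
  rw [hsplit, Finset.sum_union, Finset.sum_union, Finset.sum_singleton]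
  · linarith [thetaKernel_self_le hw hn]
  · rw [Finset.disjoint_singleton_left]; simp
  · rw [Finset.disjoint_left]; intro m; simp only [Finset.mem_Ioo, Finset.mem_union,
      Finset.mem_singleton, Finset.mem_Ioc]; omega

/-- The weight bounding the mean square of the rotated theta series. -/
noncomputable def thetaWeight (c : ℝ) (n : ℕ) : ℝ :=
  Real.exp (-(2 * n * c)) * (1 / (n * c) + 3 + 2 * Real.log (1 / c))

lemma log_natCast_le {c : ℝ} (hc : 0 < c) {n : ℕ} (hn : 1 ≤ n) :
    Real.log n ≤ n * c + Real.log (1 / c) := by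
  have hn' : (0 : ℝ) < n := by exact_mod_cast hn
  have h := Real.log_le_sub_one_of_pos (mul_pos hn' hc)
  rw [Real.log_mul hn'.ne' hc.ne'] at h
  rw [one_div, Real.log_inv]
  linarith

lemma exp_mul_sum_thetaKernel_le {w : ℂ} (hw : 0 < w.re) (hw1 : w.re ≤ 1) (hi : 1 / 2 ≤ |w.im|)
    (N : ℕ) {n : ℕ} (hn : 1 ≤ n) (hnN : n ≤ N) :
    Real.exp (-(Real.pi * n * w.re)) * ∑ m ∈ Finset.Ioc 0 N, thetaKernel w n m ≤
      thetaWeight w.re n := by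
  have h := sum_thetaKernel_le hw hw1 hi N hn hnN
  have hl := log_natCast_le hw hn
  have hn' : (0 : ℝ) < n := by exact_mod_cast hn
  have hy : 0 < n * w.re := by positivity
  have hℓ : 0 ≤ Real.log (1 / w.re) := Real.log_nonneg (by rw [le_div_iff₀ hw]; linarith)
  set y := n * w.re with hydef
  have he : y * Real.exp (-y) ≤ 1 := by
    rw [Real.exp_neg, ← div_eq_mul_inv, div_le_one (Real.exp_pos y)]
    linarith [Real.add_one_le_exp y]
  have h3 : Real.exp (-(Real.pi * n * w.re)) * Real.exp (-(Real.pi * n * w.re / 2)) ≤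
      Real.exp (-(2 * n * w.re)) * Real.exp (-y) := by
    rw [← Real.exp_add, ← Real.exp_add]
    refine Real.exp_le_exp.2 ?_
    rw [mul_assoc Real.pi, mul_assoc 2, ← hydef]
    nlinarith [Real.pi_gt_three]
  have hY : Real.exp (-y) ≤ 1 := Real.exp_le_one_iff.2 (by linarith)
  calc _ ≤ Real.exp (-(Real.pi * n * w.re)) * (Real.exp (-(Real.pi * n * w.re / 2)) *
      (1 / y + (1 + (y + Real.log (1 / w.re))) + (1 + Real.log (1 / w.re)))) := by
        gcongr
        exact h.trans (by gcongr)
    _ ≤ Real.exp (-(2 * n * w.re)) * Real.exp (-y) *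
      (1 / y + (1 + (y + Real.log (1 / w.re))) + (1 + Real.log (1 / w.re))) := by
        rw [← mul_assoc]
        gcongr
    _ ≤ _ := by
        rw [thetaWeight, mul_assoc]
        gcongr
        have h5 : 0 < 1 / y := by positivity
        nlinarith [mul_le_mul_of_nonneg_left hY (by positivity : 0 ≤ 1 / y + 2 + 2 * Real.log (1 / w.re))]

lemma thetaWeight_antitone {c : ℝ} (hc : 0 < c) (hc1 : c ≤ 1) {n : ℕ} (hn : 1 ≤ n) :
    thetaWeight c (n + 1) ≤ thetaWeight c n := by
  have hn' : (0 : ℝ) < n := by exact_mod_cast hn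
  have hℓ : 0 ≤ Real.log (1 / c) := Real.log_nonneg (by rw [le_div_iff₀ hc]; linarith)
  unfold thetaWeight
  push_cast
  gcongr <;> linarith

lemma sum_thetaWeight_le {c : ℝ} (hc : 0 < c) (hc1 : c ≤ 1) (N : ℕ) :
    ∑ n ∈ Finset.Ioc 0 N, (rho n : ℝ) ^ 2 * thetaWeight c n ≤
      32 * (1 + Real.log (1 / c)) ^ 2 / c := by
  have hℓ : 0 ≤ Real.log (1 / c) := Real.log_nonneg (by rw [le_div_iff₀ hc]; linarith)
  set ℓ := Real.log (1 / c) with hℓdef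
  refine (sum_rho_sq_mul_le (fun n hn => thetaWeight_antitone hc hc1 hn)
    (fun n hn => by unfold thetaWeight; positivity) N).trans ?_
  calc _ ≤ ∑ n ∈ Finset.Ioc 0 N, 4 * (2 + ℓ) * (Real.exp (-(n * c)) / (n * c) +
          (3 + 2 * ℓ) * Real.exp (-(n * c))) := Finset.sum_le_sum fun n hn => by
        have hn1 : 1 ≤ n := (Finset.mem_Ioc.1 hn).1
        have hl := log_natCast_le hc hn1
        have hn' : (0 : ℝ) < n := by exact_mod_cast hn1
        have hy : 0 < n * c := by positivity
        unfold thetaWeight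
        rw [← hℓdef] at hl ⊢
        set y := n * c with hydef
        have e1 : Real.exp (-(2 * n * c)) = Real.exp (-y) * Real.exp (-y) := by
          rw [← Real.exp_add, hydef]; congr 1; ring
        have he : y * Real.exp (-y) ≤ 1 := by
          rw [Real.exp_neg, ← div_eq_mul_inv, div_le_one (Real.exp_pos y)]
          linarith [Real.add_one_le_exp y]
        have hY : Real.exp (-y) ≤ 1 := Real.exp_le_one_iff.2 (by linarith)
        have h1 : (1 + Real.log n) * Real.exp (-y) ≤ 2 + ℓ := by
          have := mul_le_mul_of_nonneg_right hl (Real.exp_pos (-y)).le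
          nlinarith [mul_le_mul_of_nonneg_left hY (by positivity : 0 ≤ 1 + ℓ)]
        rw [e1]
        have h2 : 0 ≤ Real.exp (-y) * (1 / y + 3 + 2 * ℓ) := by positivity
        calc _ = 4 * (((1 + Real.log n) * Real.exp (-y)) * (Real.exp (-y) * (1 / y + 3 + 2 * ℓ))) := by
              ring
          _ ≤ 4 * ((2 + ℓ) * (Real.exp (-y) * (1 / y + 3 + 2 * ℓ))) := by gcongr
          _ = _ := by ring
    _ ≤ 4 * (2 + ℓ) * ((1 + ℓ) / c + (3 + 2 * ℓ) * (1 / c)) := by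
        rw [← Finset.mul_sum, Finset.sum_add_distrib, ← Finset.mul_sum]
        gcongr
        · exact sum_exp_neg_mul_div_le hc hc1 N
        · exact sum_exp_neg_mul_le hc N
    _ ≤ _ := by
        rw [mul_one_div, ← add_div, mul_div_assoc']
        refine div_le_div_of_nonneg_right ?_ hc.le
        nlinarith

lemma integral_norm_sq_rhoSum_le {w : ℂ} (hw : 0 < w.re) (hw1 : w.re ≤ 1) (hi : 1 / 2 ≤ |w.im|)
    (N : ℕ) :
    ∫⁻ x in Set.Ioi (1 : ℝ), ‖∑ n ∈ Finset.range N,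
      4 * (rho (n + 1) : ℂ) * cexp (-(Real.pi * (n + 1 : ℕ) * (x * w)))‖ₑ ^ 2 ≤
      ENNReal.ofReal (512 * (1 + Real.log (1 / w.re)) ^ 2 / w.re) := by
  have key := integral_norm_sq_expSum_le (Finset.Ioc 0 N) (fun n => 4 * (rho n : ℝ))
    (fun n => by have := rho_nonneg n; positivity) hw (fun n hn => (Finset.mem_Ioc.1 hn).1)
  have e : ∀ x : ℝ, ∑ n ∈ Finset.range N,
      4 * (rho (n + 1) : ℂ) * cexp (-(Real.pi * (n + 1 : ℕ) * (x * w))) =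
      ∑ n ∈ Finset.Ioc 0 N, ((4 * (rho n : ℝ) : ℝ) : ℂ) * cexp (-(Real.pi * n * (x * w))) := fun x => by
    clear key
    induction N with
    | zero => simp
    | succ N ih => rw [Finset.sum_Ioc_succ_top (by omega), Finset.sum_range_succ, ih]; push_cast; rfl
  have hs : ∫ x in Set.Ioi (1 : ℝ), ‖∑ n ∈ Finset.Ioc 0 N, ((4 * (rho n : ℝ) : ℝ) : ℂ) *
      cexp (-(Real.pi * n * (x * w)))‖ ^ 2 ≤ 512 * (1 + Real.log (1 / w.re)) ^ 2 / w.re := by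
    refine key.2.trans ?_
    calc _ = ∑ n ∈ Finset.Ioc 0 N, ∑ m ∈ Finset.Ioc 0 N,
          (4 * (rho n : ℝ) * Real.exp (-(Real.pi * n * w.re / 2))) *
          (4 * (rho m : ℝ) * Real.exp (-(Real.pi * m * w.re / 2))) * thetaKernel w n m := by
          refine Finset.sum_congr rfl fun n _ => Finset.sum_congr rfl fun m _ => ?_
          have ee : Real.exp (-(Real.pi * (n + m) * w.re)) = Real.exp (-(Real.pi * n * w.re / 2)) *
              Real.exp (-(Real.pi * m * w.re / 2)) * Real.exp (-(Real.pi * (n + m) * w.re / 2)) := by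
            rw [← Real.exp_add, ← Real.exp_add]; congr 1; ring
          rw [thetaKernel, ee]
          ring
      _ ≤ _ := sum_sum_mul_le_of_symm _ _ _ (thetaKernel_nonneg w) (thetaKernel_symm w)
      _ ≤ ∑ n ∈ Finset.Ioc 0 N, 16 * ((rho n : ℝ) ^ 2 * thetaWeight w.re n) :=
          Finset.sum_le_sum fun n hn => by
            have := exp_mul_sum_thetaKernel_le hw hw1 hi N (Finset.mem_Ioc.1 hn).1
              (Finset.mem_Ioc.1 hn).2
            have e2 : Real.exp (-(Real.pi * n * w.re / 2)) ^ 2 = Real.exp (-(Real.pi * n * w.re)) := by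
              rw [← Real.exp_nat_mul]; congr 1; push_cast; ring
            rw [mul_pow, e2, mul_pow, mul_assoc, mul_assoc]
            norm_num
            gcongr
      _ ≤ _ := by
          rw [← Finset.mul_sum]
          refine (mul_le_mul_of_nonneg_left (sum_thetaWeight_le hw hw1 N) (by norm_num)).trans
            (le_of_eq ?_)
          ring
  refine le_trans (le_of_eq ?_) (ENNReal.ofReal_le_ofReal hs)
  rw [MeasureTheory.ofReal_integral_eq_lintegral_ofReal key.1
    (Eventually.of_forall fun x => by positivity)]
  refine MeasureTheory.lintegral_congr fun x => ?_
  rw [e, ENNReal.ofReal_pow (norm_nonneg _), ofReal_norm]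

lemma lintegral_norm_sq_sqTheta_le {w : ℂ} (hw : 0 < w.re) (hw1 : w.re ≤ 1) (hi : 1 / 2 ≤ |w.im|) :
    ∫⁻ x in Set.Ioi (1 : ℝ), ‖sqTheta (x * w) - 1‖ₑ ^ 2 ≤
      ENNReal.ofReal (512 * (1 + Real.log (1 / w.re)) ^ 2 / w.re) := by
  have h1 : ∀ x ∈ Set.Ioi (1 : ℝ), ‖sqTheta (x * w) - 1‖ₑ ^ 2 = liminf (fun N : ℕ =>
      ‖∑ n ∈ Finset.range N, 4 * (rho (n + 1) : ℂ) *
        cexp (-(Real.pi * (n + 1 : ℕ) * (x * w)))‖ₑ ^ 2) atTop := fun x hx => by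
    have hx0 : 0 < ((x : ℂ) * w).re := by
      rw [re_ofReal_mul]; exact mul_pos (zero_lt_one.trans hx) hw
    have := (hasSum_sqTheta_sub_one hx0).tendsto_sum_nat
    exact (((ENNReal.continuous_pow 2).tendsto _).comp (this.enorm)).liminf_eq.symm
  rw [MeasureTheory.setLIntegral_congr_fun measurableSet_Ioi h1]
  refine (MeasureTheory.lintegral_liminf_le fun N => ?_).trans ?_
  · fun_prop
  · refine liminf_le_of_le (by isBoundedDefault) fun b hb => ?_
    obtain ⟨N, hN⟩ := hb.exists
    exact hN.trans (integral_norm_sq_rhoSum_le hw hw1 hi N)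

open MeasureTheory in
lemma lintegral_Ioo_eq_lintegral_Ioi_one_div (f : ℝ → ENNReal) :
    ∫⁻ x in Set.Ioo (0 : ℝ) 1, f x =
      ∫⁻ y in Set.Ioi (1 : ℝ), ENNReal.ofReal (y ^ 2)⁻¹ * f (1 / y) := by
  have him : (fun y : ℝ => 1 / y) '' Set.Ioi 1 = Set.Ioo 0 1 := by
    ext x
    simp only [Set.mem_image, Set.mem_Ioi, Set.mem_Ioo]
    constructor
    · rintro ⟨y, hy, rfl⟩
      exact ⟨by positivity, by rw [div_lt_one (by linarith)]; exact hy⟩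
    · rintro ⟨h0, h1⟩
      exact ⟨1 / x, by rwa [lt_div_iff₀ h0, one_mul], by simp⟩
  rw [← him, lintegral_image_eq_lintegral_abs_deriv_mul (f' := fun y => -(y ^ 2)⁻¹)
    measurableSet_Ioi (fun y hy => ?_) (fun y hy z hz h => by simpa using h)]
  · refine setLIntegral_congr_fun measurableSet_Ioi fun y hy => ?_
    simp only [abs_neg, abs_of_nonneg (inv_nonneg.2 (sq_nonneg y))]
  · have : y ≠ 0 := (zero_lt_one.trans (Set.mem_Ioi.1 hy)).ne'
    simpa [one_div] using (hasDerivAt_inv this).hasDerivWithinAt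

open MeasureTheory in
lemma lintegral_thetaPair_f_modif_le {w : ℂ} (hw : 0 < w.re) (hn : ‖w‖ = 1) (hw1 : w.re ≤ 1)
    (hi : 1 / 2 ≤ |w.im|) :
    ∫⁻ x in Set.Ioi (0 : ℝ), ‖(thetaPair w hw hn).f_modif x‖ₑ ^ 2 ≤
      ENNReal.ofReal (1024 * (1 + Real.log (1 / w.re)) ^ 2 / w.re) := by
  set P := thetaPair w hw hn with hP
  have h1 : ∀ x ∈ Set.Ioi (1 : ℝ), P.f_modif x = sqTheta (x * w) - 1 := fun x hx => by
    simp [WeakFEPair.f_modif, Set.mem_Ioi.1 hx, not_lt.2 (Set.mem_Ioi.1 hx).le, hP, thetaPair]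
  have h2 : ∀ x ∈ Set.Ioi (1 : ℝ), P.g_modif x = sqTheta (x * (starRingEnd ℂ) w) - 1 := fun x hx => by
    simp [WeakFEPair.g_modif, Set.mem_Ioi.1 hx, not_lt.2 (Set.mem_Ioi.1 hx).le, hP, thetaPair]
  have hε : ‖P.ε‖ₑ = 1 := by
    simp [hP, thetaPair, ← ofReal_norm, hn]
  have hsplit : Set.Ioi (0 : ℝ) = Set.Ioo 0 1 ∪ ({1} ∪ Set.Ioi 1) := by
    ext x; simp only [Set.mem_Ioi, Set.mem_union, Set.mem_Ioo, Set.mem_singleton_iff]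
    constructor
    · intro h; rcases lt_trichotomy x 1 with h' | h' | h' <;> simp [*]
    · rintro (h | h | h) <;> linarith
  have hB := lintegral_norm_sq_sqTheta_le hw hw1 hi
  have hA := lintegral_norm_sq_sqTheta_le (w := (starRingEnd ℂ) w) (by simpa) (by simpa)
    (by simpa using hi)
  rw [conj_re] at hA
  have hA' : ∫⁻ x in Set.Ioo (0 : ℝ) 1, ‖P.f_modif x‖ₑ ^ 2 =
      ∫⁻ y in Set.Ioi (1 : ℝ), ‖sqTheta (y * (starRingEnd ℂ) w) - 1‖ₑ ^ 2 := by
    rw [lintegral_Ioo_eq_lintegral_Ioi_one_div]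
    refine setLIntegral_congr_fun measurableSet_Ioi fun y hy => ?_
    have hy0 : 0 < y := zero_lt_one.trans hy
    have hk : P.k = 1 := rfl
    rw [P.hf_modif_FE y hy0, h2 y hy, hk, Real.rpow_one, enorm_smul, enorm_mul, hε, one_mul, mul_pow,
      ← mul_assoc]
    have : ‖(y : ℂ)‖ₑ = ENNReal.ofReal y := by
      rw [← ofReal_norm, norm_real, Real.norm_of_nonneg hy0.le]
    rw [this, ← ENNReal.ofReal_pow hy0.le, ← ENNReal.ofReal_mul (by positivity),
      inv_mul_cancel₀ (by positivity), ENNReal.ofReal_one, one_mul]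
  have hB' : ∫⁻ x in Set.Ioi (1 : ℝ), ‖P.f_modif x‖ₑ ^ 2 =
      ∫⁻ x in Set.Ioi (1 : ℝ), ‖sqTheta (x * w) - 1‖ₑ ^ 2 :=
    setLIntegral_congr_fun measurableSet_Ioi fun x hx => by simp only [h1 x hx]
  calc _ ≤ (∫⁻ x in Set.Ioo (0 : ℝ) 1, ‖P.f_modif x‖ₑ ^ 2) +
        ((∫⁻ x in ({1} : Set ℝ), ‖P.f_modif x‖ₑ ^ 2) + ∫⁻ x in Set.Ioi (1 : ℝ), ‖P.f_modif x‖ₑ ^ 2) := by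
        rw [hsplit]
        exact (lintegral_union_le _ _ _).trans (add_le_add le_rfl (lintegral_union_le _ _ _))
    _ = (∫⁻ y in Set.Ioi (1 : ℝ), ‖sqTheta (y * (starRingEnd ℂ) w) - 1‖ₑ ^ 2) +
        ∫⁻ x in Set.Ioi (1 : ℝ), ‖sqTheta (x * w) - 1‖ₑ ^ 2 := by
        rw [hA', hB', Measure.restrict_singleton]; simp
    _ ≤ _ := by
        refine (add_le_add hA hB).trans (le_of_eq ?_)
        rw [← ENNReal.ofReal_add (by positivity) (by positivity)]
        congr 1; ring

open MeasureTheory in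
lemma lintegral_thetaPair_Λ₀_le {w : ℂ} (hw : 0 < w.re) (hn : ‖w‖ = 1) (hw1 : w.re ≤ 1)
    (hi : 1 / 2 ≤ |w.im|) :
    ∫⁻ t : ℝ, ‖(thetaPair w hw hn).Λ₀ (1 / 2 + t * I)‖ₑ ^ 2 ≤
      ENNReal.ofReal (2 * Real.pi * (1024 * (1 + Real.log (1 / w.re)) ^ 2 / w.re)) := by
  have hc := ((thetaPair w hw hn).isStrongFEPair_toStrongFEPair.hasMellin ((1 / 2 : ℝ) : ℂ)).1
  refine (lintegral_mellin_sq_le hc).trans ?_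
  rw [ENNReal.ofReal_mul (p := 2 * Real.pi) (by positivity)]
  exact mul_le_mul' le_rfl (lintegral_thetaPair_f_modif_le hw hn hw1 hi)

lemma continuous_zetaK_half : Continuous fun t : ℝ => zetaK (1 / 2 + t * I) := by
  refine continuous_iff_continuousAt.2 fun t => ?_
  refine ContinuousAt.comp (f := fun t : ℝ => (1 / 2 + t * I : ℂ)) (g := zetaK)
    (differentiableAt_zetaK fun h => ?_).continuousAt (by fun_prop)
  have := congrArg re h
  norm_num at this

lemma norm_sq_zetaK_le_Λ₀ {T t : ℝ} (hT : 2 ≤ T) (ht : t ∈ Set.Icc T (2 * T))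
    (hw : 0 < (cexp ((Real.pi / 2 - 1 / T : ℝ) * I)).re)
    (hn : ‖cexp ((Real.pi / 2 - 1 / T : ℝ) * I)‖ = 1) :
    ‖zetaK (1 / 2 + t * I)‖ ^ 2 ≤
      8 * ‖(thetaPair _ hw hn).Λ₀ (1 / 2 + t * I)‖ ^ 2 + 32 := by
  have hT0 : 0 < T := by linarith
  have ht0 : 0 < t := hT0.trans_le ht.1
  have h1T : 0 < 1 / T := by positivity
  have h1T2 : 1 / T ≤ 1 / 2 := one_div_le_one_div_of_le two_pos hT
  have hp := Real.pi_gt_three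
  have h := norm_sq_zetaK_le (φ := Real.pi / 2 - 1 / T) (t := t)
    (by rw [abs_lt]; constructor <;> linarith) ht0 hw hn
  have he : (1 / 55 : ℝ) ≤ Real.exp (2 * (Real.pi / 2 - 1 / T) * t - Real.pi * t) := by
    have e4 : Real.exp 4 ≤ 55 := by
      have h1 := Real.exp_one_lt_d9
      have h2 : Real.exp 4 = Real.exp 1 ^ 4 := by rw [← Real.exp_nat_mul]; norm_num
      rw [h2]
      calc Real.exp 1 ^ 4 ≤ 2.72 ^ 4 := by gcongr; linarith
        _ ≤ 55 := by norm_num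
    calc (1 / 55 : ℝ) ≤ 1 / Real.exp 4 := one_div_le_one_div_of_le (Real.exp_pos 4) e4
      _ = Real.exp (-4) := by rw [Real.exp_neg, one_div]
      _ ≤ _ := by
        gcongr
        have : 2 * (1 / T) * t ≤ 4 := by
          rw [mul_one_div, div_mul_eq_mul_div, div_le_iff₀ hT0]
          linarith [ht.2]
        linarith
  set P := thetaPair _ hw hn with hP
  have hs1 : ∀ s : ℂ, t ≤ ‖s‖ → ‖(1 / s : ℂ)‖ ≤ 1 / 2 := fun s hs => by
    rw [norm_div, norm_one]
    exact one_div_le_one_div_of_le two_pos (hT.trans (ht.1.trans hs))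
  have hΛ : ‖P.Λ (1 / 2 + t * I)‖ ≤ ‖P.Λ₀ (1 / 2 + t * I)‖ + 1 := by
    rw [WeakFEPair.Λ]
    refine (norm_sub_le _ _).trans ?_
    have a1 : ‖(1 / (1 / 2 + t * I) : ℂ) • P.f₀‖ ≤ 1 / 2 := by
      have : P.f₀ = 1 := rfl
      rw [this, smul_eq_mul, mul_one]
      refine hs1 _ ((le_abs_self t).trans (le_trans (le_of_eq ?_) (Complex.abs_im_le_norm _)))
      simp
    have a2 : ‖(P.ε / (P.k - (1 / 2 + t * I)) : ℂ) • P.g₀‖ ≤ 1 / 2 := by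
      have e1 : P.g₀ = 1 := rfl
      have e2 : ‖P.ε‖ = 1 := by rw [hP]; exact (Complex.norm_conj _).trans hn
      have e3 : P.k = 1 := rfl
      rw [e1, smul_eq_mul, mul_one, div_eq_mul_one_div, norm_mul, e2, one_mul, e3]
      refine hs1 _ ((le_abs_self t).trans (le_trans (le_of_eq ?_) (Complex.abs_im_le_norm _)))
      simp
    linarith [norm_sub_le (P.Λ₀ (1 / 2 + t * I)) ((1 / (1 / 2 + t * I) : ℂ) • P.f₀)]
  have h2 : ‖P.Λ (1 / 2 + t * I)‖ ^ 2 ≤ 2 * ‖P.Λ₀ (1 / 2 + t * I)‖ ^ 2 + 2 := by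
    nlinarith [norm_nonneg (P.Λ (1 / 2 + t * I)), sq_nonneg (‖P.Λ₀ (1 / 2 + t * I)‖ - 1)]
  have h3 := mul_le_mul_of_nonneg_right he (sq_nonneg ‖zetaK (1 / 2 + t * I)‖)
  nlinarith [sq_nonneg ‖P.Λ₀ (1 / 2 + t * I)‖]

open MeasureTheory in
/-- The mean square of the Dedekind zeta function of `ℚ(i)` on the critical line. -/
lemma exists_integral_norm_sq_zetaK_le : ∃ C : ℝ, 0 < C ∧ ∀ T : ℝ, 2 ≤ T →
    ∫ t in T..2 * T, ‖zetaK (1 / 2 + t * I)‖ ^ 2 ≤ C * T * Real.log T ^ 2 := by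
  refine ⟨8 * (2 * Real.pi * (1024 * 32)) + 128, by positivity, fun T hT => ?_⟩
  have hT0 : 0 < T := by linarith
  have h1T : 0 < 1 / T := by positivity
  have h1T2 : 1 / T ≤ 1 / 2 := one_div_le_one_div_of_le two_pos hT
  have hp := Real.pi_gt_three
  have hp4 := Real.pi_le_four
  set w := cexp ((Real.pi / 2 - 1 / T : ℝ) * I) with hwdef
  have hre : w.re = Real.sin (1 / T) := by rw [hwdef, exp_ofReal_mul_I_re, Real.cos_pi_div_two_sub]
  have him : w.im = Real.cos (1 / T) := by rw [hwdef, exp_ofReal_mul_I_im, Real.sin_pi_div_two_sub]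
  have hsin : 1 / (2 * T) ≤ Real.sin (1 / T) := by
    refine le_trans ?_ (Real.mul_le_sin h1T.le (by linarith))
    calc 1 / (2 * T) = 1 / 2 * (1 / T) := by field_simp
      _ ≤ _ := by
        refine mul_le_mul_of_nonneg_right ?_ h1T.le
        rw [div_le_div_iff₀ two_pos (by positivity)]; linarith
  have hw : 0 < w.re := by rw [hre]; exact lt_of_lt_of_le (by positivity) hsin
  have hn : ‖w‖ = 1 := norm_exp_ofReal_mul_I _
  have hw1 : w.re ≤ 1 := hre ▸ Real.sin_le_one _
  have hi : 1 / 2 ≤ |w.im| := by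
    rw [him]
    refine le_trans ?_ (le_abs_self _)
    nlinarith [Real.one_sub_sq_div_two_le_cos (x := 1 / T)]
  have hl2 : 0.69 < Real.log 2 := by linarith [Real.log_two_gt_d9]
  have hlT : Real.log 2 ≤ Real.log T := Real.log_le_log two_pos hT
  have hinv : 1 / w.re ≤ 2 * T := by
    rw [hre, one_div_le (hre ▸ hw) (by positivity)]; exact hsin
  have hlog : 1 + Real.log (1 / w.re) ≤ 4 * Real.log T := by
    have := Real.log_le_log (by positivity) hinv
    rw [Real.log_mul two_ne_zero hT0.ne'] at this
    linarith
  have hlog0 : 0 ≤ Real.log (1 / w.re) := Real.log_nonneg (by rw [le_div_iff₀ hw]; linarith)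
  have hΛ := lintegral_thetaPair_Λ₀_le hw hn hw1 hi
  set P := thetaPair w hw hn with hP
  have hcont : Continuous fun t : ℝ => ‖P.Λ₀ (1 / 2 + t * I)‖ ^ 2 := by
    have := P.differentiable_Λ₀.continuous
    fun_prop
  have hI : ∫ t in T..2 * T, ‖P.Λ₀ (1 / 2 + t * I)‖ ^ 2 ≤
      2 * Real.pi * (1024 * (1 + Real.log (1 / w.re)) ^ 2 / w.re) := by
    rw [intervalIntegral.integral_of_le (by linarith)]
    rw [← ENNReal.ofReal_le_ofReal_iff (by positivity), ofReal_integral_eq_lintegral_ofReal]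
    · refine le_trans (setLIntegral_le_lintegral _ _) (le_trans (le_of_eq ?_) hΛ)
      refine lintegral_congr fun t => ?_
      rw [ENNReal.ofReal_pow (norm_nonneg _), ofReal_norm]
    · exact (hcont.integrableOn_Icc).mono_set Set.Ioc_subset_Icc_self
    · exact Eventually.of_forall fun t => by positivity
  calc ∫ t in T..2 * T, ‖zetaK (1 / 2 + t * I)‖ ^ 2
      ≤ ∫ t in T..2 * T, (8 * ‖P.Λ₀ (1 / 2 + t * I)‖ ^ 2 + 32) := by
        refine intervalIntegral.integral_mono_on (by linarith)
          ((continuous_zetaK_half.norm.pow 2).intervalIntegrable _ _)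
          (((hcont.const_mul 8).add continuous_const).intervalIntegrable _ _) fun t ht => ?_
        exact norm_sq_zetaK_le_Λ₀ hT ht hw hn
    _ = 8 * (∫ t in T..2 * T, ‖P.Λ₀ (1 / 2 + t * I)‖ ^ 2) + 32 * T := by
        rw [intervalIntegral.integral_add ((hcont.const_mul 8).intervalIntegrable _ _)
          (continuous_const.intervalIntegrable _ _), intervalIntegral.integral_const_mul,
          intervalIntegral.integral_const]
        simp; ring
    _ ≤ 8 * (2 * Real.pi * (1024 * (1 + Real.log (1 / w.re)) ^ 2 / w.re)) + 32 * T := by gcongr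
    _ = 8 * (2 * Real.pi * (1024 * (1 + Real.log (1 / w.re)) ^ 2 * (1 / w.re))) + 32 * T := by ring
    _ ≤ 8 * (2 * Real.pi * (1024 * (4 * Real.log T) ^ 2 * (2 * T))) +
          32 * T * (4 * Real.log T ^ 2) := by
        have : 32 * T * 1 ≤ 32 * T * (4 * Real.log T ^ 2) := by
          gcongr
          nlinarith
        rw [mul_one] at this
        gcongr
    _ = _ := by ring

lemma two_div_pi_mul_le_norm_exp_sub_one {u : ℝ} (h0 : 0 < u) (h1 : u ≤ Real.pi) :
    2 / Real.pi * u ≤ ‖cexp (u * I) - 1‖ := by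
  have e : ‖cexp (u * I) - 1‖ = 2 * Real.sin (u / 2) := by
    have := Complex.norm_exp_I_mul_ofReal_sub_one u
    rw [mul_comm, this, Real.norm_of_nonneg]
    have := Real.sin_nonneg_of_nonneg_of_le_pi (x := u / 2) (by linarith) (by linarith)
    positivity
  have := Real.mul_le_sin (x := u / 2) (by linarith) (by linarith)
  rw [e]
  linarith

/-- The Kusmin–Landau inequality for phases with antitone increments in `[c, π]`. -/
lemma norm_sum_exp_le_of_antitone (θ : ℕ → ℝ) (L : ℕ) {c : ℝ} (hc : 0 < c)
    (hlow : ∀ n < L, c ≤ θ (n + 1) - θ n) (hup : ∀ n < L, θ (n + 1) - θ n ≤ Real.pi)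
    (hanti : ∀ n, n + 1 < L → θ (n + 2) - θ (n + 1) ≤ θ (n + 1) - θ n) :
    ‖∑ n ∈ Finset.range L, cexp (θ n * I)‖ ≤ 6 / c := by
  set u : ℕ → ℝ := fun n => θ (n + 1) - θ n with hu
  set z : ℕ → ℂ := fun n => cexp (θ n * I) with hz
  set h : ℕ → ℂ := fun n => (cexp (u n * I) - 1)⁻¹ with hh
  have hpi := Real.pi_gt_three
  have hznorm : ∀ n, ‖z n‖ = 1 := fun n => norm_exp_ofReal_mul_I _
  have hupos : ∀ n < L, 0 < u n := fun n hn => hc.trans_le (hlow n hn)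
  have hdist : ∀ n < L, 2 / Real.pi * u n ≤ ‖cexp (u n * I) - 1‖ := fun n hn =>
    two_div_pi_mul_le_norm_exp_sub_one (hupos n hn) (hup n hn)
  have hne : ∀ n < L, cexp (u n * I) - 1 ≠ 0 := fun n hn h0 => by
    have := hdist n hn
    rw [h0, norm_zero] at this
    have := mul_pos (by positivity : 0 < 2 / Real.pi) (hupos n hn)
    linarith
  have hstep : ∀ n < L, z n = h n * (z (n + 1) - z n) := fun n hn => by
    have : z (n + 1) = z n * cexp (u n * I) := by
      simp only [hz, hu, ← Complex.exp_add]
      congr 1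
      push_cast
      ring
    rw [this, hh]
    field_simp [hne n hn]
  have hhnorm : ∀ n < L, ‖h n‖ ≤ Real.pi / 2 / c := fun n hn => by
    rw [hh, norm_inv, inv_le_comm₀ (norm_pos_iff.2 (hne n hn)) (by positivity)]
    refine le_trans ?_ (hdist n hn)
    rw [inv_div, div_div_eq_mul_div, div_mul_eq_mul_div]
    have := hlow n hn
    gcongr ?_ / _
    linarith [show u n = θ (n + 1) - θ n from rfl]
  have hhdiff : ∀ n, n + 1 < L → ‖h n - h (n + 1)‖ ≤
      Real.pi ^ 2 / 4 * (1 / u (n + 1) - 1 / u n) := fun n hn => by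
    have hn' : n < L := by omega
    have e : h n - h (n + 1) = (cexp (u (n + 1) * I) - cexp (u n * I)) *
        ((cexp (u n * I) - 1)⁻¹ * (cexp (u (n + 1) * I) - 1)⁻¹) := by
      rw [hh, inv_sub_inv (hne n hn') (hne _ hn), ← mul_inv, div_eq_mul_inv]
      congr 1
      ring
    have e1 : ‖cexp (u (n + 1) * I) - cexp (u n * I)‖ ≤ u n - u (n + 1) := by
      have e2 : cexp (u (n + 1) * I) - cexp (u n * I) =
          cexp (u n * I) * (cexp (I * ((u (n + 1) - u n : ℝ) : ℂ)) - 1) := by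
        rw [mul_sub, ← Complex.exp_add, mul_one]
        congr 2
        push_cast
        ring
      rw [e2, norm_mul, norm_exp_ofReal_mul_I, one_mul]
      refine (Real.norm_exp_I_mul_ofReal_sub_one_le).trans (le_of_eq ?_)
      rw [Real.norm_eq_abs, abs_sub_comm, abs_of_nonneg]
      linarith [hanti n hn, show u (n + 1) = θ (n + 2) - θ (n + 1) from rfl,
        show u n = θ (n + 1) - θ n from rfl]
    have p1 := hupos n hn'
    have p2 := hupos _ hn
    rw [e, norm_mul, norm_mul, norm_inv, norm_inv]
    calc _ ≤ (u n - u (n + 1)) * ((2 / Real.pi * u n)⁻¹ * (2 / Real.pi * u (n + 1))⁻¹) := by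
          have := hdist n hn'
          have := hdist _ hn
          have := (norm_nonneg _).trans e1
          gcongr
      _ = _ := by field_simp; norm_num
  have key : ∀ n, n < L → ‖∑ k ∈ Finset.range (n + 1), z k - h n * z (n + 1) + h 0 * z 0‖ ≤
      Real.pi ^ 2 / 4 * (1 / u n - 1 / u 0) := by
    intro n
    induction n with
    | zero =>
      intro h0
      rw [Finset.sum_range_one]
      simp only [zero_add, sub_self, mul_zero]
      have := hstep 0 h0
      rw [show z 0 - h 0 * z 1 + h 0 * z 0 = z 0 - h 0 * (z (0 + 1) - z 0) by ring, ← this, sub_self,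
        norm_zero]
    | succ n ih =>
      intro hn
      have hs := hstep _ hn
      rw [Finset.sum_range_succ, show ∑ k ∈ Finset.range (n + 1), z k + z (n + 1) -
        h (n + 1) * z (n + 1 + 1) + h 0 * z 0 = (∑ k ∈ Finset.range (n + 1), z k - h n * z (n + 1) +
        h 0 * z 0) + (h n - h (n + 1)) * z (n + 1) +
        (z (n + 1) - h (n + 1) * (z (n + 1 + 1) - z (n + 1))) by ring, ← hs, sub_self, add_zero]
      refine (norm_add_le _ _).trans ?_
      rw [norm_mul, hznorm, mul_one]
      linarith [ih (by omega), hhdiff n hn]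
  rcases Nat.eq_zero_or_pos L with rfl | hL
  · simp; positivity
  · obtain ⟨m, rfl⟩ : ∃ m, L = m + 1 := ⟨L - 1, by omega⟩
    have k1 := key m (by omega)
    have k2 := hhnorm m (by omega)
    have k3 := hhnorm 0 (by omega)
    have k4 : 1 / u m ≤ 1 / c := one_div_le_one_div_of_le hc (hlow m (by omega))
    have k5 : 0 < 1 / u 0 := one_div_pos.2 (hupos 0 hL)
    have k6 : ‖∑ k ∈ Finset.range (m + 1), z k‖ ≤ Real.pi ^ 2 / 4 * (1 / u m - 1 / u 0) +
        Real.pi / 2 / c + Real.pi / 2 / c := by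
      have e : ∑ k ∈ Finset.range (m + 1), z k = (∑ k ∈ Finset.range (m + 1), z k -
        h m * z (m + 1) + h 0 * z 0) + h m * z (m + 1) - h 0 * z 0 := by ring
      rw [e]
      refine (norm_sub_le _ _).trans (add_le_add ((norm_add_le _ _).trans (add_le_add k1 ?_)) ?_) <;>
      · rwa [norm_mul, hznorm, mul_one]
    refine k6.trans ?_
    have hp2 : Real.pi < 3.15 := Real.pi_lt_d2
    calc _ ≤ Real.pi ^ 2 / 4 * (1 / c) + Real.pi / 2 / c + Real.pi / 2 / c := by gcongr; linarith
      _ = (Real.pi ^ 2 / 4 + Real.pi) / c := by ring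
      _ ≤ 6 / c := by gcongr; nlinarith

lemma sum_range_shift_eq (g : ℕ → ℂ) {H L L' h : ℕ} (hL : L' ≤ L) (hh : h ≤ H)
    (hg : ∀ j, ¬ (H ≤ j ∧ j < H + L') → g j = 0) :
    ∑ m ∈ Finset.range (L + H), g (m + h) = ∑ n ∈ Finset.range L', g (n + H) := by
  rw [Finset.range_eq_Ico, Finset.range_eq_Ico, Finset.sum_Ico_add', Finset.sum_Ico_add']
  symm
  refine Finset.sum_subset (fun j hj => ?_) fun j _ hj => hg j fun h' => hj ?_
  · rw [Finset.mem_Ico] at hj ⊢; omega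
  · rw [Finset.mem_Ico]; omega

lemma sum_natDist_le (r : ℕ → ℝ) (hr : ∀ k, 0 ≤ r k) {H h : ℕ} (hh : h < H) :
    ∑ h' ∈ Finset.range H, r (max h h' - min h h') ≤ r 0 + 2 * ∑ k ∈ Finset.Ico 1 H, r k := by
  have hsplit : Finset.range H = Finset.range h ∪ ({h} ∪ Finset.Ioo h H) := by
    ext m; simp only [Finset.mem_range, Finset.mem_union, Finset.mem_singleton, Finset.mem_Ioo]; omega
  have hA : ∑ h' ∈ Finset.range h, r (max h h' - min h h') ≤ ∑ k ∈ Finset.Ico 1 H, r k := by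
    have : ∑ h' ∈ Finset.range h, r (max h h' - min h h') = ∑ k ∈ Finset.Ico 1 (h + 1), r k := by
      refine Finset.sum_nbij' (fun m => h - m) (fun m => h - m) ?_ ?_ ?_ ?_ ?_ <;>
        intro a ha <;> simp only [Finset.mem_range, Finset.mem_Ico] at ha ⊢ <;> try omega
      congr 1; omega
    rw [this]
    exact Finset.sum_le_sum_of_subset_of_nonneg (Finset.Ico_subset_Ico_right (by omega))
      fun k _ _ => hr k
  have hB : ∑ h' ∈ Finset.Ioo h H, r (max h h' - min h h') ≤ ∑ k ∈ Finset.Ico 1 H, r k := by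
    have : ∑ h' ∈ Finset.Ioo h H, r (max h h' - min h h') = ∑ k ∈ Finset.Ico 1 (H - h), r k := by
      refine Finset.sum_nbij' (fun m => m - h) (fun m => m + h) ?_ ?_ ?_ ?_ ?_ <;>
        intro a ha <;> simp only [Finset.mem_Ioo, Finset.mem_Ico] at ha ⊢ <;> try omega
      congr 1; omega
    rw [this]
    exact Finset.sum_le_sum_of_subset_of_nonneg (Finset.Ico_subset_Ico_right (by omega))
      fun k _ _ => hr k
  rw [hsplit, Finset.sum_union, Finset.sum_union, Finset.sum_singleton]
  · simp only [max_self, min_self, Nat.sub_self]; linarith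
  · rw [Finset.disjoint_singleton_left]; simp
  · rw [Finset.disjoint_left]; intro m
    simp only [Finset.mem_range, Finset.mem_union, Finset.mem_singleton, Finset.mem_Ioo]; omega

/-- The van der Corput inequality. -/
lemma mul_norm_sq_sum_le (z : ℕ → ℂ) (hz : ∀ n, ‖z n‖ ≤ 1) (L H : ℕ) (hH : 1 ≤ H) :
    H * ‖∑ n ∈ Finset.range L, z n‖ ^ 2 ≤ (L + H) * (L + 2 * ∑ k ∈ Finset.Ico 1 H,
      ‖∑ n ∈ Finset.range (L - k), z (n + k) * (starRingEnd ℂ) (z n)‖) := by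
  set y : ℕ → ℂ := fun j => if H ≤ j ∧ j < H + L then z (j - H) else 0 with hy
  set r : ℕ → ℝ := fun k => ‖∑ n ∈ Finset.range (L - k), z (n + k) * (starRingEnd ℂ) (z n)‖ with hr
  have hyz : ∀ n < L, y (n + H) = z n := fun n hn => by
    rw [hy]; simp only; rw [if_pos (by omega), Nat.add_sub_cancel]
  have hy0 : ∀ j, ¬ (H ≤ j ∧ j < H + L) → y j = 0 := fun j hj => if_neg hj
  have hS : ∑ m ∈ Finset.range (L + H), ∑ h ∈ Finset.range H, y (m + h) =
      H * ∑ n ∈ Finset.range L, z n := by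
    rw [Finset.sum_comm, Finset.sum_congr rfl (g := fun _ => ∑ n ∈ Finset.range L, z n)]
    · simp
    · intro h hh
      rw [sum_range_shift_eq y le_rfl (Finset.mem_range.1 hh).le hy0]
      exact Finset.sum_congr rfl fun n hn => hyz n (Finset.mem_range.1 hn)
  have hcorr : ∀ h k, h ≤ H → ∑ m ∈ Finset.range (L + H), y (m + (h + k)) * (starRingEnd ℂ) (y (m + h)) =
      ∑ n ∈ Finset.range (L - k), z (n + k) * (starRingEnd ℂ) (z n) := fun h k hh => by
    have := sum_range_shift_eq (fun j => y (j + k) * (starRingEnd ℂ) (y j)) (L := L) (L' := L - k)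
      (Nat.sub_le _ _) hh fun j hj => by
        by_cases h1 : H ≤ j ∧ j < H + L
        · rw [hy0 (j + k) (by omega), zero_mul]
        · rw [hy0 j h1, map_zero, mul_zero]
    simp only [add_assoc] at this ⊢
    rw [this]
    refine Finset.sum_congr rfl fun n hn => ?_
    have hn' := Finset.mem_range.1 hn
    rw [hyz n (by omega), show n + (H + k) = n + k + H by ring, hyz _ (by omega)]
  have hcorr' : ∀ h < H, ∀ h' < H,
      ‖∑ m ∈ Finset.range (L + H), y (m + h) * (starRingEnd ℂ) (y (m + h'))‖ =
        r (max h h' - min h h') := fun h hh h' hh' => by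
    rcases le_total h' h with hle | hle
    · obtain ⟨k, rfl⟩ := Nat.exists_eq_add_of_le hle
      rw [hcorr _ _ hh'.le, max_eq_left hle, min_eq_right hle, Nat.add_sub_cancel_left]
    · obtain ⟨k, rfl⟩ := Nat.exists_eq_add_of_le hle
      rw [max_eq_right hle, min_eq_left hle, Nat.add_sub_cancel_left, ← Complex.norm_conj, map_sum]
      simp only [map_mul, Complex.conj_conj]
      simp_rw [mul_comm ((starRingEnd ℂ) (y (_ + h)))]
      rw [hcorr _ _ hh.le]
  have hsq : ∑ m ∈ Finset.range (L + H), ‖∑ h ∈ Finset.range H, y (m + h)‖ ^ 2 ≤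
      H * (L + 2 * ∑ k ∈ Finset.Ico 1 H, r k) := by
    have e : ((∑ m ∈ Finset.range (L + H), ‖∑ h ∈ Finset.range H, y (m + h)‖ ^ 2 : ℝ) : ℂ) =
        ∑ h ∈ Finset.range H, ∑ h' ∈ Finset.range H, ∑ m ∈ Finset.range (L + H),
          y (m + h) * (starRingEnd ℂ) (y (m + h')) := by
      push_cast
      rw [Finset.sum_congr rfl fun m _ => by
        rw [← Complex.mul_conj', map_sum, Finset.sum_mul_sum], Finset.sum_comm]
      refine Finset.sum_congr rfl fun h _ => ?_
      rw [Finset.sum_comm]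
    have h0 : 0 ≤ ∑ m ∈ Finset.range (L + H), ‖∑ h ∈ Finset.range H, y (m + h)‖ ^ 2 := by positivity
    rw [← Real.norm_of_nonneg h0, ← Complex.norm_real, e]
    have hr0 : r 0 ≤ L := by
      refine (norm_sum_le _ _).trans ((Finset.sum_le_sum (g := fun _ => (1 : ℝ)) fun n _ => ?_).trans
        (le_of_eq (by simp)))
      rw [norm_mul, Complex.norm_conj]
      exact mul_le_one₀ (hz _) (norm_nonneg _) (hz _)
    calc _ ≤ ∑ h ∈ Finset.range H, ∑ h' ∈ Finset.range H, r (max h h' - min h h') :=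
          (norm_sum_le _ _).trans (Finset.sum_le_sum fun h hh => (norm_sum_le _ _).trans
            (Finset.sum_le_sum fun h' hh' =>
              (hcorr' h (Finset.mem_range.1 hh) h' (Finset.mem_range.1 hh')).le))
      _ ≤ ∑ h ∈ Finset.range H, (L + 2 * ∑ k ∈ Finset.Ico 1 H, r k) :=
          Finset.sum_le_sum fun h hh => (sum_natDist_le r (fun k => norm_nonneg _)
            (Finset.mem_range.1 hh)).trans (by gcongr)
      _ = _ := by simp [mul_add]
  have hcs : ‖(H : ℂ) * ∑ n ∈ Finset.range L, z n‖ ^ 2 ≤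
      (L + H) * ∑ m ∈ Finset.range (L + H), ‖∑ h ∈ Finset.range H, y (m + h)‖ ^ 2 := by
    rw [← hS]
    refine (pow_le_pow_left₀ (norm_nonneg _) (norm_sum_le _ _) 2).trans
      (sq_sum_le_card_mul_sum_sq.trans (le_of_eq ?_))
    simp
  have hH' : (0 : ℝ) < H := by exact_mod_cast hH
  rw [norm_mul, mul_pow, Complex.norm_natCast] at hcs
  refine le_of_mul_le_mul_left ?_ hH'
  calc _ = (H : ℝ) ^ 2 * ‖∑ n ∈ Finset.range L, z n‖ ^ 2 := by ring
    _ ≤ _ := hcs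
    _ ≤ (L + H) * (H * (L + 2 * ∑ k ∈ Finset.Ico 1 H, r k)) := by gcongr
    _ = _ := by ring

/-- The exponential sum over `X, X + 1, …, X + L - 1` with phase `φ`. -/
noncomputable def phaseSum (φ : ℝ → ℝ) (X : ℝ) (L : ℕ) : ℂ :=
  ∑ n ∈ Finset.range L, cexp (φ (X + n) * I)

lemma norm_phaseSum_le {φ F : ℝ → ℝ} {X c : ℝ} (L : ℕ) (hc : 0 < c)
    (hd : ∀ x, X ≤ x → HasDerivAt φ (F x) x) (hF : ∀ x y, X ≤ x → x ≤ y → F y ≤ F x)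
    (hup : F X ≤ Real.pi) (hlow : c ≤ F (X + L)) : ‖phaseSum φ X L‖ ≤ 6 / c := by
  have hmvt : ∀ n : ℕ, ∃ ξ, X + n < ξ ∧ ξ < X + n + 1 ∧ φ (X + (n + 1 : ℕ)) - φ (X + n) = F ξ := by
    intro n
    have hn : X ≤ X + n := by simp
    obtain ⟨ξ, hξ, h⟩ := exists_hasDerivAt_eq_slope φ F (a := X + n) (b := X + n + 1) (by linarith)
      (fun x hx => (hd x (hn.trans hx.1)).continuousAt.continuousWithinAt)
      (fun x hx => hd x (hn.trans hx.1.le))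
    refine ⟨ξ, hξ.1, hξ.2, ?_⟩
    rw [h]
    push_cast
    rw [← add_assoc]
    simp
  choose ξ h1 h2 h3 using hmvt
  have hX : ∀ n, X ≤ ξ n := fun n => by have := h1 n; have : (0 : ℝ) ≤ n := n.cast_nonneg; linarith
  refine norm_sum_exp_le_of_antitone (fun n => φ (X + n)) L hc (fun n hn => ?_) (fun n _ => ?_)
    fun n hn => ?_
  · simp only [h3]
    refine hlow.trans (hF _ _ (hX n) ?_)
    have : (n : ℝ) + 1 ≤ L := by exact_mod_cast hn
    linarith [h2 n]
  · simp only [h3]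
    exact (hF _ _ le_rfl (hX n)).trans hup
  · simp only [h3]
    refine hF _ _ (hX n) ?_
    have := h1 (n + 1)
    push_cast at this
    linarith [h2 n]

lemma mul_norm_sq_phaseSum_le (φ : ℝ → ℝ) (X : ℝ) (L H : ℕ) (hH : 1 ≤ H) :
    H * ‖phaseSum φ X L‖ ^ 2 ≤ (L + H) * (L + 2 * ∑ k ∈ Finset.Ico 1 H,
      ‖phaseSum (fun x => φ x - φ (x + k)) X (L - k)‖) := by
  refine (mul_norm_sq_sum_le (fun n => cexp (φ (X + n) * I))
    (fun n => (norm_exp_ofReal_mul_I _).le) L H hH).trans (le_of_eq ?_)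
  congr 3
  refine Finset.sum_congr rfl fun k _ => ?_
  rw [phaseSum, ← Complex.norm_conj, map_sum]
  congr 1
  refine Finset.sum_congr rfl fun n _ => ?_
  rw [map_mul, Complex.conj_conj, ← exp_conj, ← Complex.exp_add]
  congr 1
  simp only [map_mul, conj_ofReal, conj_I]
  push_cast
  rw [add_assoc X]
  ring

/-- The derivative of the phase `t * log`. -/
lemma hasDerivAt_mul_log {t x : ℝ} (hx : 0 < x) : HasDerivAt (fun x => t * Real.log x) (t / x) x := by
  simpa [div_eq_mul_inv] using (Real.hasDerivAt_log hx.ne').const_mul t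

lemma norm_phaseSum_log_le {t X : ℝ} (ht : 0 < t) (hX : 1 ≤ X) {L : ℕ} (hL : L ≤ X)
    (htX : t ≤ 3 * X) : ‖phaseSum (fun x => t * Real.log x) X L‖ ≤ 12 * X / t := by
  have hX0 : 0 < X := by linarith
  refine (norm_phaseSum_le (F := fun x => t / x) L (c := t / (2 * X)) (by positivity)
    (fun x hx => hasDerivAt_mul_log (hX0.trans_le hx)) (fun x y hx hxy => ?_) ?_ ?_).trans
    (le_of_eq ?_)
  · have : 0 < x := hX0.trans_le hx
    have : 0 < y := this.trans_le hxy
    gcongr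
  · rw [div_le_iff₀ hX0]
    nlinarith [Real.pi_gt_three]
  · have : (0 : ℝ) ≤ L := L.cast_nonneg
    gcongr
    linarith
  · field_simp; norm_num

/-- The derivative of the first difference of the phase `t * log`. -/
lemma hasDerivAt_log_diff {t x k : ℝ} (hx : 0 < x) (hk : 0 ≤ k) :
    HasDerivAt (fun x => t * Real.log x - t * Real.log (x + k)) (t * k / (x * (x + k))) x := by
  have hxk : 0 < x + k := by linarith
  refine ((hasDerivAt_mul_log (t := t) hx).sub
    ((hasDerivAt_mul_log (t := t) hxk).comp_add_const x k)).congr_deriv ?_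
  field_simp
  ring

lemma norm_phaseSum_log_diff_le {t X : ℝ} (ht : 0 < t) (hX : 1 ≤ X) {L k : ℕ} (hL : L ≤ X)
    (hk : 1 ≤ k) (hkX : k ≤ X) (htX : t * k ≤ 3 * X ^ 2) :
    ‖phaseSum (fun x => t * Real.log x - t * Real.log (x + k)) X L‖ ≤ 36 * X ^ 2 / (t * k) := by
  have hX0 : 0 < X := by linarith
  have hk0 : (0 : ℝ) < k := by exact_mod_cast hk
  refine (norm_phaseSum_le (F := fun x => t * k / (x * (x + k))) L (c := t * k / (6 * X ^ 2))
    (by positivity) (fun x hx => hasDerivAt_log_diff (hX0.trans_le hx) hk0.le)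
    (fun x y hx hxy => ?_) ?_ ?_).trans (le_of_eq ?_)
  · have : 0 < x := hX0.trans_le hx
    have : 0 < y := this.trans_le hxy
    gcongr
  · rw [div_le_iff₀ (by positivity)]
    have : X ^ 2 ≤ X * (X + k) := by nlinarith
    nlinarith [Real.pi_gt_three]
  · have : (0 : ℝ) ≤ L := L.cast_nonneg
    refine div_le_div_of_nonneg_left (by positivity) (by positivity) ?_
    calc (X + L) * (X + L + k) ≤ (2 * X) * (3 * X) := by gcongr <;> linarith
      _ = 6 * X ^ 2 := by ring
  · field_simp; norm_num

/-- The derivative of the second difference of the phase `t * log`. -/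
lemma hasDerivAt_log_diff_diff {t x k l : ℝ} (hx : 0 < x) (hk : 0 ≤ k) (hl : 0 ≤ l) :
    HasDerivAt (fun x => (t * Real.log x - t * Real.log (x + k)) -
      (t * Real.log (x + l) - t * Real.log (x + l + k)))
      (t * k * l * (1 / x + 1 / (x + k + l)) / ((x + k) * (x + l))) x := by
  have hxl : 0 < x + l := by linarith
  have hxk : 0 < x + k := by linarith
  have hxkl : 0 < x + k + l := by linarith
  have hxlk : 0 < x + l + k := by linarith
  refine ((hasDerivAt_log_diff (t := t) hx hk).sub
    ((hasDerivAt_log_diff (t := t) hxl hk).comp_add_const x l)).congr_deriv ?_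
  field_simp
  ring

lemma norm_phaseSum_log_diff_diff_le {t X : ℝ} (ht : 0 < t) (hX : 1 ≤ X) {L k l : ℕ} (hL : L ≤ X)
    (hk : 1 ≤ k) (hkX : k ≤ X) (hl : 1 ≤ l) (hlX : l ≤ X) (htX : 2 * (t * k * l) ≤ 3 * X ^ 3) :
    ‖phaseSum (fun x => (t * Real.log x - t * Real.log (x + k)) -
      (t * Real.log (x + l) - t * Real.log (x + l + k))) X L‖ ≤ 108 * X ^ 3 / (t * k * l) := by
  have hX0 : 0 < X := by linarith
  have hk0 : (0 : ℝ) < k := by exact_mod_cast hk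
  have hl0 : (0 : ℝ) < l := by exact_mod_cast hl
  have hL0 : (0 : ℝ) ≤ L := L.cast_nonneg
  refine (norm_phaseSum_le
    (F := fun x => t * k * l * (1 / x + 1 / (x + k + l)) / ((x + k) * (x + l))) L
    (c := t * k * l / (18 * X ^ 3))
    (by positivity) (fun x hx => hasDerivAt_log_diff_diff (hX0.trans_le hx) hk0.le hl0.le)
    (fun x y hx hxy => ?_) ?_ ?_).trans (le_of_eq ?_)
  · have : 0 < x := hX0.trans_le hx
    have : 0 < y := this.trans_le hxy
    gcongr
  · calc _ ≤ t * k * l * (1 / X + 1 / X) / (X * X) := by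
          gcongr <;> linarith
      _ = 2 * (t * k * l) / X ^ 3 := by field_simp; norm_num
      _ ≤ 3 := by rw [div_le_iff₀ (by positivity)]; exact htX
      _ ≤ _ := Real.pi_gt_three.le
  · calc t * k * l / (18 * X ^ 3) = t * k * l * (1 / (2 * X)) / ((3 * X) * (3 * X)) := by
          field_simp; norm_num
      _ ≤ t * k * l * (1 / (X + L)) / ((3 * X) * (3 * X)) := by gcongr; linarith
      _ ≤ t * k * l * (1 / (X + L) + 1 / (X + L + k + l)) / ((3 * X) * (3 * X)) := by
          gcongr
          have : 0 < 1 / (X + L + k + l) := by positivity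
          linarith
      _ ≤ _ := by
          gcongr <;> linarith
  · field_simp; norm_num

lemma norm_phaseSum_le_card (φ : ℝ → ℝ) (X : ℝ) (L : ℕ) : ‖phaseSum φ X L‖ ≤ L := by
  refine (norm_sum_le _ _).trans (le_of_eq ?_)
  simp [norm_exp_ofReal_mul_I]

lemma sum_Ico_inv_le {H : ℕ} {t : ℝ} (hH : 1 ≤ H) (hHt : H ≤ t) :
    ∑ k ∈ Finset.Ico 1 H, (k : ℝ)⁻¹ ≤ 1 + Real.log t := by
  have hH0 : (0 : ℝ) < H := by exact_mod_cast hH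
  calc _ ≤ ∑ k ∈ Finset.Ioc 0 H, (k : ℝ)⁻¹ :=
        Finset.sum_le_sum_of_subset_of_nonneg
          (fun k hk => by simp only [Finset.mem_Ico, Finset.mem_Ioc] at *; omega)
          fun _ _ _ => by positivity
    _ ≤ 1 + Real.log H := sum_inv_le_one_add_log H
    _ ≤ _ := by gcongr

/-- One step of van der Corput differencing when the differenced sums have a bound `M / k`. -/
lemma norm_sq_phaseSum_le {φ : ℝ → ℝ} {X M t : ℝ} {L H : ℕ} (hL : L ≤ X) (hH : 1 ≤ H)
    (hHX : H ≤ X) (hHt : H ≤ t) (hM : 0 ≤ M)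
    (h : ∀ k, 1 ≤ k → k < H → ‖phaseSum (fun x => φ x - φ (x + k)) X (L - k)‖ ≤ M * (k : ℝ)⁻¹) :
    H * ‖phaseSum φ X L‖ ^ 2 ≤ 2 * X * (X + 2 * (M * (1 + Real.log t))) := by
  have hL0 : (0 : ℝ) ≤ L := L.cast_nonneg
  have hH0 : (0 : ℝ) < H := by exact_mod_cast hH
  have hs : ∑ k ∈ Finset.Ico 1 H, ‖phaseSum (fun x => φ x - φ (x + k)) X (L - k)‖ ≤
      M * (1 + Real.log t) := by
    calc _ ≤ ∑ k ∈ Finset.Ico 1 H, M * (k : ℝ)⁻¹ := Finset.sum_le_sum fun k hk =>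
          h k (Finset.mem_Ico.1 hk).1 (Finset.mem_Ico.1 hk).2
      _ = M * ∑ k ∈ Finset.Ico 1 H, (k : ℝ)⁻¹ := by rw [Finset.mul_sum]
      _ ≤ _ := mul_le_mul_of_nonneg_left (sum_Ico_inv_le hH hHt) hM
  refine (mul_norm_sq_phaseSum_le φ X L H hH).trans ?_
  refine mul_le_mul (by linarith) (by linarith) (by positivity) (by linarith)

lemma norm_sq_phaseSum_log_le_of_mid {t X : ℝ} (hX : 1 ≤ X) {L : ℕ} (hL : L ≤ X)
    (h1 : t ≤ X ^ 2) (h2 : X ≤ t) :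
    ‖phaseSum (fun x => t * Real.log x) X L‖ ^ 2 ≤ 4 * t + 288 * X * (1 + Real.log t) := by
  have hX0 : 0 < X := by linarith
  have ht : 0 < t := by linarith
  set H := ⌊X ^ 2 / t⌋₊ with hHdef
  have hq : 1 ≤ X ^ 2 / t := by rwa [le_div_iff₀ ht, one_mul]
  have hH : 1 ≤ H := by simpa [hHdef, Nat.one_le_floor_iff] using hq
  have hHle : (H : ℝ) ≤ X ^ 2 / t := Nat.floor_le (by positivity)
  have hH1 : (1 : ℝ) ≤ H := by exact_mod_cast hH
  have hHge : X ^ 2 / (2 * t) ≤ H := by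
    have : X ^ 2 / t < H + 1 := Nat.lt_floor_add_one _
    have : X ^ 2 / (2 * t) = X ^ 2 / t / 2 := by field_simp
    linarith
  have hqX : X ^ 2 / t ≤ X := by rw [div_le_iff₀ ht]; nlinarith
  have hHX : (H : ℝ) ≤ X := hHle.trans hqX
  have key := norm_sq_phaseSum_le (φ := fun x => t * Real.log x) (X := X) (M := 36 * X ^ 2 / t)
    (t := t) hL hH hHX (hHX.trans h2) (by positivity) fun k hk hkH => ?_
  · set S := ‖phaseSum (fun x => t * Real.log x) X L‖ ^ 2
    have hS : 0 ≤ S := by positivity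
    have : X ^ 2 / (2 * t) * S ≤ 2 * X * (X + 2 * (36 * X ^ 2 / t * (1 + Real.log t))) :=
      (mul_le_mul_of_nonneg_right hHge hS).trans key
    calc S = (2 * t) / X ^ 2 * (X ^ 2 / (2 * t) * S) := by field_simp
      _ ≤ (2 * t) / X ^ 2 * (2 * X * (X + 2 * (36 * X ^ 2 / t * (1 + Real.log t)))) := by gcongr
      _ = _ := by field_simp; ring
  · have hkX : (k : ℝ) ≤ H := by exact_mod_cast hkH.le
    have hk0 : (0 : ℝ) < k := by exact_mod_cast hk
    refine (norm_phaseSum_log_diff_le ht hX ((Nat.cast_le.2 (Nat.sub_le L k)).trans hL) hk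
      (hkX.trans hHX) ?_).trans (le_of_eq ?_)
    · have : t * k ≤ t * (X ^ 2 / t) := by gcongr; exact hkX.trans hHle
      rw [mul_div_cancel₀ _ ht.ne'] at this
      nlinarith
    · field_simp

lemma norm_sq_phaseSum_log_le_of_small {τ X : ℝ} (hτ : 1 ≤ τ) {L : ℕ} (hL : L ≤ X)
    (h1 : τ ^ 24 ≤ X) (h2 : X ≤ τ ^ 26) (hlog : 1 + Real.log (τ ^ 50) ≤ 51 * τ) :
    ‖phaseSum (fun x => τ ^ 50 * Real.log x) X L‖ ^ 2 ≤ 1000 * X * τ ^ 24 := by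
  have hτ0 : 0 < τ := by linarith
  have hX : 1 ≤ X := (one_le_pow₀ hτ).trans h1
  have hX0 : 0 < X := by linarith
  set t := τ ^ 50 with ht
  have ht0 : 0 < t := by positivity
  set H := ⌊τ ^ 7⌋₊ with hHdef
  have hq : 1 ≤ τ ^ 7 := one_le_pow₀ hτ
  have hH : 1 ≤ H := by simpa [hHdef, Nat.one_le_floor_iff] using hq
  have hHle : (H : ℝ) ≤ τ ^ 7 := Nat.floor_le (by positivity)
  have hH1 : (1 : ℝ) ≤ H := by exact_mod_cast hH
  have hHge : τ ^ 7 / 2 ≤ H := by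
    have : τ ^ 7 < H + 1 := Nat.lt_floor_add_one _
    linarith
  have hHX : (H : ℝ) ≤ X := hHle.trans ((pow_le_pow_right₀ hτ (by norm_num)).trans h1)
  have hHt : (H : ℝ) ≤ t := hHle.trans (pow_le_pow_right₀ hτ (by norm_num))
  have hXt : X ^ 3 / t ≤ X * τ ^ 2 := by
    rw [div_le_iff₀ ht0]
    calc X ^ 3 = X * X ^ 2 := by ring
      _ ≤ X * (τ ^ 26) ^ 2 := by gcongr
      _ = _ := by rw [ht]; ring
  have hinner : ∀ k : ℕ, 1 ≤ k → k < H →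
      ‖phaseSum (fun x => t * Real.log x - t * Real.log (x + k)) X (L - k)‖ ≤ 220 * X / τ ^ 2 := by
    intro k hk hkH
    have hkH' : (k : ℝ) ≤ H := by exact_mod_cast hkH.le
    have hk1 : (1 : ℝ) ≤ k := by exact_mod_cast hk
    have hLk : ((L - k : ℕ) : ℝ) ≤ X := (Nat.cast_le.2 (Nat.sub_le L k)).trans hL
    have key := norm_sq_phaseSum_le (φ := fun x => t * Real.log x - t * Real.log (x + k)) (X := X)
      (M := 108 * X ^ 3 / t) (t := t) hLk hH hHX hHt (by positivity) fun l hl hlH => ?_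
    · set S := ‖phaseSum (fun x => t * Real.log x - t * Real.log (x + k)) X (L - k)‖
      have hS : 0 ≤ S ^ 2 := by positivity
      have hb : 108 * X ^ 3 / t * (1 + Real.log t) ≤ 108 * (X * τ ^ 2) * (51 * τ) := by
        refine mul_le_mul ?_ hlog ?_ (by positivity)
        · rw [mul_div_assoc]; gcongr
        · have := Real.log_nonneg (one_le_pow₀ hτ : 1 ≤ τ ^ 50)
          positivity
      have h3 : τ ^ 7 / 2 * S ^ 2 ≤ 24000 * (X ^ 2 * τ ^ 3) := by
        calc _ ≤ H * S ^ 2 := by gcongr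
          _ ≤ 2 * X * (X + 2 * (108 * X ^ 3 / t * (1 + Real.log t))) := key
          _ ≤ 2 * X * (X * τ ^ 3 + 2 * (108 * (X * τ ^ 2) * (51 * τ))) := by
              gcongr
              nlinarith [one_le_pow₀ hτ (n := 3)]
          _ = 22034 * (X ^ 2 * τ ^ 3) := by ring
          _ ≤ _ := by gcongr; norm_num
      refine abs_le_of_sq_le_sq' ?_ (by positivity) |>.2
      rw [div_pow, le_div_iff₀ (by positivity)]
      have : S ^ 2 * (τ ^ 2) ^ 2 * τ ^ 3 ≤ 48400 * X ^ 2 * τ ^ 3 := by nlinarith [sq_nonneg X, h3]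
      have := le_of_mul_le_mul_right this (by positivity)
      nlinarith
    · have hlH' : (l : ℝ) ≤ H := by exact_mod_cast hlH.le
      have hl0 : (0 : ℝ) < l := by exact_mod_cast hl
      refine (norm_phaseSum_log_diff_diff_le ht0 hX ((Nat.cast_le.2 (Nat.sub_le _ l)).trans hLk)
        hk (hkH'.trans hHX) hl (hlH'.trans hHX) ?_).trans ?_
      · calc 2 * (t * k * l) ≤ 2 * (t * τ ^ 7 * τ ^ 7) := by
              gcongr
              · exact hkH'.trans hHle
              · exact hlH'.trans hHle
          _ = 2 * τ ^ 64 := by rw [ht]; ring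
          _ ≤ 3 * (τ ^ 24) ^ 3 := by
              rw [← pow_mul]
              have := pow_le_pow_right₀ hτ (show 64 ≤ 24 * 3 by norm_num)
              have : 0 < τ ^ 64 := by positivity
              linarith
          _ ≤ _ := by gcongr
      · rw [← div_eq_mul_inv, div_div]
        refine div_le_div_of_nonneg_left (by positivity) (by positivity) ?_
        refine mul_le_mul_of_nonneg_right ?_ hl0.le
        exact le_mul_of_one_le_right ht0.le hk1
  have hvdc := mul_norm_sq_phaseSum_le (fun x => t * Real.log x) X L H hH
  set S := ‖phaseSum (fun x => t * Real.log x) X L‖ ^ 2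
  have hS : 0 ≤ S := by positivity
  have hsum : ∑ k ∈ Finset.Ico 1 H,
      ‖phaseSum (fun x => t * Real.log x - t * Real.log (x + k)) X (L - k)‖ ≤
        H * (220 * X / τ ^ 2) := by
    refine (Finset.sum_le_card_nsmul _ _ (220 * X / τ ^ 2) fun k hk =>
      hinner k (Finset.mem_Ico.1 hk).1 (Finset.mem_Ico.1 hk).2).trans ?_
    rw [nsmul_eq_mul, Nat.card_Ico]
    have : ((H - 1 : ℕ) : ℝ) ≤ H := by exact_mod_cast Nat.sub_le H 1
    gcongr
  have h3 : H * S ≤ 2 * X * (X + 2 * (H * (220 * X / τ ^ 2))) := by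
    refine hvdc.trans (mul_le_mul (by linarith) (by linarith) (by positivity) (by positivity))
  have h4 : H * S ≤ H * (884 * (X ^ 2 / τ ^ 2)) := by
    refine h3.trans ?_
    have : X ≤ 2 * H * (X / τ ^ 2) := by
      have : τ ^ 2 ≤ 2 * H := (pow_le_pow_right₀ hτ (show 2 ≤ 7 by norm_num)).trans (by linarith)
      calc X = τ ^ 2 * (X / τ ^ 2) := by field_simp
        _ ≤ _ := by gcongr
    calc _ ≤ 2 * X * (2 * H * (X / τ ^ 2) + 2 * (H * (220 * X / τ ^ 2))) := by gcongr
      _ = H * (884 * (X ^ 2 / τ ^ 2)) := by ring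
  refine (le_of_mul_le_mul_left h4 (by positivity)).trans ?_
  have : X ^ 2 / τ ^ 2 ≤ X * τ ^ 24 := by
    rw [div_le_iff₀ (by positivity)]
    calc X ^ 2 = X * X := by ring
      _ ≤ X * τ ^ 26 := by gcongr
      _ = _ := by ring
  have : 0 ≤ X * τ ^ 24 := by positivity
  linarith

lemma one_add_log_pow_le {τ : ℝ} (hτ : 1 ≤ τ) (n : ℕ) : 1 + Real.log (τ ^ n) ≤ (n + 1) * τ := by
  rw [Real.log_pow]
  have := Real.log_le_sub_one_of_pos (show 0 < τ by linarith)
  have : (n : ℝ) * Real.log τ ≤ n * τ := by gcongr; linarith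
  linarith

/-- A bound for the exponential sums occurring in the Hurwitz zeta function of height `τ ^ 50`. -/
lemma norm_sq_phaseSum_log_le {τ X : ℝ} (hτ : 1 ≤ τ) (hX : 1 ≤ X) {L : ℕ} (hL : L ≤ X)
    (hX2 : X ≤ 4 * τ ^ 100) :
    ‖phaseSum (fun x => τ ^ 50 * Real.log x) X L‖ ^ 2 ≤ 20000 * X * τ ^ 24 := by
  have hτ0 : 0 < τ := by linarith
  have hX0 : 0 < X := by linarith
  have hlog : 1 + Real.log (τ ^ 50) ≤ 51 * τ := by
    simpa [show (50 : ℝ) + 1 = 51 by norm_num] using one_add_log_pow_le hτ 50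
  have hτ24 : 1 ≤ τ ^ 24 := one_le_pow₀ hτ
  have hXτ : 0 < X * τ ^ 24 := by positivity
  have hpos : 0 < τ ^ 50 := by positivity
  rcases le_total X (τ ^ 24) with h1 | h1
  · calc _ ≤ (L : ℝ) ^ 2 := by gcongr; exact norm_phaseSum_le_card _ _ _
      _ ≤ X ^ 2 := by gcongr
      _ = X * X := sq X
      _ ≤ X * τ ^ 24 := by gcongr
      _ ≤ _ := by linarith
  rcases le_total X (τ ^ 26) with h2 | h2
  · have := norm_sq_phaseSum_log_le_of_small hτ hL h1 h2 hlog
    linarith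
  rcases le_total X (τ ^ 50) with h3 | h3
  · refine (norm_sq_phaseSum_log_le_of_mid hX hL ?_ h3).trans ?_
    · calc τ ^ 50 ≤ (τ ^ 26) ^ 2 := by rw [← pow_mul]; exact pow_le_pow_right₀ hτ (by norm_num)
        _ ≤ X ^ 2 := by gcongr
    · have e1 : τ ^ 50 ≤ X * τ ^ 24 := by
        calc τ ^ 50 = τ ^ 26 * τ ^ 24 := by ring
          _ ≤ _ := by gcongr
      have e2 : X * (1 + Real.log (τ ^ 50)) ≤ X * (51 * τ ^ 24) := by
        gcongr
        refine hlog.trans ?_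
        gcongr
        exact le_self_pow₀ hτ (by norm_num)
      nlinarith
  · have := norm_phaseSum_log_le hpos hX hL (by linarith)
    calc _ ≤ (12 * X / τ ^ 50) ^ 2 := by gcongr
      _ = 144 * X * (X / τ ^ 100) := by field_simp; ring
      _ ≤ 144 * X * 4 := by gcongr; rw [div_le_iff₀ (by positivity)]; exact hX2
      _ ≤ _ := by nlinarith

/-- The difference between `x ^ (-s)` and its average over `[x, x + 1]`. -/
noncomputable def cpowAverageError (s : ℂ) (x : ℝ) : ℂ :=
  (x : ℂ) ^ (-s) - (((x + 1 : ℝ) : ℂ) ^ (1 - s) - (x : ℂ) ^ (1 - s)) / (1 - s)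

lemma hasDerivAt_ofReal_add_cpow {x u : ℝ} (hx : 0 < x + u) (s : ℂ) :
    HasDerivAt (fun u : ℝ => ((x + u : ℝ) : ℂ) ^ s) (s * ((x + u : ℝ) : ℂ) ^ (s - 1)) u := by
  have h1 : HasDerivAt (fun z : ℂ => (x + z) ^ s) (s * (x + u) ^ (s - 1)) (u : ℂ) := by
    simpa using ((hasDerivAt_id (u : ℂ)).const_add (x : ℂ)).cpow_const (c := s)
      (Or.inl (by simpa using hx))
  simpa using h1.comp_ofReal

lemma norm_cpowAverageError_le {s : ℂ} (hs : s ≠ 1) (hσ : 0 ≤ s.re) {x : ℝ} (hx : 0 < x) :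
    ‖cpowAverageError s x‖ ≤ ‖s‖ * x ^ (-s.re - 1) := by
  have hs' : 1 - s ≠ 0 := sub_ne_zero.2 hs.symm
  have h1 : ∀ u ∈ Set.Icc (0 : ℝ) 1,
      ‖((x + u : ℝ) : ℂ) ^ (-s) - (x : ℂ) ^ (-s)‖ ≤ ‖s‖ * x ^ (-s.re - 1) := by
    intro u hu
    have := norm_image_sub_le_of_norm_deriv_le_segment'
      (f := fun u : ℝ => ((x + u : ℝ) : ℂ) ^ (-s)) (a := 0) (b := u)
      (C := ‖s‖ * x ^ (-s.re - 1))
      (fun v hv => (hasDerivAt_ofReal_add_cpow (by linarith [hv.1]) (-s)).hasDerivWithinAt)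
      (fun v hv => ?_) u ⟨hu.1, le_rfl⟩
    · simp only [add_zero] at this
      refine this.trans (mul_le_of_le_one_right (by positivity) (by linarith [hu.2]))
    · have hxv : 0 < x + v := by linarith [hv.1]
      rw [norm_mul, norm_neg, norm_cpow_eq_rpow_re_of_pos hxv]
      have : (x + v) ^ (-s - 1).re ≤ x ^ (-s.re - 1) := by
        simp only [sub_re, neg_re, one_re]
        exact Real.rpow_le_rpow_of_nonpos hx (by linarith [hv.1]) (by linarith)
      gcongr
  have := norm_image_sub_le_of_norm_deriv_le_segment_01'
    (f := fun u : ℝ => (u : ℂ) * (x : ℂ) ^ (-s) - ((x + u : ℝ) : ℂ) ^ (1 - s) / (1 - s))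
    (C := ‖s‖ * x ^ (-s.re - 1)) (f' := fun u => (x : ℂ) ^ (-s) - ((x + u : ℝ) : ℂ) ^ (-s))
    (fun u hu => ?_) (fun u hu => ?_)
  · refine le_of_eq_of_le ?_ this
    rw [cpowAverageError]
    congr 1
    simp only [ofReal_one, ofReal_zero, add_zero, one_mul, zero_mul]
    ring
  · refine HasDerivAt.hasDerivWithinAt ?_
    have h2 := (hasDerivAt_ofReal_add_cpow (x := x) (u := u) (by linarith [hu.1]) (1 - s)).div_const
      (1 - s)
    have h3 : HasDerivAt (fun u : ℝ => (u : ℂ) * (x : ℂ) ^ (-s)) ((x : ℂ) ^ (-s)) u := by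
      simpa using ((hasDerivAt_id u).ofReal_comp).mul_const ((x : ℂ) ^ (-s))
    refine (h3.sub h2).congr_deriv ?_
    rw [mul_div_assoc, show 1 - s - 1 = -s by ring]
    field_simp
  · rw [norm_sub_rev]
    exact h1 u ⟨hu.1, hu.2.le⟩

lemma differentiableAt_cpowAverageError {s : ℂ} (hs : s ≠ 1) {x : ℝ} (hx : 0 < x) :
    DifferentiableAt ℂ (fun s => cpowAverageError s x) s := by
  have hs' : 1 - s ≠ 0 := sub_ne_zero.2 hs.symm
  have h1 : (x : ℂ) ≠ 0 := by exact_mod_cast hx.ne'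
  have h2 : ((x + 1 : ℝ) : ℂ) ≠ 0 := by exact_mod_cast (by linarith : x + 1 ≠ 0)
  unfold cpowAverageError
  refine DifferentiableAt.sub ?_ (DifferentiableAt.div (DifferentiableAt.sub ?_ ?_) ?_ hs')
  · exact DifferentiableAt.const_cpow (by fun_prop) (Or.inl h1)
  · exact DifferentiableAt.const_cpow (by fun_prop) (Or.inl h2)
  · exact DifferentiableAt.const_cpow (by fun_prop) (Or.inl h1)
  · fun_prop

lemma sum_range_rpow_le {N : ℕ} (hN : 1 ≤ N) (m : ℕ) :
    ∑ i ∈ Finset.range m, ((N + i : ℕ) : ℝ) ^ (-(3 / 2) : ℝ) ≤ 4 / √N := by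
  have hterm : ∀ n : ℕ, 1 ≤ n → (n : ℝ) ^ (-(3 / 2) : ℝ) ≤ 4 / √n - 4 / √((n + 1 : ℕ) : ℝ) := by
    intro n hn
    have hn1 : (1 : ℝ) ≤ n := by exact_mod_cast hn
    have hn0 : (0 : ℝ) < n := by linarith
    set y := √(n : ℝ) with hy
    set z := √((n + 1 : ℕ) : ℝ) with hz
    have hy0 : 0 < y := Real.sqrt_pos.2 hn0
    have hz0 : 0 < z := Real.sqrt_pos.2 (by positivity)
    have hy2 : y ^ 2 = n := Real.sq_sqrt hn0.le
    have hz2 : z ^ 2 = n + 1 := by rw [hz, Real.sq_sqrt (by positivity)]; push_cast; ring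
    have hyz : y ≤ z := Real.sqrt_le_sqrt (by push_cast; linarith)
    have hzy : z ≤ 3 / 2 * y := by
      refine abs_le_of_sq_le_sq' ?_ (by positivity) |>.2
      nlinarith
    have e : (n : ℝ) ^ (-(3 / 2) : ℝ) = 1 / y ^ 3 := by
      rw [Real.rpow_neg hn0.le, hy, Real.sqrt_eq_rpow, ← Real.rpow_natCast, ← Real.rpow_mul hn0.le]
      norm_num
    rw [e, div_sub_div _ _ hy0.ne' hz0.ne', div_le_div_iff₀ (by positivity) (by positivity)]
    have h1 : (z - y) * (z + y) = 1 := by nlinarith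
    have h2 : 1 ≤ (z - y) * (5 / 2 * y) := by
      rw [← h1]; exact mul_le_mul_of_nonneg_left (by linarith) (by linarith)
    have h3 : y * z ≤ 3 / 2 * y ^ 2 := by nlinarith
    nlinarith [mul_le_mul_of_nonneg_right h2 (sq_nonneg y)]
  calc _ ≤ ∑ i ∈ Finset.range m, ((fun i : ℕ => 4 / √((N + i : ℕ) : ℝ)) i -
        (fun i : ℕ => 4 / √((N + i : ℕ) : ℝ)) (i + 1)) :=
        Finset.sum_le_sum fun i _ => hterm (N + i) (by omega)
    _ = 4 / √N - 4 / √((N + m : ℕ) : ℝ) := by rw [Finset.sum_range_sub']; simp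
    _ ≤ _ := by
      have : 0 ≤ 4 / √((N + m : ℕ) : ℝ) := by positivity
      linarith

lemma norm_cpowAverageError_add_le {s : ℂ} (hs : s ≠ 1) {δ : ℝ} (hδ : 0 ≤ δ) (hσ : δ ≤ s.re)
    {a : ℝ} (ha : 0 < a) {N : ℕ} (hN : 1 ≤ N) (n : ℕ) : ‖cpowAverageError s (n + N + a)‖ ≤
      ‖s‖ * ((N + n : ℕ) : ℝ) ^ (-(1 + δ)) := by
  have h1 : (1 : ℝ) ≤ ((N + n : ℕ) : ℝ) := by exact_mod_cast (by omega : 1 ≤ N + n)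
  refine (norm_cpowAverageError_le hs (by linarith) (by positivity)).trans ?_
  refine mul_le_mul_of_nonneg_left ?_ (norm_nonneg _)
  calc ((n : ℝ) + N + a) ^ (-s.re - 1) ≤ ((N + n : ℕ) : ℝ) ^ (-s.re - 1) :=
        Real.rpow_le_rpow_of_nonpos (by linarith) (by push_cast; linarith) (by linarith)
    _ ≤ _ := Real.rpow_le_rpow_of_exponent_le h1 (by linarith)

lemma summable_nat_add_rpow {δ : ℝ} (hδ : 0 < δ) (N : ℕ) :
    Summable fun n : ℕ => ((N + n : ℕ) : ℝ) ^ (-(1 + δ)) := by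
  have := (summable_nat_add_iff N).2 (Real.summable_nat_rpow.2 (show -(1 + δ) < -1 by linarith))
  simpa only [add_comm] using this

lemma norm_tsum_cpowAverageError_le {s : ℂ} (hs : s ≠ 1) (hσ : 1 / 2 ≤ s.re) {a : ℝ} (ha : 0 < a)
    {N : ℕ} (hN : 1 ≤ N) : ‖∑' n : ℕ, cpowAverageError s (n + N + a)‖ ≤ ‖s‖ * (4 / √N) := by
  refine (tsum_of_norm_bounded ((summable_nat_add_rpow one_half_pos N).hasSum.mul_left ‖s‖)
    (norm_cpowAverageError_add_le hs one_half_pos.le hσ ha hN)).trans ?_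
  refine mul_le_mul_of_nonneg_left ?_ (norm_nonneg _)
  refine Real.tsum_le_of_sum_range_le (fun n => by positivity) fun m => ?_
  convert sum_range_rpow_le hN m using 4
  norm_num

lemma hurwitzZeta_eq_of_one_lt_re {a : ℝ} (ha : 0 < a) (ha1 : a ≤ 1) {s : ℂ} (hs : 1 < s.re)
    {N : ℕ} (hN : 1 ≤ N) : HurwitzZeta.hurwitzZeta a s =
      ∑ n ∈ Finset.range N, ((n + a : ℝ) : ℂ) ^ (-s) -
      ((N + a : ℝ) : ℂ) ^ (1 - s) / (1 - s) + ∑' n : ℕ, cpowAverageError s (n + N + a) := by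
  have hs1 : s ≠ 1 := by rintro rfl; simp at hs
  have hz : HasSum (fun n : ℕ => ((n + a : ℝ) : ℂ) ^ (-s)) (HurwitzZeta.hurwitzZeta a s) := by
    convert HurwitzZeta.hasSum_hurwitzZeta_of_one_lt_re ⟨ha.le, ha1⟩ hs using 2 with n
    rw [cpow_neg, one_div]; push_cast; rfl
  have htail := (hasSum_nat_add_iff' N).2 hz
  have herr : HasSum (fun n : ℕ => cpowAverageError s (n + N + a))
      (∑' n : ℕ, cpowAverageError s (n + N + a)) :=
    (Summable.of_norm_bounded ((summable_nat_add_rpow one_half_pos N).mul_left ‖s‖)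
      (norm_cpowAverageError_add_le hs1 one_half_pos.le (by linarith) ha hN)).hasSum
  set g : ℕ → ℂ := fun n => ((n + N + a : ℝ) : ℂ) ^ (1 - s) / (1 - s) with hg
  have hdiff := (htail.sub herr).tendsto_sum_nat
  have hsum : ∀ m, ∑ n ∈ Finset.range m, ((((n + N : ℕ) + a : ℝ) : ℂ) ^ (-s) -
      cpowAverageError s (n + N + a)) = g m - g 0 := by
    intro m
    rw [← Finset.sum_range_sub]
    refine Finset.sum_congr rfl fun n _ => ?_
    rw [cpowAverageError, hg]
    push_cast
    rw [show (n : ℂ) + 1 + N + a = n + N + a + 1 by ring]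
    ring
  have hg0 : Tendsto g atTop (nhds 0) := by
    rw [tendsto_zero_iff_norm_tendsto_zero]
    have hlim : Tendsto (fun n : ℕ => ((n : ℝ) + N + a) ^ (-(s.re - 1)) / ‖1 - s‖) atTop
        (nhds (0 / ‖1 - s‖)) := by
      refine ((tendsto_rpow_neg_atTop (by linarith)).comp ?_).div_const _
      simp only [add_assoc]
      exact tendsto_atTop_add_const_right _ _ tendsto_natCast_atTop_atTop
    rw [zero_div] at hlim
    refine hlim.congr fun n => ?_
    rw [hg, norm_div, norm_cpow_eq_rpow_re_of_pos (by positivity)]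
    congr 2
    simp
  simp only [hsum] at hdiff
  have := tendsto_nhds_unique hdiff (hg0.sub_const (g 0))
  have e0 : g 0 = ((N + a : ℝ) : ℂ) ^ (1 - s) / (1 - s) := by simp [hg]
  rw [e0, zero_sub] at this
  linear_combination this

lemma hurwitzZeta_eq {a : ℝ} (ha : 0 < a) (ha1 : a ≤ 1) {s : ℂ} (hs : 1 / 2 ≤ s.re) (hs0 : 0 < s.im)
    {N : ℕ} (hN : 1 ≤ N) : HurwitzZeta.hurwitzZeta a s =
      ∑ n ∈ Finset.range N, ((n + a : ℝ) : ℂ) ^ (-s) -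
      ((N + a : ℝ) : ℂ) ^ (1 - s) / (1 - s) + ∑' n : ℕ, cpowAverageError s (n + N + a) := by
  set R : ℝ := ‖s‖ + ‖2 + s.im * I‖ + 1 with hR
  set U : Set ℂ := ({z | 1 / 4 < z.re} ∩ {z | 0 < z.im}) ∩ Metric.ball 0 R with hU
  have hUo : IsOpen U := ((isOpen_lt continuous_const continuous_re).inter
    (isOpen_lt continuous_const continuous_im)).inter Metric.isOpen_ball
  have hUc : IsPreconnected U := (((convex_halfSpace_re_gt _).inter
    (convex_halfSpace_im_gt _)).inter (convex_ball _ _)).isPreconnected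
  have hne : ∀ z ∈ U, z ≠ 1 := by
    rintro z ⟨⟨-, hz⟩, -⟩ rfl
    simp at hz
  have hpos : ∀ n : ℕ, (0 : ℝ) < n + a := fun n => by positivity
  refine eqOn_of_eqOn_re_gt (b := 1) (z := 2 + s.im * I) hUo hUc (fun z hz => ?_) ?_ ?_
    (by simp) (fun z _ hz1 => hurwitzZeta_eq_of_one_lt_re ha ha1 hz1 hN) ?_
  · exact (HurwitzZeta.differentiableAt_hurwitzZeta a (hne z hz)).differentiableWithinAt
  · refine (DifferentiableOn.sub (fun z hz => ?_) fun z hz => ?_).add ?_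
    · refine DifferentiableAt.differentiableWithinAt ?_
      refine DifferentiableAt.fun_sum fun n _ => DifferentiableAt.const_cpow (by fun_prop)
        (Or.inl (by exact_mod_cast (hpos n).ne'))
    · refine DifferentiableAt.differentiableWithinAt ?_
      refine (DifferentiableAt.const_cpow (by fun_prop) (Or.inl (by exact_mod_cast (hpos N).ne'))).div
        (by fun_prop) (sub_ne_zero.2 (hne z hz).symm)
    · refine differentiableOn_tsum_of_summable_norm
        (u := fun n : ℕ => R * ((N + n : ℕ) : ℝ) ^ (-(1 + 1 / 4) : ℝ))
        ((summable_nat_add_rpow (by norm_num) N).mul_left R) (fun n z hz => ?_) hUo fun n z hz => ?_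
      · exact (differentiableAt_cpowAverageError (hne z hz) (by positivity)).differentiableWithinAt
      · refine (norm_cpowAverageError_add_le (hne z hz) (δ := 1 / 4) (by norm_num) hz.1.1.le ha hN
          n).trans ?_
        refine mul_le_mul_of_nonneg_right ?_ (by positivity)
        have := hz.2
        rw [mem_ball_zero_iff] at this
        exact this.le
  · refine ⟨⟨by simp; norm_num, by simpa using hs0⟩, ?_⟩
    rw [mem_ball_zero_iff, hR]
    linarith [norm_nonneg s]
  · refine ⟨⟨by simp only [Set.mem_ofPred_eq]; linarith, hs0⟩, ?_⟩
    rw [mem_ball_zero_iff, hR]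
    linarith [norm_nonneg (2 + s.im * I)]

/-- Abel's inequality. -/
lemma norm_sum_mul_le_of_antitone {w : ℕ → ℝ} {z : ℕ → ℂ} {B : ℝ} (hw : Antitone w)
    (hw0 : ∀ n, 0 ≤ w n) (L : ℕ) (h : ∀ l ≤ L, ‖∑ n ∈ Finset.range l, z n‖ ≤ B) :
    ‖∑ n ∈ Finset.range L, (w n : ℂ) * z n‖ ≤ w 0 * B := by
  have hB : 0 ≤ B := by simpa using h 0 (Nat.zero_le _)
  have key : ∀ l, ∑ n ∈ Finset.range l, (w n : ℂ) * z n =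
      (w l : ℂ) * ∑ n ∈ Finset.range l, z n +
      ∑ n ∈ Finset.range l, ((w n - w (n + 1) : ℝ) : ℂ) * ∑ m ∈ Finset.range (n + 1), z m := by
    intro l
    induction l with
    | zero => simp
    | succ l ih =>
      rw [Finset.sum_range_succ, ih, Finset.sum_range_succ (fun n => ((w n - w (n + 1) : ℝ) : ℂ) *
        ∑ m ∈ Finset.range (n + 1), z m), Finset.sum_range_succ z l]
      push_cast
      ring
  rw [key]
  calc _ ≤ w L * B + ∑ n ∈ Finset.range L, (w n - w (n + 1)) * B := by
        refine (norm_add_le _ _).trans (add_le_add ?_ ((norm_sum_le _ _).trans ?_))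
        · rw [norm_mul, Complex.norm_of_nonneg (hw0 L)]
          exact mul_le_mul_of_nonneg_left (h L le_rfl) (hw0 L)
        · refine Finset.sum_le_sum fun n hn => ?_
          have hn' : 0 ≤ w n - w (n + 1) := sub_nonneg.2 (hw (Nat.le_succ n))
          rw [norm_mul, Complex.norm_of_nonneg hn']
          exact mul_le_mul_of_nonneg_left (h _ (Finset.mem_range.1 hn)) hn'
    _ = _ := by rw [← Finset.sum_mul, Finset.sum_range_sub']; ring

lemma norm_cpow_block_le {τ X σ : ℝ} (hτ : 1 ≤ τ) (hX : 1 ≤ X) {L : ℕ} (hL : L ≤ X)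
    (hX2 : X ≤ 4 * τ ^ 100) (hσ : 1 / 2 ≤ σ) :
    ‖∑ n ∈ Finset.range L, ((X + n : ℝ) : ℂ) ^ (-(σ + (τ ^ 50 : ℝ) * I : ℂ))‖ ≤ 142 * τ ^ 12 := by
  have hX0 : 0 < X := by linarith
  have hpos : ∀ n : ℕ, 0 < X + n := fun n => by positivity
  rw [← Complex.norm_conj, map_sum]
  have hterm : ∀ n : ℕ, (starRingEnd ℂ) (((X + n : ℝ) : ℂ) ^ (-(σ + (τ ^ 50 : ℝ) * I : ℂ))) =
      (((X + n) ^ (-σ) : ℝ) : ℂ) * cexp ((τ ^ 50 * Real.log (X + n) : ℝ) * I) := by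
    intro n
    have h0 : ((X + n : ℝ) : ℂ) ≠ 0 := by exact_mod_cast (hpos n).ne'
    rw [cpow_def_of_ne_zero h0, ← exp_conj, ← ofReal_log (hpos n).le, Real.rpow_def_of_pos (hpos n),
      ofReal_exp, ← Complex.exp_add]
    congr 1
    simp only [map_mul, map_neg, map_add, conj_ofReal, conj_I]
    push_cast
    ring
  simp only [hterm]
  refine (norm_sum_mul_le_of_antitone (w := fun n : ℕ => (X + n) ^ (-σ))
    (z := fun n : ℕ => cexp ((τ ^ 50 * Real.log (X + n) : ℝ) * I)) (B := 142 * √X * τ ^ 12)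
    (fun m n hmn => ?_) (fun n => by positivity) L fun l hl => ?_).trans ?_
  · refine Real.rpow_le_rpow_of_nonpos (hpos m) ?_ (by linarith)
    have : (m : ℝ) ≤ n := by exact_mod_cast hmn
    linarith
  · have hl' : (l : ℝ) ≤ X := (Nat.cast_le.2 hl).trans hL
    have := norm_sq_phaseSum_log_le hτ hX hl' hX2
    rw [phaseSum] at this
    refine abs_le_of_sq_le_sq' (this.trans ?_) (by positivity) |>.2
    rw [mul_pow, mul_pow, Real.sq_sqrt hX0.le, ← pow_mul]
    have : 0 ≤ X * τ ^ 24 := by positivity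
    norm_num
    linarith
  · have h1 : X ^ (-σ) ≤ X ^ (-(1 / 2) : ℝ) := Real.rpow_le_rpow_of_exponent_le hX (by linarith)
    simp only [Nat.cast_zero, add_zero]
    calc _ ≤ X ^ (-(1 / 2) : ℝ) * (142 * √X * τ ^ 12) := by gcongr
      _ = (X ^ (-(1 / 2) : ℝ) * X ^ (1 / 2 : ℝ)) * (142 * τ ^ 12) := by
        rw [Real.sqrt_eq_rpow]; ring
      _ = _ := by rw [← Real.rpow_add hX0]; norm_num

lemma norm_sum_range_two_pow_le {τ σ a : ℝ} (hτ : 1 ≤ τ) (ha : 1 / 4 ≤ a) (ha1 : a ≤ 1)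
    (hσ : 1 / 2 ≤ σ) (hσ2 : σ ≤ 2) (J : ℕ) (hJ : (2 : ℝ) ^ J ≤ 2 * τ ^ 100) :
    ‖∑ n ∈ Finset.range (2 ^ J), ((n + a : ℝ) : ℂ) ^ (-(σ + (τ ^ 50 : ℝ) * I : ℂ))‖ ≤
      16 + 142 * τ ^ 12 * J := by
  induction J with
  | zero =>
    simp only [pow_zero, Finset.range_one, Finset.sum_singleton]
    rw [norm_cpow_eq_rpow_re_of_pos (by simp; linarith)]
    simp only [Nat.cast_zero, zero_add, neg_re, add_re, mul_re, ofReal_re, I_re, mul_zero,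
      ofReal_im, I_im, mul_one, sub_self, add_zero]
    calc a ^ (-σ) ≤ (1 / 4 : ℝ) ^ (-σ) :=
          Real.rpow_le_rpow_of_nonpos (by norm_num) ha (by linarith)
      _ = 4 ^ σ := by rw [Real.rpow_neg (by norm_num), ← Real.inv_rpow (by norm_num)]; norm_num
      _ ≤ 4 ^ (2 : ℝ) := Real.rpow_le_rpow_of_exponent_le (by norm_num) hσ2
      _ ≤ _ := by norm_num
  | succ J ih =>
    have hτ100 : 1 ≤ τ ^ 100 := one_le_pow₀ hτ
    have h2 : (2 : ℝ) ^ (J + 1) = 2 * 2 ^ J := by ring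
    have h2J : (1 : ℝ) ≤ 2 ^ J := one_le_pow₀ (by norm_num)
    have h3 := ih (by linarith)
    rw [show 2 ^ (J + 1) = 2 ^ J + 2 ^ J by ring, Finset.sum_range_add]
    have h4 := norm_cpow_block_le hτ (X := 2 ^ J + a) (L := 2 ^ J) (by linarith)
      (by push_cast; linarith) (by linarith) hσ
    refine (norm_add_le _ _).trans ?_
    have h5 : ∀ n : ℕ, ((2 ^ J + n : ℕ) : ℝ) + a = 2 ^ J + a + n := fun n => by push_cast; ring
    simp only [h5]
    push_cast at h3 h4 ⊢
    linarith

/-- A subconvexity bound for the Hurwitz zeta function at height `τ ^ 50`. -/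
lemma norm_hurwitzZeta_le {τ σ a : ℝ} (hτ : 1 ≤ τ) (ha : 1 / 4 ≤ a) (ha1 : a ≤ 1)
    (hσ : 1 / 2 ≤ σ) (hσ2 : σ ≤ 2) :
    ‖HurwitzZeta.hurwitzZeta a (σ + (τ ^ 50 : ℝ) * I)‖ ≤ 200000 * τ ^ (49 / 4 : ℝ) := by
  have hτ0 : 0 < τ := by linarith
  set s : ℂ := σ + (τ ^ 50 : ℝ) * I with hs
  have hre : s.re = σ := by rw [hs, add_re, re_ofReal_mul]; simp
  have him : s.im = τ ^ 50 := by rw [hs, add_im, im_ofReal_mul]; simp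
  have ht : 1 ≤ τ ^ 50 := one_le_pow₀ hτ
  obtain ⟨j, hj1, hj2⟩ := exists_nat_pow_near (one_le_pow₀ hτ : 1 ≤ τ ^ 100) one_lt_two
  set J := j + 1 with hJ
  have hJ2 : (2 : ℝ) ^ J ≤ 2 * τ ^ 100 := by rw [hJ, pow_succ]; linarith
  have hNN : 1 ≤ 2 ^ J := Nat.one_le_two_pow
  have hN0 : (0 : ℝ) < 2 ^ J := by positivity
  have hsqrt : τ ^ 50 ≤ √((2 ^ J : ℕ) : ℝ) := by
    refine Real.le_sqrt_of_sq_le ?_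
    push_cast
    rw [← pow_mul]
    exact hj2.le
  have hJle : (J : ℝ) ≤ 700 * τ ^ (1 / 4 : ℝ) := by
    have h1 := Real.log_le_log (by positivity) hj1
    rw [Real.log_pow, Real.log_pow] at h1
    have h2 := Real.log_le_rpow_div hτ0.le (show (0 : ℝ) < 1 / 4 by norm_num)
    have h3 := Real.log_two_gt_d9
    have h4 : 1 ≤ τ ^ (1 / 4 : ℝ) := Real.one_le_rpow hτ (by norm_num)
    have h5 : (0 : ℝ) ≤ j := j.cast_nonneg
    rw [hJ]
    push_cast at h1 ⊢
    nlinarith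
  have hsum := norm_sum_range_two_pow_le hτ ha ha1 hσ hσ2 J hJ2
  have hsn : ‖s‖ ≤ 3 * τ ^ 50 := by
    refine (Complex.norm_le_abs_re_add_abs_im s).trans ?_
    rw [hre, him, abs_of_pos (by linarith), abs_of_pos (by linarith)]
    linarith
  have hs1 : τ ^ 50 ≤ ‖1 - s‖ := by
    refine le_trans ?_ (Complex.abs_im_le_norm _)
    simp [him, abs_of_pos (show 0 < τ ^ 50 by linarith)]
  have hne : s ≠ 1 := by
    intro h
    rw [h] at him
    simp only [one_im] at him
    linarith
  have hmid : ‖((((2 ^ J : ℕ) : ℝ) + a : ℝ) : ℂ) ^ (1 - s) / (1 - s)‖ ≤ 3 := by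
    have hb : (1 : ℝ) ≤ ((2 ^ J : ℕ) : ℝ) + a := by
      have : (1 : ℝ) ≤ ((2 ^ J : ℕ) : ℝ) := by exact_mod_cast hNN
      linarith
    rw [norm_div, norm_cpow_eq_rpow_re_of_pos (by linarith)]
    have : (((2 ^ J : ℕ) : ℝ) + a) ^ (1 - s).re ≤ 3 * τ ^ 50 := by
      calc _ ≤ (((2 ^ J : ℕ) : ℝ) + a) ^ (1 / 2 : ℝ) :=
            Real.rpow_le_rpow_of_exponent_le hb (by simp [hre]; linarith)
        _ = √(((2 ^ J : ℕ) : ℝ) + a) := by rw [Real.sqrt_eq_rpow]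
        _ ≤ √((3 * τ ^ 50) ^ 2) := by
          apply Real.sqrt_le_sqrt
          push_cast
          have : (3 * τ ^ 50) ^ 2 = 9 * τ ^ 100 := by ring
          nlinarith [one_le_pow₀ hτ (n := 100)]
        _ = _ := Real.sqrt_sq (by positivity)
    rw [div_le_iff₀ (by linarith)]
    linarith
  have htail : ‖∑' n : ℕ, cpowAverageError s (n + (2 ^ J : ℕ) + a)‖ ≤ 12 := by
    refine (norm_tsum_cpowAverageError_le hne (by rw [hre]; exact hσ) (by linarith) hNN).trans ?_
    have hq : 0 < √((2 ^ J : ℕ) : ℝ) := by linarith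
    rw [← mul_div_assoc, div_le_iff₀ hq]
    linarith
  rw [hurwitzZeta_eq (by linarith) ha1 (by rw [hre]; exact hσ) (by rw [him]; linarith) hNN]
  have hτ12 : 1 ≤ τ ^ (49 / 4 : ℝ) := Real.one_le_rpow hτ (by norm_num)
  have hmul : τ ^ 12 * J ≤ 700 * τ ^ (49 / 4 : ℝ) := by
    calc τ ^ 12 * J ≤ τ ^ 12 * (700 * τ ^ (1 / 4 : ℝ)) := by gcongr
      _ = 700 * (τ ^ (12 : ℝ) * τ ^ (1 / 4 : ℝ)) := by
        rw [show (12 : ℝ) = (12 : ℕ) by norm_num, Real.rpow_natCast]; ring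
      _ = _ := by rw [← Real.rpow_add hτ0]; norm_num
  have h6 := norm_add_le (∑ n ∈ Finset.range (2 ^ J), ((n + a : ℝ) : ℂ) ^ (-s) -
      ((((2 ^ J : ℕ) : ℝ) + a : ℝ) : ℂ) ^ (1 - s) / (1 - s))
    (∑' n : ℕ, cpowAverageError s (n + (2 ^ J : ℕ) + a))
  have h7 := norm_sub_le (∑ n ∈ Finset.range (2 ^ J), ((n + a : ℝ) : ℂ) ^ (-s))
    (((((2 ^ J : ℕ) : ℝ) + a : ℝ) : ℂ) ^ (1 - s) / (1 - s))
  nlinarith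

/-- A subconvexity bound for the Dedekind zeta function of `ℚ(i)`. -/
lemma exists_norm_zetaK_le : ∃ C, 0 < C ∧ ∀ σ t : ℝ, 1 / 2 ≤ σ → σ ≤ 2 → 1 ≤ t →
    ‖zetaK (σ + t * I)‖ ≤ C * t ^ (49 / 100 : ℝ) := by
  refine ⟨200000 * (3 * 200000), by norm_num, fun σ t hσ hσ2 ht => ?_⟩
  have ht0 : 0 < t := by linarith
  obtain ⟨τ, hτ, hτt⟩ : ∃ τ : ℝ, 1 ≤ τ ∧ τ ^ 50 = t :=
    ⟨t ^ (1 / 50 : ℝ), Real.one_le_rpow ht (by norm_num), by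
      rw [← Real.rpow_natCast, ← Real.rpow_mul ht0.le]; norm_num⟩
  have hτ0 : 0 < τ := by linarith
  have e : t ^ (49 / 100 : ℝ) = τ ^ (49 / 4 : ℝ) * τ ^ (49 / 4 : ℝ) := by
    rw [← hτt, ← Real.rpow_natCast, ← Real.rpow_mul hτ0.le, ← Real.rpow_add hτ0]; norm_num
  have h := fun a ha ha1 => norm_hurwitzZeta_le (a := a) hτ ha ha1 hσ hσ2
  rw [hτt] at h
  set s : ℂ := σ + t * I
  have hz : ‖riemannZeta s‖ ≤ 200000 * τ ^ (49 / 4 : ℝ) := by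
    have := h 1 (by norm_num) le_rfl
    rwa [show ((1 : ℝ) : UnitAddCircle) = 0 from AddCircle.coe_period 1,
      HurwitzZeta.hurwitzZeta_zero] at this
  have hL : ‖chiC.LFunction s‖ ≤ 3 * 200000 * τ ^ (49 / 4 : ℝ) := by
    rw [DirichletCharacter.LFunction, ZMod.LFunction, norm_mul]
    have h1 : ‖((4 : ℕ) : ℂ) ^ (-s)‖ ≤ 1 := by
      rw [norm_natCast_cpow_of_pos (by norm_num)]
      refine Real.rpow_le_one_of_one_le_of_nonpos (by norm_num) ?_
      simp [s]; linarith
    have h2 : ∀ j : ZMod 4, j ∈ Finset.univ.erase (0 : ZMod 4) →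
        ‖chiC j * HurwitzZeta.hurwitzZeta (ZMod.toAddCircle j) s‖ ≤ 200000 * τ ^ (49 / 4 : ℝ) := by
      intro j hj
      have hj0 : j ≠ 0 := by simpa using hj
      have hv : 1 ≤ j.val := Nat.one_le_iff_ne_zero.2 (by rwa [Ne, ZMod.val_eq_zero])
      have hv1 : (1 : ℝ) ≤ j.val := by exact_mod_cast hv
      have hv4 : (j.val : ℝ) < (4 : ℕ) := by exact_mod_cast j.val_lt
      rw [ZMod.toAddCircle_apply, norm_mul]
      have := h (j.val / (4 : ℕ)) (by push_cast; linarith) (by push_cast at hv4 ⊢; linarith)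
      refine (mul_le_of_le_one_left (norm_nonneg _) (DirichletCharacter.norm_le_one chiC j)).trans
        this
    have h3 : ‖∑ j, chiC j * HurwitzZeta.hurwitzZeta (ZMod.toAddCircle j) s‖ ≤
        3 * 200000 * τ ^ (49 / 4 : ℝ) := by
      rw [← Finset.add_sum_erase _ _ (Finset.mem_univ (0 : ZMod 4))]
      have h0 : chiC (0 : ZMod 4) = 0 := chiC.map_nonunit (by decide)
      rw [h0, zero_mul, zero_add]
      refine (norm_sum_le_of_le _ h2).trans (le_of_eq ?_)
      rw [Finset.sum_const, Finset.card_erase_of_mem (Finset.mem_univ _)]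
      simp [ZMod.card]
      ring
    calc _ ≤ 1 * (3 * 200000 * τ ^ (49 / 4 : ℝ)) := by gcongr
      _ = _ := one_mul _
  rw [zetaK, norm_mul, e]
  calc _ ≤ (200000 * τ ^ (49 / 4 : ℝ)) * (3 * 200000 * τ ^ (49 / 4 : ℝ)) := by gcongr
    _ = _ := by ring

/-- Half the leading coefficient of the summatory function of `rho * rho`. -/
noncomputable def leadCoeff : ℂ := chiC.LFunction 1 ^ 2 / 2

/-- The secondary coefficient in the integrated summatory function of `rho * rho`. -/
noncomputable def secondCoeff : ℂ :=
  Real.eulerMascheroniConstant * chiC.LFunction 1 ^ 2 + chiC.LFunction 1 * deriv chiC.LFunction 1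
    - 3 / 4 * chiC.LFunction 1 ^ 2

/-- The function `(s - 1)² zetaK(s)² / (s (s + 1))` with its first-order expansion
at `s = 1` removed. -/
noncomputable def mellinNumerator (s : ℂ) : ℂ :=
  (riemannZeta₁ s * chiC.LFunction s) ^ 2 / (s * (s + 1)) - leadCoeff - secondCoeff * (s - 1) / s

/-- The Mellin transform of the integrated remainder term for `rho * rho`. -/
noncomputable def mellinRemainder (s : ℂ) : ℂ := dslope (dslope mellinNumerator 1) 1 s

lemma differentiableOn_mellinNumerator : DifferentiableOn ℂ mellinNumerator {s | 0 < s.re} := by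
  intro s hs
  have hs : 0 < s.re := hs
  have h0 : s ≠ 0 := by rintro rfl; simp at hs
  have h1 : s + 1 ≠ 0 := by
    intro h; have := congrArg re h; simp at this; linarith
  have h2 := differentiable_riemannZeta₁ s
  have h3 := DirichletCharacter.differentiable_LFunction chiC_ne_one s
  unfold mellinNumerator
  refine DifferentiableAt.differentiableWithinAt ?_
  refine DifferentiableAt.sub (DifferentiableAt.sub ?_ (by fun_prop)) ?_
  · exact ((h2.mul h3).pow 2).div (by fun_prop) (mul_ne_zero h0 h1)
  · exact DifferentiableAt.div (by fun_prop) (by fun_prop) h0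

lemma mellinNumerator_one : mellinNumerator 1 = 0 := by
  simp [mellinNumerator, leadCoeff]; ring

lemma deriv_mellinNumerator_one : deriv mellinNumerator 1 = 0 := by
  have h2 := (differentiable_riemannZeta₁ 1).hasDerivAt
  have h3 := (DirichletCharacter.differentiable_LFunction chiC_ne_one 1).hasDerivAt
  have h4 := ((h2.mul h3).pow 2).div ((hasDerivAt_id (1:ℂ)).mul ((hasDerivAt_id (1:ℂ)).add_const 1))
    (by norm_num)
  have h5 := (((hasDerivAt_id (1:ℂ)).sub_const 1).const_mul secondCoeff).div (hasDerivAt_id (1:ℂ))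
    (by norm_num)
  have h6 := (h4.sub_const leadCoeff).sub h5
  refine (h6.congr_deriv ?_).deriv
  simp [secondCoeff]
  ring

lemma differentiableOn_mellinRemainder : DifferentiableOn ℂ mellinRemainder {s | 0 < s.re} := by
  have h : {s : ℂ | 0 < s.re} ∈ nhds (1:ℂ) :=
    (isOpen_lt continuous_const continuous_re).mem_nhds (by simp)
  exact (differentiableOn_dslope h).2 ((differentiableOn_dslope h).2 differentiableOn_mellinNumerator)

lemma mellinRemainder_eq {s : ℂ} (h0 : s ≠ 0) (h1 : s ≠ 1) :
    mellinRemainder s = zetaK s ^ 2 / (s * (s + 1)) - leadCoeff / (s - 1) ^ 2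
      - secondCoeff / (s * (s - 1)) := by
  have h2 : s - 1 ≠ 0 := sub_ne_zero.2 h1
  rw [mellinRemainder, dslope_of_ne _ h1, slope_def_field, dslope_same, deriv_mellinNumerator_one,
    dslope_of_ne _ h1, slope_def_field, mellinNumerator_one, mellinNumerator, zetaK,
    riemannZeta_eq_inv_sub_mul h1]
  field_simp
  ring

lemma continuous_mellinRemainder_line {σ : ℝ} (hσ : 0 < σ) :
    Continuous fun t : ℝ => mellinRemainder (σ + t * I) := by
  rw [continuous_iff_continuousAt]
  intro t
  have h := (differentiableOn_mellinRemainder.differentiableAt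
    ((isOpen_lt continuous_const continuous_re).mem_nhds
      (by simpa using hσ : (σ + t * I : ℂ) ∈ {s : ℂ | 0 < s.re}))).continuousAt
  exact ContinuousAt.comp (f := fun t : ℝ => (σ + t * I : ℂ)) h (by fun_prop)

lemma norm_add_ofReal_mul_I_sq (a t : ℝ) : ‖(a + t * I : ℂ)‖ ^ 2 = a ^ 2 + t ^ 2 := by
  rw [← normSq_eq_norm_sq, normSq_add_mul_I]

lemma norm_mellinRemainder_half_le : ∃ C : ℝ, 0 < C ∧ ∀ t : ℝ,
    ‖mellinRemainder (1 / 2 + t * I)‖ ≤ C * (‖zetaK (1 / 2 + t * I)‖ ^ 2 + 1) / (1 + t ^ 2) := by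
  refine ⟨4 * (1 + ‖leadCoeff‖ + ‖secondCoeff‖), by positivity, fun t => ?_⟩
  set s : ℂ := 1 / 2 + t * I with hs
  have hss : s = ((1/2 : ℝ) : ℂ) + t * I := by simp [hs]
  have n0 : ‖s‖ ^ 2 = 1 / 4 + t ^ 2 := by
    rw [hss, norm_add_ofReal_mul_I_sq]; norm_num
  have n1 : ‖s - 1‖ ^ 2 = 1 / 4 + t ^ 2 := by
    rw [show s - 1 = ((-1/2 : ℝ) : ℂ) + t * I by rw [hss]; push_cast; ring,
      norm_add_ofReal_mul_I_sq]; norm_num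
  have n2 : ‖s + 1‖ ^ 2 = 9 / 4 + t ^ 2 := by
    rw [show s + 1 = ((3/2 : ℝ) : ℂ) + t * I by rw [hss]; push_cast; ring,
      norm_add_ofReal_mul_I_sq]; norm_num
  have h01 : ‖s‖ = ‖s - 1‖ := by
    rw [← sq_eq_sq₀ (norm_nonneg _) (norm_nonneg _), n0, n1]
  have h02 : ‖s‖ ≤ ‖s + 1‖ := by
    rw [← sq_le_sq₀ (norm_nonneg _) (norm_nonneg _), n0, n2]; linarith
  have hpos : 0 < ‖s‖ := by
    rcases (norm_nonneg s).eq_or_lt with h | h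
    · rw [← h] at n0; nlinarith
    · exact h
  have hs0 : s ≠ 0 := norm_pos_iff.1 hpos
  have hs1 : s ≠ 1 := sub_ne_zero.1 (norm_pos_iff.1 (h01 ▸ hpos))
  have key : ‖mellinRemainder s‖ ≤
      (‖zetaK s‖ ^ 2 + ‖leadCoeff‖ + ‖secondCoeff‖) / ‖s‖ ^ 2 := by
    rw [mellinRemainder_eq hs0 hs1]
    refine (norm_sub_le _ _).trans ?_
    refine (add_le_add (norm_sub_le _ _) le_rfl).trans ?_
    rw [add_div, add_div, norm_div, norm_div, norm_div, norm_mul, norm_mul, norm_pow, norm_pow,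
      ← h01, ← sq]
    gcongr
    rw [sq]
    gcongr
  refine key.trans ?_
  rw [n0, div_le_div_iff₀ (by positivity) (by positivity)]
  have e1 : ‖zetaK s‖ ^ 2 + ‖leadCoeff‖ + ‖secondCoeff‖ ≤
      (1 + ‖leadCoeff‖ + ‖secondCoeff‖) * (‖zetaK s‖ ^ 2 + 1) := by
    nlinarith [norm_nonneg leadCoeff, norm_nonneg secondCoeff, sq_nonneg ‖zetaK s‖,
      mul_nonneg (norm_nonneg leadCoeff) (sq_nonneg ‖zetaK s‖),
      mul_nonneg (norm_nonneg secondCoeff) (sq_nonneg ‖zetaK s‖)]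
  calc _ ≤ (1 + ‖leadCoeff‖ + ‖secondCoeff‖) * (‖zetaK s‖ ^ 2 + 1) * (4 * (1 / 4 + t ^ 2)) := by
        gcongr
        nlinarith [sq_nonneg t]
    _ = _ := by ring

/-- Uniform decay in the strip `1/2 ≤ Re s ≤ 2`. -/
lemma exists_norm_mellinRemainder_le : ∃ C : ℝ, 0 < C ∧ ∀ σ t : ℝ, 1 / 2 ≤ σ → σ ≤ 2 →
    ‖mellinRemainder (σ + t * I)‖ ≤ C * (1 + t ^ 2) ^ (-(51 / 100) : ℝ) := by
  obtain ⟨C₁, hC₁, h₁⟩ := exists_norm_zetaK_le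
  have hK : IsCompact (Set.Icc (1/2:ℝ) 2 ×ℂ Set.Icc (-1:ℝ) 1) :=
    (isCompact_Icc).reProdIm isCompact_Icc
  obtain ⟨C₂, h₂⟩ := hK.exists_bound_of_continuousOn
    (differentiableOn_mellinRemainder.continuousOn.mono fun s hs => by
      have := (mem_reProdIm.1 hs).1.1
      simp only [Set.mem_ofPred_eq]; linarith)
  set C₃ := C₁ ^ 2 + ‖leadCoeff‖ + ‖secondCoeff‖ with hC₃
  have hC₃0 : 0 < C₃ := by positivity
  have h2p : (0:ℝ) < 2 ^ (51 / 100 : ℝ) := by positivity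
  refine ⟨(|C₂| + C₃) * 2 ^ (51 / 100 : ℝ), by positivity, fun σ t h1 h2 => ?_⟩
  have hq : (0:ℝ) < (1 + t ^ 2) ^ (-(51 / 100) : ℝ) := by positivity
  rcases le_or_gt |t| 1 with ht | ht
  · have hb := h₂ (σ + t * I) (mem_reProdIm.2 ⟨by simp; constructor <;> linarith,
      by simpa using abs_le.1 ht⟩)
    have ht2 : t ^ 2 ≤ 1 := by rw [← sq_abs]; nlinarith [abs_nonneg t]
    have h3 : 1 ≤ 2 ^ (51 / 100 : ℝ) * (1 + t ^ 2) ^ (-(51 / 100) : ℝ) := by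
      rw [Real.rpow_neg (by positivity), ← div_eq_mul_inv, one_le_div (by positivity)]
      exact Real.rpow_le_rpow (by positivity) (by linarith) (by norm_num)
    calc _ ≤ (|C₂| + C₃) * 1 := by rw [mul_one]; exact hb.trans (by linarith [le_abs_self C₂])
      _ ≤ (|C₂| + C₃) * (2 ^ (51 / 100 : ℝ) * (1 + t ^ 2) ^ (-(51 / 100) : ℝ)) := by gcongr
      _ = _ := by ring
  · set s : ℂ := σ + t * I with hs
    have habs : 0 < |t| := by linarith
    have hz : ‖zetaK s‖ ≤ C₁ * |t| ^ (49/100:ℝ) := by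
      rcases abs_cases t with ⟨h, -⟩ | ⟨h, h'⟩
      · rw [h]; exact h₁ σ t h1 h2 (h ▸ ht.le)
      · rw [← norm_zetaK_conj, h]
        have : (starRingEnd ℂ) s = σ + ((-t : ℝ) : ℂ) * I := by simp [hs]
        rw [this]; exact h₁ σ (-t) h1 h2 (h ▸ ht.le)
    have im_le : ∀ a : ℝ, |t| ≤ ‖s + a‖ := fun a => by
      have := abs_im_le_norm (s + a); simpa [hs] using this
    have n0 : |t| ≤ ‖s‖ := by simpa using im_le 0
    have n1 : |t| ≤ ‖s + 1‖ := by simpa using im_le 1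
    have n2 : |t| ≤ ‖s - 1‖ := by simpa [sub_eq_add_neg] using im_le (-1)
    have hs0 : s ≠ 0 := norm_pos_iff.1 (habs.trans_le n0)
    have hs1 : s ≠ 1 := sub_ne_zero.1 (norm_pos_iff.1 (habs.trans_le n2))
    have key : ‖mellinRemainder s‖ ≤
        (‖zetaK s‖ ^ 2 + ‖leadCoeff‖ + ‖secondCoeff‖) / |t| ^ 2 := by
      rw [mellinRemainder_eq hs0 hs1]
      refine (norm_sub_le _ _).trans ?_
      refine (add_le_add (norm_sub_le _ _) le_rfl).trans ?_
      rw [add_div, add_div, norm_div, norm_div, norm_div, norm_mul, norm_mul, norm_pow, norm_pow]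
      gcongr
      · rw [sq]; gcongr
      · rw [sq]; gcongr
    refine key.trans ?_
    have e0 : (1:ℝ) ≤ |t| ^ (49/50 : ℝ) := Real.one_le_rpow ht.le (by norm_num)
    have e1 : ‖zetaK s‖ ^ 2 ≤ C₁ ^ 2 * |t| ^ (49/50 : ℝ) := by
      calc _ ≤ (C₁ * |t| ^ (49/100:ℝ)) ^ 2 := by gcongr
        _ = _ := by
          rw [mul_pow, ← Real.rpow_natCast (|t| ^ (49/100:ℝ)), ← Real.rpow_mul (abs_nonneg t)]
          norm_num
    have e2 : ‖zetaK s‖ ^ 2 + ‖leadCoeff‖ + ‖secondCoeff‖ ≤ C₃ * |t| ^ (49/50 : ℝ) := by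
      rw [hC₃]
      nlinarith [norm_nonneg leadCoeff, norm_nonneg secondCoeff]
    have e3 : |t| ^ (49/50 : ℝ) / |t| ^ 2 ≤ 2 ^ (51 / 100 : ℝ) * (1 + t ^ 2) ^ (-(51 / 100) : ℝ) := by
      have : |t| ^ (49/50 : ℝ) / |t| ^ 2 = (|t| ^ 2) ^ (-(51/100) : ℝ) := by
        rw [← Real.rpow_natCast |t| 2, ← Real.rpow_mul (abs_nonneg t), ← Real.rpow_sub habs]
        norm_num
      rw [this, Real.rpow_neg (by positivity), Real.rpow_neg (by positivity), ← div_eq_mul_inv,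
        inv_eq_one_div, div_le_div_iff₀ (by positivity) (by positivity), one_mul,
        ← Real.mul_rpow (by positivity) (by positivity)]
      refine Real.rpow_le_rpow (by positivity) ?_ (by norm_num)
      rw [← sq_abs t]; nlinarith
    calc _ ≤ C₃ * |t| ^ (49/50 : ℝ) / |t| ^ 2 := by gcongr
      _ = C₃ * (|t| ^ (49/50 : ℝ) / |t| ^ 2) := by ring
      _ ≤ (|C₂| + C₃) * (2 ^ (51 / 100 : ℝ) * (1 + t ^ 2) ^ (-(51 / 100) : ℝ)) := by
        gcongr; linarith [abs_nonneg C₂]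
      _ = _ := by ring

lemma integrable_of_norm_le_rpow {g : ℝ → ℂ} (hg : Continuous g) {C : ℝ}
    (h : ∀ t, ‖g t‖ ≤ C * (1 + t ^ 2) ^ (-(51 / 100) : ℝ)) : MeasureTheory.Integrable g := by
  have h1 := integrable_rpow_neg_one_add_norm_sq (E := ℝ) (μ := MeasureTheory.volume) (r := 51/50)
    (by simp; norm_num)
  refine (h1.const_mul C).mono' hg.aestronglyMeasurable (Eventually.of_forall fun t => ?_)
  refine (h t).trans_eq ?_
  norm_num

/-- The integrated summatory function of `rho * rho`. -/
noncomputable def rhoConvInt (y : ℝ) : ℝ := ∑' n : ℕ, ((rho * rho) n : ℝ) * max (y - n) 0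

/-- The main term of `rhoConvInt`. -/
noncomputable def rhoConvMain (y : ℝ) : ℂ :=
  leadCoeff * (y ^ 2 * Real.log y : ℝ) + secondCoeff * (y ^ 2 - y : ℝ)

lemma hasMellin_indicator_Ioi {g : ℝ → ℂ} {w v : ℂ}
    (hi : MeasureTheory.IntegrableOn (fun t : ℝ => (t : ℂ) ^ (w - 1) * g t) (Set.Ioi 1))
    (hv : ∫ t in Set.Ioi (1:ℝ), (t : ℂ) ^ (w - 1) * g t = v) :
    HasMellin ((Set.Ioi (1:ℝ)).indicator g) w v := by
  have h : (fun t : ℝ => (t : ℂ) ^ (w - 1) • (Set.Ioi (1:ℝ)).indicator g t) =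
      (Set.Ioi (1:ℝ)).indicator fun t : ℝ => (t : ℂ) ^ (w - 1) * g t := by
    ext t
    by_cases ht : t ∈ Set.Ioi (1:ℝ) <;> simp [ht]
  have hs : Set.Ioi (0:ℝ) ∩ Set.Ioi 1 = Set.Ioi 1 :=
    Set.inter_eq_right.2 (Set.Ioi_subset_Ioi zero_le_one)
  constructor
  · rw [MellinConvergent, h]
    exact (MeasureTheory.integrable_indicator_iff measurableSet_Ioi |>.2 hi).integrableOn
  · rw [mellin, h, MeasureTheory.setIntegral_indicator measurableSet_Ioi, hs, hv]

lemma hasMellin_cpow_Ioi {w : ℂ} (k : ℕ) (hw : w.re + k < 0) :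
    HasMellin ((Set.Ioi (1:ℝ)).indicator fun t : ℝ => (t : ℂ) ^ k) w (-(w + k)⁻¹) := by
  have hk : (w - 1 + k).re < -1 := by simp; linarith
  have h : ∀ t ∈ Set.Ioi (1:ℝ), (t : ℂ) ^ (w - 1 + k) = (t : ℂ) ^ (w - 1) * (t : ℂ) ^ k :=
    fun t ht => by
      have ht0 : (t : ℂ) ≠ 0 := by exact_mod_cast (zero_lt_one.trans ht).ne'
      rw [cpow_add _ _ ht0, cpow_natCast]
  refine hasMellin_indicator_Ioi ((MeasureTheory.integrableOn_congr_fun h measurableSet_Ioi).1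
    (integrableOn_Ioi_cpow_of_lt hk one_pos)) ?_
  rw [← MeasureTheory.setIntegral_congr_fun measurableSet_Ioi h,
    integral_Ioi_cpow_of_lt hk one_pos]
  rw [show w - 1 + k + 1 = w + k by ring]
  simp [neg_div]

lemma hasMellin_sq_mul_log_Ioi {w : ℂ} (hw : w.re + 2 < 0) :
    HasMellin ((Set.Ioi (1:ℝ)).indicator fun t : ℝ => (t : ℂ) ^ 2 * (Real.log t : ℂ)) w
      (((w + 2) ^ 2)⁻¹) := by
  set c : ℂ := w + 2 with hc
  have hcre : c.re < 0 := by simpa [hc] using hw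
  have hc0 : c ≠ 0 := by rintro h; simp [h] at hcre
  have h : ∀ t ∈ Set.Ioi (1:ℝ), (Real.log t : ℂ) * (t : ℂ) ^ (c - 1) =
      (t : ℂ) ^ (w - 1) * ((t : ℂ) ^ 2 * (Real.log t : ℂ)) := fun t ht => by
    have ht0 : (t : ℂ) ≠ 0 := by exact_mod_cast (zero_lt_one.trans ht).ne'
    rw [show c - 1 = w - 1 + (2 : ℕ) by rw [hc]; push_cast; ring, cpow_add _ _ ht0, cpow_natCast]
    ring
  have hint : MeasureTheory.IntegrableOn (fun t : ℝ => (Real.log t : ℂ) * (t : ℂ) ^ (c - 1))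
      (Set.Ioi 1) := by
    have hlt : ((c - 1).re + -c.re / 2) < -1 := by simp; linarith
    refine ((integrableOn_Ioi_rpow_of_lt hlt one_pos).const_mul (1 / (-c.re / 2))).mono' ?_ ?_
    · refine ContinuousOn.aestronglyMeasurable (fun t ht => ?_) measurableSet_Ioi
      have ht0 : 0 < t := zero_lt_one.trans ht
      refine ContinuousAt.continuousWithinAt ?_
      exact (continuous_ofReal.continuousAt.comp (Real.continuousAt_log ht0.ne')).mul
        (continuousAt_ofReal_cpow_const _ _ (Or.inr ht0.ne'))
    · refine (MeasureTheory.ae_restrict_iff' measurableSet_Ioi).2 (Eventually.of_forall fun t ht => ?_)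
      have ht0 : 0 < t := zero_lt_one.trans ht
      have hl : 0 ≤ Real.log t := Real.log_nonneg (le_of_lt ht)
      rw [norm_mul, norm_cpow_eq_rpow_re_of_pos ht0, Complex.norm_of_nonneg hl, Real.rpow_add ht0]
      have := Real.log_le_rpow_div ht0.le (show 0 < -c.re / 2 by linarith)
      calc _ ≤ t ^ (-c.re / 2) / (-c.re / 2) * t ^ (c - 1).re := by gcongr
        _ = _ := by ring
  refine hasMellin_indicator_Ioi ((MeasureTheory.integrableOn_congr_fun h measurableSet_Ioi).1 hint) ?_
  rw [← MeasureTheory.setIntegral_congr_fun measurableSet_Ioi h]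
  have hd : ∀ t ∈ Set.Ici (1:ℝ), HasDerivAt
      (fun t : ℝ => (t : ℂ) ^ c * ((Real.log t : ℂ) / c - 1 / c ^ 2))
      ((Real.log t : ℂ) * (t : ℂ) ^ (c - 1)) t := fun t ht => by
    have ht0 : 0 < t := zero_lt_one.trans_le ht
    have ht0' : (t : ℂ) ≠ 0 := by exact_mod_cast ht0.ne'
    have d1 := hasDerivAt_ofReal_cpow_const' ht0.ne' (r := c - 1) (by simpa [sub_eq_neg_self] using hc0)
    have d2 := ((Real.hasDerivAt_log ht0.ne').ofReal_comp.div_const c).sub_const (1 / c ^ 2)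
    have d3 := (d1.mul_const c).mul d2
    have e : ∀ u : ℝ, (u : ℂ) ^ (c - 1 + 1) / (c - 1 + 1) * c = (u : ℂ) ^ c := fun u => by
      rw [sub_add_cancel]; field_simp
    have e2 : (t : ℂ) ^ c = t * (t : ℂ) ^ (c - 1) := by
      rw [cpow_sub _ _ ht0', cpow_one]; field_simp
    simp only [Pi.mul_def, e] at d3
    refine d3.congr_deriv ?_
    rw [e2]
    push_cast
    field_simp
    ring
  rw [MeasureTheory.integral_Ioi_of_hasDerivAt_of_tendsto' hd hint (m := 0)]
  · simp
  · have h1 : Tendsto (fun t : ℝ => t ^ c.re * Real.log t) atTop (nhds 0) := by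
      have := (isLittleO_log_rpow_atTop (show 0 < -c.re by linarith)).tendsto_div_nhds_zero
      refine this.congr' ?_
      filter_upwards [eventually_gt_atTop 0] with t ht
      rw [Real.rpow_neg ht.le, div_inv_eq_mul, mul_comm]
    have h2 : Tendsto (fun t : ℝ => t ^ c.re) atTop (nhds 0) := by
      have := tendsto_rpow_neg_atTop (show 0 < -c.re by linarith)
      simpa using this
    rw [tendsto_zero_iff_norm_tendsto_zero]
    refine squeeze_zero' (Eventually.of_forall fun _ => norm_nonneg _) ?_
      (by simpa using (h1.div_const ‖c‖).add (h2.div_const (‖c‖ ^ 2)))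
    filter_upwards [eventually_ge_atTop 1] with t ht
    have ht0 : 0 < t := by linarith
    rw [norm_mul, norm_cpow_eq_rpow_re_of_pos ht0]
    calc _ ≤ t ^ c.re * (Real.log t / ‖c‖ + 1 / ‖c‖ ^ 2) := by
          gcongr
          refine (norm_sub_le _ _).trans_eq ?_
          rw [norm_div, norm_div, norm_pow, norm_one, Complex.norm_of_nonneg (Real.log_nonneg ht)]
      _ = _ := by ring

lemma hasMellin_max_sub {w : ℂ} (hw : w.re < -1) {n : ℕ} (hn : n ≠ 0) :
    HasMellin (fun t : ℝ => ((max (t - n) 0 : ℝ) : ℂ)) w ((n : ℂ) ^ (w + 1) / (w * (w + 1))) := by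
  have h0 := hasMellin_cpow_Ioi (w := w) 0 (by simp; linarith)
  have h1 := hasMellin_cpow_Ioi (w := w) 1 (by simp; linarith)
  have h2 := hasMellin_sub h1.1 h0.1
  rw [h1.2, h0.2] at h2
  set f : ℝ → ℂ := fun t => (Set.Ioi (1:ℝ)).indicator (fun t : ℝ => (t : ℂ) ^ 1) t -
    (Set.Ioi (1:ℝ)).indicator (fun t : ℝ => (t : ℂ) ^ 0) t with hf
  have hn0 : (0:ℝ) < n := by exact_mod_cast Nat.pos_of_ne_zero hn
  have hinv : (0:ℝ) < (n:ℝ)⁻¹ := inv_pos.2 hn0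
  have e : (fun t : ℝ => ((max (t - n) 0 : ℝ) : ℂ)) =
      fun t : ℝ => (n : ℂ) • f ((n:ℝ)⁻¹ * t) := by
    ext t
    have hn0' : (n : ℂ) ≠ 0 := by exact_mod_cast hn
    by_cases ht : (n:ℝ) < t
    · have : (n:ℝ)⁻¹ * t ∈ Set.Ioi (1:ℝ) := by
        rw [Set.mem_Ioi, inv_mul_eq_div, one_lt_div hn0]; exact ht
      simp only [hf, Set.indicator_of_mem this]
      rw [max_eq_left (by linarith)]
      push_cast
      simp; field_simp
    · have : (n:ℝ)⁻¹ * t ∉ Set.Ioi (1:ℝ) := by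
        rw [Set.mem_Ioi, inv_mul_eq_div, one_lt_div hn0]; exact ht
      simp only [hf, Set.indicator_of_notMem this]
      rw [max_eq_right (by linarith)]
      simp
  have hc := (MellinConvergent.comp_mul_left (s := w) (f := f) hinv).2 h2.1
  rw [e]
  have h3 := hasMellin_const_smul hc (n : ℂ)
  refine ⟨h3.1, ?_⟩
  have hw0 : w ≠ 0 := by rintro rfl; simp at hw; linarith
  have hw1 : w + 1 ≠ 0 := by
    intro h; have := congrArg re h; simp at this; linarith
  rw [h3.2, mellin_comp_mul_left f w hinv, h2.2]
  have hn0' : (n : ℂ) ≠ 0 := by exact_mod_cast hn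
  rw [ofReal_inv, ofReal_natCast, inv_cpow _ _ (by rw [natCast_arg]; exact Real.pi_pos.ne),
    ← cpow_neg, neg_neg, cpow_add _ _ hn0', cpow_one]
  simp only [smul_eq_mul, Nat.cast_one, Nat.cast_zero, add_zero]
  field_simp
  ring

lemma hasMellin_rhoConvMain {w : ℂ} (hw : w.re < -2) :
    HasMellin (fun t : ℝ => rhoConvMain (max t 1)) w
      (leadCoeff / (w + 2) ^ 2 + secondCoeff / ((w + 1) * (w + 2))) := by
  have h1 := hasMellin_cpow_Ioi (w := w) 1 (by simp; linarith)
  have h2 := hasMellin_cpow_Ioi (w := w) 2 (by simp; linarith)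
  have h3 := hasMellin_sq_mul_log_Ioi (w := w) (by linarith)
  have h4 := hasMellin_sub h2.1 h1.1
  have h5 := hasMellin_const_smul h4.1 secondCoeff
  have h6 := hasMellin_const_smul h3.1 leadCoeff
  have h7 := hasMellin_add h6.1 h5.1
  rw [h6.2, h5.2, h3.2, h4.2, h1.2, h2.2] at h7
  convert h7 using 1
  · ext t
    by_cases ht : t ∈ Set.Ioi (1:ℝ)
    · simp only [Set.indicator_of_mem ht]
      rw [max_eq_left (le_of_lt ht), rhoConvMain]
      push_cast
      simp
    · simp only [Set.indicator_of_notMem ht]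
      rw [max_eq_right (not_lt.1 ht), rhoConvMain]
      simp
  · have hw0 : w + 2 ≠ 0 := by
      intro h; have := congrArg re h; simp at this; linarith
    have hw1 : w + 1 ≠ 0 := by
      intro h; have := congrArg re h; simp at this; linarith
    simp only [smul_eq_mul, Nat.cast_one, Nat.cast_ofNat]
    field_simp
    ring

lemma rho_mul_rho_nonneg (n : ℕ) : (0 : ℝ) ≤ ((rho * rho) n : ℝ) := by
  rw [ArithmeticFunction.mul_apply]
  exact_mod_cast Finset.sum_nonneg fun p _ => mul_nonneg (rho_nonneg _) (rho_nonneg _)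

lemma hasSum_rho_mul_rho {s : ℂ} (hs : 1 < s.re) :
    HasSum (fun n : ℕ => ((rho * rho) n : ℂ) * (n : ℂ) ^ (-s)) (zetaK s ^ 2) := by
  have h := ArithmeticFunction.LSeriesHasSum_mul (f := (rho : ArithmeticFunction ℂ))
    (g := (rho : ArithmeticFunction ℂ)) (by simpa using LSeriesHasSum_rho hs)
    (by simpa using LSeriesHasSum_rho hs)
  rw [sq]
  refine h.congr_fun fun n => ?_
  symm
  rw [LSeries.term_def]
  split_ifs with h0
  · simp [h0]
  · rw [cpow_neg, div_eq_mul_inv]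
    congr 1
    rw [← ArithmeticFunction.intCoe_mul]
    simp

lemma rhoConvInt_eq_sum {y : ℝ} {N : ℕ} (hy : y ≤ N) :
    rhoConvInt y = ∑ n ∈ Finset.Ioc 0 N, ((rho * rho) n : ℝ) * max (y - n) 0 := by
  refine tsum_eq_sum fun n hn => ?_
  rcases eq_or_ne n 0 with rfl | h0
  · simp
  · have : (N : ℝ) < n := by
      have : N < n := by simp at hn; omega
      exact_mod_cast this
    rw [max_eq_right (by linarith), mul_zero]

lemma continuous_rhoConvInt : Continuous rhoConvInt := by
  rw [continuous_iff_continuousAt]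
  intro y
  obtain ⟨N, hN⟩ := exists_nat_gt y
  have h : (fun z : ℝ => ∑ n ∈ Finset.Ioc 0 N, ((rho * rho) n : ℝ) * max (z - n) 0) =ᶠ[nhds y]
      rhoConvInt := by
    filter_upwards [Iio_mem_nhds hN] with z hz using (rhoConvInt_eq_sum (le_of_lt hz)).symm
  refine ContinuousAt.congr ?_ h
  fun_prop

lemma integrable_tsum_of_summable_integral_norm {α : Type*} [MeasurableSpace α]
    {μ : MeasureTheory.Measure α} {F : ℕ → α → ℂ} (hF : ∀ n, MeasureTheory.Integrable (F n) μ)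
    (hs : Summable fun n => ∫ a, ‖F n a‖ ∂μ)
    (hm : MeasureTheory.AEStronglyMeasurable (fun a => ∑' n, F n a) μ) :
    MeasureTheory.Integrable (fun a => ∑' n, F n a) μ := by
  refine ⟨hm, ?_⟩
  calc ∫⁻ a, ‖∑' n, F n a‖ₑ ∂μ ≤ ∫⁻ a, ∑' n, ‖F n a‖ₑ ∂μ :=
        MeasureTheory.lintegral_mono fun a => enorm_tsum_le_tsum_enorm
    _ = ∑' n, ∫⁻ a, ‖F n a‖ₑ ∂μ := MeasureTheory.lintegral_tsum fun n => (hF n).1.enorm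
    _ = ∑' n, ENNReal.ofReal (∫ a, ‖F n a‖ ∂μ) := by
        congr with n
        exact (MeasureTheory.ofReal_integral_norm_eq_lintegral_enorm (hF n)).symm
    _ < ⊤ := hs.tsum_ofReal_lt_top

lemma hasMellin_rhoConvInt {s : ℂ} (hs : 1 < s.re) :
    HasMellin (fun t => (rhoConvInt t : ℂ)) (-s - 1) (zetaK s ^ 2 / (s * (s + 1))) := by
  have hsre : (-s - 1).re < -1 := by simp; linarith
  have hw : ∀ n : ℕ, HasMellin (fun t : ℝ => (((rho * rho) n : ℝ) : ℂ) * ((max (t - n) 0 : ℝ) : ℂ))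
      (-s - 1) ((((rho * rho) n : ℝ) : ℂ) * ((n : ℂ) ^ (-s) / (s * (s + 1)))) := fun n => by
    rcases eq_or_ne n 0 with rfl | hn
    · refine ⟨?_, ?_⟩
      · simp [MellinConvergent]
      · simp [mellin]
    · have h1 := hasMellin_max_sub hsre hn
      have h2 := hasMellin_const_smul h1.1 (((rho * rho) n : ℝ) : ℂ)
      rw [h1.2] at h2
      refine ⟨h2.1, h2.2.trans ?_⟩
      rw [smul_eq_mul, sub_add_cancel]
      congr 2
      ring
  set σ : ℂ := (s.re : ℂ) with hσ
  have hσre : 1 < σ.re := by simpa [hσ] using hs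
  have hσre' : (-σ - 1).re < -1 := by simp [hσ]; linarith
  have hnorm : ∀ n : ℕ, ∫ t in Set.Ioi (0:ℝ), ‖(t : ℂ) ^ (-s - 1 - 1) •
      ((((rho * rho) n : ℝ) : ℂ) * ((max (t - n) 0 : ℝ) : ℂ))‖ =
      ‖((rho * rho) n : ℂ) * (n : ℂ) ^ (-s)‖ * ‖1 / (σ * (σ + 1))‖ := fun n => by
    rcases eq_or_ne n 0 with rfl | hn
    · simp
    · have h1 := (hasMellin_max_sub hσre' hn).2
      have h2 : ((∫ t in Set.Ioi (0:ℝ), t ^ (-s.re - 1 - 1) * max (t - n) 0 : ℝ) : ℂ) =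
          mellin (fun t : ℝ => ((max (t - n) 0 : ℝ) : ℂ)) (-σ - 1) := by
        rw [mellin, ← integral_complex_ofReal]
        refine MeasureTheory.setIntegral_congr_fun measurableSet_Ioi fun t ht => ?_
        have ht0 : 0 ≤ t := le_of_lt ht
        simp only [hσ, smul_eq_mul]
        push_cast [ofReal_cpow ht0]
        rfl
      have h3 : 0 ≤ ∫ t in Set.Ioi (0:ℝ), t ^ (-s.re - 1 - 1) * max (t - n) 0 :=
        MeasureTheory.setIntegral_nonneg measurableSet_Ioi fun t ht =>
          mul_nonneg (Real.rpow_nonneg (le_of_lt ht) _) (le_max_right _ _)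
      have h4 := congrArg norm (h2.trans h1)
      rw [Complex.norm_of_nonneg h3, sub_add_cancel] at h4
      have h5 : ‖(n : ℂ) ^ (-s)‖ = ‖(n : ℂ) ^ (-σ)‖ := by
        rw [norm_natCast_cpow_of_pos (Nat.pos_of_ne_zero hn),
          norm_natCast_cpow_of_pos (Nat.pos_of_ne_zero hn)]
        simp [hσ]
      have h6 : ∀ t ∈ Set.Ioi (0:ℝ), ‖(t : ℂ) ^ (-s - 1 - 1) •
          ((((rho * rho) n : ℝ) : ℂ) * ((max (t - n) 0 : ℝ) : ℂ))‖ =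
          ((rho * rho) n : ℝ) * (t ^ (-s.re - 1 - 1) * max (t - n) 0) := fun t ht => by
        rw [norm_smul, norm_mul, norm_cpow_eq_rpow_re_of_pos ht,
          Complex.norm_of_nonneg (rho_mul_rho_nonneg n), Complex.norm_of_nonneg (le_max_right _ _)]
        simp only [sub_re, neg_re, one_re]
        ring
      rw [MeasureTheory.setIntegral_congr_fun measurableSet_Ioi h6,
        MeasureTheory.integral_const_mul, h4, norm_mul, h5]
      have h7 : -σ - 1 = -(σ + 1) := by ring
      rw [norm_div, norm_mul, norm_div, norm_mul, h7, norm_neg, norm_neg, norm_one,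
        norm_intCast, abs_of_nonneg (rho_mul_rho_nonneg n)]
      ring
  have hsum := hasSum_rho_mul_rho hs
  have key := MeasureTheory.hasSum_integral_of_summable_integral_norm
    (μ := MeasureTheory.volume.restrict (Set.Ioi (0:ℝ)))
    (F := fun n (t:ℝ) => (t : ℂ) ^ (-s - 1 - 1) •
      ((((rho * rho) n : ℝ) : ℂ) * ((max (t - n) 0 : ℝ) : ℂ))) (fun n => (hw n).1)
    ((hsum.summable.norm.mul_right _).congr fun n => (hnorm n).symm)
  have e : ∀ t : ℝ, ∑' n : ℕ, (t : ℂ) ^ (-s - 1 - 1) •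
      ((((rho * rho) n : ℝ) : ℂ) * ((max (t - n) 0 : ℝ) : ℂ)) =
      (t : ℂ) ^ (-s - 1 - 1) • (rhoConvInt t : ℂ) := fun t => by
    simp_rw [smul_eq_mul]
    rw [tsum_mul_left, rhoConvInt, ofReal_tsum]
    push_cast
    rfl
  have hmeas : MeasureTheory.AEStronglyMeasurable
      (fun t : ℝ => (t : ℂ) ^ (-s - 1 - 1) • (rhoConvInt t : ℂ))
      (MeasureTheory.volume.restrict (Set.Ioi (0:ℝ))) := by
    refine ContinuousOn.aestronglyMeasurable (fun t ht => ?_) measurableSet_Ioi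
    refine ContinuousAt.continuousWithinAt ?_
    exact (continuousAt_ofReal_cpow_const _ _ (Or.inr (ne_of_gt ht))).smul
      (continuous_ofReal.comp continuous_rhoConvInt).continuousAt
  have hint := integrable_tsum_of_summable_integral_norm
    (μ := MeasureTheory.volume.restrict (Set.Ioi (0:ℝ)))
    (F := fun n (t:ℝ) => (t : ℂ) ^ (-s - 1 - 1) •
      ((((rho * rho) n : ℝ) : ℂ) * ((max (t - n) 0 : ℝ) : ℂ))) (fun n => (hw n).1)
    ((hsum.summable.norm.mul_right _).congr fun n => (hnorm n).symm) (by simp_rw [e]; exact hmeas)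
  simp_rw [e] at key hint
  refine ⟨hint, key.unique ?_⟩
  have h1 := hsum.mul_right (1 / (s * (s + 1)))
  rw [mul_one_div] at h1
  refine h1.congr_fun fun n => ?_
  refine ((hw n).2).trans ?_
  push_cast; ring

lemma continuous_rhoConvMain_max : Continuous fun t : ℝ => rhoConvMain (max t 1) := by
  have h : Continuous fun t : ℝ => Real.log (max t 1) :=
    Continuous.log (by fun_prop) fun t => (zero_lt_one.trans_le (le_max_right _ _)).ne'
  unfold rhoConvMain
  fun_prop

lemma integrable_mellinRemainder_line {σ : ℝ} (h1 : 1 / 2 ≤ σ) (h2 : σ ≤ 2) :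
    MeasureTheory.Integrable fun t : ℝ => mellinRemainder (σ + t * I) := by
  obtain ⟨C, -, hC⟩ := exists_norm_mellinRemainder_le
  exact integrable_of_norm_le_rpow (continuous_mellinRemainder_line (by linarith))
    fun t => hC σ t h1 h2

lemma integral_mellinRemainder_two {y : ℝ} (hy : 0 < y) :
    (rhoConvInt y : ℂ) - rhoConvMain (max y 1) = ((1 / (2 * Real.pi) : ℝ) : ℂ) *
      ∫ t : ℝ, (y : ℂ) ^ ((2:ℝ) + t * I + 1 : ℂ) * mellinRemainder ((2:ℝ) + t * I) := by
  set G : ℝ → ℂ := fun t => (rhoConvInt t : ℂ) - rhoConvMain (max t 1) with hG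
  have hm : ∀ t : ℝ, HasMellin G (((-3:ℝ):ℂ) + t * I) (mellinRemainder ((2:ℝ) + (-t:ℝ) * I)) := fun t => by
    set s : ℂ := (2:ℝ) + (-t:ℝ) * I with hs
    have hsre : s.re = 2 := by simp [hs]
    have h1 := hasMellin_rhoConvInt (s := s) (by rw [hsre]; norm_num)
    have h2 := hasMellin_rhoConvMain (w := -s - 1) (by simp [hsre])
    have h3 := hasMellin_sub h1.1 h2.1
    have h0 : s ≠ 0 := by intro h; rw [h] at hsre; simp at hsre
    have hs1 : s ≠ 1 := by intro h; rw [h] at hsre; simp at hsre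
    have e : -s - 1 = ((-3:ℝ):ℂ) + t * I := by rw [hs]; push_cast; ring
    rw [h1.2, h2.2, e] at h3
    refine ⟨h3.1, h3.2.trans ?_⟩
    rw [mellinRemainder_eq h0 hs1, ← e]
    have : s - 1 ≠ 0 := sub_ne_zero.2 hs1
    have e1 : -s - 1 + 2 = -(s - 1) := by ring
    have e2 : -s - 1 + 1 = -s := by ring
    rw [e1, e2, neg_mul_neg, neg_sq]
    ring
  have hint := integrable_mellinRemainder_line (σ := 2) (by norm_num) le_rfl
  have h := mellinInv_mellin_eq (-3) G hy (by simpa using (hm 0).1)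
    (by
      unfold VerticalIntegrable
      simp_rw [(hm _).2]
      exact hint.comp_neg)
    ((continuous_ofReal.comp continuous_rhoConvInt).sub continuous_rhoConvMain_max).continuousAt
  have h2 : G y = (rhoConvInt y : ℂ) - rhoConvMain (max y 1) := rfl
  rw [← h2, ← h, mellinInv, real_smul]
  congr 1
  simp_rw [(hm _).2]
  rw [← MeasureTheory.integral_neg_eq_self]
  congr with t
  rw [smul_eq_mul]
  congr 2
  push_cast
  ring
  congr 1
  push_cast
  ring

lemma integral_mellinRemainder_shift {y : ℝ} (hy : 0 < y) :
    ∫ t : ℝ, (y : ℂ) ^ ((2:ℝ) + t * I + 1 : ℂ) * mellinRemainder ((2:ℝ) + t * I) =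
      ∫ t : ℝ, (y : ℂ) ^ (((1/2:ℝ):ℂ) + t * I + 1 : ℂ) * mellinRemainder (((1/2:ℝ):ℂ) + t * I) := by
  have hy' : (y : ℂ) ≠ 0 := by exact_mod_cast hy.ne'
  set F : ℂ → ℂ := fun s => (y : ℂ) ^ (s + 1) * mellinRemainder s with hF
  have hdiff : DifferentiableOn ℂ F {s | 0 < s.re} := by
    refine DifferentiableOn.mul ?_ differentiableOn_mellinRemainder
    exact fun s _ => ((differentiableAt_id.add_const 1).const_cpow (Or.inl hy')).differentiableWithinAt
  have hnorm : ∀ σ t : ℝ, ‖F (σ + t * I)‖ = y ^ (σ + 1) * ‖mellinRemainder (σ + t * I)‖ := fun σ t => by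
    rw [hF]; simp only
    rw [norm_mul, norm_cpow_eq_rpow_re_of_pos hy]
    simp
  have hint : ∀ σ : ℝ, 1 / 2 ≤ σ → σ ≤ 2 → MeasureTheory.Integrable fun t : ℝ => F (σ + t * I) :=
    fun σ h1 h2 => by
      refine (integrable_mellinRemainder_line h1 h2).norm.const_mul (y ^ (σ + 1)) |>.mono' ?_ ?_
      · have hc : Continuous fun t : ℝ => F (σ + t * I) := by
          refine Continuous.mul ?_ (continuous_mellinRemainder_line (by linarith))
          exact Continuous.const_cpow (by fun_prop) (Or.inl hy')
        exact hc.aestronglyMeasurable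
      · exact Eventually.of_forall fun t => (hnorm σ t).le
  obtain ⟨C, hC, hb⟩ := exists_norm_mellinRemainder_le
  set Y := max (y ^ (3:ℝ)) (y ^ (3/2:ℝ)) with hY
  have hYb : ∀ σ : ℝ, 1/2 ≤ σ → σ ≤ 2 → y ^ (σ + 1) ≤ Y := fun σ h1 h2 => by
    rcases le_total 1 y with h | h
    · exact (Real.rpow_le_rpow_of_exponent_le h (by linarith)).trans (le_max_left _ _)
    · exact (Real.rpow_le_rpow_of_exponent_ge hy h (by linarith)).trans (le_max_right _ _)
  have hdecay : Tendsto (fun T : ℝ => (1 + T ^ 2) ^ (-(51/100):ℝ)) atTop (nhds 0) := by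
    refine (tendsto_rpow_neg_atTop (by norm_num : (0:ℝ) < 51/100)).comp ?_
    exact tendsto_atTop_add_const_left _ _ (tendsto_pow_atTop two_ne_zero)
  have hor : ∀ ε : ℝ, ε ^ 2 = 1 →
      Tendsto (fun T : ℝ => ∫ x in (1/2:ℝ)..2, F (x + (ε * T : ℝ) * I)) atTop (nhds 0) :=
    fun ε hε => by
      rw [tendsto_zero_iff_norm_tendsto_zero]
      refine squeeze_zero (fun _ => norm_nonneg _) (fun T => ?_)
        (by simpa using hdecay.const_mul (Y * C * |2 - 1/2|))
      refine (intervalIntegral.norm_integral_le_of_norm_le_const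
        (C := Y * (C * (1 + T ^ 2) ^ (-(51/100):ℝ))) fun x hx => ?_).trans_eq (by ring)
      rw [Set.uIoc_of_le (by norm_num)] at hx
      rw [hnorm]
      have h1 := hb x (ε * T) hx.1.le hx.2
      rw [mul_pow, hε, one_mul] at h1
      exact mul_le_mul (hYb x hx.1.le hx.2) h1 (norm_nonneg _)
        (le_trans (by positivity) (le_max_left _ _))
  have vert : ∀ σ : ℝ, 1/2 ≤ σ → σ ≤ 2 → Tendsto (fun T : ℝ => ∫ t in (-T)..T, F (σ + t * I)) atTop
      (nhds (∫ t : ℝ, F (σ + t * I))) := fun σ h1 h2 =>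
    MeasureTheory.intervalIntegral_tendsto_integral (hint σ h1 h2) tendsto_neg_atTop_atBot tendsto_id
  have rect : ∀ T : ℝ, (∫ x in (1/2:ℝ)..2, F (x + (-1 * T : ℝ) * I)) -
      (∫ x in (1/2:ℝ)..2, F (x + (1 * T : ℝ) * I)) + I • (∫ t in (-T)..T, F ((2:ℝ) + t * I)) -
      I • (∫ t in (-T)..T, F ((1/2:ℝ) + t * I)) = 0 := fun T => by
    have := integral_boundary_rect_eq_zero_of_differentiableOn F ⟨1/2, -T⟩ ⟨2, T⟩
      (hdiff.mono fun s hs => by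
        have h := (mem_reProdIm.1 hs).1
        simp only [Set.uIcc_of_le (show (1/2:ℝ) ≤ 2 by norm_num)] at h
        simp only [Set.mem_ofPred_eq]; linarith [h.1])
    simpa using this
  have lim := (((hor (-1) (by norm_num)).sub (hor 1 (by norm_num))).add
    ((vert 2 (by norm_num) le_rfl).const_smul I)).sub ((vert (1/2) le_rfl (by norm_num)).const_smul I)
  have h0 := tendsto_nhds_unique (lim.congr rect) tendsto_const_nhds
  rw [sub_self, zero_add, ← smul_sub, smul_eq_zero, sub_eq_zero] at h0
  exact h0.resolve_left I_ne_zero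

lemma rhoConvInt_eq {y : ℝ} (hy : 0 < y) :
    (rhoConvInt y : ℂ) = rhoConvMain (max y 1) + ((1 / (2 * Real.pi) : ℝ) : ℂ) *
      ∫ t : ℝ, (y : ℂ) ^ (3 / 2 + t * I : ℂ) * mellinRemainder (1 / 2 + t * I) := by
  rw [← sub_eq_iff_eq_add', integral_mellinRemainder_two hy, integral_mellinRemainder_shift hy]
  congr 2
  ext t
  push_cast
  congr 2
  ring

/-- The multiplicative function `n ↦ n ^ σ` for a real exponent `σ`. -/
noncomputable def rpowArith (σ : ℝ) : ArithmeticFunction ℝ :=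
  ⟨fun n => if n = 0 then 0 else (n : ℝ) ^ σ, by simp⟩

lemma rpowArith_apply {σ : ℝ} {n : ℕ} (hn : n ≠ 0) : rpowArith σ n = (n : ℝ) ^ σ := by
  simp [rpowArith, hn]

lemma isMultiplicative_rpowArith (σ : ℝ) : (rpowArith σ).IsMultiplicative := by
  rw [ArithmeticFunction.IsMultiplicative.iff_ne_zero]
  refine ⟨by simp [rpowArith], fun {m n} hm hn _ => ?_⟩
  rw [rpowArith_apply hm, rpowArith_apply hn, rpowArith_apply (mul_ne_zero hm hn), Nat.cast_mul,
    Real.mul_rpow (by positivity) (by positivity)]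

lemma prod_one_add_rpow_eq (σ : ℝ) (P : ℕ) :
    ∏ p ∈ Nat.primesLE P, (1 + (p : ℝ) ^ σ) = ∑ a ∈ (primorial P).divisors, (a : ℝ) ^ σ := by
  have := (isMultiplicative_rpowArith σ).prodPrimeFactors_one_add_of_squarefree
    (squarefree_primorial P)
  rw [primeFactors_primorial] at this
  calc _ = ∏ p ∈ Nat.primesLE P, (1 + rpowArith σ p) := Finset.prod_congr rfl fun p hp => by
        rw [rpowArith_apply (Nat.prime_of_mem_primesLE hp).ne_zero]
    _ = _ := this
    _ = _ := Finset.sum_congr rfl fun a ha => rpowArith_apply (Nat.pos_of_mem_divisors ha).ne'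

lemma sum_log_div_le (P : ℕ) :
    ∑ p ∈ Nat.primesLE P, Real.log p * (p : ℝ)⁻¹ ≤ Real.log 4 * (1 + Real.log P) := by
  rw [Nat.primesLE_eq_filter_Ioc_zero, Finset.sum_filter]
  have h := sum_mul_le_sum_mul_of_antitone (a := fun p => if p.Prime then Real.log p else 0)
    (b := fun _ => Real.log 4) (φ := fun n => (n : ℝ)⁻¹) ?_ ?_ ?_ P
  · calc _ = ∑ n ∈ Finset.Ioc 0 P, (if n.Prime then Real.log n else 0) * (n : ℝ)⁻¹ :=
          Finset.sum_congr rfl fun n _ => by split_ifs <;> simp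
      _ ≤ ∑ n ∈ Finset.Ioc 0 P, Real.log 4 * (n : ℝ)⁻¹ := h
      _ ≤ _ := by
          rw [← Finset.mul_sum]
          exact mul_le_mul_of_nonneg_left (sum_inv_le_one_add_log P)
            (Real.log_nonneg (by norm_num))
  · intro N
    have := Chebyshev.theta_le_log4_mul_x (x := N) (by positivity)
    rw [Chebyshev.theta_eq_sum_primesLE_log, Nat.primesLE_eq_filter_Ioc_zero,
      Finset.sum_filter] at this
    simpa [mul_comm] using this
  · intro n hn
    have : (0:ℝ) < n := by exact_mod_cast hn
    gcongr
    simp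
  · intro n _
    positivity

lemma exp_le_one_add_two_mul {x : ℝ} (h0 : 0 ≤ x) (h1 : x ≤ 1) : Real.exp x ≤ 1 + 2 * x := by
  have := Real.abs_exp_sub_one_le (x := x) (by rwa [abs_of_nonneg h0])
  rw [abs_of_nonneg h0] at this
  linarith [(abs_le.1 this).2]

/-- A Mertens-type bound for the reciprocals of the squarefree `P`-smooth numbers. -/
lemma sum_inv_divisors_primorial_le {P : ℕ} (hP : 2 ≤ P) :
    ∑ a ∈ (primorial P).divisors, (a : ℝ)⁻¹ ≤ 20 * Real.log P := by
  set S := ∑ a ∈ (primorial P).divisors, (a : ℝ)⁻¹ with hS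
  have hP2 : (2:ℝ) ≤ P := by exact_mod_cast hP
  have hl2 : Real.log 2 ≤ Real.log P := Real.log_le_log (by norm_num) hP2
  have hl2' := Real.log_two_gt_d9
  have hl2'' := Real.log_two_lt_d9
  have hl : 0 < Real.log P := by linarith
  set δ := (Real.log P)⁻¹ with hδ
  have hδ0 : 0 < δ := by positivity
  have hrankin : ∑ a ∈ (primorial P).divisors, (a : ℝ) ^ (δ - 1) ≤ S * Real.exp 7 := by
    have hSprod : S = ∏ p ∈ Nat.primesLE P, (1 + (p : ℝ) ^ (-1:ℝ)) := by
      rw [prod_one_add_rpow_eq, hS]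
      simp_rw [Real.rpow_neg_one]
    rw [← prod_one_add_rpow_eq, hSprod]
    have h7 : ∏ p ∈ Nat.primesLE P, Real.exp (2 * δ * (Real.log p * (p : ℝ)⁻¹)) ≤ Real.exp 7 := by
      rw [← Real.exp_sum, Real.exp_le_exp, ← Finset.mul_sum]
      have h4 : Real.log 4 = 2 * Real.log 2 := by
        rw [show (4:ℝ) = 2 ^ 2 by norm_num, Real.log_pow]; norm_num
      calc _ ≤ 2 * δ * (Real.log 4 * (1 + Real.log P)) :=
            mul_le_mul_of_nonneg_left (sum_log_div_le P) (by positivity)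
        _ = (4 * Real.log 2 * (1 + Real.log P)) / Real.log P := by
            rw [h4, hδ]; field_simp; norm_num
        _ ≤ 7 := by
            rw [div_le_iff₀ hl]
            nlinarith
    refine le_trans ?_ (mul_le_mul_of_nonneg_left h7 (Finset.prod_nonneg fun p _ => by positivity))
    rw [← Finset.prod_mul_distrib]
    refine Finset.prod_le_prod (fun p _ => by positivity) fun p hp => ?_
    have hp1 := Nat.two_le_of_mem_primesLE hp
    have hp2 : (2:ℝ) ≤ p := by exact_mod_cast hp1
    have hpP : (p:ℝ) ≤ P := by exact_mod_cast Nat.le_of_mem_primesLE hp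
    have hp0 : (0:ℝ) < p := by linarith
    have hlp : 0 ≤ Real.log p := Real.log_nonneg (by linarith)
    have hpd : (p:ℝ) ^ δ ≤ 1 + 2 * (δ * Real.log p) := by
      rw [Real.rpow_def_of_pos hp0, mul_comm]
      refine exp_le_one_add_two_mul (by positivity) ?_
      rw [hδ, inv_mul_le_iff₀ hl, mul_one]
      exact Real.log_le_log hp0 hpP
    set y := 2 * δ * (Real.log p * (p : ℝ)⁻¹) with hy
    have hy0 : 0 ≤ y := by positivity
    calc 1 + (p:ℝ) ^ (δ - 1) = 1 + (p:ℝ) ^ δ * (p:ℝ)⁻¹ := by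
          rw [Real.rpow_sub_one hp0.ne', div_eq_mul_inv]
      _ ≤ 1 + (1 + 2 * (δ * Real.log p)) * (p:ℝ)⁻¹ := by gcongr
      _ = 1 + (p:ℝ) ^ (-1:ℝ) + y := by rw [Real.rpow_neg_one, hy]; ring
      _ ≤ (1 + (p:ℝ) ^ (-1:ℝ)) * (1 + y) := by
          nlinarith [mul_nonneg (Real.rpow_nonneg hp0.le (-1:ℝ)) hy0]
      _ ≤ _ := by
          gcongr
          rw [add_comm]; exact Real.add_one_le_exp y
  have hsplit : ∀ a ∈ (primorial P).divisors, (a : ℝ)⁻¹ ≤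
      (if a ∈ Finset.Ioc 0 (P ^ 8) then (a : ℝ)⁻¹ else 0) + Real.exp (-8) * (a : ℝ) ^ (δ - 1) := by
    intro a ha
    have ha0 : (0:ℝ) < a := by exact_mod_cast Nat.pos_of_mem_divisors ha
    split_ifs with h
    · have : 0 < Real.exp (-8) * (a : ℝ) ^ (δ - 1) := by positivity
      linarith
    · have h8 : (P:ℝ) ^ 8 ≤ a := by
        rw [Finset.mem_Ioc, not_and, not_le] at h
        exact_mod_cast (h (Nat.pos_of_mem_divisors ha)).le
      have : Real.exp 8 ≤ (a:ℝ) ^ δ := by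
        rw [Real.rpow_def_of_pos ha0, Real.exp_le_exp, hδ, le_mul_inv_iff₀ hl]
        calc 8 * Real.log P = Real.log (P ^ 8) := by rw [Real.log_pow]; norm_num
          _ ≤ _ := Real.log_le_log (by positivity) h8
      rw [zero_add, Real.rpow_sub_one ha0.ne', Real.exp_neg, div_eq_mul_inv, ← mul_assoc]
      refine le_mul_of_one_le_left (by positivity) ?_
      rwa [one_le_inv_mul₀ (Real.exp_pos _)]
  have h1 : S ≤ (1 + 8 * Real.log P) + Real.exp (-8) * (S * Real.exp 7) := by
    refine (Finset.sum_le_sum hsplit).trans ?_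
    rw [Finset.sum_add_distrib, ← Finset.mul_sum]
    refine add_le_add ?_ (mul_le_mul_of_nonneg_left hrankin (Real.exp_pos _).le)
    rw [← Finset.sum_filter]
    have := sum_inv_le_one_add_log (P ^ 8)
    rw [Nat.cast_pow, Real.log_pow] at this
    refine (Finset.sum_le_sum_of_subset_of_nonneg ?_ fun _ _ _ => by positivity).trans this
    exact fun a ha => (Finset.mem_filter.1 ha).2
  have h2 : Real.exp (-8) * (S * Real.exp 7) = S * Real.exp (-1) := by
    rw [mul_left_comm, ← Real.exp_add]; norm_num
  have h3 : Real.exp (-1) ≤ 1 / 2 := by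
    rw [Real.exp_neg, one_div]
    exact inv_anti₀ (by norm_num) (by linarith [Real.add_one_le_exp 1])
  have hS0 : 0 ≤ S := Finset.sum_nonneg fun _ _ => by positivity
  rw [h2] at h1
  nlinarith

lemma norm_integral_exp_le {c : ℝ} (hc : c ≠ 0) (A B : ℝ) :
    ‖∫ t in A..B, cexp (c * I * t)‖ ≤ 2 / |c| := by
  have hc' : (c * I : ℂ) ≠ 0 := by simp [hc]
  rw [integral_exp_mul_complex hc', norm_div, norm_mul, norm_I, mul_one, norm_real, Real.norm_eq_abs]
  gcongr
  refine (norm_sub_le _ _).trans ?_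
  have h (x : ℝ) : ‖cexp (c * I * x)‖ = 1 := by
    rw [mul_right_comm, ← ofReal_mul, norm_exp_ofReal_mul_I]
  rw [h, h]; norm_num

lemma integral_norm_sq_trigSum_le (S : Finset ℕ) (b : ℕ → ℂ) (l : ℕ → ℝ) {A B : ℝ} (hAB : A ≤ B)
    (K : ℕ → ℕ → ℝ) (hK : ∀ n m, 0 ≤ K n m) (hsymm : ∀ n m, K n m = K m n)
    (hd : ∀ n, K n n = B - A)
    (ho : ∀ n ∈ S, ∀ m ∈ S, n ≠ m → l n ≠ l m ∧ 2 / |l n - l m| ≤ K n m) :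
    ∫ t in A..B, ‖∑ n ∈ S, b n * cexp (l n * I * t)‖ ^ 2 ≤
      ∑ n ∈ S, ‖b n‖ ^ 2 * ∑ m ∈ S, K n m := by
  have e : ∀ t : ℝ, ((‖∑ n ∈ S, b n * cexp (l n * I * t)‖ ^ 2 : ℝ) : ℂ) =
      ∑ n ∈ S, ∑ m ∈ S, b n * (starRingEnd ℂ) (b m) * cexp ((l n - l m : ℝ) * I * t) := fun t => by
    rw [← normSq_eq_norm_sq, ← mul_conj, map_sum, Finset.sum_mul_sum]
    refine Finset.sum_congr rfl fun n _ => Finset.sum_congr rfl fun m _ => ?_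
    rw [map_mul, ← exp_conj, mul_mul_mul_comm, ← Complex.exp_add]
    congr 2
    simp only [map_mul, conj_ofReal, conj_I]
    push_cast
    ring
  have h1 : ((∫ t in A..B, ‖∑ n ∈ S, b n * cexp (l n * I * t)‖ ^ 2 : ℝ) : ℂ) =
      ∑ n ∈ S, ∑ m ∈ S, b n * (starRingEnd ℂ) (b m) *
        ∫ t in A..B, cexp ((l n - l m : ℝ) * I * t) := by
    rw [← intervalIntegral.integral_ofReal]
    simp_rw [e]
    have hc (x : ℝ) : Continuous fun t : ℝ => cexp (x * I * t) := by fun_prop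
    rw [intervalIntegral.integral_finsetSum fun n _ => Continuous.intervalIntegrable
      (continuous_finsetSum _ fun m _ => (hc _).const_mul _) _ _]
    refine Finset.sum_congr rfl fun n _ => ?_
    rw [intervalIntegral.integral_finsetSum fun m _ => ((hc _).const_mul _).intervalIntegrable _ _]
    exact Finset.sum_congr rfl fun m _ => intervalIntegral.integral_const_mul _ _
  refine le_trans ?_ (sum_sum_mul_le_of_symm S (fun n => ‖b n‖) K hK hsymm)
  refine (le_abs_self _).trans ?_
  rw [← Real.norm_eq_abs, ← Complex.norm_real, h1]
  refine (norm_sum_le _ _).trans (Finset.sum_le_sum fun n hn => (norm_sum_le _ _).trans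
    (Finset.sum_le_sum fun m hm => ?_))
  rw [norm_mul, norm_mul, RCLike.norm_conj]
  refine mul_le_mul_of_nonneg_left ?_ (by positivity)
  by_cases h : n = m
  · subst h
    rw [hd]
    simp only [sub_self, ofReal_zero, zero_mul, Complex.exp_zero, intervalIntegral.integral_const]
    rw [norm_smul, norm_one, mul_one, Real.norm_of_nonneg (sub_nonneg.2 hAB)]
  · obtain ⟨h1, h2⟩ := ho n hn m hm h
    exact (norm_integral_exp_le (sub_ne_zero.2 h1) A B).trans h2

lemma sum_inv_abs_sub_le (n N : ℕ) (hn : n ∈ Finset.Ioc 0 N) :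
    ∑ m ∈ Finset.Ioc 0 N, (if n = m then (0:ℝ) else |(n:ℝ) - m|⁻¹) ≤ 2 * (1 + Real.log N) := by
  have h1 : ∀ m ∈ Finset.Ioc 0 N, (if n = m then (0:ℝ) else |(n:ℝ) - m|⁻¹) ≤
      ∑ k ∈ Finset.Ioc 0 N, (k:ℝ)⁻¹ * ((if m = n + k then 1 else 0) + if m + k = n then 1 else 0) := by
    intro m hm
    have hnn : ∀ k ∈ Finset.Ioc 0 N, (0:ℝ) ≤
        (k:ℝ)⁻¹ * ((if m = n + k then 1 else 0) + if m + k = n then 1 else 0) := by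
      intro k _; positivity
    rw [Finset.mem_Ioc] at hm hn
    rcases lt_trichotomy n m with h | h | h
    · rw [if_neg h.ne]
      refine le_trans ?_ (Finset.single_le_sum hnn (Finset.mem_Ioc.2 (⟨by omega, by omega⟩ :
        0 < m - n ∧ m - n ≤ N)))
      rw [if_pos (by omega), if_neg (by omega), Nat.cast_sub h.le, abs_sub_comm, abs_of_pos
        (sub_pos.2 (by exact_mod_cast h))]
      simp
    · rw [if_pos h]; exact Finset.sum_nonneg hnn
    · rw [if_neg h.ne']
      refine le_trans ?_ (Finset.single_le_sum hnn (Finset.mem_Ioc.2 (⟨by omega, by omega⟩ :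
        0 < n - m ∧ n - m ≤ N)))
      rw [if_neg (by omega), if_pos (by omega), Nat.cast_sub h.le, abs_of_pos
        (sub_pos.2 (by exact_mod_cast h))]
      simp
  refine (Finset.sum_le_sum h1).trans ?_
  rw [Finset.sum_comm]
  have h2 : ∀ k ∈ Finset.Ioc 0 N, ∑ m ∈ Finset.Ioc 0 N,
      (k:ℝ)⁻¹ * ((if m = n + k then 1 else 0) + if m + k = n then 1 else 0) ≤ 2 * (k:ℝ)⁻¹ := by
    intro k _
    rw [← Finset.mul_sum, mul_comm, Finset.sum_add_distrib]
    refine mul_le_mul_of_nonneg_right ?_ (by positivity)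
    have e1 : ∑ m ∈ Finset.Ioc 0 N, (if m = n + k then (1:ℝ) else 0) ≤ 1 := by
      rw [Finset.sum_ite_eq']; split_ifs <;> norm_num
    have e2 : ∑ m ∈ Finset.Ioc 0 N, (if m + k = n then (1:ℝ) else 0) ≤ 1 := by
      refine (Finset.sum_le_sum (g := fun m => if m = n - k then (1:ℝ) else 0) fun m _ => ?_).trans ?_
      · split_ifs <;> first | omega | norm_num
      · rw [Finset.sum_ite_eq']; split_ifs <;> norm_num
    linarith
  refine (Finset.sum_le_sum h2).trans ?_
  rw [← Finset.mul_sum]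
  exact mul_le_mul_of_nonneg_left (sum_inv_le_one_add_log N) (by norm_num)

lemma sub_le_mul_abs_log_sub {n m N : ℕ} (hn : n ∈ Finset.Ioc 0 N) (hm : m ∈ Finset.Ioc 0 N)
    (h : n < m) : (m:ℝ) - n ≤ N * (Real.log m - Real.log n) := by
  rw [Finset.mem_Ioc] at hn hm
  have hn0 : (0:ℝ) < n := by exact_mod_cast hn.1
  have hm0 : (0:ℝ) < m := by exact_mod_cast hm.1
  have h1 : (m:ℝ) ≤ N := by exact_mod_cast hm.2
  have h2 : (n:ℝ) < m := by exact_mod_cast h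
  have := Real.one_sub_inv_le_log_of_pos (div_pos hm0 hn0)
  rw [Real.log_div hm0.ne' hn0.ne', inv_div] at this
  have h3 : (m:ℝ) * (1 - n / m) = m - n := by field_simp
  rw [← h3]
  have h4 : 0 ≤ 1 - (n:ℝ) / m := by rw [sub_nonneg, div_le_one hm0]; exact h2.le
  gcongr

/-- Mean value theorem for Dirichlet polynomials. -/
lemma integral_norm_sq_dirichletPoly_le (c : ℕ → ℂ) (N : ℕ) {A B : ℝ} (hAB : A ≤ B) :
    ∫ t in A..B, ‖∑ n ∈ Finset.Ioc 0 N, c n * (n:ℂ) ^ (-(1 + 2 * t * I) : ℂ)‖ ^ 2 ≤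
      (B - A + 2 * N * (1 + Real.log N)) * ∑ n ∈ Finset.Ioc 0 N, ‖c n‖ ^ 2 / (n:ℝ) ^ 2 := by
  have e : ∀ t : ℝ, ∑ n ∈ Finset.Ioc 0 N, c n * (n:ℂ) ^ (-(1 + 2 * t * I) : ℂ) =
      ∑ n ∈ Finset.Ioc 0 N, (c n / n) * cexp ((-2 * Real.log n : ℝ) * I * t) := by
    intro t
    refine Finset.sum_congr rfl fun n hn => ?_
    have hn0 : (n:ℂ) ≠ 0 := Nat.cast_ne_zero.2 (Finset.mem_Ioc.1 hn).1.ne'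
    rw [neg_add, Complex.cpow_add _ _ hn0, cpow_neg_one, cpow_def_of_ne_zero hn0, ← natCast_log,
      div_eq_mul_inv, ← mul_assoc]
    congr 2
    push_cast
    ring
  simp_rw [e]
  refine (integral_norm_sq_trigSum_le (Finset.Ioc 0 N) (fun n => c n / n)
    (fun n => -2 * Real.log n) hAB
    (fun n m => if n = m then B - A else N * |(n:ℝ) - m|⁻¹) ?_ ?_ ?_ ?_).trans ?_
  · intro n m
    split_ifs
    · linarith
    · positivity
  · intro n m
    rw [abs_sub_comm]
    by_cases h : n = m
    · simp [h]
    · rw [if_neg h, if_neg (Ne.symm h)]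
  · intro n; simp
  · have key : ∀ n ∈ Finset.Ioc 0 N, ∀ m ∈ Finset.Ioc 0 N, n < m →
        -2 * Real.log n ≠ -2 * Real.log m ∧
          2 / |-2 * Real.log n - -2 * Real.log m| ≤ N * |(n:ℝ) - m|⁻¹ := by
      intro n hn m hm h
      have h1 := sub_le_mul_abs_log_sub hn hm h
      rw [Finset.mem_Ioc] at hn hm
      have hl : Real.log n < Real.log m :=
        Real.log_lt_log (by exact_mod_cast hn.1) (by exact_mod_cast h)
      have h2 : (n:ℝ) < m := by exact_mod_cast h
      refine ⟨by linarith, ?_⟩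
      rw [show -2 * Real.log n - -2 * Real.log m = 2 * (Real.log m - Real.log n) by ring,
        abs_of_pos (by linarith), abs_sub_comm, abs_of_pos (by linarith), ← div_eq_mul_inv,
        div_le_div_iff₀ (by linarith) (by linarith)]
      linarith
    intro n hn m hm h
    rw [if_neg h]
    rcases lt_or_gt_of_ne h with h | h
    · exact key n hn m hm h
    · obtain ⟨h1, h2⟩ := key m hm n hn h
      exact ⟨h1.symm, by rwa [abs_sub_comm, abs_sub_comm (n:ℝ)]⟩
  · rw [Finset.mul_sum]
    refine Finset.sum_le_sum fun n hn => ?_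
    rw [mul_comm, norm_div, div_pow, Complex.norm_natCast]
    refine mul_le_mul_of_nonneg_right ?_ (by positivity)
    calc _ = ∑ m ∈ Finset.Ioc 0 N, ((if n = m then B - A else 0) +
          N * (if n = m then (0:ℝ) else |(n:ℝ) - m|⁻¹)) :=
          Finset.sum_congr rfl fun m _ => by split_ifs <;> simp
      _ ≤ (B - A) + N * (2 * (1 + Real.log N)) := by
          rw [Finset.sum_add_distrib, ← Finset.mul_sum, Finset.sum_ite_eq, if_pos hn]
          gcongr
          exact sum_inv_abs_sub_le n N hn
      _ = _ := by ring

section CardFactors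

open ArithmeticFunction (cardFactors)

lemma sum_pow_cardFactors_divisors_le (k : ℕ) {n : ℕ} (hn : n ≠ 0) :
    ∑ d ∈ n.divisors, k ^ cardFactors d ≤ (k + 1) ^ cardFactors n := by
  induction n using induction_on_primes with
  | zero => exact absurd rfl hn
  | one => simp
  | prime_mul p m hp ih =>
    have hm : m ≠ 0 := by rintro rfl; simp at hn
    have hsub : (p * m).divisors ⊆ m.divisors ∪ m.divisors.image (p * ·) := by
      intro d hd
      rw [Nat.mem_divisors] at hd
      by_cases h : p ∣ d
      · obtain ⟨e, rfl⟩ := h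
        exact Finset.mem_union_right _ (Finset.mem_image.2
          ⟨e, Nat.mem_divisors.2 ⟨Nat.dvd_of_mul_dvd_mul_left hp.pos hd.1, hm⟩, rfl⟩)
      · exact Finset.mem_union_left _ (Nat.mem_divisors.2
          ⟨((hp.coprime_iff_not_dvd.2 h).symm).dvd_of_dvd_mul_left hd.1, hm⟩)
    have himg : ∑ d ∈ m.divisors.image (p * ·), k ^ cardFactors d =
        k * ∑ d ∈ m.divisors, k ^ cardFactors d := by
      rw [Finset.sum_image fun a _ b _ h => Nat.eq_of_mul_eq_mul_left hp.pos h, Finset.mul_sum]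
      refine Finset.sum_congr rfl fun d hd => ?_
      rw [ArithmeticFunction.cardFactors_mul hp.ne_zero (Nat.pos_of_mem_divisors hd).ne',
        ArithmeticFunction.cardFactors_apply_prime hp, pow_add, pow_one]
    rw [ArithmeticFunction.cardFactors_mul hp.ne_zero hm,
      ArithmeticFunction.cardFactors_apply_prime hp, pow_add, pow_one]
    calc _ ≤ ∑ d ∈ m.divisors ∪ m.divisors.image (p * ·), k ^ cardFactors d :=
          Finset.sum_le_sum_of_subset hsub
      _ ≤ ∑ d ∈ m.divisors, k ^ cardFactors d +
          ∑ d ∈ m.divisors.image (p * ·), k ^ cardFactors d := by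
          rw [← Finset.sum_union_inter]; exact Nat.le_add_right _ _
      _ = (k + 1) * ∑ d ∈ m.divisors, k ^ cardFactors d := by rw [himg]; ring
      _ ≤ _ := Nat.mul_le_mul_left _ (ih hm)

lemma pow_cardFactors_le {P n : ℕ} (hn : n ≠ 0) (h : n.Coprime (primorial P)) :
    P ^ cardFactors n ≤ n := by
  induction n using induction_on_primes with
  | zero => exact absurd rfl hn
  | one => simp
  | prime_mul p m hp ih =>
    have hm : m ≠ 0 := by rintro rfl; simp at hn
    have hpP : P ≤ p := by
      by_contra! hlt
      exact (hp.coprime_iff_not_dvd.1 h.coprime_mul_right) (hp.dvd_primorial_iff.2 hlt.le)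
    rw [ArithmeticFunction.cardFactors_mul hp.ne_zero hm,
      ArithmeticFunction.cardFactors_apply_prime hp, pow_add, pow_one]
    exact Nat.mul_le_mul hpP (ih hm h.coprime_mul_left)

lemma norm_pow_apply_le {u : ArithmeticFunction ℂ} (hu : ∀ n, ‖u n‖ ≤ 1) (k n : ℕ) :
    ‖(u ^ k) n‖ ≤ (k : ℝ) ^ cardFactors n := by
  induction k generalizing n with
  | zero =>
    rw [pow_zero, ArithmeticFunction.one_apply]
    split_ifs with h
    · simp [h]
    · simp
  | succ k ih =>
    rcases eq_or_ne n 0 with rfl | hn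
    · simp
    rw [pow_succ, ArithmeticFunction.mul_apply]
    calc _ ≤ ∑ x ∈ n.divisorsAntidiagonal, ‖(u ^ k) x.1 * u x.2‖ := norm_sum_le _ _
      _ ≤ ∑ x ∈ n.divisorsAntidiagonal, (k : ℝ) ^ cardFactors x.1 := by
          refine Finset.sum_le_sum fun x _ => ?_
          rw [norm_mul]
          exact (mul_le_of_le_one_right (norm_nonneg _) (hu _)).trans (ih _)
      _ = ((∑ d ∈ n.divisors, k ^ cardFactors d : ℕ) : ℝ) := by
          rw [Nat.sum_divisorsAntidiagonal fun a _ => (k : ℝ) ^ cardFactors a]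
          push_cast; rfl
      _ ≤ _ := by exact_mod_cast sum_pow_cardFactors_divisors_le k hn

lemma pow_apply_support {u : ArithmeticFunction ℂ} {U V D : ℕ}
    (hu : ∀ n, u n ≠ 0 → U ≤ n ∧ n ≤ V ∧ n.Coprime D) {k n : ℕ} (h : (u ^ k) n ≠ 0) :
    U ^ k ≤ n ∧ n ≤ V ^ k ∧ n.Coprime D := by
  induction k generalizing n with
  | zero =>
    rw [pow_zero, ArithmeticFunction.one_apply] at h
    have : n = 1 := by by_contra h'; simp [h'] at h
    simp [this]
  | succ k ih =>
    rw [pow_succ, ArithmeticFunction.mul_apply] at h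
    obtain ⟨x, hx, hne⟩ := Finset.exists_ne_zero_of_sum_ne_zero h
    obtain ⟨h1, h2, h3⟩ := ih (left_ne_zero_of_mul hne)
    obtain ⟨h4, h5, h6⟩ := hu _ (right_ne_zero_of_mul hne)
    rw [← (Nat.mem_divisorsAntidiagonal.1 hx).1, pow_succ, pow_succ]
    exact ⟨Nat.mul_le_mul h1 h4, Nat.mul_le_mul h2 h5, h3.mul_left h6⟩

lemma LSeriesHasSum_pow {u : ArithmeticFunction ℂ} {s a : ℂ} (h : LSeriesHasSum (u ·) s a) (k : ℕ) :
    LSeriesHasSum ((u ^ k) ·) s (a ^ k) := by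
  induction k with
  | zero =>
    rw [pow_zero, pow_zero]
    have : HasSum (LSeries.term (fun n => (1 : ArithmeticFunction ℂ) n) s)
        (LSeries.term (fun n => (1 : ArithmeticFunction ℂ) n) s 1) := by
      refine hasSum_single 1 fun n hn => ?_
      simp [LSeries.term, ArithmeticFunction.one_apply_ne hn]
    simp only [LSeries.term_of_ne_zero one_ne_zero, ArithmeticFunction.one_one, Nat.cast_one,
      one_cpow, div_one] at this
    exact this
  | succ k ih =>
    rw [pow_succ, pow_succ]
    exact ArithmeticFunction.LSeriesHasSum_mul ih h

lemma LSeriesHasSum_of_support {u : ArithmeticFunction ℂ} {V : ℕ} (hu : ∀ n, u n ≠ 0 → n ≤ V)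
    (s : ℂ) : LSeriesHasSum (u ·) s (∑ n ∈ Finset.Ioc 0 V, u n * (n:ℂ) ^ (-s)) := by
  have h : ∑ n ∈ Finset.Ioc 0 V, u n * (n:ℂ) ^ (-s) =
      ∑ n ∈ Finset.Ioc 0 V, LSeries.term (u ·) s n := by
    refine Finset.sum_congr rfl fun n hn => ?_
    rw [LSeries.term_of_ne_zero (Finset.mem_Ioc.1 hn).1.ne', cpow_neg, div_eq_mul_inv]
  rw [h]
  refine hasSum_sum_of_ne_finset_zero fun n hn => ?_
  rcases eq_or_ne n 0 with rfl | h0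
  · exact LSeries.term_zero _ _
  rw [LSeries.term_of_ne_zero h0]
  have : u n = 0 := by
    by_contra h'
    exact hn (Finset.mem_Ioc.2 ⟨Nat.pos_of_ne_zero h0, hu n h'⟩)
  simp [this]

lemma dirichletPoly_pow {u : ArithmeticFunction ℂ} {U V D : ℕ}
    (hu : ∀ n, u n ≠ 0 → U ≤ n ∧ n ≤ V ∧ n.Coprime D) (s : ℂ) (k : ℕ) :
    (∑ n ∈ Finset.Ioc 0 V, u n * (n:ℂ) ^ (-s)) ^ k =
      ∑ n ∈ Finset.Ioc 0 (V ^ k), (u ^ k) n * (n:ℂ) ^ (-s) :=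
  (LSeriesHasSum_pow (LSeriesHasSum_of_support (fun n hn => (hu n hn).2.1) s) k).unique
    (LSeriesHasSum_of_support (fun _ hn => (pow_apply_support hu hn).2.1) s)

/-- High moments of Dirichlet polynomials supported on integers with no small prime factor. -/
lemma integral_norm_pow_dirichletPoly_le {u : ArithmeticFunction ℂ} {U V P k : ℕ} {A B E : ℝ}
    (hAB : A ≤ B) (hU : 1 ≤ U) (hV : 1 ≤ V) (hu1 : ∀ n, ‖u n‖ ≤ 1)
    (hu : ∀ n, u n ≠ 0 → U ≤ n ∧ n ≤ V ∧ n.Coprime (primorial P))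
    (hE : ∀ j : ℕ, P ^ j ≤ V ^ k → ((k : ℝ) ^ j) ^ 2 ≤ E) :
    ∫ t in A..B, ‖∑ n ∈ Finset.Ioc 0 V, u n * (n:ℂ) ^ (-(1 + 2 * t * I) : ℂ)‖ ^ (2 * k) ≤
      (B - A + 2 * (V:ℝ) ^ k * (1 + k * Real.log V)) * (E * (2 / (U:ℝ) ^ k)) := by
  simp_rw [mul_comm 2 k, pow_mul, ← norm_pow _ k,
    dirichletPoly_pow hu]
  refine (integral_norm_sq_dirichletPoly_le _ _ hAB).trans ?_
  have hVk : 1 ≤ V ^ k := Nat.one_le_pow _ _ hV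
  rw [Nat.cast_pow, Real.log_pow]
  have hlog : 0 ≤ (k:ℝ) * Real.log V := by positivity
  refine mul_le_mul_of_nonneg_left ?_ (by have := sub_nonneg.2 hAB; positivity)
  have hE0 : 0 ≤ E := (by positivity : (0:ℝ) ≤ ((k:ℝ) ^ 0) ^ 2).trans (hE 0 (by simpa using hVk))
  have hUk : 1 ≤ U ^ k := Nat.one_le_pow _ _ hU
  have h1 : ∀ n ∈ Finset.Ioc 0 (V ^ k), ‖(u ^ k) n‖ ^ 2 / (n:ℝ) ^ 2 ≤
      if n ∈ Finset.Ioo (U ^ k - 1) (V ^ k + 1) then E * ((n:ℝ) ^ 2)⁻¹ else 0 := by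
    intro n hn
    by_cases h0 : (u ^ k) n = 0
    · rw [h0]; split_ifs <;> simp; positivity
    obtain ⟨h2, h3, h4⟩ := pow_apply_support hu h0
    rw [if_pos (Finset.mem_Ioo.2 ⟨by omega, by omega⟩), div_eq_mul_inv]
    have h5 := norm_pow_apply_le hu1 k n
    have h6 := hE _ ((pow_cardFactors_le (Finset.mem_Ioc.1 hn).1.ne' h4).trans h3)
    gcongr
    exact (pow_le_pow_left₀ (norm_nonneg _) h5 2).trans h6
  refine (Finset.sum_le_sum h1).trans ?_
  rw [← Finset.sum_filter]
  refine (Finset.sum_le_sum_of_subset_of_nonneg (t := Finset.Ioo (U ^ k - 1) (V ^ k + 1))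
    (fun n hn => (Finset.mem_filter.1 hn).2) fun _ _ _ => by positivity).trans ?_
  rw [← Finset.mul_sum]
  refine mul_le_mul_of_nonneg_left ?_ hE0
  have := sum_Ioo_inv_sq_le (α := ℝ) (U ^ k - 1) (V ^ k + 1)
  rw [Nat.cast_sub hUk] at this
  simpa using this

end CardFactors

/-- The weight `|ζ_K(1/2 + it)|² + 1`. -/
noncomputable def zetaWeight (t : ℝ) : ℝ := ‖zetaK (1 / 2 + t * I)‖ ^ 2 + 1

lemma one_le_zetaWeight (t : ℝ) : 1 ≤ zetaWeight t := by
  unfold zetaWeight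
  have := sq_nonneg ‖zetaK (1 / 2 + t * I)‖
  linarith

lemma zetaWeight_nonneg (t : ℝ) : 0 ≤ zetaWeight t := zero_le_one.trans (one_le_zetaWeight t)

lemma continuous_zetaWeight : Continuous zetaWeight :=
  (continuous_zetaK_half.norm.pow 2).add continuous_const

lemma zetaWeight_neg (t : ℝ) : zetaWeight (-t) = zetaWeight t := by
  unfold zetaWeight
  rw [← norm_zetaK_conj]
  congr 4
  apply Complex.ext <;> simp

lemma exists_integral_zetaWeight_le : ∃ C : ℝ, 0 < C ∧ ∀ T : ℝ, 2 ≤ T →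
    ∫ t in T..2 * T, zetaWeight t ≤ C * T * Real.log T ^ 2 := by
  obtain ⟨C, hC, h⟩ := exists_integral_norm_sq_zetaK_le
  refine ⟨C + 4, by positivity, fun T hT => ?_⟩
  unfold zetaWeight
  have hc : Continuous fun t : ℝ => ‖zetaK (1 / 2 + t * I)‖ ^ 2 := continuous_zetaK_half.norm.pow 2
  rw [intervalIntegral.integral_add (hc.intervalIntegrable _ _)
    (continuous_const.intervalIntegrable _ _)]
  have h1 := h T hT
  have h2 : (1:ℝ) ≤ 4 * Real.log T ^ 2 := by
    have : Real.log 2 ≤ Real.log T := Real.log_le_log (by norm_num) hT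
    nlinarith [Real.log_two_gt_d9]
  have h3 : ∫ t in T..2 * T, (1:ℝ) = T := by rw [intervalIntegral.integral_const]; simp; ring
  rw [h3]
  nlinarith

lemma exists_zetaWeight_le : ∃ C : ℝ, 0 < C ∧ ∀ T : ℝ, 1 ≤ T → ∀ t ∈ Set.Icc T (2 * T),
    zetaWeight t ≤ C * (T ^ (1 / 1000 : ℝ)) ^ 980 := by
  obtain ⟨C, hC, h⟩ := exists_norm_zetaK_le
  refine ⟨C ^ 2 * 2 + 1, by positivity, fun T hT t ht => ?_⟩
  have ht1 : 1 ≤ t := hT.trans ht.1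
  have h1 := h (1 / 2) t le_rfl (by norm_num) ht1
  push_cast at h1
  have h2 : (t ^ (49 / 100 : ℝ)) ^ 2 ≤ 2 * (T ^ (1 / 1000 : ℝ)) ^ 980 := by
    rw [← Real.rpow_natCast, ← Real.rpow_natCast, ← Real.rpow_mul (by linarith),
      ← Real.rpow_mul (by linarith)]
    norm_num
    calc t ^ (49 / 50 : ℝ) ≤ (2 * T) ^ (49 / 50 : ℝ) :=
          Real.rpow_le_rpow (by linarith) ht.2 (by norm_num)
      _ = 2 ^ (49 / 50 : ℝ) * T ^ (49 / 50 : ℝ) := Real.mul_rpow (by norm_num) (by linarith)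
      _ ≤ 2 ^ (1 : ℝ) * T ^ (49 / 50 : ℝ) := by
          gcongr
          · norm_num
          · norm_num
      _ = _ := by rw [Real.rpow_one]
  have h3 : 1 ≤ (T ^ (1 / 1000 : ℝ)) ^ 980 :=
    one_le_pow₀ (Real.one_le_rpow hT (by norm_num))
  unfold zetaWeight
  calc ‖zetaK (1 / 2 + t * I)‖ ^ 2 + 1 ≤ (C * t ^ (49 / 100 : ℝ)) ^ 2 + 1 := by gcongr
    _ = C ^ 2 * (t ^ (49 / 100 : ℝ)) ^ 2 + 1 := by ring
    _ ≤ C ^ 2 * (2 * (T ^ (1 / 1000 : ℝ)) ^ 980) + 1 * (T ^ (1 / 1000 : ℝ)) ^ 980 := by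
        gcongr; linarith
    _ = _ := by ring

/-- The odd Möbius function on the integers of `(U, 2 * U] ∩ (0, Z]` with no prime factor `≤ P`. -/
noncomputable def roughDyadic (Z P U : ℕ) : ArithmeticFunction ℂ :=
  ⟨fun n => if U < n ∧ n ≤ 2 * U ∧ n ≤ Z ∧ n.Coprime (primorial P) then (oddMoebius n : ℂ) else 0,
    by simp⟩

lemma roughDyadic_apply (Z P U n : ℕ) : roughDyadic Z P U n =
    if U < n ∧ n ≤ 2 * U ∧ n ≤ Z ∧ n.Coprime (primorial P) then (oddMoebius n : ℂ) else 0 := rfl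

lemma roughDyadic_support {Z P U n : ℕ} (h : roughDyadic Z P U n ≠ 0) :
    U < n ∧ n ≤ 2 * U ∧ n ≤ Z ∧ n.Coprime (primorial P) := by
  by_contra h'
  exact h (if_neg h')

lemma norm_oddMoebius_le (n : ℕ) : ‖(oddMoebius n : ℂ)‖ ≤ 1 := by
  rw [Complex.norm_intCast]
  exact_mod_cast abs_oddMoebius_le n

lemma norm_roughDyadic_le (Z P U n : ℕ) : ‖roughDyadic Z P U n‖ ≤ 1 := by
  rw [roughDyadic_apply]
  split_ifs
  · exact norm_oddMoebius_le n
  · simp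

lemma lt_of_coprime_primorial {P n : ℕ} (h1 : 1 < n) (h : n.Coprime (primorial P)) : P < n := by
  have := n.minFac_prime h1.ne'
  by_contra! hle
  exact (this.coprime_iff_not_dvd.1 (h.coprime_dvd_left n.minFac_dvd))
    (this.dvd_primorial_iff.2 ((Nat.minFac_le (by omega)).trans hle))

lemma continuous_dirichletPoly (c : ℕ → ℂ) (N : ℕ) :
    Continuous fun t : ℝ => ∑ n ∈ Finset.Ioc 0 N, c n * (n:ℂ) ^ (-(1 + 2 * t * I) : ℂ) := by
  refine continuous_finsetSum _ fun n hn => continuous_const.mul ?_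
  have hn0 : (n:ℂ) ≠ 0 := Nat.cast_ne_zero.2 (Finset.mem_Ioc.1 hn).1.ne'
  exact Continuous.const_cpow (by fun_prop) (Or.inl hn0)

lemma le_inv_add_pow {L x : ℝ} (hL : 0 < L) (hx : 0 ≤ x) (q : ℕ) :
    x ≤ L⁻¹ + L ^ (2 * q + 1) * x ^ (2 * (q + 1)) := by
  rcases le_total x L⁻¹ with h | h
  · have : 0 ≤ L ^ (2 * q + 1) * x ^ (2 * (q + 1)) := by positivity
    linarith
  · have h1 : 1 ≤ L * x := by
      calc 1 = L * L⁻¹ := (mul_inv_cancel₀ hL.ne').symm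
        _ ≤ _ := by gcongr
    have h2 : x ≤ (L * x) ^ (2 * q + 1) * x := le_mul_of_one_le_left hx (one_le_pow₀ h1)
    have h3 : (L * x) ^ (2 * q + 1) * x = L ^ (2 * q + 1) * x ^ (2 * (q + 1)) := by
      rw [mul_pow, mul_assoc, ← pow_succ]; ring
    have : 0 < L⁻¹ := by positivity
    linarith

lemma integral_mul_norm_le {w : ℝ → ℝ} (hw : Continuous w) (hw0 : ∀ t, 0 ≤ w t) {M : ℝ → ℂ}
    (hM : Continuous M) {A B L W : ℝ} (hAB : A ≤ B) (hL : 0 < L) (hW : ∀ t ∈ Set.Icc A B, w t ≤ W)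
    (q : ℕ) :
    ∫ t in A..B, w t * ‖M t‖ ≤ L⁻¹ * (∫ t in A..B, w t) +
      L ^ (2 * q + 1) * W * ∫ t in A..B, ‖M t‖ ^ (2 * (q + 1)) := by
  have hMp : Continuous fun t => ‖M t‖ ^ (2 * (q + 1)) := hM.norm.pow _
  rw [← intervalIntegral.integral_const_mul, ← intervalIntegral.integral_const_mul,
    ← intervalIntegral.integral_add ((hw.const_mul _).intervalIntegrable _ _)
      ((hMp.const_mul _).intervalIntegrable _ _)]
  refine intervalIntegral.integral_mono_on hAB ((hw.mul hM.norm).intervalIntegrable _ _)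
    (((hw.const_mul _).add (hMp.const_mul _)).intervalIntegrable _ _) fun t ht => ?_
  calc w t * ‖M t‖ ≤ w t * (L⁻¹ + L ^ (2 * q + 1) * ‖M t‖ ^ (2 * (q + 1))) :=
        mul_le_mul_of_nonneg_left (le_inv_add_pow hL (norm_nonneg _) q) (hw0 t)
    _ = L⁻¹ * w t + L ^ (2 * q + 1) * w t * ‖M t‖ ^ (2 * (q + 1)) := by ring
    _ ≤ _ := by
        have := hW t ht
        gcongr

lemma le_rpow_inv_of_pow_le {T x : ℝ} {m n j : ℕ} (hT : 1 ≤ T) (hm : m ≠ 0)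
    (h : x ^ m ≤ T ^ n) (hj : 1000 * n ≤ m * j) : x ≤ (T ^ (1 / 1000 : ℝ)) ^ j := by
  set r := T ^ (1 / 1000 : ℝ) with hr
  have hr1 : 1 ≤ r := Real.one_le_rpow hT (by norm_num)
  have hrT : r ^ 1000 = T := by
    rw [hr, ← Real.rpow_natCast, ← Real.rpow_mul (by linarith)]; norm_num
  refine le_of_pow_le_pow_left₀ hm (by positivity) ?_
  rw [← pow_mul, mul_comm j m]
  calc x ^ m ≤ r ^ (1000 * n) := by rw [pow_mul, hrT]; exact h
    _ ≤ _ := pow_le_pow_right₀ hr1 hj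

/-- The dyadic pieces of the rough part are small on average against the weight. -/
lemma exists_integral_zetaWeight_mul_roughDyadic_le : ∃ C : ℝ, 0 < C ∧ ∀ (L : ℕ) (T : ℝ) (Z U : ℕ),
    2 ≤ L → 2 ≤ T → 1 ≤ U → Real.log Z ≤ L → Real.log T ≤ L → (L:ℝ) ^ 200 ≤ T →
    ∫ t in T..2 * T, zetaWeight t * ‖∑ n ∈ Finset.Ioc 0 (2 * U),
      roughDyadic Z (L ^ 6000) U n * (n:ℂ) ^ (-(1 + 2 * t * I) : ℂ)‖ ≤ C * T * L := by
  obtain ⟨C₁, hC₁, h₁⟩ := exists_integral_zetaWeight_le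
  obtain ⟨C₂, hC₂, h₂⟩ := exists_zetaWeight_le
  refine ⟨C₁ + 42 * C₂, by positivity, fun L T Z U hL hT hU hZ hTL hLT => ?_⟩
  have hL2 : (2:ℝ) ≤ L := by exact_mod_cast hL
  have hT1 : 1 ≤ T := by linarith
  set u := roughDyadic Z (L ^ 6000) U with hu
  by_cases hne : ∀ n, u n = 0
  · simp only [hne, zero_mul, Finset.sum_const_zero, norm_zero, mul_zero,
      intervalIntegral.integral_zero]
    positivity
  push Not at hne
  obtain ⟨b, hb⟩ := hne
  obtain ⟨hUb, hb2, hbZ, hbD⟩ := roughDyadic_support hb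
  have hPb := lt_of_coprime_primorial (by omega) hbD
  have hUL : L ^ 5999 ≤ U := by
    have : L ^ 5999 * 2 ≤ L ^ 6000 := by
      rw [pow_succ L 5999]; exact Nat.mul_le_mul_left _ hL
    omega
  have hUZ : U ≤ Z := by omega
  have hU2 : 2 ≤ U := (hL.trans (Nat.le_self_pow (by norm_num) L)).trans hUL
  set r := T ^ (1 / 1000 : ℝ) with hr
  have hr1 : 1 ≤ r := Real.one_le_rpow hT1 (by norm_num)
  have hrT : r ^ 1000 = T := by
    rw [hr, ← Real.rpow_natCast, ← Real.rpow_mul (by linarith)]; norm_num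
  set q := Nat.log U ⌊T⌋₊ with hq
  have hfl : 1 ≤ ⌊T⌋₊ := (Nat.one_le_floor_iff T).2 hT1
  have hUq : (U:ℝ) ^ q ≤ T := by
    refine le_trans ?_ (Nat.floor_le (by linarith : 0 ≤ T))
    exact_mod_cast Nat.pow_log_le_self U (by omega)
  have hUk : T ≤ (U:ℝ) ^ (q + 1) := by
    refine (Nat.lt_floor_add_one T).le.trans ?_
    exact_mod_cast Nat.lt_pow_succ_log_self hU2 _
  have hULr : (L:ℝ) ^ 5999 ≤ U := by exact_mod_cast hUL
  have hLq : (L:ℝ) ^ q ≤ r := by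
    have : ((L:ℝ) ^ q) ^ 5999 ≤ T ^ 1 := by
      rw [← pow_mul, mul_comm, pow_mul, pow_one]
      exact (pow_le_pow_left₀ (by positivity) hULr q).trans hUq
    exact (le_rpow_inv_of_pow_le (j := 1) hT1 (by norm_num) this (by norm_num)).trans_eq (pow_one _)
  have hLr : (L:ℝ) ≤ r ^ 5 := le_rpow_inv_of_pow_le (m := 200) (n := 1) hT1
    (by norm_num) (by simpa using hLT) (by norm_num)
  have h2q : (2:ℝ) ^ q ≤ r := (pow_le_pow_left₀ (by norm_num) hL2 q).trans hLq
  have hqL : q ≤ L := by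
    have h1 : (2:ℝ) ^ (5999 * q) ≤ T := by
      rw [pow_mul]
      exact (pow_le_pow_left₀ (by positivity)
        ((pow_le_pow_left₀ (by norm_num) hL2 _).trans hULr) q).trans hUq
    have h2 := (Real.log_le_log (by positivity) h1).trans hTL
    rw [Real.log_pow] at h2
    push_cast at h2
    have h3 := Real.log_two_gt_d9
    have : (q:ℝ) ≤ L := by nlinarith [(Nat.cast_nonneg q : (0:ℝ) ≤ q)]
    exact_mod_cast this
  have hkL : q + 1 ≤ L ^ 2 := by nlinarith
  have hE : ∀ j : ℕ, (L ^ 6000) ^ j ≤ (2 * U) ^ (q + 1) → (((q + 1 : ℕ) : ℝ) ^ j) ^ 2 ≤ r ^ 3 := by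
    intro j hj
    rcases Nat.eq_zero_or_pos q with h0 | h0
    · rw [h0]; simpa using one_le_pow₀ hr1
    have hj' : (((L:ℝ) ^ (4 * j))) ^ 1500 ≤ T ^ 4 := by
      have e1 : (((L:ℝ) ^ (4 * j))) ^ 1500 ≤ (2 * (U:ℝ)) ^ (q + 1) := by
        rw [← pow_mul, show 4 * j * 1500 = 6000 * j by ring, pow_mul]
        exact_mod_cast hj
      refine e1.trans ?_
      have e2 : (U:ℝ) ^ (q + 1) ≤ T ^ 2 := by
        calc (U:ℝ) ^ (q + 1) ≤ (U:ℝ) ^ (q * 2) :=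
              pow_le_pow_right₀ (by exact_mod_cast hU) (by omega)
          _ = ((U:ℝ) ^ q) ^ 2 := pow_mul _ _ _
          _ ≤ _ := by gcongr
      have e3 : (2:ℝ) ^ (q + 1) ≤ T ^ 2 := by
        refine le_trans ?_ e2
        gcongr
        exact_mod_cast hU2
      rw [mul_pow]
      calc _ ≤ T ^ 2 * T ^ 2 := by gcongr
        _ = _ := by ring
    have := le_rpow_inv_of_pow_le (j := 3) hT1 (by norm_num) hj' (by norm_num)
    refine le_trans ?_ this
    have hk : ((q + 1 : ℕ) : ℝ) ≤ (L:ℝ) ^ 2 := by exact_mod_cast hkL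
    calc (((q + 1 : ℕ) : ℝ) ^ j) ^ 2 ≤ (((L:ℝ) ^ 2) ^ j) ^ 2 := by gcongr
      _ = _ := by ring
  have hmom := integral_norm_pow_dirichletPoly_le (u := u) (U := U) (V := 2 * U) (P := L ^ 6000)
    (k := q + 1) (A := T) (B := 2 * T) (E := r ^ 3) (by linarith) hU (by omega)
    (norm_roughDyadic_le _ _ _) (fun n hn => ⟨(roughDyadic_support hn).1.le,
      (roughDyadic_support hn).2.1, (roughDyadic_support hn).2.2.2⟩) hE
  have hU0 : (0:ℝ) < U := by exact_mod_cast hU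
  have hlogU : Real.log (2 * U : ℕ) ≤ 2 * L := by
    push_cast
    rw [Real.log_mul (by norm_num) hU0.ne']
    have : Real.log U ≤ Real.log Z := Real.log_le_log hU0 (by exact_mod_cast hUZ)
    linarith [Real.log_two_lt_d9]
  have hmom2 : ∫ t in T..2 * T, ‖∑ n ∈ Finset.Ioc 0 (2 * U),
      u n * (n:ℂ) ^ (-(1 + 2 * t * I) : ℂ)‖ ^ (2 * (q + 1)) ≤ 42 * r ^ 14 := by
    refine hmom.trans ?_
    have hq1 : ((q + 1 : ℕ) : ℝ) ≤ 2 * L := by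
      have : (q:ℝ) ≤ L := by exact_mod_cast hqL
      push_cast; linarith
    have hlog : 1 + ((q + 1 : ℕ) : ℝ) * Real.log (2 * U : ℕ) ≤ 5 * r ^ 10 := by
      calc _ ≤ 1 + (2 * L) * (2 * L : ℝ) := by gcongr
        _ ≤ 5 * (L:ℝ) ^ 2 := by nlinarith
        _ ≤ 5 * (r ^ 5) ^ 2 := by gcongr
        _ = _ := by ring
    have hlog0 : 0 ≤ 1 + ((q + 1 : ℕ) : ℝ) * Real.log (2 * U : ℕ) := by positivity
    calc (2 * T - T + 2 * ((2 * U : ℕ):ℝ) ^ (q + 1) * (1 + ((q + 1 : ℕ) : ℝ) * Real.log (2 * U : ℕ)))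
          * (r ^ 3 * (2 / (U:ℝ) ^ (q + 1)))
        = 2 * r ^ 3 * (T / (U:ℝ) ^ (q + 1) + 2 * (2 * 2 ^ q) *
          (1 + ((q + 1 : ℕ) : ℝ) * Real.log (2 * U : ℕ))) := by
          push_cast; field_simp; ring
      _ ≤ 2 * r ^ 3 * (1 + 2 * (2 * r) * (5 * r ^ 10)) := by
          gcongr
          rw [div_le_one (by positivity)]; exact hUk
      _ ≤ 2 * r ^ 3 * (r ^ 11 + 2 * (2 * r) * (5 * r ^ 10)) := by
          gcongr
          exact one_le_pow₀ hr1
      _ = _ := by ring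
  have hfin := integral_mul_norm_le continuous_zetaWeight zetaWeight_nonneg
    (continuous_dirichletPoly u (2 * U)) (A := T) (B := 2 * T) (L := L) (by linarith) (by linarith)
    (h₂ T hT1) q
  refine hfin.trans ?_
  have hlogT : 0 ≤ Real.log T := Real.log_nonneg hT1
  have a1 : (L:ℝ)⁻¹ * (∫ t in T..2 * T, zetaWeight t) ≤ C₁ * T * L := by
    rw [inv_mul_le_iff₀ (by linarith)]
    refine (h₁ T hT).trans ?_
    calc C₁ * T * Real.log T ^ 2 ≤ C₁ * T * (L:ℝ) ^ 2 := by gcongr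
      _ = _ := by ring
  have a2 : (L:ℝ) ^ (2 * q + 1) * (C₂ * r ^ 980) * (42 * r ^ 14) ≤ 42 * C₂ * T * L := by
    calc (L:ℝ) ^ (2 * q + 1) * (C₂ * r ^ 980) * (42 * r ^ 14)
        = 42 * C₂ * ((L:ℝ) ^ q) ^ 2 * r ^ 994 * L := by ring
      _ ≤ 42 * C₂ * r ^ 2 * r ^ 994 * L := by gcongr
      _ = 42 * C₂ * r ^ 996 * L := by ring
      _ ≤ 42 * C₂ * r ^ 1000 * L := by gcongr; norm_num
      _ = _ := by rw [hrT]
  have a3 : (L:ℝ) ^ (2 * q + 1) * (C₂ * r ^ 980) * (∫ t in T..2 * T, ‖∑ n ∈ Finset.Ioc 0 (2 * U),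
      u n * (n:ℂ) ^ (-(1 + 2 * t * I) : ℂ)‖ ^ (2 * (q + 1))) ≤ 42 * C₂ * T * L :=
    (mul_le_mul_of_nonneg_left hmom2 (by positivity)).trans a2
  linarith

/-- The Dirichlet polynomial `∑_{d ≤ Z} f(d) d^{-1-2 * i * t}` of the odd Möbius function. -/
noncomputable def moebiusPoly (Z : ℕ) (t : ℝ) : ℂ :=
  ∑ d ∈ Finset.Ioc 0 Z, (oddMoebius d : ℂ) * (d:ℂ) ^ (-(1 + 2 * t * I) : ℂ)

/-- The part of `moebiusPoly` supported on integers with no prime factor `≤ P`. -/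
noncomputable def roughPoly (P Z : ℕ) (t : ℝ) : ℂ :=
  ∑ d ∈ Finset.Ioc 0 Z, (if d.Coprime (primorial P) then (oddMoebius d : ℂ) else 0) *
    (d:ℂ) ^ (-(1 + 2 * t * I) : ℂ)

lemma continuous_moebiusPoly (Z : ℕ) : Continuous (moebiusPoly Z) := continuous_dirichletPoly _ _

lemma continuous_roughPoly (P Z : ℕ) : Continuous (roughPoly P Z) :=
  continuous_dirichletPoly (fun d => if d.Coprime (primorial P) then (oddMoebius d : ℂ) else 0) Z

lemma norm_natCast_cpow_neg_one_add {n : ℕ} (hn : 0 < n) (t : ℝ) :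
    ‖(n:ℂ) ^ (-(1 + 2 * t * I) : ℂ)‖ = (n:ℝ)⁻¹ := by
  rw [norm_natCast_cpow_of_pos hn]
  have : (-(1 + 2 * t * I) : ℂ).re = -1 := by simp
  rw [this, Real.rpow_neg_one]

lemma norm_moebiusPoly_le (Z : ℕ) (t : ℝ) : ‖moebiusPoly Z t‖ ≤ 1 + Real.log Z := by
  refine (norm_sum_le _ _).trans ((Finset.sum_le_sum fun d hd => ?_).trans
    (sum_inv_le_one_add_log Z))
  rw [norm_mul, norm_natCast_cpow_neg_one_add (Finset.mem_Ioc.1 hd).1]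
  exact mul_le_of_le_one_left (by positivity) (norm_oddMoebius_le d)

lemma oddMoebius_eq_zero_of_sq_dvd {p d : ℕ} (hp : p.Prime) (h : p * p ∣ d) : oddMoebius d = 0 := by
  unfold oddMoebius
  split_ifs
  · refine ArithmeticFunction.moebius_eq_zero_of_not_squarefree fun hs => ?_
    exact hp.one_lt.ne' (Nat.isUnit_iff.1 (hs p h))
  · rfl

lemma sum_gcd_fiber_eq {F G : ℕ → ℂ} {a D Z : ℕ} (haD : a ∣ D) (hD : D ≠ 0)
    (hF : ∀ p d, p.Prime → p * p ∣ d → F d = 0)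
    (hG : ∀ b, b.Coprime D → F (a * b) = G b) :
    ∑ d ∈ (Finset.Ioc 0 Z).filter (fun d => d.gcd D = a), F d =
      ∑ b ∈ Finset.Ioc 0 (Z / a), if b.Coprime D then G b else 0 := by
  have ha : 0 < a := Nat.pos_of_dvd_of_pos haD (Nat.pos_of_ne_zero hD)
  rw [← Finset.sum_filter]
  have h1 : ∑ b ∈ (Finset.Ioc 0 (Z / a)).filter (fun b => b.Coprime D), G b =
      ∑ d ∈ ((Finset.Ioc 0 (Z / a)).filter (fun b => b.Coprime D)).image (a * ·), F d := by
    rw [Finset.sum_image fun x _ y _ h => Nat.eq_of_mul_eq_mul_left ha h]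
    exact Finset.sum_congr rfl fun b hb => (hG b (Finset.mem_filter.1 hb).2).symm
  rw [h1]
  symm
  refine Finset.sum_subset ?_ ?_
  · intro d hd
    obtain ⟨b, hb, rfl⟩ := Finset.mem_image.1 hd
    obtain ⟨hb1, hb2⟩ := Finset.mem_filter.1 hb
    rw [Finset.mem_Ioc, Nat.le_div_iff_mul_le ha] at hb1
    refine Finset.mem_filter.2 ⟨Finset.mem_Ioc.2 ⟨Nat.mul_pos ha hb1.1, by linarith⟩, ?_⟩
    rw [Nat.Coprime.gcd_mul_right_cancel _ hb2]
    exact Nat.gcd_eq_left haD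
  · intro d hd hnd
    obtain ⟨hd1, hd2⟩ := Finset.mem_filter.1 hd
    rw [Finset.mem_Ioc] at hd1
    have had : a ∣ d := hd2 ▸ Nat.gcd_dvd_left d D
    obtain ⟨b, rfl⟩ := had
    have hb : ¬ b.Coprime D := fun hb => hnd (Finset.mem_image.2 ⟨b, Finset.mem_filter.2
      ⟨Finset.mem_Ioc.2 ⟨Nat.pos_of_mul_pos_left hd1.1,
        (Nat.le_div_iff_mul_le ha).2 (by linarith)⟩, hb⟩, rfl⟩)
    obtain ⟨p, hp, hpb, hpD⟩ := Nat.Prime.not_coprime_iff_dvd.1 hb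
    have hpa : p ∣ a := hd2 ▸ Nat.dvd_gcd (hpb.mul_left a) hpD
    exact hF p _ hp (Nat.mul_dvd_mul hpa hpb)

lemma moebiusPoly_eq_sum_roughPoly (P Z : ℕ) (t : ℝ) : moebiusPoly Z t =
    ∑ a ∈ (primorial P).divisors, (oddMoebius a : ℂ) * (a:ℂ) ^ (-(1 + 2 * t * I) : ℂ) *
      roughPoly P (Z / a) t := by
  have hD := primorial_ne_zero P
  unfold moebiusPoly
  rw [← Finset.sum_fiberwise_of_maps_to (t := (primorial P).divisors)
    (g := fun d => d.gcd (primorial P))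
    fun d _ => Nat.mem_divisors.2 ⟨Nat.gcd_dvd_right _ _, hD⟩]
  refine Finset.sum_congr rfl fun a ha => ?_
  have haD := Nat.dvd_of_mem_divisors ha
  rw [sum_gcd_fiber_eq (G := fun b => (oddMoebius a : ℂ) * (a:ℂ) ^ (-(1 + 2 * t * I) : ℂ) *
    ((oddMoebius b : ℂ) * (b:ℂ) ^ (-(1 + 2 * t * I) : ℂ))) haD hD, roughPoly, Finset.mul_sum]
  · refine Finset.sum_congr rfl fun b _ => ?_
    split_ifs
    · rfl
    · simp
  · intro p d hp h
    rw [oddMoebius_eq_zero_of_sq_dvd hp h]; simp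
  · intro b hb
    rw [oddMoebius_mul (hb.coprime_dvd_right haD).symm, Nat.cast_mul, natCast_mul_natCast_cpow]
    push_cast; ring

lemma sum_roughPoly_dyadic (P Z : ℕ) (t : ℝ) (J : ℕ) :
    ∑ n ∈ Finset.Ioc 0 (2 ^ J), (if n ≤ Z ∧ n.Coprime (primorial P) then (oddMoebius n : ℂ) else 0) *
      (n:ℂ) ^ (-(1 + 2 * t * I) : ℂ) = (if 1 ≤ Z then 1 else 0) +
    ∑ j ∈ Finset.range J, ∑ n ∈ Finset.Ioc 0 (2 * 2 ^ j),
      roughDyadic Z P (2 ^ j) n * (n:ℂ) ^ (-(1 + 2 * t * I) : ℂ) := by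
  induction J with
  | zero => rw [pow_zero, show Finset.Ioc 0 1 = {1} from rfl]; simp [oddMoebius]
  | succ J ih =>
    rw [Finset.sum_range_succ, ← add_assoc, ← ih, pow_succ, mul_comm _ 2,
      ← Finset.sum_Ioc_consecutive _ (Nat.zero_le (2 ^ J)) (by omega : 2 ^ J ≤ 2 * 2 ^ J),
      ← Finset.sum_Ioc_consecutive _ (Nat.zero_le (2 ^ J)) (by omega : 2 ^ J ≤ 2 * 2 ^ J)]
    congr 1
    have h0 : ∑ n ∈ Finset.Ioc 0 (2 ^ J),
        roughDyadic Z P (2 ^ J) n * (n:ℂ) ^ (-(1 + 2 * t * I) : ℂ) = 0 := by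
      refine Finset.sum_eq_zero fun n hn => ?_
      rw [roughDyadic_apply, if_neg (by rw [Finset.mem_Ioc] at hn; omega), zero_mul]
    rw [h0, zero_add]
    refine Finset.sum_congr rfl fun n hn => ?_
    rw [Finset.mem_Ioc] at hn
    rw [roughDyadic_apply]
    simp only [hn.1, hn.2, true_and]

lemma norm_roughPoly_le {P Z J : ℕ} (hJ : Z ≤ 2 ^ J) (t : ℝ) : ‖roughPoly P Z t‖ ≤ 1 +
    ∑ j ∈ Finset.range J, ‖∑ n ∈ Finset.Ioc 0 (2 * 2 ^ j),
      roughDyadic Z P (2 ^ j) n * (n:ℂ) ^ (-(1 + 2 * t * I) : ℂ)‖ := by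
  have h : roughPoly P Z t = ∑ n ∈ Finset.Ioc 0 (2 ^ J),
      (if n ≤ Z ∧ n.Coprime (primorial P) then (oddMoebius n : ℂ) else 0) *
        (n:ℂ) ^ (-(1 + 2 * t * I) : ℂ) := by
    rw [roughPoly, ← Finset.sum_Ioc_consecutive _ (Nat.zero_le Z) hJ]
    have h0 : ∑ n ∈ Finset.Ioc Z (2 ^ J),
        (if n ≤ Z ∧ n.Coprime (primorial P) then (oddMoebius n : ℂ) else 0) *
          (n:ℂ) ^ (-(1 + 2 * t * I) : ℂ) = 0 := by
      refine Finset.sum_eq_zero fun n hn => ?_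
      rw [if_neg (by rw [Finset.mem_Ioc] at hn; omega), zero_mul]
    rw [h0, add_zero]
    refine Finset.sum_congr rfl fun n hn => ?_
    simp only [(Finset.mem_Ioc.1 hn).2, true_and]
  rw [h, sum_roughPoly_dyadic]
  refine (norm_add_le _ _).trans (add_le_add ?_ (norm_sum_le _ _))
  split_ifs <;> simp

lemma exists_integral_zetaWeight_mul_roughPoly_le : ∃ C : ℝ, 0 < C ∧ ∀ (L : ℕ) (T : ℝ) (Z : ℕ),
    2 ≤ L → 2 ≤ T → Real.log Z ≤ L → Real.log T ≤ L → (L:ℝ) ^ 200 ≤ T →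
    ∫ t in T..2 * T, zetaWeight t * ‖roughPoly (L ^ 6000) Z t‖ ≤ C * T * (L:ℝ) ^ 2 := by
  obtain ⟨C₁, hC₁, h₁⟩ := exists_integral_zetaWeight_le
  obtain ⟨C₂, hC₂, h₂⟩ := exists_integral_zetaWeight_mul_roughDyadic_le
  refine ⟨C₁ + 2 * C₂, by positivity, fun L T Z hL hT hZ hTL hLT => ?_⟩
  set J := Nat.log 2 Z + 1 with hJ
  have hL2 : (2:ℝ) ≤ L := by exact_mod_cast hL
  have hJL : (J:ℝ) ≤ 2 * L := by
    rcases Nat.eq_zero_or_pos Z with h0 | h0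
    · rw [hJ, h0]; simp; linarith
    have h1 : ((2:ℕ):ℝ) ^ Nat.log 2 Z ≤ Z := by exact_mod_cast Nat.pow_log_le_self 2 h0.ne'
    have h2 := (Real.log_le_log (by positivity) h1).trans hZ
    rw [Real.log_pow, Nat.cast_ofNat] at h2
    rw [hJ]; push_cast
    nlinarith [Real.log_two_gt_d9, (Nat.cast_nonneg (Nat.log 2 Z) : (0:ℝ) ≤ _)]
  have hc (j : ℕ) := continuous_dirichletPoly (fun n => roughDyadic Z (L ^ 6000) (2 ^ j) n) (2 * 2 ^ j)
  have hcj (j : ℕ) : IntervalIntegrable (fun t : ℝ => zetaWeight t *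
      ‖∑ n ∈ Finset.Ioc 0 (2 * 2 ^ j), roughDyadic Z (L ^ 6000) (2 ^ j) n *
        (n:ℂ) ^ (-(1 + 2 * t * I) : ℂ)‖) MeasureTheory.volume T (2 * T) :=
    (continuous_zetaWeight.mul (hc j).norm).intervalIntegrable T (2 * T)
  have hw := continuous_zetaWeight.intervalIntegrable (μ := MeasureTheory.volume) T (2 * T)
  have hsum : IntervalIntegrable (fun t : ℝ => ∑ j ∈ Finset.range J, zetaWeight t *
      ‖∑ n ∈ Finset.Ioc 0 (2 * 2 ^ j), roughDyadic Z (L ^ 6000) (2 ^ j) n *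
        (n:ℂ) ^ (-(1 + 2 * t * I) : ℂ)‖) MeasureTheory.volume T (2 * T) :=
    (continuous_finsetSum _ fun j _ =>
      continuous_zetaWeight.mul (hc j).norm).intervalIntegrable _ _
  calc ∫ t in T..2 * T, zetaWeight t * ‖roughPoly (L ^ 6000) Z t‖
      ≤ ∫ t in T..2 * T, (zetaWeight t + ∑ j ∈ Finset.range J, zetaWeight t *
        ‖∑ n ∈ Finset.Ioc 0 (2 * 2 ^ j), roughDyadic Z (L ^ 6000) (2 ^ j) n *
          (n:ℂ) ^ (-(1 + 2 * t * I) : ℂ)‖) := by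
        refine intervalIntegral.integral_mono_on (by linarith)
          ((continuous_zetaWeight.mul (continuous_roughPoly _ _).norm).intervalIntegrable _ _)
          (hw.add hsum) fun t _ => ?_
        rw [← Finset.mul_sum]
        calc _ ≤ zetaWeight t * _ := mul_le_mul_of_nonneg_left
              (norm_roughPoly_le (Nat.lt_pow_succ_log_self (by norm_num) Z).le t) (zetaWeight_nonneg t)
          _ = _ := by rw [mul_add, mul_one]
    _ = (∫ t in T..2 * T, zetaWeight t) + ∑ j ∈ Finset.range J, ∫ t in T..2 * T, zetaWeight t *
        ‖∑ n ∈ Finset.Ioc 0 (2 * 2 ^ j), roughDyadic Z (L ^ 6000) (2 ^ j) n *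
          (n:ℂ) ^ (-(1 + 2 * t * I) : ℂ)‖ := by
        rw [intervalIntegral.integral_add hw hsum,
          intervalIntegral.integral_finsetSum fun j _ => hcj j]
    _ ≤ C₁ * T * Real.log T ^ 2 + ∑ j ∈ Finset.range J, C₂ * T * L :=
        add_le_add (h₁ T hT) (Finset.sum_le_sum fun j _ =>
          h₂ L T Z (2 ^ j) hL hT Nat.one_le_two_pow hZ hTL hLT)
    _ = C₁ * T * Real.log T ^ 2 + J * (C₂ * T * L) := by simp
    _ ≤ C₁ * T * (L:ℝ) ^ 2 + (2 * L) * (C₂ * T * L) := by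
        have : 0 ≤ Real.log T := Real.log_nonneg (by linarith)
        gcongr
    _ = _ := by ring

lemma exists_integral_zetaWeight_mul_moebiusPoly_le : ∃ C : ℝ, 0 < C ∧ ∀ (L : ℕ) (T : ℝ) (Z : ℕ),
    2 ≤ L → 2 ≤ T → Real.log Z ≤ L → Real.log T ≤ L → (L:ℝ) ^ 200 ≤ T →
    ∫ t in T..2 * T, zetaWeight t * ‖moebiusPoly Z t‖ ≤ C * T * (L:ℝ) ^ 2 * Real.log L := by
  obtain ⟨C, hC, h⟩ := exists_integral_zetaWeight_mul_roughPoly_le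
  refine ⟨C * 120000, by positivity, fun L T Z hL hT hZ hTL hLT => ?_⟩
  set P := L ^ 6000 with hP
  have hc (Z : ℕ) : Continuous fun t : ℝ => zetaWeight t * ‖roughPoly P Z t‖ :=
    continuous_zetaWeight.mul (continuous_roughPoly P Z).norm
  calc ∫ t in T..2 * T, zetaWeight t * ‖moebiusPoly Z t‖
      ≤ ∫ t in T..2 * T, ∑ a ∈ (primorial P).divisors, (a:ℝ)⁻¹ *
          (zetaWeight t * ‖roughPoly P (Z / a) t‖) := by
        refine intervalIntegral.integral_mono_on (by linarith)
          ((continuous_zetaWeight.mul (continuous_moebiusPoly _).norm).intervalIntegrable _ _)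
          ((continuous_finsetSum _ fun a _ => (hc _).const_mul _).intervalIntegrable _ _)
          fun t _ => ?_
        rw [moebiusPoly_eq_sum_roughPoly P]
        refine (mul_le_mul_of_nonneg_left (norm_sum_le _ _) (zetaWeight_nonneg t)).trans ?_
        rw [Finset.mul_sum]
        refine Finset.sum_le_sum fun a ha => ?_
        rw [norm_mul, norm_mul, norm_natCast_cpow_neg_one_add (Nat.pos_of_mem_divisors ha),
          mul_left_comm]
        refine mul_le_mul_of_nonneg_right ?_
          (mul_nonneg (zetaWeight_nonneg t) (norm_nonneg _))
        exact mul_le_of_le_one_left (by positivity) (norm_oddMoebius_le a)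
    _ = ∑ a ∈ (primorial P).divisors, (a:ℝ)⁻¹ *
          ∫ t in T..2 * T, zetaWeight t * ‖roughPoly P (Z / a) t‖ := by
        rw [intervalIntegral.integral_finsetSum fun a _ =>
          ((hc _).const_mul _).intervalIntegrable _ _]
        exact Finset.sum_congr rfl fun a _ => intervalIntegral.integral_const_mul _ _
    _ ≤ ∑ a ∈ (primorial P).divisors, (a:ℝ)⁻¹ * (C * T * (L:ℝ) ^ 2) := by
        refine Finset.sum_le_sum fun a _ => mul_le_mul_of_nonneg_left
          (h L T (Z / a) hL hT ?_ hTL hLT) (by positivity)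
        refine le_trans ?_ hZ
        rcases Nat.eq_zero_or_pos (Z / a) with h0 | h0
        · rw [h0]; simpa using Real.log_natCast_nonneg Z
        · exact Real.log_le_log (by exact_mod_cast h0) (by exact_mod_cast Nat.div_le_self _ _)
    _ ≤ (20 * Real.log P) * (C * T * (L:ℝ) ^ 2) := by
        rw [← Finset.sum_mul]
        refine mul_le_mul_of_nonneg_right (sum_inv_divisors_primorial_le ?_) (by positivity)
        exact hL.trans (Nat.le_self_pow (by norm_num) L)
    _ = _ := by
        rw [hP, Nat.cast_pow, Real.log_pow, Nat.cast_ofNat]; ring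

lemma integral_indicator_Ici_le {n y : ℝ} (hn : 0 ≤ n) (hy : 0 ≤ y) :
    ∫ v in (0:ℝ)..y, (Set.Ici n).indicator (fun _ => (1:ℝ)) v = max (y - n) 0 := by
  rw [intervalIntegral.integral_of_le hy, show (fun _ => (1:ℝ)) = (1 : ℝ → ℝ) from rfl,
    MeasureTheory.integral_indicator_one measurableSet_Ici, MeasureTheory.Measure.real,
    MeasureTheory.Measure.restrict_apply measurableSet_Ici]
  rcases hn.eq_or_lt with rfl | hn
  · rw [Set.inter_eq_right.2 fun v hv => hv.1.le]
    simp [hy]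
  · have h : Set.Ici n ∩ Set.Ioc 0 y = Set.Icc n y := by
      ext v
      simp only [Set.mem_inter_iff, Set.mem_Ici, Set.mem_Ioc, Set.mem_Icc]
      exact ⟨fun h => ⟨h.1, h.2.2⟩, fun h => ⟨h.1, hn.trans_le h.1, h.2⟩⟩
    rw [h, Real.volume_Icc, ENNReal.toReal_ofReal']

lemma sum_floor_eq_sum_indicator (a : ℕ → ℝ) {N : ℕ} {v : ℝ} (h0 : 0 ≤ v) (hv : v ≤ N) :
    ∑ n ∈ Finset.Ioc 0 ⌊v⌋₊, a n =
      ∑ n ∈ Finset.Ioc 0 N, a n * (Set.Ici (n:ℝ)).indicator (fun _ => (1:ℝ)) v := by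
  have hN : ⌊v⌋₊ ≤ N := Nat.floor_le_of_le hv
  rw [← Finset.sum_Ioc_consecutive _ (Nat.zero_le _) hN]
  rw [Finset.sum_eq_zero (s := Finset.Ioc ⌊v⌋₊ N) fun n hn => ?_, add_zero]
  · refine Finset.sum_congr rfl fun n hn => ?_
    rw [Set.indicator_of_mem, mul_one]
    exact (Nat.le_floor_iff h0).1 (Finset.mem_Ioc.1 hn).2
  · rw [Set.indicator_of_notMem, mul_zero]
    rw [Set.mem_Ici, not_le]
    exact (Nat.floor_lt h0).1 (Finset.mem_Ioc.1 hn).1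

lemma intervalIntegrable_indicator_Ici (n a b : ℝ) : IntervalIntegrable
    ((Set.Ici n).indicator (fun _ => (1:ℝ))) MeasureTheory.volume a b :=
  ⟨(MeasureTheory.integrable_const 1).indicator measurableSet_Ici,
    (MeasureTheory.integrable_const 1).indicator measurableSet_Ici⟩

lemma intervalIntegrable_sum_floor (a : ℕ → ℝ) {y z : ℝ} (hy : 0 ≤ y) (hz : 0 ≤ z) :
    IntervalIntegrable (fun v => ∑ n ∈ Finset.Ioc 0 ⌊v⌋₊, a n) MeasureTheory.volume y z := by
  have h : IntervalIntegrable (fun v => ∑ n ∈ Finset.Ioc 0 ⌈max y z⌉₊,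
      a n * (Set.Ici (n:ℝ)).indicator (fun _ => (1:ℝ)) v) MeasureTheory.volume y z := by
    have := IntervalIntegrable.sum (μ := MeasureTheory.volume) (a := y) (b := z)
      (Finset.Ioc 0 ⌈max y z⌉₊)
      (f := fun n v => a n * (Set.Ici (n:ℝ)).indicator (fun _ => (1:ℝ)) v)
      fun n _ => (intervalIntegrable_indicator_Ici n y z).const_mul (a n)
    refine this.congr fun v _ => ?_
    simp
  refine h.congr fun v hv => ?_
  rw [Set.uIoc, Set.mem_Ioc] at hv
  exact (sum_floor_eq_sum_indicator a ((le_min hy hz).trans hv.1.le)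
    (hv.2.trans (Nat.le_ceil _))).symm

lemma integral_sum_floor (a : ℕ → ℝ) {y : ℝ} {N : ℕ} (hy : 0 ≤ y) (hN : y ≤ N) :
    ∫ v in (0:ℝ)..y, ∑ n ∈ Finset.Ioc 0 ⌊v⌋₊, a n =
      ∑ n ∈ Finset.Ioc 0 N, a n * max (y - n) 0 := by
  rw [intervalIntegral.integral_congr (g := fun v => ∑ n ∈ Finset.Ioc 0 N,
      a n * (Set.Ici (n:ℝ)).indicator (fun _ => (1:ℝ)) v),
    intervalIntegral.integral_finsetSum]
  · refine Finset.sum_congr rfl fun n _ => ?_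
    rw [intervalIntegral.integral_const_mul, integral_indicator_Ici_le n.cast_nonneg hy]
  · exact fun n _ => (intervalIntegrable_indicator_Ici n 0 y).const_mul (a n)
  · intro v hv
    rw [Set.uIcc_of_le hy] at hv
    exact sum_floor_eq_sum_indicator a hv.1 (hv.2.trans hN)

/-- The summatory function of `rho n ^ 2` at a real argument. -/
noncomputable def rhoSqSum (x : ℝ) : ℝ := ∑ n ∈ Finset.Ioc 0 ⌊x⌋₊, (rho n : ℝ) ^ 2

lemma rhoSqSum_mono : Monotone rhoSqSum := fun _ _ h =>
  Finset.sum_le_sum_of_subset_of_nonneg (Finset.Ioc_subset_Ioc_right (Nat.floor_le_floor h))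
    fun _ _ _ => sq_nonneg _

lemma integral_rhoConvSum_floor {y : ℝ} (hy : 0 ≤ y) :
    ∫ v in (0:ℝ)..y, (rhoConvSum ⌊v⌋₊ : ℝ) = rhoConvInt y := by
  rw [rhoConvInt_eq_sum (Nat.le_ceil y), ← integral_sum_floor _ hy (Nat.le_ceil y)]
  simp [rhoConvSum]

lemma integral_rhoConvSum_floor_div {p x : ℝ} (hp : 0 < p) (hx : 0 ≤ x) :
    ∫ v in (0:ℝ)..x, (rhoConvSum ⌊v / p⌋₊ : ℝ) = p * rhoConvInt (x / p) := by
  rw [intervalIntegral.integral_comp_div (fun v => (rhoConvSum ⌊v⌋₊ : ℝ)) hp.ne', zero_div,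
    integral_rhoConvSum_floor (by positivity), smul_eq_mul]

lemma intervalIntegrable_rhoConvSum_floor_div {p x : ℝ} (hp : 0 < p) (hx : 0 ≤ x) :
    IntervalIntegrable (fun v => (rhoConvSum ⌊v / p⌋₊ : ℝ)) MeasureTheory.volume 0 x := by
  have h := intervalIntegrable_sum_floor (fun n => ((rho * rho) n : ℝ)) le_rfl
    (div_nonneg hx hp.le)
  have h2 := h.comp_mul_left (c := p⁻¹)
  simp only [div_inv_eq_mul, div_mul_cancel₀ _ hp.ne', zero_mul] at h2
  refine h2.congr fun v _ => ?_
  simp [rhoConvSum, div_eq_inv_mul]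

lemma rhoSqSum_eq {v : ℝ} {Z : ℕ} (hv : v ≤ (Z:ℝ) ^ 2) :
    rhoSqSum v = ∑ d ∈ Finset.Ioc 0 Z, (oddMoebius d : ℝ) *
      ((rhoConvSum ⌊v / (d:ℝ) ^ 2⌋₊ : ℝ) - (rhoConvSum ⌊v / (2 * (d:ℝ) ^ 2)⌋₊ : ℝ)) := by
  have h := sum_rho_sq ⌊v⌋₊
  have h1 : rhoSqSum v = ((∑ n ∈ Finset.Ioc 0 ⌊v⌋₊, rho n ^ 2 : ℤ) : ℝ) := by
    rw [rhoSqSum]; push_cast; rfl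
  have hfl (d : ℕ) : ⌊v / (d:ℝ) ^ 2⌋₊ = ⌊v⌋₊ / d ^ 2 := by
    rw [← Nat.floor_div_natCast]; push_cast; rfl
  have hfl2 (d : ℕ) : ⌊v / (2 * (d:ℝ) ^ 2)⌋₊ = ⌊v⌋₊ / d ^ 2 / 2 := by
    rw [← hfl, ← Nat.floor_div_natCast, div_div]; push_cast; rw [mul_comm]
  set F : ℕ → ℝ := fun d => (oddMoebius d : ℝ) *
      ((rhoConvSum (⌊v⌋₊ / d ^ 2) : ℝ) - (rhoConvSum (⌊v⌋₊ / d ^ 2 / 2) : ℝ)) with hF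
  have hF0 (d : ℕ) (hd : ⌊v⌋₊ < d ^ 2) : F d = 0 := by
    simp only [hF]; rw [Nat.div_eq_of_lt hd]; simp
  have key (M : ℕ) (hM : ⌊v⌋₊ ≤ M ^ 2) : ∑ d ∈ Finset.Ioc 0 M, F d =
      ∑ d ∈ Finset.Ioc 0 (max Z ⌊v⌋₊ ⊔ M), F d := by
    refine Finset.sum_subset (Finset.Ioc_subset_Ioc_right le_sup_right) fun d hd hd' => hF0 d ?_
    rw [Finset.mem_Ioc] at hd hd'
    exact hM.trans_lt (Nat.pow_lt_pow_left (by omega) (by norm_num))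
  have hZ : ⌊v⌋₊ ≤ Z ^ 2 := Nat.floor_le_of_le (by exact_mod_cast hv)
  have hN : ⌊v⌋₊ ≤ ⌊v⌋₊ ^ 2 := Nat.le_self_pow (by norm_num) _
  rw [h1, h]
  simp only [hfl, hfl2]
  have e1 := key Z hZ
  have e2 := key ⌊v⌋₊ hN
  rw [sup_eq_left.2 (le_max_left _ _)] at e1
  rw [sup_eq_left.2 (le_max_right _ _)] at e2
  push_cast
  exact e2.trans e1.symm

lemma integral_rhoSqSum {x : ℝ} {Z : ℕ} (h0 : 0 ≤ x) (hx : x ≤ (Z:ℝ) ^ 2) :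
    ∫ v in (0:ℝ)..x, rhoSqSum v = ∑ d ∈ Finset.Ioc 0 Z, (oddMoebius d : ℝ) *
      ((d:ℝ) ^ 2 * rhoConvInt (x / (d:ℝ) ^ 2) -
        2 * (d:ℝ) ^ 2 * rhoConvInt (x / (2 * (d:ℝ) ^ 2))) := by
  have hi {d : ℕ} (hd : d ∈ Finset.Ioc 0 Z) : 0 < (d:ℝ) ^ 2 := by
    have : 0 < d := (Finset.mem_Ioc.1 hd).1
    positivity
  rw [intervalIntegral.integral_congr (g := fun v => ∑ d ∈ Finset.Ioc 0 Z, (oddMoebius d : ℝ) *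
      ((rhoConvSum ⌊v / (d:ℝ) ^ 2⌋₊ : ℝ) - (rhoConvSum ⌊v / (2 * (d:ℝ) ^ 2)⌋₊ : ℝ))),
    intervalIntegral.integral_finsetSum]
  · refine Finset.sum_congr rfl fun d hd => ?_
    have h1 := intervalIntegrable_rhoConvSum_floor_div (hi hd) h0
    have h2 := intervalIntegrable_rhoConvSum_floor_div (mul_pos two_pos (hi hd)) h0
    rw [intervalIntegral.integral_const_mul, intervalIntegral.integral_sub h1 h2,
      integral_rhoConvSum_floor_div (hi hd) h0,
      integral_rhoConvSum_floor_div (mul_pos two_pos (hi hd)) h0]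
  · exact fun d hd => ((intervalIntegrable_rhoConvSum_floor_div (hi hd) h0).sub
      (intervalIntegrable_rhoConvSum_floor_div (mul_pos two_pos (hi hd)) h0)).const_mul _
  · intro v hv
    rw [Set.uIcc_of_le h0] at hv
    exact rhoSqSum_eq (hv.2.trans hx)

lemma intervalIntegrable_rhoSqSum (a b : ℝ) :
    IntervalIntegrable rhoSqSum MeasureTheory.volume a b :=
  rhoSqSum_mono.intervalIntegrable

lemma mul_rhoSqSum_le_integral {x h : ℝ} (hh : 0 ≤ h) :
    h * rhoSqSum x ≤ ∫ v in x..x + h, rhoSqSum v := by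
  have := intervalIntegral.integral_mono_on (by linarith : x ≤ x + h)
    (intervalIntegrable_const (c := rhoSqSum x)) (intervalIntegrable_rhoSqSum x (x + h))
    fun v hv => rhoSqSum_mono hv.1
  simpa using this

lemma integral_le_mul_rhoSqSum {x h : ℝ} (hh : 0 ≤ h) :
    ∫ v in x - h..x, rhoSqSum v ≤ h * rhoSqSum x := by
  have := intervalIntegral.integral_mono_on (by linarith : x - h ≤ x)
    (intervalIntegrable_rhoSqSum (x - h) x) (intervalIntegrable_const (c := rhoSqSum x))
    fun v hv => rhoSqSum_mono hv.2
  simpa using this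

lemma intervalIntegrable_zetaWeight_mul_moebiusPoly (Z : ℕ) (a b : ℝ) : IntervalIntegrable
    (fun t => zetaWeight t * ‖moebiusPoly Z t‖) MeasureTheory.volume a b :=
  (continuous_zetaWeight.mul (continuous_moebiusPoly Z).norm).intervalIntegrable a b

lemma integral_zetaWeight_mul_moebiusPoly_le_log (Z : ℕ) {a b : ℝ} (hab : a ≤ b) :
    ∫ t in a..b, zetaWeight t * ‖moebiusPoly Z t‖ ≤ (1 + Real.log Z) * ∫ t in a..b, zetaWeight t := by
  rw [← intervalIntegral.integral_const_mul]
  refine intervalIntegral.integral_mono_on hab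
    (intervalIntegrable_zetaWeight_mul_moebiusPoly Z a b)
    ((continuous_zetaWeight.intervalIntegrable a b).const_mul _) fun t _ => ?_
  rw [mul_comm]
  exact mul_le_mul_of_nonneg_right (norm_moebiusPoly_le Z t) (zetaWeight_nonneg t)

lemma exists_integral_zetaWeight_mul_moebiusPoly_le' : ∃ C : ℝ, 0 < C ∧
    ∀ (L : ℕ) (T : ℝ) (Z : ℕ), 2 ≤ L → 2 ≤ T → Real.log Z ≤ L → Real.log T ≤ L →
    ∫ t in T..2 * T, zetaWeight t * ‖moebiusPoly Z t‖ ≤ C * T * (L:ℝ) ^ 2 * Real.log L := by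
  obtain ⟨C₁, hC₁, h₁⟩ := exists_integral_zetaWeight_le
  obtain ⟨C₂, hC₂, h₂⟩ := exists_integral_zetaWeight_mul_moebiusPoly_le
  refine ⟨C₂ + 80000 * C₁, by positivity, fun L T Z hL hT hZ hTL => ?_⟩
  have hL2 : (2:ℝ) ≤ L := by exact_mod_cast hL
  have hlL : 0 ≤ Real.log L := Real.log_natCast_nonneg L
  have hT0 : 0 ≤ Real.log T := Real.log_nonneg (by linarith)
  by_cases hLT : (L:ℝ) ^ 200 ≤ T
  · refine (h₂ L T Z hL hT hZ hTL hLT).trans ?_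
    have : 0 ≤ 80000 * C₁ * T * (L:ℝ) ^ 2 * Real.log L := by positivity
    nlinarith
  · have h1 : Real.log T ≤ 200 * Real.log L := by
      have := Real.log_le_log (by linarith) (not_le.1 hLT).le
      rwa [Real.log_pow, Nat.cast_ofNat] at this
    have h2 : Real.log L ≤ L := Real.log_le_self (by positivity)
    calc ∫ t in T..2 * T, zetaWeight t * ‖moebiusPoly Z t‖
        ≤ (1 + Real.log Z) * ∫ t in T..2 * T, zetaWeight t :=
          integral_zetaWeight_mul_moebiusPoly_le_log Z (by linarith)
      _ ≤ (2 * L) * (C₁ * T * Real.log T ^ 2) :=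
          mul_le_mul (by linarith) (h₁ T hT)
            (intervalIntegral.integral_nonneg (by linarith) fun t _ => zetaWeight_nonneg t)
            (by positivity)
      _ ≤ (2 * L) * (C₁ * T * (200 * Real.log L) ^ 2) := by gcongr
      _ = 80000 * C₁ * T * L * Real.log L * Real.log L := by ring
      _ ≤ 80000 * C₁ * T * L * Real.log L * L := by gcongr
      _ ≤ _ := by
        have : 0 ≤ C₂ * T * (L:ℝ) ^ 2 * Real.log L := by positivity
        nlinarith

/-- The size of a smoothed Perron kernel with cut-off at height `Y`. -/
noncomputable def perronWeight (Y t : ℝ) : ℝ := min (1 + |t|) Y / (1 + t ^ 2)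

lemma continuous_perronWeight (Y : ℝ) : Continuous (perronWeight Y) :=
  ((continuous_const.add continuous_abs).min continuous_const).div
    (continuous_const.add (continuous_id.pow 2)) fun t => by positivity

lemma perronWeight_neg (Y t : ℝ) : perronWeight Y (-t) = perronWeight Y t := by
  simp [perronWeight]

lemma perronWeight_le_two {Y t : ℝ} : perronWeight Y t ≤ 2 := by
  rw [perronWeight, div_le_iff₀ (by positivity)]
  refine (min_le_left _ _).trans ?_
  rw [← sq_abs]
  nlinarith [sq_nonneg (|t| - 1)]

lemma perronWeight_le_div {Y t T : ℝ} (hT : 1 ≤ T) (ht : T ≤ t) : perronWeight Y t ≤ 2 / T := by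
  rw [perronWeight, div_le_div_iff₀ (by positivity) (by positivity)]
  refine (mul_le_mul_of_nonneg_right (min_le_left _ _) (by positivity)).trans ?_
  rw [abs_of_nonneg (by linarith)]
  nlinarith

lemma perronWeight_le_div_sq {Y t T : ℝ} (hY : 0 ≤ Y) (hT : 1 ≤ T) (ht : T ≤ t) :
    perronWeight Y t ≤ Y / T ^ 2 := by
  rw [perronWeight]
  exact div_le_div₀ hY (min_le_right _ _) (by positivity) (by nlinarith)

/-- The integrand majorizing the contribution of the critical line. -/
noncomputable def lineWeight (Z : ℕ) (Y t : ℝ) : ℝ :=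
  zetaWeight t * ‖moebiusPoly Z t‖ * perronWeight Y t

lemma continuous_lineWeight (Z : ℕ) (Y : ℝ) : Continuous (lineWeight Z Y) :=
  (continuous_zetaWeight.mul (continuous_moebiusPoly Z).norm).mul (continuous_perronWeight Y)

lemma intervalIntegrable_lineWeight (Z : ℕ) (Y a b : ℝ) :
    IntervalIntegrable (lineWeight Z Y) MeasureTheory.volume a b :=
  (continuous_lineWeight Z Y).intervalIntegrable a b

lemma integral_lineWeight_le {Z : ℕ} {Y a b c : ℝ} (hab : a ≤ b)
    (hc : ∀ t ∈ Set.Icc a b, perronWeight Y t ≤ c) :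
    ∫ t in a..b, lineWeight Z Y t ≤ (∫ t in a..b, zetaWeight t * ‖moebiusPoly Z t‖) * c := by
  rw [← intervalIntegral.integral_mul_const]
  refine intervalIntegral.integral_mono_on hab (intervalIntegrable_lineWeight Z Y a b)
    ((intervalIntegrable_zetaWeight_mul_moebiusPoly Z a b).mul_const c) fun t ht => ?_
  exact mul_le_mul_of_nonneg_left (hc t ht) (mul_nonneg (zetaWeight_nonneg t) (norm_nonneg _))

lemma exists_integral_lineWeight_le_of_le : ∃ C : ℝ, 0 < C ∧ ∀ (L Z j : ℕ) (Y : ℝ), 2 ≤ L →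
    Real.log Z ≤ L → j ≤ L →
    ∫ t in (0:ℝ)..2 ^ (j + 1), lineWeight Z Y t ≤ C * (L:ℝ) + j * (C * (L:ℝ) ^ 2 * Real.log L) := by
  obtain ⟨C, hC, h⟩ := exists_integral_zetaWeight_mul_moebiusPoly_le'
  have hI : 0 ≤ ∫ t in (0:ℝ)..2, zetaWeight t :=
    intervalIntegral.integral_nonneg (by norm_num) fun t _ => zetaWeight_nonneg t
  refine ⟨2 * C + 4 * ∫ t in (0:ℝ)..2, zetaWeight t, by positivity, fun L Z j Y hL hZ => ?_⟩
  set K := ∫ t in (0:ℝ)..2, zetaWeight t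
  have hL2 : (2:ℝ) ≤ L := by exact_mod_cast hL
  have hlL : 0 ≤ Real.log L := Real.log_natCast_nonneg L
  induction j with
  | zero =>
    intro _
    have h1 := integral_lineWeight_le (Z := Z) (Y := Y) (c := 2) (zero_le_two (α := ℝ))
      fun t _ => perronWeight_le_two
    have h2 := integral_zetaWeight_mul_moebiusPoly_le_log Z (zero_le_two (α := ℝ))
    have h3 : (1 + Real.log Z) * K ≤ (2 * L) * K := mul_le_mul_of_nonneg_right (by linarith) hI
    have h4 : 0 ≤ C * (L:ℝ) := by positivity
    simp only [zero_add, pow_one, Nat.cast_zero, zero_mul, add_zero]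
    nlinarith
  | succ j ih =>
    intro hj
    have hT : (2:ℝ) ≤ 2 ^ (j + 1) := by
      rw [pow_succ]; nlinarith [one_le_pow₀ (n := j) (one_le_two (α := ℝ))]
    have hlog : Real.log (2 ^ (j + 1)) ≤ L := by
      rw [Real.log_pow]
      have : ((j + 1 : ℕ) : ℝ) ≤ L := by exact_mod_cast hj
      nlinarith [Real.log_two_lt_d9, Real.log_two_gt_d9]
    have h1 := integral_lineWeight_le (Z := Z) (Y := Y) (a := 2 ^ (j + 1)) (b := 2 * 2 ^ (j + 1))
      (c := 2 / 2 ^ (j + 1)) (by linarith)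
      fun t ht => perronWeight_le_div (by linarith) ht.1
    have h2 := h L (2 ^ (j + 1)) Z hL hT hZ hlog
    have h3 : (∫ t in (2:ℝ) ^ (j + 1)..2 * 2 ^ (j + 1), zetaWeight t * ‖moebiusPoly Z t‖) *
        (2 / 2 ^ (j + 1)) ≤ 2 * C * (L:ℝ) ^ 2 * Real.log L := by
      refine (mul_le_mul_of_nonneg_right h2 (by positivity)).trans (le_of_eq ?_)
      field_simp
    have h5 : 0 ≤ K * ((L:ℝ) ^ 2 * Real.log L) := by positivity
    rw [pow_succ _ (j + 1), mul_comm _ (2:ℝ), ← intervalIntegral.integral_add_adjacent_intervals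
      (intervalIntegrable_lineWeight Z Y 0 (2 ^ (j + 1))) (intervalIntegrable_lineWeight Z Y _ _)]
    push_cast
    nlinarith [ih (by omega)]

lemma summable_add_two_sq_mul_geometric : Summable fun k : ℕ => ((k:ℝ) + 2) ^ 2 * (1 / 2) ^ k := by
  have h := summable_pow_mul_geometric_of_norm_lt_one 2 (r := (1 / 2 : ℝ)) (by norm_num)
  refine (((summable_nat_add_iff 2).2 h).mul_right 4).congr fun k => ?_
  push_cast
  ring

lemma exists_integral_lineWeight_tail_le : ∃ C : ℝ, 0 < C ∧ ∀ (L Z j k : ℕ), 2 ≤ L →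
    Real.log Z ≤ L → j ≤ L →
    ∫ t in (2:ℝ) ^ (j + 1)..2 ^ (j + 1 + k), lineWeight Z (2 ^ j) t ≤
      C * (L:ℝ) ^ 3 * ∑ i ∈ Finset.range k, ((i:ℝ) + 2) ^ 2 * (1 / 2) ^ i := by
  obtain ⟨C, hC, h⟩ := exists_integral_zetaWeight_le
  refine ⟨2 * C, by positivity, fun L Z j k hL hZ hj => ?_⟩
  have hL2 : (2:ℝ) ≤ L := by exact_mod_cast hL
  have hjL : (j:ℝ) ≤ L := by exact_mod_cast hj
  induction k with
  | zero => simp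
  | succ k ih =>
    set T : ℝ := 2 ^ (j + 1 + k) with hTdef
    have hT : (2:ℝ) ≤ T := by
      rw [hTdef, show j + 1 + k = (j + k) + 1 by ring, pow_succ]
      nlinarith [one_le_pow₀ (n := j + k) (one_le_two (α := ℝ))]
    have hlT0 : 0 ≤ Real.log T := Real.log_nonneg (by linarith)
    have hlT : Real.log T ≤ L * (k + 2) := by
      rw [hTdef, Real.log_pow]
      push_cast
      have h0 : (0:ℝ) ≤ k := k.cast_nonneg
      have h1 : ((j:ℝ) + 1 + k) * Real.log 2 ≤ ((j:ℝ) + 1 + k) * 1 :=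
        mul_le_mul_of_nonneg_left (by linarith [Real.log_two_lt_d9]) (by positivity)
      nlinarith
    have h1 := integral_lineWeight_le (Z := Z) (Y := 2 ^ j) (a := T) (b := 2 * T)
      (c := 2 ^ j / T ^ 2) (by linarith)
      fun t ht => perronWeight_le_div_sq (by positivity) (by linarith) ht.1
    have h2 : ∫ t in T..2 * T, zetaWeight t * ‖moebiusPoly Z t‖ ≤
        (2 * L) * (C * T * (L * (k + 2)) ^ 2) := by
      refine (integral_zetaWeight_mul_moebiusPoly_le_log Z (by linarith)).trans
        (mul_le_mul (by linarith) ((h T hT).trans (by gcongr))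
        (intervalIntegral.integral_nonneg (by linarith) fun t _ => zetaWeight_nonneg t)
        (by positivity))
    have hjT : 2 ^ j / T ^ 2 * T ≤ (1 / 2) ^ k := by
      have : T ≠ 0 := by positivity
      have e : 2 ^ j / T ^ 2 * T = 2 ^ j / T := by field_simp
      rw [e, hTdef, div_le_iff₀ (by positivity), pow_add, pow_succ, one_div, inv_pow]
      have : (0:ℝ) < 2 ^ j := by positivity
      field_simp
      linarith
    have h3 : (∫ t in T..2 * T, zetaWeight t * ‖moebiusPoly Z t‖) * (2 ^ j / T ^ 2) ≤
        2 * C * (L:ℝ) ^ 3 * (((k:ℝ) + 2) ^ 2 * (1 / 2) ^ k) := by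
      calc _ ≤ (2 * L) * (C * T * (L * (k + 2)) ^ 2) * (2 ^ j / T ^ 2) :=
            mul_le_mul_of_nonneg_right h2 (by positivity)
        _ = 2 * C * (L:ℝ) ^ 3 * ((k:ℝ) + 2) ^ 2 * (2 ^ j / T ^ 2 * T) := by ring
        _ ≤ 2 * C * (L:ℝ) ^ 3 * ((k:ℝ) + 2) ^ 2 * (1 / 2) ^ k := by gcongr
        _ = _ := by ring
    rw [← add_assoc, pow_succ _ (j + 1 + k), ← hTdef, mul_comm T 2, Finset.sum_range_succ, mul_add,
      ← intervalIntegral.integral_add_adjacent_intervals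
      (intervalIntegrable_lineWeight Z _ _ T) (intervalIntegrable_lineWeight Z _ _ _)]
    linarith

lemma exists_integral_lineWeight_le : ∃ C : ℝ, 0 < C ∧ ∀ (L Z j k : ℕ), 2 ≤ L →
    Real.log Z ≤ L → j ≤ L →
    ∫ t in (0:ℝ)..2 ^ (j + 1 + k), lineWeight Z (2 ^ j) t ≤ C * (L:ℝ) ^ 3 * Real.log L := by
  obtain ⟨C₁, hC₁, h₁⟩ := exists_integral_lineWeight_le_of_le
  obtain ⟨C₂, hC₂, h₂⟩ := exists_integral_lineWeight_tail_le
  set S := ∑' k : ℕ, ((k:ℝ) + 2) ^ 2 * (1 / 2) ^ k with hS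
  have hS0 : 0 ≤ S := tsum_nonneg fun k => by positivity
  refine ⟨3 * C₁ + 2 * (C₂ * S), by positivity, fun L Z j k hL hZ hj => ?_⟩
  have hL2 : (2:ℝ) ≤ L := by exact_mod_cast hL
  have hjL : (j:ℝ) ≤ L := by exact_mod_cast hj
  have hlL : 1 / 2 ≤ Real.log L :=
    le_trans (by linarith [Real.log_two_gt_d9]) (Real.log_le_log two_pos hL2)
  rw [← intervalIntegral.integral_add_adjacent_intervals
    (intervalIntegrable_lineWeight Z _ 0 (2 ^ (j + 1))) (intervalIntegrable_lineWeight Z _ _ _)]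
  calc _ ≤ (C₁ * L + j * (C₁ * (L:ℝ) ^ 2 * Real.log L)) + C₂ * (L:ℝ) ^ 3 * S := by
        refine add_le_add (h₁ L Z j _ hL hZ hj) ((h₂ L Z j k hL hZ hj).trans ?_)
        refine mul_le_mul_of_nonneg_left ?_ (by positivity)
        exact summable_add_two_sq_mul_geometric.sum_le_tsum _ fun i _ => by positivity
    _ ≤ (C₁ * ((L:ℝ) ^ 3 * (2 * Real.log L)) + L * (C₁ * (L:ℝ) ^ 2 * Real.log L)) +
        C₂ * (L:ℝ) ^ 3 * S * (2 * Real.log L) := by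
        refine add_le_add (add_le_add (mul_le_mul_of_nonneg_left ?_ hC₁.le) ?_) ?_
        · nlinarith [pow_le_pow_right₀ (by linarith : (1:ℝ) ≤ L) (by norm_num : 1 ≤ 3),
            pow_pos (by linarith : (0:ℝ) < L) 3]
        · exact mul_le_mul_of_nonneg_right hjL (by positivity)
        · exact le_mul_of_one_le_right (by positivity) (by linarith)
    _ = _ := by ring

lemma norm_moebiusPoly_neg (Z : ℕ) (t : ℝ) : ‖moebiusPoly Z (-t)‖ = ‖moebiusPoly Z t‖ := by
  have h : moebiusPoly Z (-t) = (starRingEnd ℂ) (moebiusPoly Z t) := by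
    rw [moebiusPoly, moebiusPoly, map_sum]
    refine Finset.sum_congr rfl fun d _ => ?_
    have hd : (starRingEnd ℂ) (d:ℂ) = d := Complex.conj_natCast d
    rw [map_mul, map_intCast]
    congr 1
    have h := Complex.cpow_conj (d:ℂ) (-(1 + 2 * t * I)) (by
      rw [Complex.natCast_arg]; exact Real.pi_pos.ne)
    rw [hd] at h
    rw [← h]
    congr 1
    simp only [map_neg, map_add, map_one, map_mul, map_ofNat, Complex.conj_ofReal, Complex.conj_I,
      Complex.ofReal_neg]
    ring
  rw [h, Complex.norm_conj]

lemma lineWeight_neg (Z : ℕ) (Y t : ℝ) : lineWeight Z Y (-t) = lineWeight Z Y t := by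
  rw [lineWeight, lineWeight, zetaWeight_neg, norm_moebiusPoly_neg, perronWeight_neg]

lemma norm_integral_le_of_even {F : ℝ → ℂ} {g : ℝ → ℝ} (hF : MeasureTheory.Integrable F)
    (hFg : ∀ t, ‖F t‖ ≤ g t) (hg : Continuous g) (heven : ∀ t, g (-t) = g t) {B : ℝ} {j : ℕ}
    (hB : ∀ k : ℕ, ∫ t in (0:ℝ)..2 ^ (j + k), g t ≤ B) : ‖∫ t, F t‖ ≤ 2 * B := by
  have hT : Tendsto (fun k : ℕ => (2:ℝ) ^ (j + k)) atTop atTop :=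
    (tendsto_pow_atTop_atTop_of_one_lt one_lt_two).comp
      (tendsto_atTop_mono (fun k => Nat.le_add_left k j) tendsto_id)
  have h := (MeasureTheory.intervalIntegral_tendsto_integral hF
    (tendsto_neg_atTop_atBot.comp hT) hT).norm
  refine le_of_tendsto' h fun k => ?_
  have h0 : (0:ℝ) ≤ 2 ^ (j + k) := by positivity
  simp only [Function.comp_apply]
  refine (intervalIntegral.norm_integral_le_of_norm_le (by linarith)
    (Eventually.of_forall fun t _ => hFg t) (hg.intervalIntegrable _ _)).trans ?_
  rw [← intervalIntegral.integral_add_adjacent_intervals (b := 0) (hg.intervalIntegrable _ _)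
    (hg.intervalIntegrable _ _)]
  have h1 : ∫ t in -(2:ℝ) ^ (j + k)..0, g t = ∫ t in (0:ℝ)..2 ^ (j + k), g t := by
    have := intervalIntegral.integral_comp_neg (a := 0) (b := (2:ℝ) ^ (j + k)) g
    rw [neg_zero] at this
    rw [← this]
    simp only [heven]
  rw [h1]
  linarith [hB k]

/-- The critical line integral in the explicit formula for the integrated sum of `rho n ^ 2`. -/
noncomputable def lineIntegral (Z : ℕ) (x : ℝ) : ℂ :=
  ∫ t : ℝ, (x:ℂ) ^ (3 / 2 + t * I : ℂ) * ((1 - (2:ℂ) ^ (-(1 / 2 + t * I) : ℂ)) *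
    moebiusPoly Z t * mellinRemainder (1 / 2 + t * I))

lemma norm_ofReal_cpow_line {y : ℝ} (hy : 0 < y) (a t : ℝ) :
    ‖(y:ℂ) ^ (a + t * I : ℂ)‖ = y ^ a := by
  rw [norm_cpow_eq_rpow_re_of_pos hy]; simp

lemma norm_one_sub_two_cpow_le (t : ℝ) : ‖1 - (2:ℂ) ^ (-(1 / 2 + t * I) : ℂ)‖ ≤ 2 := by
  refine (norm_sub_le _ _).trans ?_
  have h := norm_ofReal_cpow_line two_pos (-(1 / 2)) (-t)
  have h2 : (2:ℝ) ^ (-(1 / 2) : ℝ) ≤ 1 := Real.rpow_le_one_of_one_le_of_nonpos one_le_two (by norm_num)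
  have e : (-(1 / 2 + t * I) : ℂ) = ((-(1 / 2) : ℝ) : ℂ) + ((-t : ℝ) : ℂ) * I := by
    push_cast; ring
  rw [e]
  push_cast at h ⊢
  rw [h, norm_one]
  linarith

lemma integrable_mellinRemainder_half :
    MeasureTheory.Integrable fun t : ℝ => mellinRemainder (1 / 2 + t * I) := by
  simpa using integrable_mellinRemainder_line (σ := 1 / 2) le_rfl (by norm_num)

lemma integrable_mul_mellinRemainder {c : ℝ → ℂ} (hc : Continuous c) {B : ℝ}
    (hB : ∀ t, ‖c t‖ ≤ B) :
    MeasureTheory.Integrable fun t : ℝ => c t * mellinRemainder (1 / 2 + t * I) :=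
  integrable_mellinRemainder_half.bdd_mul hc.aestronglyMeasurable (Eventually.of_forall hB)

lemma integrable_cpow_mul_mellinRemainder {y : ℝ} (hy : 0 < y) :
    MeasureTheory.Integrable fun t : ℝ =>
      (y:ℂ) ^ (3 / 2 + t * I : ℂ) * mellinRemainder (1 / 2 + t * I) := by
  refine integrable_mul_mellinRemainder
    (Continuous.const_cpow (by fun_prop) (Or.inl (by exact_mod_cast hy.ne'))) (B := y ^ (3 / 2 : ℝ))
    fun t => ?_
  have := norm_ofReal_cpow_line hy (3 / 2) t
  push_cast at this
  exact this.le

lemma integrable_lineIntegrand (Z : ℕ) {x : ℝ} (hx : 0 < x) :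
    MeasureTheory.Integrable fun t : ℝ => (x:ℂ) ^ (3 / 2 + t * I : ℂ) *
      ((1 - (2:ℂ) ^ (-(1 / 2 + t * I) : ℂ)) *
        moebiusPoly Z t * mellinRemainder (1 / 2 + t * I)) := by
  have h1 : Continuous fun t : ℝ => (x:ℂ) ^ (3 / 2 + t * I : ℂ) :=
    Continuous.const_cpow (by fun_prop) (Or.inl (by exact_mod_cast hx.ne'))
  have h2 : Continuous fun t : ℝ => (2:ℂ) ^ (-(1 / 2 + t * I) : ℂ) :=
    Continuous.const_cpow (by fun_prop) (Or.inl two_ne_zero)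
  have h := integrable_mul_mellinRemainder
    (c := fun t : ℝ => (x:ℂ) ^ (3 / 2 + t * I : ℂ) * ((1 - (2:ℂ) ^ (-(1 / 2 + t * I) : ℂ)) *
      moebiusPoly Z t)) (B := x ^ (3 / 2 : ℝ) * (2 * (1 + Real.log Z)))
    (h1.mul ((continuous_const.sub h2).mul (continuous_moebiusPoly Z))) fun t => ?_
  · refine h.congr (Eventually.of_forall fun t => ?_)
    simp only [mul_assoc]
  · have := norm_ofReal_cpow_line hx (3 / 2) t
    push_cast at this
    rw [norm_mul, norm_mul, this]
    refine mul_le_mul_of_nonneg_left ?_ (by positivity)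
    exact mul_le_mul (norm_one_sub_two_cpow_le t) (norm_moebiusPoly_le Z t) (norm_nonneg _)
      zero_le_two

lemma mul_ofReal_div_cpow {x p : ℝ} (hx : 0 < x) (hp : 0 < p) (s : ℂ) :
    (p:ℂ) * ((x / p : ℝ) : ℂ) ^ s = (x:ℂ) ^ s * (p:ℂ) ^ (1 - s) := by
  rw [Complex.ofReal_div, div_eq_mul_inv, ← Complex.ofReal_inv,
    mul_cpow_ofReal_nonneg hx.le (by positivity), Complex.ofReal_inv,
    inv_cpow _ _ (by rw [Complex.arg_ofReal_of_nonneg hp.le]; exact Real.pi_pos.ne),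
    Complex.cpow_sub _ _ (by exact_mod_cast hp.ne'), Complex.cpow_one]
  ring

lemma two_mul_sq_cpow {d : ℕ} (t : ℝ) (hd : 0 < d) :
    ((2 * (d:ℝ) ^ 2 : ℝ) : ℂ) ^ (1 - (3 / 2 + t * I) : ℂ) =
      (2:ℂ) ^ (-(1 / 2 + t * I) : ℂ) * (d:ℂ) ^ (-(1 + 2 * t * I) : ℂ) := by
  rw [Complex.ofReal_mul, mul_cpow_ofReal_nonneg zero_le_two (by positivity)]
  have h := Complex.natCast_cpow_natCast_mul d 2 (1 - (3 / 2 + t * I) : ℂ)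
  push_cast at h ⊢
  rw [← h]
  congr 2 <;> ring

lemma sq_cpow_line {d : ℕ} (t : ℝ) :
    (((d:ℝ) ^ 2 : ℝ) : ℂ) ^ (1 - (3 / 2 + t * I) : ℂ) = (d:ℂ) ^ (-(1 + 2 * t * I) : ℂ) := by
  have h := Complex.natCast_cpow_natCast_mul d 2 (1 - (3 / 2 + t * I) : ℂ)
  push_cast at h ⊢
  rw [← h]
  congr 1
  ring

/-- The polar part of the integrated sum of `rho n ^ 2`. -/
noncomputable def polarPart (Z : ℕ) (x : ℝ) : ℂ :=
  ∑ d ∈ Finset.Ioc 0 Z, (oddMoebius d : ℂ) *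
    ((d:ℂ) ^ 2 * rhoConvMain (max (x / (d:ℝ) ^ 2) 1) -
      2 * (d:ℂ) ^ 2 * rhoConvMain (max (x / (2 * (d:ℝ) ^ 2)) 1))

lemma ofReal_integral_rhoSqSum {x : ℝ} {Z : ℕ} (h0 : 0 < x) (hx : x ≤ (Z:ℝ) ^ 2) :
    ((∫ v in (0:ℝ)..x, rhoSqSum v : ℝ) : ℂ) =
      polarPart Z x + ((1 / (2 * Real.pi) : ℝ) : ℂ) * lineIntegral Z x := by
  have hline : lineIntegral Z x = ∑ d ∈ Finset.Ioc 0 Z, (oddMoebius d : ℂ) *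
      ((d:ℂ) ^ 2 * (∫ t : ℝ, ((x / (d:ℝ) ^ 2 : ℝ) : ℂ) ^ (3 / 2 + t * I : ℂ) *
          mellinRemainder (1 / 2 + t * I)) -
        2 * (d:ℂ) ^ 2 * (∫ t : ℝ, ((x / (2 * (d:ℝ) ^ 2) : ℝ) : ℂ) ^ (3 / 2 + t * I : ℂ) *
          mellinRemainder (1 / 2 + t * I))) := by
    have hd0 {d : ℕ} (hd : d ∈ Finset.Ioc 0 Z) : 0 < (d:ℝ) ^ 2 := by
      have : 0 < d := (Finset.mem_Ioc.1 hd).1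
      positivity
    have hi1 {d : ℕ} (hd : d ∈ Finset.Ioc 0 Z) :=
      integrable_cpow_mul_mellinRemainder (div_pos h0 (hd0 hd))
    have hi2 {d : ℕ} (hd : d ∈ Finset.Ioc 0 Z) :=
      integrable_cpow_mul_mellinRemainder (div_pos h0 (mul_pos two_pos (hd0 hd)))
    have hterm {d : ℕ} (hd : d ∈ Finset.Ioc 0 Z) : (oddMoebius d : ℂ) *
        ((d:ℂ) ^ 2 * (∫ t : ℝ, ((x / (d:ℝ) ^ 2 : ℝ) : ℂ) ^ (3 / 2 + t * I : ℂ) *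
            mellinRemainder (1 / 2 + t * I)) -
          2 * (d:ℂ) ^ 2 * (∫ t : ℝ, ((x / (2 * (d:ℝ) ^ 2) : ℝ) : ℂ) ^ (3 / 2 + t * I : ℂ) *
            mellinRemainder (1 / 2 + t * I))) = ∫ t : ℝ, (oddMoebius d : ℂ) *
        ((d:ℂ) ^ 2 * (((x / (d:ℝ) ^ 2 : ℝ) : ℂ) ^ (3 / 2 + t * I : ℂ) *
            mellinRemainder (1 / 2 + t * I)) -
          2 * (d:ℂ) ^ 2 * (((x / (2 * (d:ℝ) ^ 2) : ℝ) : ℂ) ^ (3 / 2 + t * I : ℂ) *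
            mellinRemainder (1 / 2 + t * I))) := by
      rw [MeasureTheory.integral_const_mul,
        MeasureTheory.integral_sub ((hi1 hd).const_mul _) ((hi2 hd).const_mul _),
        MeasureTheory.integral_const_mul, MeasureTheory.integral_const_mul]
    rw [Finset.sum_congr rfl fun d hd => hterm hd, ← MeasureTheory.integral_finsetSum]
    · refine MeasureTheory.integral_congr_ae (Eventually.of_forall fun t => ?_)
      simp only [moebiusPoly, Finset.mul_sum, Finset.sum_mul]
      refine Finset.sum_congr rfl fun d hd => ?_
      have e1 := mul_ofReal_div_cpow h0 (hd0 hd) (3 / 2 + t * I)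
      have e2 := mul_ofReal_div_cpow h0 (mul_pos two_pos (hd0 hd)) (3 / 2 + t * I)
      rw [sq_cpow_line] at e1
      rw [two_mul_sq_cpow t (Finset.mem_Ioc.1 hd).1] at e2
      push_cast at e1 e2 ⊢
      linear_combination (-(oddMoebius d : ℂ) * mellinRemainder (1 / 2 + t * I)) * e1 +
        ((oddMoebius d : ℂ) * mellinRemainder (1 / 2 + t * I)) * e2
    · exact fun d hd => (((hi1 hd).const_mul _).sub ((hi2 hd).const_mul _)).const_mul _
  rw [integral_rhoSqSum h0.le hx, hline, polarPart, Finset.mul_sum, ← Finset.sum_add_distrib]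
  push_cast
  refine Finset.sum_congr rfl fun d hd => ?_
  have hd0 : 0 < (d:ℝ) ^ 2 := by
    have : 0 < d := (Finset.mem_Ioc.1 hd).1
    positivity
  rw [rhoConvInt_eq (div_pos h0 hd0), rhoConvInt_eq (div_pos h0 (mul_pos two_pos hd0))]
  push_cast
  ring

lemma norm_cpow_line_sub_le {a b t : ℝ} (ha : 0 < a) (hab : a ≤ b) :
    ‖(b:ℂ) ^ (3 / 2 + t * I : ℂ) - (a:ℂ) ^ (3 / 2 + t * I : ℂ)‖ ≤
      (2 + |t|) * Real.sqrt b * (b - a) := by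
  set s : ℂ := 3 / 2 + t * I with hs
  have hs0 : s ≠ 0 := fun h => by
    have := congrArg Complex.re h
    simp [hs] at this
  have hsn : ‖s‖ ≤ 2 + |t| := by
    refine (norm_add_le _ _).trans (add_le_add ?_ ?_)
    · norm_num
    · simp
  have h := Convex.norm_image_sub_le_of_norm_hasDerivWithin_le (s := Set.Icc a b)
    (f := fun y : ℝ => (y:ℂ) ^ s) (f' := fun y => s * (y:ℂ) ^ (s - 1)) (x := a) (y := b)
    (C := (2 + |t|) * Real.sqrt b)
    (fun y hy => (hasDerivAt_ofReal_cpow_const (ha.trans_le hy.1).ne' hs0).hasDerivWithinAt)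
    (fun y hy => ?_) (convex_Icc a b) (Set.left_mem_Icc.2 hab) (Set.right_mem_Icc.2 hab)
  · rwa [Real.norm_of_nonneg (by linarith)] at h
  · have hy0 : 0 < y := ha.trans_le hy.1
    have e : s - 1 = ((1 / 2 : ℝ) : ℂ) + t * I := by rw [hs]; push_cast; ring
    rw [norm_mul, e, norm_ofReal_cpow_line hy0, ← Real.sqrt_eq_rpow]
    exact mul_le_mul hsn (Real.sqrt_le_sqrt hy.2) (Real.sqrt_nonneg _) (by positivity)

lemma norm_cpow_line_sub_le_min {a b t x Y : ℝ} (ha : 0 < a) (hab : b = a + Real.sqrt x)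
    (hb : b ≤ 2 * x) (hY : Real.sqrt x ≤ Y) (hx : 1 ≤ x) :
    ‖(b:ℂ) ^ (3 / 2 + t * I : ℂ) - (a:ℂ) ^ (3 / 2 + t * I : ℂ)‖ ≤ 6 * x * min (1 + |t|) Y := by
  have hs := Real.sq_sqrt (by linarith : 0 ≤ x)
  have hs0 : 0 < Real.sqrt x := Real.sqrt_pos.2 (by linarith)
  have hsb : Real.sqrt b ≤ 3 / 2 * Real.sqrt x := by
    refine Real.sqrt_le_iff.2 ⟨by positivity, ?_⟩
    nlinarith
  have hb0 : 0 < b := by linarith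
  rw [mul_min_of_nonneg _ _ (by positivity)]
  refine le_min ?_ ?_
  · refine (norm_cpow_line_sub_le ha (by linarith)).trans ?_
    rw [show b - a = Real.sqrt x by linarith]
    calc (2 + |t|) * Real.sqrt b * Real.sqrt x
        ≤ (2 + |t|) * (3 / 2 * Real.sqrt x) * Real.sqrt x := by gcongr
      _ = 3 / 2 * (2 + |t|) * Real.sqrt x ^ 2 := by ring
      _ = 3 / 2 * (2 + |t|) * x := by rw [hs]
      _ ≤ 6 * x * (1 + |t|) := by
        nlinarith [abs_nonneg t, mul_nonneg (abs_nonneg t) (by linarith : 0 ≤ x)]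
  · have e (y : ℝ) (hy : 0 < y) : ‖(y:ℂ) ^ (3 / 2 + t * I : ℂ)‖ = y * Real.sqrt y := by
      have := norm_ofReal_cpow_line hy (3 / 2) t
      push_cast at this
      rw [this, show (3 / 2 : ℝ) = 1 + 1 / 2 by norm_num, Real.rpow_add hy, Real.rpow_one,
        ← Real.sqrt_eq_rpow]
    refine (norm_sub_le _ _).trans ?_
    rw [e b hb0, e a ha]
    have h1 : a * Real.sqrt a ≤ b * Real.sqrt b :=
      mul_le_mul (by linarith) (Real.sqrt_le_sqrt (by linarith)) (Real.sqrt_nonneg _) hb0.le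
    have h2 : b * Real.sqrt b ≤ (2 * x) * (3 / 2 * Y) :=
      mul_le_mul hb (by linarith) (Real.sqrt_nonneg _) (by positivity)
    linarith

lemma exists_norm_lineIntegral_sub_le : ∃ C : ℝ, 0 < C ∧ ∀ (L Z j : ℕ) (x a b : ℝ), 2 ≤ L →
    Real.log Z ≤ L → j ≤ L → 1 ≤ x → 0 < a → b = a + Real.sqrt x → b ≤ 2 * x →
    Real.sqrt x ≤ 2 ^ j →
    ‖lineIntegral Z b - lineIntegral Z a‖ ≤ C * x * (L:ℝ) ^ 3 * Real.log L := by
  obtain ⟨C₁, hC₁, h₁⟩ := norm_mellinRemainder_half_le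
  obtain ⟨C₂, hC₂, h₂⟩ := exists_integral_lineWeight_le
  refine ⟨2 * (12 * C₁ * C₂), by positivity, fun L Z j x a b hL hZ hj hx ha hab hb hY => ?_⟩
  have hb0 : 0 < b := by rw [hab]; positivity
  rw [lineIntegral, lineIntegral,
    ← MeasureTheory.integral_sub (integrable_lineIntegrand Z hb0) (integrable_lineIntegrand Z ha)]
  refine (norm_integral_le_of_even (g := fun t => 12 * C₁ * x * lineWeight Z (2 ^ j) t) (j := j + 1)
    (B := 12 * C₁ * x * (C₂ * (L:ℝ) ^ 3 * Real.log L))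
    ((integrable_lineIntegrand Z hb0).sub (integrable_lineIntegrand Z ha)) (fun t => ?_)
    ((continuous_lineWeight Z _).const_mul _) (fun t => by rw [lineWeight_neg]) fun k => ?_).trans
    (le_of_eq (by ring))
  · rw [Pi.sub_apply, ← sub_mul, norm_mul, norm_mul, norm_mul]
    have k1 := norm_cpow_line_sub_le_min (t := t) ha hab hb hY hx
    have k2 : ‖1 - (2:ℂ) ^ (-(1 / 2 + t * I) : ℂ)‖ * ‖moebiusPoly Z t‖ *
        ‖mellinRemainder (1 / 2 + t * I)‖ ≤
        2 * ‖moebiusPoly Z t‖ * (C₁ * zetaWeight t / (1 + t ^ 2)) :=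
      mul_le_mul (mul_le_mul_of_nonneg_right (norm_one_sub_two_cpow_le t) (norm_nonneg _)) (h₁ t)
        (norm_nonneg _) (by positivity)
    refine (mul_le_mul k1 k2 (by positivity)
      (mul_nonneg (by linarith) (le_min (by positivity) (by positivity)))).trans (le_of_eq ?_)
    rw [lineWeight, perronWeight]
    ring
  · rw [intervalIntegral.integral_const_mul]
    exact mul_le_mul_of_nonneg_left (h₂ L Z j k hL hZ hj) (by positivity)

lemma abs_sq_mul_log_sub_le {a b : ℝ} (ha : 1 ≤ a) (hab : a ≤ b) (hb : b ≤ 2 * a) :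
    |b ^ 2 * Real.log b - a ^ 2 * Real.log a - (b - a) * (2 * a * Real.log a + a)| ≤
      (b - a) ^ 2 * (3 + Real.log a) := by
  have ha0 : 0 < a := by linarith
  have hb0 : 0 < b := by linarith
  have hla : 0 ≤ Real.log a := Real.log_nonneg ha
  have hlog : Real.log (b / a) = Real.log b - Real.log a := Real.log_div hb0.ne' ha0.ne'
  have h1 : b * (Real.log b - Real.log a) ≥ b - a := by
    have := Real.one_sub_inv_le_log_of_pos (div_pos hb0 ha0)
    rw [hlog, inv_div] at this
    calc b - a = b * (1 - a / b) := by field_simp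
      _ ≤ _ := mul_le_mul_of_nonneg_left this hb0.le
  have h2 : a * (Real.log b - Real.log a) ≤ b - a := by
    have := Real.log_le_sub_one_of_pos (div_pos hb0 ha0)
    rw [hlog] at this
    calc _ ≤ a * (b / a - 1) := mul_le_mul_of_nonneg_left this ha0.le
      _ = b - a := by field_simp
  set u := Real.log b - Real.log a with hu
  set δ := b - a with hδ
  have e : b ^ 2 * Real.log b - a ^ 2 * Real.log a - δ * (2 * a * Real.log a + a) =
      b ^ 2 * u - a * δ + δ ^ 2 * Real.log a := by
    rw [hδ, hu]; ring
  have hδ0 : 0 ≤ δ := by linarith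
  have hδa : δ ≤ a := by linarith
  have hu0 : 0 ≤ u := sub_nonneg.2 (Real.log_le_log ha0 hab)
  have hlow : a * δ ≤ b ^ 2 * u := by nlinarith
  have hup : b ^ 2 * u ≤ a * δ + 3 * δ ^ 2 := by
    have h3 : b ^ 2 * u = a * (a * u) + 2 * δ * (a * u) + δ * (δ * u) := by rw [hδ]; ring
    have h4 : δ * u ≤ a * u := mul_le_mul_of_nonneg_right hδa hu0
    rw [h3]
    nlinarith
  rw [e, abs_le]
  constructor
  · nlinarith [mul_nonneg (sq_nonneg δ) hla]
  · nlinarith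

lemma abs_sq_mul_log_max_sub_le {a b : ℝ} (ha : 0 < a) (hab : a ≤ b) (hb : b ≤ 2 * a) :
    |max b 1 ^ 2 * Real.log (max b 1) - max a 1 ^ 2 * Real.log (max a 1) -
      (b - a) * (2 * a * Real.log a + a)| ≤
      7 * ((b - a) * (1 + (b - a) * (1 + max (Real.log a) 0))) := by
  have hδ : 0 ≤ b - a := by linarith
  rcases le_or_gt 1 a with h1 | h1
  · rw [max_eq_left h1, max_eq_left (h1.trans hab)]
    have hl := Real.log_nonneg h1
    rw [max_eq_left hl]
    refine (abs_sq_mul_log_sub_le h1 hab hb).trans ?_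
    nlinarith [mul_nonneg (sq_nonneg (b - a)) hl, sq_nonneg (b - a)]
  · rw [max_eq_right h1.le (a := a), Real.log_one, mul_zero, sub_zero]
    have hy : |max b 1 ^ 2 * Real.log (max b 1)| ≤ 4 * (b - a) := by
      have hB0 : 1 ≤ max b 1 := le_max_right _ _
      have hB2 : max b 1 ≤ 2 := max_le (by linarith) (by norm_num)
      have hBd : max b 1 - 1 ≤ b - a := by
        rcases max_cases b 1 with h | h <;> rw [h.1] <;> linarith
      have hl := Real.log_le_sub_one_of_pos (by linarith : 0 < max b 1)
      have hl0 := Real.log_nonneg hB0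
      rw [abs_of_nonneg (by positivity)]
      exact mul_le_mul (by nlinarith) (hl.trans hBd) hl0 (by norm_num)
    have hm : |2 * a * Real.log a + a| ≤ 3 := by
      have hl := Real.one_sub_inv_le_log_of_pos ha
      have h2 : a - 1 ≤ a * Real.log a := by
        calc a - 1 = a * (1 - a⁻¹) := by field_simp
          _ ≤ _ := mul_le_mul_of_nonneg_left hl ha.le
      have h3 : a * Real.log a ≤ 0 :=
        mul_nonpos_of_nonneg_of_nonpos ha.le (Real.log_nonpos ha.le h1.le)
      rw [abs_le]; constructor <;> nlinarith
    have hm2 : |(b - a) * (2 * a * Real.log a + a)| ≤ (b - a) * 3 := by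
      rw [abs_mul, abs_of_nonneg hδ]
      exact mul_le_mul_of_nonneg_left hm hδ
    refine (abs_sub _ _).trans ?_
    have : 0 ≤ (b - a) * ((b - a) * (1 + max (Real.log a) 0)) := by positivity
    linarith

lemma abs_sq_sub_max_sub_le {a b : ℝ} (ha : 0 < a) (hab : a ≤ b) (hb : b ≤ 2 * a) :
    |max b 1 ^ 2 - max b 1 - (max a 1 ^ 2 - max a 1) - (b - a) * (2 * a)| ≤
      7 * ((b - a) * (1 + (b - a) * (1 + max (Real.log a) 0))) := by
  have hδ : 0 ≤ b - a := by linarith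
  have h0 : 0 ≤ (b - a) * (b - a) * max (Real.log a) 0 := by positivity
  rcases le_or_gt 1 a with h1 | h1
  · rw [max_eq_left h1 (b := 1), max_eq_left (h1.trans hab) (b := 1)]
    rw [abs_le]; constructor <;> nlinarith
  · rw [max_eq_right h1.le (a := a)]
    have hB0 : 1 ≤ max b 1 := le_max_right _ _
    have hB2 : max b 1 ≤ 2 := max_le (by linarith) (by norm_num)
    have hBd : max b 1 - 1 ≤ b - a := by
      rcases max_cases b 1 with h | h <;> rw [h.1] <;> linarith
    rw [abs_le]; constructor <;> nlinarith

/-- The derivative of the polar main term `rhoConvMain`, up to a constant. -/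
noncomputable def rhoConvDensity (y : ℝ) : ℂ :=
  leadCoeff * (2 * y * Real.log y + y : ℝ) + secondCoeff * (2 * y : ℝ)

lemma exists_norm_rhoConvMain_sub_le : ∃ C : ℝ, 0 < C ∧ ∀ a b : ℝ, 0 < a → a ≤ b → b ≤ 2 * a →
    ‖rhoConvMain (max b 1) - rhoConvMain (max a 1) - ((b - a : ℝ) : ℂ) * rhoConvDensity a‖ ≤
      C * ((b - a) * (1 + (b - a) * (1 + max (Real.log a) 0))) := by
  refine ⟨7 * (1 + ‖leadCoeff‖ + ‖secondCoeff‖), by positivity, fun a b ha hab hb => ?_⟩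
  have h1 := abs_sq_mul_log_max_sub_le ha hab hb
  have h2 := abs_sq_sub_max_sub_le ha hab hb
  have hδ : 0 ≤ b - a := by linarith
  have e : rhoConvMain (max b 1) - rhoConvMain (max a 1) - ((b - a : ℝ) : ℂ) * rhoConvDensity a =
      leadCoeff * ((max b 1 ^ 2 * Real.log (max b 1) - max a 1 ^ 2 * Real.log (max a 1) -
        (b - a) * (2 * a * Real.log a + a) : ℝ) : ℂ) +
      secondCoeff * ((max b 1 ^ 2 - max b 1 - (max a 1 ^ 2 - max a 1) -
        (b - a) * (2 * a) : ℝ) : ℂ) := by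
    simp only [rhoConvMain, rhoConvDensity, Complex.ofReal_sub, Complex.ofReal_mul,
      Complex.ofReal_add]
    ring
  rw [e]
  refine (norm_add_le _ _).trans ?_
  rw [norm_mul, norm_mul, Complex.norm_real, Complex.norm_real, Real.norm_eq_abs, Real.norm_eq_abs]
  have k1 := mul_le_mul_of_nonneg_left h1 (norm_nonneg leadCoeff)
  have k2 := mul_le_mul_of_nonneg_left h2 (norm_nonneg secondCoeff)
  have : 0 ≤ (b - a) * (1 + (b - a) * (1 + max (Real.log a) 0)) := by positivity
  nlinarith

lemma exists_norm_mul_rhoConvMain_sub_le : ∃ C : ℝ, 0 < C ∧ ∀ X H p : ℝ, 1 ≤ X → 0 ≤ H → H ≤ X →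
    1 ≤ p → ‖(p:ℂ) * rhoConvMain (max ((X + H) / p) 1) - (p:ℂ) * rhoConvMain (max (X / p) 1) -
      (H:ℂ) * rhoConvDensity (X / p)‖ ≤ C * (H * (1 + H / p * (1 + Real.log X))) := by
  obtain ⟨C, hC, h⟩ := exists_norm_rhoConvMain_sub_le
  refine ⟨C, hC, fun X H p hX hH hHX hp => ?_⟩
  have hp0 : 0 < p := by linarith
  have hδ : (X + H) / p - X / p = H / p := by ring
  have h1 := h (X / p) ((X + H) / p) (by positivity) (by gcongr; linarith)
    (by rw [← mul_div_assoc]; gcongr; linarith)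
  rw [hδ] at h1
  have e : (p:ℂ) * rhoConvMain (max ((X + H) / p) 1) - (p:ℂ) * rhoConvMain (max (X / p) 1) -
      (H:ℂ) * rhoConvDensity (X / p) = (p:ℂ) * (rhoConvMain (max ((X + H) / p) 1) -
        rhoConvMain (max (X / p) 1) - ((H / p : ℝ) : ℂ) * rhoConvDensity (X / p)) := by
    have : (p:ℂ) ≠ 0 := by exact_mod_cast hp0.ne'
    push_cast
    field_simp
  rw [e, norm_mul, Complex.norm_of_nonneg hp0.le]
  refine (mul_le_mul_of_nonneg_left h1 hp0.le).trans ?_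
  have hl : max (Real.log (X / p)) 0 ≤ Real.log X :=
    max_le (Real.log_le_log (by positivity) (div_le_self (by linarith) hp)) (Real.log_nonneg hX)
  calc p * (C * (H / p * (1 + H / p * (1 + max (Real.log (X / p)) 0))))
      = C * (H * (1 + H / p * (1 + max (Real.log (X / p)) 0))) := by field_simp
    _ ≤ _ := by gcongr

/-- The density of the polar part of the integrated sum of `rho n ^ 2`. -/
noncomputable def polarDensity (Z : ℕ) (X : ℝ) : ℂ :=
  ∑ d ∈ Finset.Ioc 0 Z, (oddMoebius d : ℂ) *
    (rhoConvDensity (X / (d:ℝ) ^ 2) - rhoConvDensity (X / (2 * (d:ℝ) ^ 2)))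

lemma exists_norm_polarPart_sub_le : ∃ C : ℝ, 0 < C ∧ ∀ (Z : ℕ) (X H : ℝ), 1 ≤ X → 0 ≤ H → H ≤ X →
    ‖polarPart Z (X + H) - polarPart Z X - (H:ℂ) * polarDensity Z X‖ ≤
      C * (H * (Z + H * (1 + Real.log X))) := by
  obtain ⟨C, hC, h⟩ := exists_norm_mul_rhoConvMain_sub_le
  refine ⟨4 * C, by positivity, fun Z X H hX hH hHX => ?_⟩
  have hlX := Real.log_nonneg hX
  have hterm : ∀ d ∈ Finset.Ioc 0 Z, ‖(oddMoebius d : ℂ) *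
      ((d:ℂ) ^ 2 * rhoConvMain (max ((X + H) / (d:ℝ) ^ 2) 1) -
        2 * (d:ℂ) ^ 2 * rhoConvMain (max ((X + H) / (2 * (d:ℝ) ^ 2)) 1)) - (oddMoebius d : ℂ) *
      ((d:ℂ) ^ 2 * rhoConvMain (max (X / (d:ℝ) ^ 2) 1) -
        2 * (d:ℂ) ^ 2 * rhoConvMain (max (X / (2 * (d:ℝ) ^ 2)) 1)) -
      (H:ℂ) * ((oddMoebius d : ℂ) * (rhoConvDensity (X / (d:ℝ) ^ 2) -
        rhoConvDensity (X / (2 * (d:ℝ) ^ 2))))‖ ≤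
      2 * C * H + 2 * C * H * H * (1 + Real.log X) * ((d:ℝ) ^ 2)⁻¹ := fun d hd => by
    have hd1 : (1:ℝ) ≤ (d:ℝ) ^ 2 := one_le_pow₀ (by exact_mod_cast (Finset.mem_Ioc.1 hd).1)
    have h1 := h X H ((d:ℝ) ^ 2) hX hH hHX hd1
    have h2 := h X H (2 * (d:ℝ) ^ 2) hX hH hHX (by linarith)
    have h3 : C * (H * (1 + H / (2 * (d:ℝ) ^ 2) * (1 + Real.log X))) ≤
        C * (H * (1 + H / (d:ℝ) ^ 2 * (1 + Real.log X))) := by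
      gcongr
      linarith
    push_cast at h1 h2
    have h4 := norm_sub_le_of_le h1 (h2.trans h3)
    calc _ = ‖(oddMoebius d : ℂ) *
          ((d:ℂ) ^ 2 * rhoConvMain (max ((X + H) / (d:ℝ) ^ 2) 1) -
            (d:ℂ) ^ 2 * rhoConvMain (max (X / (d:ℝ) ^ 2) 1) -
            (H:ℂ) * rhoConvDensity (X / (d:ℝ) ^ 2) -
            (2 * (d:ℂ) ^ 2 * rhoConvMain (max ((X + H) / (2 * (d:ℝ) ^ 2)) 1) -
            2 * (d:ℂ) ^ 2 * rhoConvMain (max (X / (2 * (d:ℝ) ^ 2)) 1) -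
            (H:ℂ) * rhoConvDensity (X / (2 * (d:ℝ) ^ 2))))‖ := by
          congr 1
          ring
      _ ≤ _ := by
          rw [norm_mul]
          refine (mul_le_of_le_one_left (norm_nonneg _) (norm_oddMoebius_le d)).trans ?_
          refine h4.trans (le_of_eq ?_)
          ring
  rw [polarPart, polarPart, polarDensity, Finset.mul_sum, ← Finset.sum_sub_distrib,
    ← Finset.sum_sub_distrib]
  refine (norm_sum_le _ _).trans ((Finset.sum_le_sum hterm).trans ?_)
  rw [Finset.sum_add_distrib, Finset.sum_const, Nat.card_Ioc, nsmul_eq_mul, Nat.sub_zero,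
    ← Finset.mul_sum]
  have h5 := mul_le_mul_of_nonneg_left (sum_inv_sq_le Z)
    (by positivity : 0 ≤ 2 * C * H * H * (1 + Real.log X))
  have h6 : 0 ≤ C * H * Z := by positivity
  nlinarith

lemma polarDensity_eq (Z : ℕ) {X : ℝ} (hX : 0 < X) : polarDensity Z X =
    (X:ℂ) * ((leadCoeff * (Real.log X + Real.log 2 + 1 / 2) + secondCoeff) *
      (∑ d ∈ Finset.Ioc 0 Z, (oddMoebius d : ℂ) / (d:ℂ) ^ 2) - 2 * leadCoeff *
      ∑ d ∈ Finset.Ioc 0 Z, (oddMoebius d : ℂ) * Real.log d / (d:ℂ) ^ 2) := by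
  rw [polarDensity, Finset.mul_sum, Finset.mul_sum, ← Finset.sum_sub_distrib, Finset.mul_sum]
  refine Finset.sum_congr rfl fun d hd => ?_
  have hd0 : (d:ℝ) ≠ 0 := by
    have := (Finset.mem_Ioc.1 hd).1
    positivity
  have hd0' : (d:ℂ) ≠ 0 := by exact_mod_cast hd0
  have l1 : Real.log (X / (d:ℝ) ^ 2) = Real.log X - 2 * Real.log d := by
    rw [Real.log_div hX.ne' (by positivity), Real.log_pow]; push_cast; ring
  have l2 : Real.log (X / (2 * (d:ℝ) ^ 2)) = Real.log X - Real.log 2 - 2 * Real.log d := by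
    rw [Real.log_div hX.ne' (by positivity), Real.log_mul two_ne_zero (by positivity),
      Real.log_pow]; push_cast; ring
  rw [rhoConvDensity, rhoConvDensity, l1, l2]
  push_cast
  field_simp
  ring

lemma LFunction_one_eq_pi_div_four {N : ℕ} [NeZero N] (χ : DirichletCharacter ℂ N) (hχ : χ ≠ 1)
    (hseries : ∀ s : ℂ, 1 < s.re →
      χ.LFunction s = ∑' j : ℕ, (-1) ^ j * ((2 * j + 1 : ℕ) : ℂ) ^ (-s)) :
    χ.LFunction 1 = Real.pi / 4 := by
  set S : ℝ → ℕ → ℝ := fun s n => ∑ i ∈ Finset.range n, (-1) ^ i * ((2 * i + 1 : ℕ) : ℝ) ^ (-s)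
    with hS
  have hsum : ∀ s : ℝ, 1 < s →
      HasSum (fun j : ℕ => ((-1) ^ j * ((2 * j + 1 : ℕ) : ℝ) ^ (-s) : ℝ))
        (χ.LFunction s).re ∧ (χ.LFunction s).im = 0 := fun s hs => by
    have h1 : Summable fun j : ℕ => ((-1) ^ j * ((2 * j + 1 : ℕ) : ℝ) ^ (-s) : ℝ) := by
      refine Summable.of_norm ?_
      have h2 : Summable fun n : ℕ => (n : ℝ) ^ (-s) := Real.summable_nat_rpow.2 (by linarith)
      refine (h2.comp_injective (i := fun j : ℕ => 2 * j + 1) fun a b h => ?_).congr fun j => ?_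
      · simpa using h
      · rw [Function.comp_apply, norm_mul, norm_pow, norm_neg, norm_one, one_pow, one_mul,
          Real.norm_of_nonneg (by positivity)]
    have h3 : χ.LFunction s = ((∑' j : ℕ, (-1) ^ j * ((2 * j + 1 : ℕ) : ℝ) ^ (-s) : ℝ) : ℂ) := by
      rw [hseries s (by simpa using hs), Complex.ofReal_tsum]
      refine tsum_congr fun j => ?_
      rw [Complex.ofReal_mul, Complex.ofReal_cpow (by positivity)]
      push_cast
      rfl
    rw [h3, Complex.ofReal_re, Complex.ofReal_im]
    exact ⟨h1.hasSum, rfl⟩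
  have hanti : ∀ s : ℝ, 1 < s → Antitone fun i : ℕ => ((2 * i + 1 : ℕ) : ℝ) ^ (-s) :=
    fun s hs a b hab => Real.rpow_le_rpow_of_nonpos (by positivity) (by gcongr) (by linarith)
  have hcont : Continuous fun s : ℝ => χ.LFunction s :=
    (DirichletCharacter.differentiable_LFunction hχ).continuous.comp Complex.continuous_ofReal
  have hlim : Tendsto (fun s : ℝ => χ.LFunction s) (nhdsWithin 1 (Set.Ioi 1))
      (nhds (χ.LFunction 1)) := by
    simpa using (hcont.tendsto 1).mono_left nhdsWithin_le_nhds
  have hSlim : ∀ n, Tendsto (fun s : ℝ => S s n) (nhdsWithin 1 (Set.Ioi 1)) (nhds (S 1 n)) :=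
    fun n => by
      have : Continuous fun s : ℝ => S s n := by
        refine continuous_finsetSum _ fun i _ => continuous_const.mul ?_
        exact (Real.continuous_const_rpow (by positivity)).comp continuous_neg
      exact (this.tendsto 1).mono_left nhdsWithin_le_nhds
  have hre := (Complex.continuous_re.tendsto _).comp hlim
  have him := (Complex.continuous_im.tendsto _).comp hlim
  have hlow : ∀ k, S 1 (2 * k) ≤ (χ.LFunction 1).re := fun k =>
    le_of_tendsto_of_tendsto (hSlim _) hre <| by
      filter_upwards [self_mem_nhdsWithin] with s hs
      exact (hanti s hs).alternating_series_le_tendsto (hsum s hs).1.tendsto_sum_nat k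
  have hup : ∀ k, (χ.LFunction 1).re ≤ S 1 (2 * k + 1) := fun k =>
    le_of_tendsto_of_tendsto hre (hSlim _) <| by
      filter_upwards [self_mem_nhdsWithin] with s hs
      exact (hanti s hs).tendsto_le_alternating_series (hsum s hs).1.tendsto_sum_nat k
  have hS1 : S 1 = fun n => ∑ i ∈ Finset.range n, (-1 : ℝ) ^ i / (2 * i + 1) := by
    funext n
    refine Finset.sum_congr rfl fun i _ => ?_
    rw [Real.rpow_neg_one, div_eq_mul_inv]
    push_cast
    rfl
  have hpi := Real.tendsto_sum_pi_div_four
  rw [← hS1] at hpi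
  have e1 : (χ.LFunction 1).re = Real.pi / 4 := by
    refine le_antisymm (ge_of_tendsto (hpi.comp (tendsto_atTop_mono (fun k => ?_) tendsto_id))
      (Eventually.of_forall hup)) (le_of_tendsto
      (hpi.comp (tendsto_atTop_mono (fun k => ?_) tendsto_id)) (Eventually.of_forall hlow))
    · simp only [id]; omega
    · simp only [id]; omega
  have e2 : (χ.LFunction 1).im = 0 := by
    refine tendsto_nhds_unique him (tendsto_const_nhds.congr' ?_)
    filter_upwards [self_mem_nhdsWithin] with s hs
    exact (hsum s hs).2.symm
  refine Complex.ext ?_ ?_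
  · rw [e1, show (Real.pi / 4 : ℂ) = ((Real.pi / 4 : ℝ) : ℂ) by push_cast; rfl, Complex.ofReal_re]
  · rw [e2, show (Real.pi / 4 : ℂ) = ((Real.pi / 4 : ℝ) : ℂ) by push_cast; rfl, Complex.ofReal_im]

lemma abscissaOfAbsConv_oddMoebius_le :
    LSeries.abscissaOfAbsConv (fun n => (oddMoebius n : ℂ)) ≤ 1 :=
  LSeries.abscissaOfAbsConv_le_of_le_const ⟨1, fun n _ => norm_oddMoebius_le n⟩

lemma LSeries_oddMoebius_eq {s : ℂ} (hs : 1 < s.re) :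
    LSeries (fun n => (oddMoebius n : ℂ)) s = ((1 - (2:ℂ) ^ (-s)) * riemannZeta s)⁻¹ := by
  have h1 := DirichletCharacter.LSeries.mul_mu_eq_one (1 : DirichletCharacter ℂ 2) hs
  rw [← DirichletCharacter.LFunction_eq_LSeries _ hs] at h1
  have h2 := DirichletCharacter.LFunctionTrivChar_eq_mul_riemannZeta (N := 2) (s := s)
    (by rintro rfl; simp at hs)
  rw [DirichletCharacter.LFunctionTrivChar, Nat.prime_two.primeFactors, Finset.prod_singleton] at h2
  rw [h2] at h1
  push_cast at h1
  rw [← eq_inv_of_mul_eq_one_right h1]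
  refine LSeries_congr (fun {n} hn => ?_) s
  simp only [Pi.mul_apply]
  rw [oddMoebius]
  split_ifs with h
  · rw [MulChar.one_apply, one_mul]
    exact (ZMod.isUnit_iff_coprime n 2).2 h.coprime_two_right
  · rw [MulChar.map_nonunit, zero_mul, Int.cast_zero]
    rw [ZMod.isUnit_iff_coprime]
    simpa using h

lemma hasSum_oddMoebius_div_sq :
    HasSum (fun d : ℕ => (oddMoebius d : ℂ) / (d:ℂ) ^ 2) (8 / (Real.pi:ℂ) ^ 2) := by
  have h2 : (1:ℝ) < (2:ℂ).re := by norm_num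
  have hs : LSeriesSummable (fun n => (oddMoebius n : ℂ)) 2 :=
    LSeriesSummable_of_abscissaOfAbsConv_lt_re
      (abscissaOfAbsConv_oddMoebius_le.trans_lt (by exact_mod_cast h2))
  have h3 := hs.LSeriesHasSum
  rw [LSeriesHasSum, LSeries_oddMoebius_eq h2] at h3
  have hpi : (Real.pi:ℂ) ≠ 0 := by exact_mod_cast Real.pi_ne_zero
  have e : ((1 - (2:ℂ) ^ (-(2:ℂ))) * riemannZeta 2)⁻¹ = 8 / (Real.pi:ℂ) ^ 2 := by
    rw [riemannZeta_two, Complex.cpow_neg, Complex.cpow_ofNat]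
    field_simp
    norm_num
  rw [e] at h3
  refine h3.congr_fun fun n => ?_
  rcases eq_or_ne n 0 with rfl | hn
  · simp
  · rw [LSeries.term_of_ne_zero hn, Complex.cpow_ofNat]

lemma hasSum_oddMoebius_mul_log_div_sq :
    HasSum (fun d : ℕ => (oddMoebius d : ℂ) * Real.log d / (d:ℂ) ^ 2)
      (8 / (Real.pi:ℂ) ^ 2 * (6 * deriv riemannZeta 2 / (Real.pi:ℂ) ^ 2 + Real.log 2 / 3)) := by
  have h2 : (1:ℝ) < (2:ℂ).re := by norm_num
  have habs : LSeries.abscissaOfAbsConv (fun n => (oddMoebius n : ℂ)) < (2:ℂ).re :=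
    abscissaOfAbsConv_oddMoebius_le.trans_lt (by exact_mod_cast h2)
  have hs := (LSeriesSummable_logMul_of_lt_re habs).LSeriesHasSum
  have hd := LSeries_hasDerivAt habs
  have hev : LSeries (fun n => (oddMoebius n : ℂ)) =ᶠ[nhds 2]
      fun s => ((1 - (2:ℂ) ^ (-s)) * riemannZeta s)⁻¹ := by
    filter_upwards [(isOpen_lt continuous_const Complex.continuous_re).mem_nhds h2] with s hs
    exact LSeries_oddMoebius_eq hs
  have hz := (differentiableAt_riemannZeta (s := 2) (by norm_num)).hasDerivAt
  have hp : HasDerivAt (fun s : ℂ => 1 - (2:ℂ) ^ (-s)) ((2:ℂ) ^ (-2:ℂ) * Complex.log 2) 2 := by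
    have := ((hasDerivAt_neg (2:ℂ)).const_cpow (c := 2) (Or.inl two_ne_zero)).const_sub 1
    exact this.congr_deriv (by ring)
  have hpi : (Real.pi:ℂ) ≠ 0 := by exact_mod_cast Real.pi_ne_zero
  have h4 : (2:ℂ) ^ (-2:ℂ) = 1 / 4 := by
    rw [Complex.cpow_neg, Complex.cpow_ofNat]; norm_num
  have hne : (1 - (2:ℂ) ^ (-2:ℂ)) * riemannZeta 2 ≠ 0 := by
    rw [h4, riemannZeta_two]
    refine mul_ne_zero (by norm_num) (div_ne_zero (pow_ne_zero _ hpi) (by norm_num))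
  have hF := ((hp.mul hz).inv hne).congr_of_eventuallyEq hev
  have huniq := hd.unique hF
  rw [Pi.mul_apply, h4, riemannZeta_two] at huniq
  have hval : LSeries (LSeries.logMul fun n => (oddMoebius n : ℂ)) 2 = 8 / (Real.pi:ℂ) ^ 2 *
      (6 * deriv riemannZeta 2 / (Real.pi:ℂ) ^ 2 + Real.log 2 / 3) := by
    rw [neg_div, neg_inj] at huniq
    rw [huniq, Complex.ofReal_log (by norm_num)]
    push_cast
    field_simp
    ring
  rw [LSeriesHasSum, hval] at hs
  refine hs.congr_fun fun n => ?_
  rcases eq_or_ne n 0 with rfl | hn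
  · simp
  · rw [LSeries.term_of_ne_zero hn, Complex.cpow_ofNat, LSeries.logMul, Complex.natCast_log]
    ring

lemma sum_Ioc_log_div_sq_le {Z M : ℕ} (hZ : 1 ≤ Z) (hM : Z ≤ M) :
    ∑ d ∈ Finset.Ioc Z M, (1 + Real.log d) / (d:ℝ) ^ 2 ≤
      (3 + Real.log Z) / Z - (3 + Real.log M) / M := by
  induction M, hM using Nat.le_induction with
  | base => simp
  | succ m hm ih =>
    rw [Finset.sum_Ioc_succ_top hm]
    have hm1 : (1:ℝ) ≤ m := by exact_mod_cast hZ.trans hm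
    have hm0 : (0:ℝ) < m := by linarith
    have hlog : Real.log (m + 1) ≤ Real.log m + 1 / m := by
      have := Real.log_le_sub_one_of_pos (by positivity : (0:ℝ) < (m + 1) / m)
      rw [Real.log_div (by positivity) hm0.ne'] at this
      have e : ((m:ℝ) + 1) / m - 1 = 1 / m := by field_simp; ring
      linarith
    have hl := Real.log_nonneg hm1
    have h1 : (1 + Real.log (m + 1)) / ((m:ℝ) + 1) ^ 2 ≤
        (3 + Real.log m) / m - (3 + Real.log (m + 1)) / (m + 1) := by
      have h2 : (3 + Real.log (m + 1) - 1 / m) / m ≤ (3 + Real.log m) / m := by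
        gcongr; linarith
      refine le_trans ?_ (sub_le_sub_right h2 _)
      set u := Real.log ((m:ℝ) + 1)
      have hu : 0 ≤ u := Real.log_nonneg (by linarith)
      rw [← sub_nonneg]
      have e : (3 + u - 1 / (m:ℝ)) / m - (3 + u) / (m + 1) - (1 + u) / ((m:ℝ) + 1) ^ 2 =
          (m ^ 2 + m + u * m - 1) / (m ^ 2 * (m + 1) ^ 2) := by
        field_simp
        ring
      rw [e]
      refine div_nonneg ?_ (by positivity)
      nlinarith [mul_nonneg hu hm0.le]
    push_cast
    linarith

lemma norm_sum_Ioc_sub_le_of_hasSum {g : ℕ → ℂ} {S : ℂ} (hg : HasSum g S) (hg0 : g 0 = 0)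
    (hle : ∀ d : ℕ, ‖g d‖ ≤ (1 + Real.log d) / (d:ℝ) ^ 2) {Z : ℕ} (hZ : 1 ≤ Z) :
    ‖∑ d ∈ Finset.Ioc 0 Z, g d - S‖ ≤ (3 + Real.log Z) / Z := by
  have hlim : Tendsto (fun M : ℕ => ‖∑ d ∈ Finset.Ioc 0 Z, g d - ∑ d ∈ Finset.Ioc 0 M, g d‖) atTop
      (nhds ‖∑ d ∈ Finset.Ioc 0 Z, g d - S‖) := by
    refine (tendsto_const_nhds.sub ?_).norm
    refine (hg.tendsto_sum_nat.comp (tendsto_add_atTop_nat 1)).congr fun M => ?_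
    rw [Function.comp_apply, Finset.range_eq_Ico, ← Finset.sum_Ioo_add_eq_sum_Ico M.succ_pos, hg0,
      add_zero]
    refine Finset.sum_congr ?_ fun _ _ => rfl
    ext d
    simp only [Finset.mem_Ioo, Finset.mem_Ioc]
    omega
  refine le_of_tendsto hlim ?_
  filter_upwards [eventually_ge_atTop Z] with M hM
  rw [← Finset.sum_Ioc_consecutive g (Nat.zero_le Z) hM, sub_add_cancel_left, norm_neg]
  refine (norm_sum_le_of_le _ fun d _ => hle d).trans ((sum_Ioc_log_div_sq_le hZ hM).trans ?_)
  have : 0 ≤ Real.log M := Real.log_natCast_nonneg M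
  have : 0 ≤ (3 + Real.log M) / M := by positivity
  linarith

/-- The coefficient of `X` in the limiting form of `polarDensity`. -/
noncomputable def rhoSqCoeff : ℂ :=
  8 / (Real.pi:ℂ) ^ 2 * (leadCoeff * (Real.log 2 + 1 / 2) + secondCoeff -
    2 * leadCoeff * (6 * deriv riemannZeta 2 / (Real.pi:ℂ) ^ 2 + Real.log 2 / 3))

/-- The main term of `rhoSqSum`. -/
noncomputable def rhoSqMain (x : ℝ) : ℂ :=
  8 / (Real.pi:ℂ) ^ 2 * leadCoeff * (x * Real.log x : ℝ) + rhoSqCoeff * x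

lemma exists_norm_polarDensity_sub_le : ∃ C : ℝ, 0 < C ∧ ∀ (Z : ℕ) (X : ℝ), 1 ≤ X → 1 ≤ Z →
    ‖polarDensity Z X - rhoSqMain X‖ ≤
      C * (X * (1 + Real.log X) * ((3 + Real.log Z) / Z)) := by
  refine ⟨3 * ‖leadCoeff‖ + ‖leadCoeff * (Real.log 2 + 1 / 2) + secondCoeff‖ + 1, by positivity,
    fun Z X hX hZ => ?_⟩
  have hlX := Real.log_nonneg hX
  have t1 := norm_sum_Ioc_sub_le_of_hasSum hasSum_oddMoebius_div_sq (by simp) (fun d => by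
    have hl : 0 ≤ Real.log d := Real.log_natCast_nonneg d
    rw [norm_div, norm_pow, Complex.norm_natCast]
    gcongr
    exact (norm_oddMoebius_le d).trans (by linarith)) hZ
  have t2 := norm_sum_Ioc_sub_le_of_hasSum hasSum_oddMoebius_mul_log_div_sq (by simp) (fun d => by
    have hl : 0 ≤ Real.log d := Real.log_natCast_nonneg d
    rw [norm_div, norm_pow, Complex.norm_natCast, norm_mul, Complex.norm_of_nonneg hl]
    gcongr
    exact (mul_le_of_le_one_left hl (norm_oddMoebius_le d)).trans (by linarith)) hZ
  rw [polarDensity_eq Z (by linarith)]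
  set A := ∑ d ∈ Finset.Ioc 0 Z, (oddMoebius d : ℂ) / (d:ℂ) ^ 2
  set B := ∑ d ∈ Finset.Ioc 0 Z, (oddMoebius d : ℂ) * Real.log d / (d:ℂ) ^ 2
  set a : ℂ := 8 / (Real.pi:ℂ) ^ 2 with ha
  set b : ℂ := 6 * deriv riemannZeta 2 / (Real.pi:ℂ) ^ 2 + Real.log 2 / 3 with hb
  set T := (3 + Real.log Z) / Z
  set D := leadCoeff * (Real.log 2 + 1 / 2) + secondCoeff with hD
  have hT : 0 ≤ T := (norm_nonneg _).trans t1
  have e : (X:ℂ) * ((leadCoeff * (Real.log X + Real.log 2 + 1 / 2) + secondCoeff) * A -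
      2 * leadCoeff * B) - rhoSqMain X =
      (X:ℂ) * (leadCoeff * (Real.log X : ℝ) * (A - a) + D * (A - a) -
        2 * leadCoeff * (B - a * b)) := by
    rw [rhoSqMain, rhoSqCoeff, ← ha, ← hb, hD]
    push_cast
    ring
  rw [e, norm_mul, Complex.norm_of_nonneg (by linarith : 0 ≤ X)]
  have k1 : ‖leadCoeff * (Real.log X : ℝ) * (A - a)‖ ≤ ‖leadCoeff‖ * Real.log X * T := by
    rw [norm_mul, norm_mul, Complex.norm_of_nonneg hlX]
    gcongr
  have k2 : ‖D * (A - a)‖ ≤ ‖D‖ * T := by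
    rw [norm_mul]; gcongr
  have k3 : ‖2 * leadCoeff * (B - a * b)‖ ≤ 2 * ‖leadCoeff‖ * T := by
    rw [norm_mul, norm_mul, Complex.norm_ofNat]; gcongr
  have k4 := (norm_sub_le _ _).trans (add_le_add ((norm_add_le _ _).trans (add_le_add k1 k2)) k3)
  refine (mul_le_mul_of_nonneg_left k4 (by linarith : 0 ≤ X)).trans ?_
  have hp : 0 ≤ ‖leadCoeff‖ * T := by positivity
  have hq : 0 ≤ ‖D‖ * T := by positivity
  have k5 : ‖leadCoeff‖ * Real.log X * T + ‖D‖ * T + 2 * ‖leadCoeff‖ * T ≤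
      (3 * ‖leadCoeff‖ + ‖D‖ + 1) * (1 + Real.log X) * T := by
    nlinarith [mul_nonneg hp hlX, mul_nonneg hq hlX, mul_nonneg hT hlX]
  calc X * _ ≤ X * ((3 * ‖leadCoeff‖ + ‖D‖ + 1) * (1 + Real.log X) * T) :=
        mul_le_mul_of_nonneg_left k5 (by linarith)
    _ = _ := by ring

lemma exists_norm_rhoSqMain_sub_le : ∃ C : ℝ, 0 < C ∧ ∀ a x : ℝ, 1 ≤ a → a ≤ x →
    ‖rhoSqMain a - rhoSqMain x‖ ≤ C * ((x - a) * (1 + Real.log x)) := by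
  refine ⟨‖8 / (Real.pi:ℂ) ^ 2 * leadCoeff‖ + ‖rhoSqCoeff‖ + 1, by positivity,
    fun a x ha hax => ?_⟩
  have hx0 : 0 < x := by linarith
  have hlx := Real.log_nonneg (ha.trans hax)
  have h1 : |a * Real.log a - x * Real.log x| ≤ (x - a) * (1 + Real.log x) := by
    have h2 : a * Real.log a ≤ x * Real.log x :=
      mul_le_mul hax (Real.log_le_log (by linarith) hax) (Real.log_nonneg ha) hx0.le
    have h3 : a * (Real.log x - Real.log a) ≤ x - a := by
      have := Real.log_le_sub_one_of_pos (div_pos hx0 (by linarith : 0 < a))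
      rw [Real.log_div hx0.ne' (by linarith)] at this
      calc _ ≤ a * (x / a - 1) := mul_le_mul_of_nonneg_left this (by linarith)
        _ = x - a := by field_simp
    rw [abs_of_nonpos (by linarith)]
    nlinarith
  have e : rhoSqMain a - rhoSqMain x = 8 / (Real.pi:ℂ) ^ 2 * leadCoeff *
      (a * Real.log a - x * Real.log x : ℝ) + rhoSqCoeff * (a - x : ℝ) := by
    rw [rhoSqMain, rhoSqMain]; push_cast; ring
  have h4 : |a - x| ≤ (x - a) * (1 + Real.log x) := by
    rw [abs_of_nonpos (by linarith)]
    nlinarith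
  rw [e]
  refine (norm_add_le _ _).trans ?_
  rw [norm_mul _ (((a * Real.log a - x * Real.log x : ℝ)) : ℂ), norm_mul rhoSqCoeff,
    Complex.norm_real, Complex.norm_real, Real.norm_eq_abs, Real.norm_eq_abs]
  have k1 := mul_le_mul_of_nonneg_left h1 (norm_nonneg (8 / (Real.pi:ℂ) ^ 2 * leadCoeff))
  have k2 := mul_le_mul_of_nonneg_left h4 (norm_nonneg rhoSqCoeff)
  have : 0 ≤ (x - a) * (1 + Real.log x) := mul_nonneg (by linarith) (by linarith)
  linarith

lemma exists_norm_integral_rhoSqSum_div_sub_le : ∃ C : ℝ, 0 < C ∧ ∀ (x a : ℝ) (L : ℕ), 16 ≤ x →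
    x - Real.sqrt x ≤ a → a ≤ x → Real.log x + 4 ≤ L →
    ‖((1 / Real.sqrt x * ∫ v in a..a + Real.sqrt x, rhoSqSum v : ℝ) : ℂ) - rhoSqMain x‖ ≤
      C * (Real.sqrt x * (L:ℝ) ^ 3 * Real.log L) := by
  obtain ⟨C₁, hC₁, h₁⟩ := exists_norm_polarPart_sub_le
  obtain ⟨C₂, hC₂, h₂⟩ := exists_norm_lineIntegral_sub_le
  obtain ⟨C₃, hC₃, h₃⟩ := exists_norm_polarDensity_sub_le
  obtain ⟨C₄, hC₄, h₄⟩ := exists_norm_rhoSqMain_sub_le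
  refine ⟨4 * C₁ + C₂ + C₃ + C₄, by positivity, fun x a L hx ha hax hL => ?_⟩
  set H := Real.sqrt x with hH
  have hHH : H * H = x := Real.mul_self_sqrt (by linarith)
  have hH4 : 4 ≤ H := Real.le_sqrt_of_sq_le (by linarith)
  have hHx : 4 * H ≤ x := by nlinarith
  have ha1 : 1 ≤ a := by linarith
  have hlx : 0 ≤ Real.log x := Real.log_nonneg (by linarith)
  have hla : Real.log a ≤ Real.log x := Real.log_le_log (by linarith) hax
  have hla0 : 0 ≤ Real.log a := Real.log_nonneg ha1
  have hL4 : (4:ℝ) ≤ L := by linarith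
  set Z : ℕ := ⌈2 * H⌉₊ with hZ
  have hZ1 : 2 * H ≤ Z := Nat.le_ceil _
  have hZ2 : (Z:ℝ) ≤ 3 * H := by
    have := (Nat.ceil_lt_add_one (by linarith : 0 ≤ 2 * H)).le
    linarith
  have hZ0 : (0:ℝ) < Z := by linarith
  have hZsq : a + H ≤ (Z:ℝ) ^ 2 := by nlinarith
  have hlH : Real.log H = Real.log x / 2 := Real.log_sqrt (by linarith)
  have hlZ : Real.log Z ≤ L := by
    have h5 : Real.log Z ≤ Real.log (3 * H) := Real.log_le_log hZ0 hZ2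
    rw [Real.log_mul (by norm_num) (by linarith), hlH] at h5
    have := Real.log_le_sub_one_of_pos (by norm_num : (0:ℝ) < 3)
    linarith
  have h2L : H ≤ 2 ^ L := by
    rw [← Real.log_le_log_iff (by linarith) (by positivity), Real.log_pow, hlH]
    have := Real.log_two_gt_d9
    nlinarith
  have hlogL : 1 ≤ Real.log L := by
    have h5 : Real.log 4 ≤ Real.log L := Real.log_le_log (by norm_num) hL4
    have h6 : Real.log 4 = 2 * Real.log 2 := by
      rw [show (4:ℝ) = 2 ^ 2 by norm_num, Real.log_pow]; push_cast; ring
    have := Real.log_two_gt_d9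
    linarith
  set E := H * (L:ℝ) ^ 3 * Real.log L with hE
  have hE2 : H * (L:ℝ) ^ 2 ≤ E := by
    have h5 : H * (L:ℝ) ^ 2 * 1 ≤ H * (L:ℝ) ^ 2 * (L * Real.log L) := by
      gcongr
      nlinarith
    rw [hE]
    nlinarith
  have hE1 : H * L ≤ E := by
    refine le_trans ?_ hE2
    gcongr
    nlinarith
  have i0 : ∀ a b, IntervalIntegrable rhoSqSum MeasureTheory.volume a b :=
    fun a b => intervalIntegrable_rhoSqSum a b
  have hint : ((∫ v in a..a + H, rhoSqSum v : ℝ) : ℂ) =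
      (polarPart Z (a + H) - polarPart Z a) + ((1 / (2 * Real.pi) : ℝ) : ℂ) *
        (lineIntegral Z (a + H) - lineIntegral Z a) := by
    rw [← intervalIntegral.integral_interval_sub_left (i0 0 (a + H)) (i0 0 a), Complex.ofReal_sub,
      ofReal_integral_rhoSqSum (by linarith) hZsq, ofReal_integral_rhoSqSum (by linarith)
      (by linarith)]
    ring
  have b1 := h₁ Z a H ha1 (by linarith) (by linarith)
  have b2 := h₂ L Z L x a (a + H) (by exact_mod_cast (by linarith : (2:ℝ) ≤ L)) hlZ le_rfl
    (by linarith) (by linarith) rfl (by linarith) h2L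
  have b3 := h₃ Z a ha1 (by exact_mod_cast (by linarith : (1:ℝ) ≤ Z))
  have b4 := h₄ a x ha1 hax
  have hH0 : (H:ℂ) ≠ 0 := by exact_mod_cast (by linarith : H ≠ 0)
  have hsplit : ((1 / H * ∫ v in a..a + H, rhoSqSum v : ℝ) : ℂ) - rhoSqMain x =
      ((1 / H : ℝ) : ℂ) * (polarPart Z (a + H) - polarPart Z a - (H:ℂ) * polarDensity Z a) +
      ((1 / H * (1 / (2 * Real.pi)) : ℝ) : ℂ) * (lineIntegral Z (a + H) - lineIntegral Z a) +
      (polarDensity Z a - rhoSqMain a) + (rhoSqMain a - rhoSqMain x) := by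
    rw [Complex.ofReal_mul, hint]
    push_cast
    field_simp
    ring
  have c1 : ‖((1 / H : ℝ) : ℂ) *
      (polarPart Z (a + H) - polarPart Z a - (H:ℂ) * polarDensity Z a)‖ ≤ 4 * C₁ * E := by
    rw [norm_mul, Complex.norm_of_nonneg (by positivity)]
    calc _ ≤ 1 / H * (C₁ * (H * (Z + H * (1 + Real.log a)))) := by gcongr
      _ = C₁ * (Z + H * (1 + Real.log a)) := by field_simp
      _ ≤ C₁ * (4 * (H * L)) := by gcongr; nlinarith
      _ ≤ C₁ * (4 * E) := by gcongr
      _ = _ := by ring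
  have c2 : ‖((1 / H * (1 / (2 * Real.pi)) : ℝ) : ℂ) *
      (lineIntegral Z (a + H) - lineIntegral Z a)‖ ≤ C₂ * E := by
    rw [norm_mul, Complex.norm_of_nonneg (by positivity)]
    have hpi : 1 / (2 * Real.pi) ≤ 1 := by
      rw [div_le_one (by positivity)]
      linarith [Real.pi_gt_three]
    calc _ ≤ 1 / H * 1 * (C₂ * x * (L:ℝ) ^ 3 * Real.log L) := by gcongr
      _ = C₂ * E := by rw [hE, ← hHH]; field_simp
  have c3 : ‖polarDensity Z a - rhoSqMain a‖ ≤ C₃ * E := by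
    refine b3.trans (mul_le_mul_of_nonneg_left (le_trans ?_ hE2) hC₃.le)
    have h5 : 0 ≤ Real.log Z := Real.log_natCast_nonneg Z
    calc a * (1 + Real.log a) * ((3 + Real.log Z) / Z)
        ≤ x * L * ((2 * L) / (2 * H)) := by
          gcongr
          · linarith
          · linarith
      _ = H * (L:ℝ) ^ 2 := by rw [← hHH]; field_simp
  have c4 : ‖rhoSqMain a - rhoSqMain x‖ ≤ C₄ * E := by
    refine b4.trans (mul_le_mul_of_nonneg_left (le_trans ?_ hE1) hC₄.le)
    exact mul_le_mul (by linarith) (by linarith) (by linarith) (by linarith)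
  rw [hsplit]
  refine (norm_add_le_of_le (norm_add_le_of_le (norm_add_le_of_le c1 c2) c3) c4).trans
    (le_of_eq ?_)
  ring

lemma exists_norm_rhoSqSum_sub_le : ∃ C : ℝ, 0 < C ∧ ∀ (x : ℝ) (L : ℕ), 16 ≤ x →
    Real.log x + 4 ≤ L →
    ‖(rhoSqSum x : ℂ) - rhoSqMain x‖ ≤ C * (Real.sqrt x * (L:ℝ) ^ 3 * Real.log L) := by
  obtain ⟨C, hC, h⟩ := exists_norm_integral_rhoSqSum_div_sub_le
  refine ⟨3 * C, by positivity, fun x L hx hL => ?_⟩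
  set H := Real.sqrt x with hH
  have hH0 : 0 < H := Real.sqrt_pos.2 (by linarith)
  have h1 := h x x L hx (by linarith) le_rfl hL
  have h2 := h x (x - H) L hx le_rfl (by linarith) hL
  rw [sub_add_cancel] at h2
  set E := H * (L:ℝ) ^ 3 * Real.log L
  set P := 1 / H * ∫ v in x..x + H, rhoSqSum v with hP
  set Q := 1 / H * ∫ v in x - H..x, rhoSqSum v with hQ
  have hBP : rhoSqSum x ≤ P := by
    rw [hP, one_div, ← div_eq_inv_mul, le_div_iff₀ hH0, mul_comm]
    exact mul_rhoSqSum_le_integral hH0.le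
  have hQB : Q ≤ rhoSqSum x := by
    rw [hQ, one_div, ← div_eq_inv_mul, div_le_iff₀ hH0, mul_comm]
    exact integral_le_mul_rhoSqSum hH0.le
  have h3 : ‖(rhoSqSum x : ℂ) - P‖ ≤ ‖(P : ℂ) - Q‖ := by
    rw [← Complex.ofReal_sub, ← Complex.ofReal_sub, Complex.norm_real, Complex.norm_real,
      Real.norm_of_nonpos (by linarith), Real.norm_of_nonneg (by linarith)]
    linarith
  have h4 : ‖(P : ℂ) - Q‖ ≤ C * E + C * E := by
    rw [← sub_sub_sub_cancel_right _ _ (rhoSqMain x)]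
    exact norm_sub_le_of_le h1 h2
  have h5 := norm_add_le_of_le (h3.trans h4) h1
  rw [sub_add_sub_cancel] at h5
  linarith

lemma eq_chiC_of_ne_one {χ : DirichletCharacter ℂ 4} (hχ : χ ≠ 1) : χ = chiC := by
  have h3u : IsUnit (3 : ZMod 4) := by decide
  have hcases : ∀ a : ZMod 4, IsUnit a → a = 1 ∨ a = 3 := by decide
  have hsq : χ 3 * χ 3 = 1 := by
    rw [← map_mul, show (3 : ZMod 4) * 3 = 1 by decide, map_one]
  rcases mul_self_eq_one_iff.1 hsq with h | h
  · refine absurd (MulChar.ext fun a => ?_) hχ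
    rw [MulChar.one_apply a.isUnit]
    rcases hcases a a.isUnit with h1 | h1 <;> rw [h1]
    · exact map_one χ
    · exact h
  · refine MulChar.ext fun a => ?_
    rcases hcases a a.isUnit with h1 | h1 <;> rw [h1]
    · rw [map_one, map_one]
    · rw [h, chiC_apply, show ZMod.χ₄ 3 = -1 by decide]
      norm_num

lemma sum_rTwoSquares_sq (x : ℝ) :
    ∑ n ∈ Finset.Icc 1 ⌊x⌋₊, ((rTwoSquares n : ℂ)) ^ 2 = 16 * (rhoSqSum x : ℂ) := by
  rw [rhoSqSum, Complex.ofReal_sum, Finset.mul_sum]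
  refine Finset.sum_congr rfl fun n hn => ?_
  have h := rTwoSquares_eq_four_mul_rho (n := n)
    (Nat.one_le_iff_ne_zero.1 (Finset.mem_Icc.1 hn).1)
  have h2 : (rTwoSquares n : ℂ) = 4 * (rho n : ℂ) := by exact_mod_cast h
  rw [h2]
  push_cast
  ring

lemma rhoSqMain_eq (hL : chiC.LFunction 1 = Real.pi / 4) (x : ℝ) :
    16 * rhoSqMain x = 4 * x * Real.log x + (-4 + 8 * (Real.eulerMascheroniConstant : ℂ)
      + 4 / 3 * (Real.log 2 : ℂ) + 32 / (Real.pi : ℂ) * deriv chiC.LFunction 1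
      - 48 / (Real.pi : ℂ) ^ 2 * deriv riemannZeta 2) * x := by
  have hpi : (Real.pi:ℂ) ≠ 0 := by exact_mod_cast Real.pi_ne_zero
  rw [rhoSqMain, rhoSqCoeff, leadCoeff, secondCoeff, hL]
  push_cast
  field_simp
  ring

/-- **(Sierpiński–Ramanujan–Schinzel problem.)** With `r(n)` the number of
representations of `n` as a sum of two squares and `χ₋₄` the nontrivial Dirichlet
character mod 4 with `L`-function `L`,
`∑_{n ≤ x} r(n)² = 4 x log x + C x + O(x^{1/2} (log x)³ log log x)` where
`C = −4 + 8γ + (4/3) log 2 + (32/π) L′(1) − (48/π²) ζ′(2)`. -/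
theorem sum_r_sq_asymptotics
    (χ : DirichletCharacter ℂ 4) (hχ : χ ≠ 1)
    (hχseries : ∀ s : ℂ, 1 < s.re →
      DirichletCharacter.LFunction χ s = ∑' j : ℕ, (-1) ^ j * ((2 * j + 1 : ℕ) : ℂ) ^ (-s))
    (C : ℂ)
    (hC : C = -4 + 8 * (Real.eulerMascheroniConstant : ℂ) + 4 / 3 * (Real.log 2 : ℂ)
      + 32 / (Real.pi : ℂ) * deriv (DirichletCharacter.LFunction χ) 1
      - 48 / (Real.pi : ℂ) ^ 2 * deriv riemannZeta 2) :
    (fun x : ℝ => (∑ n ∈ Finset.Icc 1 ⌊x⌋₊, ((rTwoSquares n : ℂ)) ^ 2)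
        - (4 * x * Real.log x + C * x)) =O[atTop]
      fun x : ℝ => x ^ ((1 : ℝ) / 2) * Real.log x ^ 3 * Real.log (Real.log x) := by
  obtain rfl := eq_chiC_of_ne_one hχ
  have hL := LFunction_one_eq_pi_div_four chiC chiC_ne_one hχseries
  obtain ⟨K, hK, h⟩ := exists_norm_rhoSqSum_sub_le
  refine IsBigO.of_bound (16 * (K * 16)) ?_
  filter_upwards [eventually_ge_atTop (Real.exp 5), eventually_ge_atTop 16] with x hx5 hx
  have hx0 : 0 < x := by linarith
  have hl5 : 5 ≤ Real.log x := (Real.le_log_iff_exp_le hx0).2 hx5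
  have hll : 1 ≤ Real.log (Real.log x) := by
    rw [Real.le_log_iff_exp_le (by linarith)]
    linarith [Real.exp_one_lt_d9]
  set L : ℕ := ⌈Real.log x + 4⌉₊
  have hLle : (L:ℝ) ≤ 2 * Real.log x := by
    have := (Nat.ceil_lt_add_one (by linarith : 0 ≤ Real.log x + 4)).le
    linarith
  have hLge : Real.log x + 4 ≤ L := Nat.le_ceil _
  have hlogL : Real.log L ≤ 2 * Real.log (Real.log x) := by
    have h1 := Real.log_le_log (by linarith) hLle
    rw [Real.log_mul two_ne_zero (by linarith)] at h1
    linarith [Real.log_two_lt_d9]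
  have hlogL0 : 0 ≤ Real.log L := Real.log_natCast_nonneg L
  have hE : Real.sqrt x * (L:ℝ) ^ 3 * Real.log L ≤
      16 * (x ^ ((1 : ℝ) / 2) * Real.log x ^ 3 * Real.log (Real.log x)) := by
    calc Real.sqrt x * (L:ℝ) ^ 3 * Real.log L
        ≤ Real.sqrt x * (2 * Real.log x) ^ 3 * (2 * Real.log (Real.log x)) := by gcongr
      _ = _ := by rw [Real.sqrt_eq_rpow]; ring
  rw [sum_rTwoSquares_sq, hC, ← rhoSqMain_eq hL, ← mul_sub, norm_mul, Complex.norm_ofNat,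
    Real.norm_of_nonneg (by positivity)]
  have h2 := (h x L hx hLge).trans (mul_le_mul_of_nonneg_left hE hK.le)
  linarith
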